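/- Let p ≥ 5 be a regular prime and let N be a prime with N ≡ 1 (mod p). If M_1 is a p-th power in 𝔽_N^×, then r_K ≥ 2. -/

import Mathlib

open scoped TensorProduct

/-- The `p`-rank of a commutative group `G`, i.e. `dim_{𝔽_p}(G ⊗ 𝔽_p)`. -/
noncomputable def pRank (p : ℕ) (G : Type*) [CommGroup G] : ℕ :=
  Module.finrank (ZMod p) (ZMod p ⊗[ℤ] Additive G)

/-- The `p`-rank of the class group of the number field `K`. -/
noncomputable def classRank (p : ℕ) (K : Type*) [Field K] : ℕ :=
  pRank p (ClassGroup (NumberField.RingOfIntegers K))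

/-- `p` is a regular prime: `p` does not divide the class number of `ℚ(ζ_p)`. -/
def RegularPrime (p : ℕ+) : Prop :=
  ¬ (p : ℕ) ∣ Nat.card (ClassGroup (NumberField.RingOfIntegers (CyclotomicField p ℚ)))

/-- `M_i = ∏_{k=1}^{N-1} ∏_{a=1}^{k-1} k^{a^i}` as an element of `𝔽_N = ZMod N`. -/
def Mnum (N i : ℕ) : ZMod N :=
  ∏ k ∈ Finset.Icc 1 (N - 1), ∏ a ∈ Finset.Icc 1 (k - 1), (k : ZMod N) ^ (a ^ i)

/-- `S_i = ∏_{k=1}^{p-1} ((Mk)!)^{k^i}` with `M = (N-1)/p`, as an element of `ZMod N`. -/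
def Snum (p N i : ℕ) : ZMod N :=
  ∏ k ∈ Finset.Icc 1 (p - 1), (Nat.factorial ((N - 1) / p * k) : ZMod N) ^ (k ^ i)

/-- `A_m = ∏_{k=1}^{N-1} k^{k^m}` as an element of `ZMod N`. -/
def Anum (N m : ℕ) : ZMod N :=
  ∏ k ∈ Finset.Icc 1 (N - 1), (k : ZMod N) ^ (k ^ m)

/-- Merel's number `C = ∏_{k=1}^{(N-1)/2} k^k` as an element of `ZMod N`. -/
def MerelC (N : ℕ) : ZMod N :=
  ∏ k ∈ Finset.Icc 1 ((N - 1) / 2), (k : ZMod N) ^ k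

/-- `x` is a `p`-th power in `𝔽_N`. -/
def IsPthPow (p : ℕ) {N : ℕ} (x : ZMod N) : Prop :=
  ∃ y : ZMod N, y ^ p = x



namespace S14

open NumberField NumberField.Units NumberField.mixedEmbedding NumberField.InfinitePlace
  NumberField.mixedEmbedding.fundamentalCone NumberField.Units.dirichletUnitTheorem Module

open scoped Classical

noncomputable section

/-- tent function -/
def tent (t : ℝ) : ℝ := max 0 (1 - |t|)

lemma tent_nonneg (t : ℝ) : 0 ≤ tent t := le_max_left _ _
lemma tent_le_one (t : ℝ) : tent t ≤ 1 := max_le zero_le_one (by linarith [abs_nonneg t])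
lemma tent_lip (a b : ℝ) : |tent a - tent b| ≤ |a - b| := by
  unfold tent
  refine (abs_max_sub_max_le_max _ _ _ _).trans ?_
  simp only [sub_self, abs_zero]
  refine max_le (abs_nonneg _) ?_
  rw [show 1 - |a| - (1 - |b|) = |b| - |a| by ring, abs_sub_comm a b]
  exact abs_abs_sub_abs_le_abs_sub b a
lemma tent_ne_zero {t : ℝ} (h : tent t ≠ 0) : |t| < 1 := by
  unfold tent at h
  by_contra h'
  exact h (max_eq_left (by linarith))

lemma tent_sum (t : ℝ) : tent (t + ((⌊-t⌋ : ℤ) : ℝ)) + tent (t + ((⌊-t⌋ + 1 : ℤ) : ℝ)) = 1 := by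
  have h1 := Int.floor_le (-t)
  have h2 := Int.lt_floor_add_one (-t)
  unfold tent
  push_cast
  rw [abs_of_nonpos (by linarith : t + (⌊-t⌋ : ℝ) ≤ 0),
    abs_of_nonneg (by linarith : 0 ≤ t + ((⌊-t⌋ : ℝ) + 1)), max_eq_right (by linarith),
    max_eq_right (by linarith)]
  ring

lemma tent_shift_eq_zero (t : ℝ) (n : ℤ) (h : n ∉ ({⌊-t⌋, ⌊-t⌋ + 1} : Finset ℤ)) :
    tent (t + n) = 0 := by
  by_contra h0
  have := abs_lt.mp (tent_ne_zero h0)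
  apply h
  have h1 := Int.floor_le (-t)
  have h2 := Int.lt_floor_add_one (-t)
  have h3 : n < ⌊-t⌋ + 2 := by
    have : (n : ℝ) < (⌊-t⌋ : ℝ) + 2 := by linarith [this.2]
    exact_mod_cast this
  have h4 : ⌊-t⌋ - 1 < n := by
    have : (⌊-t⌋ : ℝ) - 1 < n := by linarith [this.1]
    exact_mod_cast this
  simp only [Finset.mem_insert, Finset.mem_singleton]
  omega

lemma tent_hasSum {r : ℕ} (t : Fin r → ℝ) :
    HasSum (fun n : Fin r → ℤ => ∏ i, tent (t i + n i)) 1 := by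
  classical
  have key := hasSum_sum_of_ne_finset_zero (L := SummationFilter.unconditional _) (f := fun n : Fin r → ℤ => ∏ i, tent (t i + n i))
    (s := Fintype.piFinset fun i => ({⌊-t i⌋, ⌊-t i⌋ + 1} : Finset ℤ)) (by
      intro n hn
      rw [Fintype.mem_piFinset] at hn
      push Not at hn
      obtain ⟨i, hi⟩ := hn
      exact Finset.prod_eq_zero (Finset.mem_univ i) (tent_shift_eq_zero _ _ hi))
  rw [← Finset.prod_univ_sum (fun i => ({⌊-t i⌋, ⌊-t i⌋ + 1} : Finset ℤ))
    (fun i n => tent (t i + (n : ℝ)))] at key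
  convert key using 1
  symm
  apply Finset.prod_eq_one
  intro i _
  rw [Finset.sum_pair (by simp)]
  exact tent_sum _

lemma prod_lip {ι : Type*} (s : Finset ι) (f g : ι → ℝ) (hf : ∀ i, |f i| ≤ 1) (hg : ∀ i, |g i| ≤ 1) :
    |∏ i ∈ s, f i - ∏ i ∈ s, g i| ≤ ∑ i ∈ s, |f i - g i| := by
  classical
  induction s using Finset.induction_on with
  | empty => simp
  | insert a s ha ih =>
    rw [Finset.prod_insert ha, Finset.prod_insert ha, Finset.sum_insert ha]
    have : f a * ∏ i ∈ s, f i - g a * ∏ i ∈ s, g i =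
      (f a - g a) * ∏ i ∈ s, f i + g a * (∏ i ∈ s, f i - ∏ i ∈ s, g i) := by ring
    rw [this]
    refine (abs_add_le _ _).trans (add_le_add ?_ ?_)
    · rw [abs_mul]
      refine mul_le_of_le_one_right (abs_nonneg _) ?_
      rw [Finset.abs_prod]
      exact Finset.prod_le_one (fun i _ => abs_nonneg _) (fun i _ => hf i)
    · rw [abs_mul]
      exact (mul_le_of_le_one_left (abs_nonneg _) (hg a)).trans ih

variable (F : Type*) [Field F] [NumberField F]

/-- real basis of log space -/
def ubasis : Basis (Fin (rank F)) ℝ (logSpace F) :=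
  (basisUnitLattice F).ofZLatticeBasis ℝ (unitLattice F)

variable {F}
/-- coordinates -/
def tcoord (x : mixedSpace F) : Fin (rank F) → ℝ := fun i => (ubasis F).repr (logMap x) i

/-- the weight -/
def wt (x : mixedSpace F) : ℝ := ∏ i, tent (tcoord x i)

lemma wt_nonneg (x : mixedSpace F) : 0 ≤ wt x := Finset.prod_nonneg fun _ _ => tent_nonneg _
lemma wt_le_one (x : mixedSpace F) : wt x ≤ 1 :=
  Finset.prod_le_one (fun _ _ => tent_nonneg _) fun _ _ => tent_le_one _

lemma tcoord_unit_smul (ζ : torsion F) (n : Fin (rank F) → ℤ) (x : mixedSpace F)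
    (hx : mixedEmbedding.norm x ≠ 0) (i : Fin (rank F)) :
    tcoord (((ζ : (𝓞 F)ˣ) * ∏ i, (fundSystem F i) ^ (n i)) • x) i = tcoord x i + n i := by
  unfold tcoord
  rw [logMap_unit_smul _ hx, ofMul_mul, map_add (logEmbedding F), ofMul_prod, map_sum (logEmbedding F)]
  have h0 : logEmbedding F (Additive.ofMul (ζ : (𝓞 F)ˣ)) = 0 :=
    (logEmbedding_eq_zero_iff).mpr ζ.2
  have h1 : ∀ j, logEmbedding F (Additive.ofMul (fundSystem F j ^ n j)) =
      (n j : ℝ) • (ubasis F j) := by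
    intro j
    rw [ofMul_zpow, map_zsmul, logEmbedding_fundSystem, ubasis, Basis.ofZLatticeBasis_apply]
    exact (Int.cast_smul_eq_zsmul ℝ _ _).symm
  rw [h0, zero_add, map_add, Finset.sum_congr rfl (fun j _ => h1 j), map_sum]
  simp only [Finsupp.coe_add, Pi.add_apply, map_smul, Basis.repr_self, Finsupp.coe_finsetSum,
    Finset.sum_apply, Finsupp.smul_single, smul_eq_mul, mul_one, Finsupp.single_apply]
  simp [add_comm]

/-- units as product -/
def unitsEquiv : (torsion F × (Fin (rank F) → ℤ)) ≃ (𝓞 F)ˣ :=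
  Equiv.ofBijective (fun ζe => (ζe.1 : (𝓞 F)ˣ) * ∏ i, (fundSystem F i) ^ (ζe.2 i)) (by
    rw [Function.bijective_iff_existsUnique]
    intro b
    obtain ⟨a, h1, h2⟩ := exist_unique_eq_mul_prod F b
    exact ⟨a, h1.symm, fun y hy => h2 y hy.symm⟩)

lemma wt_unitsEquiv (x : mixedSpace F) (hx : mixedEmbedding.norm x ≠ 0)
    (a : torsion F × (Fin (rank F) → ℤ)) :
    wt (unitsEquiv a • x) = ∏ i, tent (tcoord x i + a.2 i) := by
  unfold wt
  refine Finset.prod_congr rfl fun i _ => ?_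
  rw [← tcoord_unit_smul a.1 a.2 x hx i]
  rfl

lemma hasSum_torsion : HasSum (fun _ : torsion F => (1 : ℝ)) ((torsionOrder F : ℕ) : ℝ) := by
  have : Fintype (torsion F) := Fintype.ofFinite _
  have h := hasSum_fintype (fun _ : torsion F => (1 : ℝ))
  rw [Finset.sum_const, Finset.card_univ, nsmul_eq_mul, mul_one] at h
  rwa [torsionOrder, ← Fintype.card_eq_nat_card]

lemma wt_hasSum (x : mixedSpace F) (hx : mixedEmbedding.norm x ≠ 0) :
    HasSum (fun u : (𝓞 F)ˣ => wt (u • x)) ((torsionOrder F : ℕ) : ℝ) := by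
  rw [← (unitsEquiv (F := F)).hasSum_iff]
  have h2 := tent_hasSum (tcoord x)
  have hn1 : 0 ≤ (fun _ : torsion F => (1 : ℝ)) := fun _ => zero_le_one
  have hn2 : 0 ≤ (fun n : Fin (rank F) → ℤ => ∏ i, tent (tcoord x i + n i)) :=
    fun _ => Finset.prod_nonneg fun _ _ => tent_nonneg _
  have hs := (hasSum_torsion (F := F)).summable.mul_of_nonneg h2.summable hn1 hn2
  have h3 := (hasSum_torsion (F := F)).mul h2 hs
  rw [mul_one] at h3
  refine h3.congr_fun ?_
  intro a
  rw [one_mul]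
  exact wt_unitsEquiv x hx a

/-- bound for log coordinates on support -/
lemma wt_supp : ∃ C : ℝ, 0 < C ∧ ∀ x : mixedSpace F, mixedEmbedding.norm x ≠ 0 → wt x ≠ 0 →
    ∀ w, |Real.log (normAtPlace w x) - Real.log (mixedEmbedding.norm x) * (finrank ℚ F : ℝ)⁻¹| ≤ C := by
  classical
  set B : ℝ := ∑ i, ‖ubasis F i‖ with hB
  have hB0 : 0 ≤ B := Finset.sum_nonneg fun i _ => norm_nonneg _
  have hlog : ∀ x : mixedSpace F, wt x ≠ 0 → ‖logMap x‖ ≤ B := by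
    intro x hx
    have h := (ubasis F).sum_repr (logMap x)
    rw [← h]
    refine (norm_sum_le _ _).trans (Finset.sum_le_sum fun i _ => ?_)
    rw [_root_.norm_smul]
    refine mul_le_of_le_one_left (norm_nonneg _) ?_
    have := Finset.prod_ne_zero_iff.mp hx i (Finset.mem_univ _)
    exact (tent_ne_zero this).le
  have hw1 : ∀ x : mixedSpace F, wt x ≠ 0 → ∀ w : InfinitePlace F, w ≠ w₀ →
     |(mult w : ℝ) * (Real.log (normAtPlace w x) - Real.log (mixedEmbedding.norm x) * (finrank ℚ F : ℝ)⁻¹)| ≤ B := by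
    intro x hx w hw
    have := (norm_le_pi_norm (logMap x) ⟨w, hw⟩).trans (hlog x hx)
    rwa [logMap_apply, Real.norm_eq_abs] at this
  have hmul : ∀ w : InfinitePlace F, (1 : ℝ) ≤ mult w := fun w => by
    exact_mod_cast (mult_pos (w := w))
  refine ⟨B * (Fintype.card (InfinitePlace F)) + 1, by positivity, fun x hn hx => ?_⟩
  have hsum : ∑ w : InfinitePlace F, (mult w : ℝ) * (Real.log (normAtPlace w x) - Real.log (mixedEmbedding.norm x) * (finrank ℚ F : ℝ)⁻¹) = 0 := by
    simp_rw [mul_sub]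
    rw [Finset.sum_sub_distrib, ← Finset.sum_mul]
    have h1 : ∑ w : InfinitePlace F, (mult w : ℝ) = finrank ℚ F := by
      exact_mod_cast sum_mult_eq
    have h2 : Real.log (mixedEmbedding.norm x) = ∑ w : InfinitePlace F, (mult w : ℝ) * Real.log (normAtPlace w x) := by
      rw [mixedEmbedding.norm_apply, Real.log_prod]
      · simp
      · intro w _
        exact pow_ne_zero _ (mixedEmbedding.norm_ne_zero_iff.mp hn w)
    rw [h1, ← h2]
    have : (finrank ℚ F : ℝ) ≠ 0 := by exact_mod_cast finrank_pos.ne'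
    field_simp
    simp
  have habs : ∀ w : InfinitePlace F, |(mult w : ℝ) * (Real.log (normAtPlace w x) - Real.log (mixedEmbedding.norm x) * (finrank ℚ F : ℝ)⁻¹)| ≤ B * (Fintype.card (InfinitePlace F)) := by
    intro w
    have hc : (1 : ℝ) ≤ Fintype.card (InfinitePlace F) := by
      exact_mod_cast Fintype.card_pos_iff.mpr ⟨w⟩
    by_cases hw : w = w₀
    · rw [← Finset.add_sum_erase _ _ (Finset.mem_univ w)] at hsum
      rw [eq_neg_of_add_eq_zero_left hsum, abs_neg]
      refine (Finset.abs_sum_le_sum_abs _ _).trans ?_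
      refine (Finset.sum_le_card_nsmul _ _ B fun v hv => ?_).trans ?_
      · exact hw1 x hx v (by rw [← hw]; exact Finset.ne_of_mem_erase hv)
      · rw [nsmul_eq_mul, mul_comm]
        refine mul_le_mul_of_nonneg_left ?_ hB0
        exact_mod_cast (Finset.card_erase_le).trans (by simp)
    · exact (hw1 x hx w hw).trans (le_mul_of_one_le_right hB0 hc)
  intro w
  have h := habs w
  rw [abs_mul, abs_of_pos (by linarith [hmul w] : (0 : ℝ) < mult w)] at h
  have := le_mul_of_one_le_left (abs_nonneg (Real.log (normAtPlace w x) - Real.log (mixedEmbedding.norm x) * (finrank ℚ F : ℝ)⁻¹)) (hmul w)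
  linarith

/-- `log norm` as a sum. -/
lemma log_norm_eq (x : mixedSpace F) (hn : mixedEmbedding.norm x ≠ 0) :
    Real.log (mixedEmbedding.norm x) = ∑ w : InfinitePlace F, (mult w : ℝ) * Real.log (normAtPlace w x) := by
  rw [mixedEmbedding.norm_apply, Real.log_prod]
  · simp
  · intro w _
    exact pow_ne_zero _ (mixedEmbedding.norm_ne_zero_iff.mp hn w)

lemma sum_mult_real : ∑ w : InfinitePlace F, (mult w : ℝ) = finrank ℚ F := by
  exact_mod_cast sum_mult_eq

lemma log_norm_lip (x y : mixedSpace F) (hx : mixedEmbedding.norm x ≠ 0) (hy : mixedEmbedding.norm y ≠ 0)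
    (ε : ℝ) (h : ∀ w, |Real.log (normAtPlace w x) - Real.log (normAtPlace w y)| ≤ ε) :
    |Real.log (mixedEmbedding.norm x) - Real.log (mixedEmbedding.norm y)| ≤ finrank ℚ F * ε := by
  rw [log_norm_eq x hx, log_norm_eq y hy, ← Finset.sum_sub_distrib, ← sum_mult_real, Finset.sum_mul]
  refine (Finset.abs_sum_le_sum_abs _ _).trans (Finset.sum_le_sum fun w _ => ?_)
  rw [← mul_sub, abs_mul, Nat.abs_cast]
  exact mul_le_mul_of_nonneg_left (h w) (Nat.cast_nonneg _)

lemma wt_lip : ∃ C : ℝ, 0 < C ∧ ∀ x y : mixedSpace F, mixedEmbedding.norm x ≠ 0 → mixedEmbedding.norm y ≠ 0 →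
    ∀ ε : ℝ, 0 ≤ ε → (∀ w, |Real.log (normAtPlace w x) - Real.log (normAtPlace w y)| ≤ ε) →
      |wt x - wt y| ≤ C * ε := by
  obtain ⟨A, hA⟩ : ∃ A : ℝ, 0 ≤ A ∧ ∀ i, ∀ v : logSpace F, |(ubasis F).repr v i| ≤ A * ‖v‖ := by
    let T : Fin (rank F) → (logSpace F →L[ℝ] ℝ) := fun i =>
      LinearMap.toContinuousLinearMap ((ubasis F).coord i)
    refine ⟨∑ i, ‖T i‖, Finset.sum_nonneg fun i _ => norm_nonneg _, fun i v => ?_⟩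
    have : |(ubasis F).repr v i| ≤ ‖T i‖ * ‖v‖ := by
      have := (T i).le_opNorm v
      rwa [Real.norm_eq_abs] at this
    refine this.trans (mul_le_mul_of_nonneg_right ?_ (norm_nonneg _))
    exact Finset.single_le_sum (f := fun i => ‖T i‖) (fun i _ => norm_nonneg _) (Finset.mem_univ i)
  refine ⟨(rank F : ℝ) * (A * 4) + 1, by have := hA.1; positivity, fun x y hx hy ε hε h => ?_⟩
  have hn : (0 : ℝ) < finrank ℚ F := by exact_mod_cast finrank_pos
  have hlog : ‖logMap x - logMap y‖ ≤ 4 * ε := by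
    rw [pi_norm_le_iff_of_nonneg (by positivity)]
    intro w
    rw [Pi.sub_apply, logMap_apply, logMap_apply, ← mul_sub, Real.norm_eq_abs, abs_mul, Nat.abs_cast]
    have h2 : (mult w.1 : ℝ) ≤ 2 := by
      unfold mult; split_ifs <;> norm_num
    have h3 : |Real.log (normAtPlace w.1 x) - Real.log (mixedEmbedding.norm x) * (finrank ℚ F : ℝ)⁻¹ -
      (Real.log (normAtPlace w.1 y) - Real.log (mixedEmbedding.norm y) * (finrank ℚ F : ℝ)⁻¹)| ≤ ε + ε := by
      rw [show ∀ a b c d e : ℝ, a - b * e - (c - d * e) = (a - c) - (b - d) * e by intros; ring]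
      refine (abs_sub _ _).trans (add_le_add (h _) ?_)
      rw [abs_mul, abs_of_pos (inv_pos.mpr hn)]
      have := log_norm_lip x y hx hy ε h
      rw [← div_eq_mul_inv, div_le_iff₀ hn]
      linarith
    calc _ ≤ 2 * (ε + ε) := mul_le_mul h2 h3 (abs_nonneg _) (by norm_num)
      _ = _ := by ring
  have h5 : |wt x - wt y| ≤ ∑ i : Fin (rank F), A * (4 * ε) := by
    refine (prod_lip _ _ _ (fun i => ?_) (fun i => ?_)).trans (Finset.sum_le_sum fun i _ => ?_)
    · rw [abs_of_nonneg (tent_nonneg _)]; exact tent_le_one _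
    · rw [abs_of_nonneg (tent_nonneg _)]; exact tent_le_one _
    · refine (tent_lip _ _).trans ?_
      have := hA.2 i (logMap x - logMap y)
      rw [map_sub] at this
      refine this.trans (mul_le_mul_of_nonneg_left hlog hA.1)
  simp only [Finset.sum_const, Finset.card_univ, Fintype.card_fin, nsmul_eq_mul] at h5
  linarith

end

end S14


namespace S14

open NumberField NumberField.Units NumberField.mixedEmbedding NumberField.InfinitePlace
  NumberField.mixedEmbedding.fundamentalCone NumberField.Units.dirichletUnitTheorem Module

open scoped Classical
set_option linter.unusedSectionVars false

noncomputable section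

variable {F : Type*} [Field F] [NumberField F]

/-- embedding of integers -/
def emb (x : 𝓞 F) : mixedSpace F := mixedEmbedding F (x : F)

lemma emb_add (x y : 𝓞 F) : emb (x + y) = emb x + emb y := by simp [emb]
lemma emb_zero : emb (0 : 𝓞 F) = 0 := by simp [emb]
lemma emb_norm_ne {x : 𝓞 F} (hx : x ≠ 0) : mixedEmbedding.norm (emb x) ≠ 0 := by
  unfold emb
  rw [mixedEmbedding.norm_ne_zero_iff]
  intro w
  rw [normAtPlace_apply]
  simpa using hx

lemma emb_norm_eq (x : 𝓞 F) :
    mixedEmbedding.norm (emb x) = (Ideal.absNorm (Ideal.span {x}) : ℝ) := by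
  unfold emb
  rw [norm_eq_norm, Ideal.absNorm_span_singleton]
  rw [← Algebra.coe_norm_int]
  simp

lemma normAtPlace_le_norm (x : mixedSpace F) (w : InfinitePlace F) : normAtPlace w x ≤ ‖x‖ := by
  rw [norm_eq_sup'_normAtPlace]
  exact Finset.le_sup' (fun w => normAtPlace w x) (Finset.mem_univ w)

lemma exists_normAtPlace_eq (x : mixedSpace F) : ∃ w, normAtPlace w x = ‖x‖ := by
  rw [norm_eq_sup'_normAtPlace]
  obtain ⟨w, _, hw⟩ := Finset.exists_mem_eq_sup' (s := (Finset.univ : Finset (InfinitePlace F)))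
    Finset.univ_nonempty (fun w => normAtPlace w x)
  exact ⟨w, hw.symm⟩

lemma norm_ge_of_places (x : mixedSpace F) (a : ℝ) (ha : 0 ≤ a) (h : ∀ w, a ≤ normAtPlace w x) :
    a ^ finrank ℚ F ≤ mixedEmbedding.norm x := by
  rw [mixedEmbedding.norm_apply, ← sum_mult_eq, ← Finset.prod_pow_eq_pow_sum]
  exact Finset.prod_le_prod (fun w _ => by positivity) fun w _ => pow_le_pow_left₀ ha (h w) _

lemma est1 : ∃ c : ℝ, 0 < c ∧ c ≤ 1 ∧ ∀ x : mixedSpace F, mixedEmbedding.norm x ≠ 0 → wt x ≠ 0 →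
    ∀ w, c * ‖x‖ ≤ normAtPlace w x := by
  obtain ⟨C, hC, h⟩ := wt_supp (F := F)
  refine ⟨Real.exp (-2 * C), Real.exp_pos _, Real.exp_le_one_iff.mpr (by linarith), fun x hx hw w => ?_⟩
  obtain ⟨w', hw'⟩ := exists_normAtPlace_eq x
  have hp : ∀ w, 0 < normAtPlace w x := fun w =>
    lt_of_le_of_ne (normAtPlace_nonneg _ _) (mixedEmbedding.norm_ne_zero_iff.mp hx w).symm
  rw [← hw', ← Real.exp_log (hp w'), ← Real.exp_log (hp w), ← Real.exp_add, Real.exp_le_exp]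
  have h1 := abs_le.mp (h x hx hw w)
  have h2 := abs_le.mp (h x hx hw w')
  linarith [h1.1, h2.2]

/-- summand -/
def HH (s : ℂ) (x : 𝓞 F) : ℂ := (wt (emb x) : ℂ) * ((mixedEmbedding.norm (emb x) : ℝ) : ℂ) ^ (-s)

lemma HH_zero {s : ℂ} (hs : s ≠ 0) : HH s (0 : 𝓞 F) = 0 := by
  simp [HH, emb_zero, Complex.zero_cpow (neg_ne_zero.mpr hs)]

lemma norm_pos_emb {x : 𝓞 F} (hx : x ≠ 0) : 0 < mixedEmbedding.norm (emb x) :=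
  lt_of_le_of_ne (mixedEmbedding.norm_nonneg _) (emb_norm_ne hx).symm

lemma HH_norm (s : ℂ) {x : 𝓞 F} (hx : x ≠ 0) :
    ‖HH s x‖ = wt (emb x) * (mixedEmbedding.norm (emb x)) ^ (-s.re) := by
  rw [HH, norm_mul, Complex.norm_cpow_eq_rpow_re_of_pos (norm_pos_emb hx), Complex.norm_real,
    Real.norm_of_nonneg (wt_nonneg _)]
  simp

lemma HH_norm_le_one (s : ℂ) (hs : 0 < s.re) (x : 𝓞 F) : ‖HH s x‖ ≤ 1 := by
  by_cases hx : x = 0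
  · subst hx
    rw [HH_zero (by rintro rfl; simp at hs)]
    simp
  · rw [HH_norm s hx]
    refine mul_le_one₀ (wt_le_one _) (Real.rpow_nonneg (norm_pos_emb hx).le _) ?_
    refine Real.rpow_le_one_of_one_le_of_nonpos ?_ (by linarith)
    rw [emb_norm_eq]
    have : 0 < Ideal.absNorm (Ideal.span {x}) := by
      have := norm_pos_emb hx
      rw [emb_norm_eq] at this
      exact_mod_cast this
    exact_mod_cast this

lemma log_sub_le {a b m : ℝ} (hm : 0 < m) (ha : m ≤ a) (hb : m ≤ b) :
    |Real.log a - Real.log b| ≤ |a - b| / m := by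
  have key : ∀ a b : ℝ, m ≤ a → m ≤ b → Real.log a - Real.log b ≤ |a - b| / m := by
    intro a b ha hb
    have ha0 : 0 < a := by linarith
    have hb0 : 0 < b := by linarith
    rw [← Real.log_div ha0.ne' hb0.ne']
    refine (Real.log_le_sub_one_of_pos (by positivity)).trans ?_
    have : a / b - 1 = (a - b) / b := by field_simp
    rw [this]
    calc (a - b) / b ≤ |a - b| / b := by gcongr; exact le_abs_self _
      _ ≤ |a - b| / m := by gcongr
  rw [abs_le]
  constructor
  · have := key b a hb ha
    rw [abs_sub_comm] at this
    linarith
  · exact key a b ha hb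

lemma cpow_diff {A B : ℝ} (hA : 0 < A) (hB : 0 < B) {s : ℂ} {δ M : ℝ} (hs : ‖s‖ ≤ 2)
    (h : |Real.log A - Real.log B| ≤ δ) (hδ : 2 * δ ≤ 1) (hM : B ^ (-s.re) ≤ M) :
    ‖((A : ℂ)) ^ (-s) - (B : ℂ) ^ (-s)‖ ≤ M * (4 * δ) := by
  have hB' : (B : ℂ) ≠ 0 := by exact_mod_cast hB.ne'
  have hA' : (A : ℂ) ≠ 0 := by exact_mod_cast hA.ne'
  have e1 : (A : ℂ) ^ (-s) = (B : ℂ) ^ (-s) * Complex.exp (((Real.log A - Real.log B : ℝ) : ℂ) * (-s)) := by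
    rw [Complex.cpow_def_of_ne_zero hA', Complex.cpow_def_of_ne_zero hB', ← Complex.exp_add,
      ← Complex.ofReal_log hA.le, ← Complex.ofReal_log hB.le]
    congr 1
    push_cast
    ring
  rw [e1, ← mul_sub_one, norm_mul, Complex.norm_cpow_eq_rpow_re_of_pos hB, Complex.neg_re]
  have hz : ‖((Real.log A - Real.log B : ℝ) : ℂ) * (-s)‖ ≤ δ * 2 := by
    rw [norm_mul, norm_neg, Complex.norm_real, Real.norm_eq_abs]
    exact mul_le_mul h hs (norm_nonneg _) ((abs_nonneg _).trans h)
  have h2 := Complex.norm_exp_sub_one_le (x := ((Real.log A - Real.log B : ℝ) : ℂ) * (-s)) (by linarith)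
  refine mul_le_mul hM (by linarith) (norm_nonneg _) ((Real.rpow_nonneg hB.le _).trans hM)

lemma est2 (r : 𝓞 F) : ∃ R₀ C : ℝ, 1 ≤ R₀ ∧ 0 ≤ C ∧ ∀ y : 𝓞 F, R₀ ≤ ‖emb y‖ → ∀ s : ℂ,
    ‖s‖ ≤ 2 → 1 - (1 / 4) * (finrank ℚ F : ℝ)⁻¹ ≤ s.re →
    ‖HH s (y + r) - HH s y‖ ≤ C * ‖emb y‖ ^ (-((finrank ℚ F : ℝ) + 3 / 4)) := by
  obtain ⟨c, hc0, hc1, hc⟩ := est1 (F := F)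
  obtain ⟨C₁, hC₁, hlip⟩ := wt_lip (F := F)
  obtain ⟨n, hn⟩ : ∃ n : ℝ, n = (finrank ℚ F : ℝ) := ⟨_, rfl⟩
  rw [← hn]
  have hn1 : 1 ≤ n := by
    rw [hn]; exact_mod_cast (finrank_pos (R := ℚ) (M := F))
  obtain ⟨ρ, hρ⟩ : ∃ ρ : ℝ, ρ = ‖emb r‖ := ⟨_, rfl⟩
  have hρ0 : 0 ≤ ρ := by rw [hρ]; exact norm_nonneg _
  obtain ⟨K, hK⟩ : ∃ K : ℝ, K = (8 * (1 + ρ) / c) := ⟨_, rfl⟩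
  have hK8 : 8 ≤ K := by
    rw [hK, le_div_iff₀ hc0]; nlinarith
  have hKρ : 8 * ρ / c ≤ K := by rw [hK]; gcongr; linarith
  obtain ⟨D, hD⟩ : ∃ D : ℝ, D = (c / 8) ^ (-(n - 1/4)) := ⟨_, rfl⟩
  have hD0 : 0 ≤ D := by rw [hD]; exact Real.rpow_nonneg (by positivity) _
  refine ⟨2 * n * K, (C₁ * K) * D + D * (4 * (n * K)), by nlinarith, by positivity, fun y hy s hs hsre => ?_⟩
  obtain ⟨Y, hY⟩ : ∃ Y : ℝ, Y = ‖emb y‖ := ⟨_, rfl⟩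
  rw [← hY] at hy ⊢
  have hY1 : 1 ≤ Y := by nlinarith
  have hY0 : 0 < Y := by linarith
  have hKY : K ≤ Y := by nlinarith
  have hcY : 1 + ρ ≤ c / 8 * Y := by
    rw [hK, div_le_iff₀ hc0] at hKY; linarith
  have hy0 : y ≠ 0 := by
    rintro rfl
    rw [emb_zero, norm_zero] at hY
    linarith
  have hyr0 : y + r ≠ 0 := by
    intro h0
    have : Y = ρ := by
      rw [hY, hρ, eq_neg_of_add_eq_zero_left h0]
      unfold emb; simp
    nlinarith
  by_cases hz : wt (emb y) = 0 ∧ wt (emb (y + r)) = 0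
  · simp only [HH, hz.1, hz.2]; simp only [Complex.ofReal_zero, zero_mul, sub_self, norm_zero]; positivity
  have hdiff : ∀ w, |normAtPlace w (emb (y + r)) - normAtPlace w (emb y)| ≤ ρ := by
    intro w
    have h1 := normAtPlace_add_le w (emb y) (emb r)
    have h2 := normAtPlace_add_le w (emb (y + r)) (-emb r)
    rw [normAtPlace_neg, emb_add, add_neg_cancel_right] at h2
    rw [emb_add]
    have h3 := normAtPlace_le_norm (emb r) w
    rw [← hρ] at h3
    rw [abs_le]; constructor <;> linarith
  have hlow : ∀ w, c / 4 * Y ≤ normAtPlace w (emb y) := by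
    intro w
    by_cases h1 : wt (emb y) = 0
    · have h2 : wt (emb (y + r)) ≠ 0 := fun h => hz ⟨h1, h⟩
      have h3 := hc _ (emb_norm_ne hyr0) h2 w
      have h4 : Y - ρ ≤ ‖emb (y + r)‖ := by
        rw [emb_add]
        have := norm_sub_norm_le (emb y) (-emb r)
        rwa [sub_neg_eq_add, norm_neg, ← hY, ← hρ] at this
      have h5 := (abs_le.mp (hdiff w)).2
      have h6 : c * (Y - ρ) ≤ c * ‖emb (y + r)‖ := by gcongr
      nlinarith
    · have h3 := hc _ (emb_norm_ne hy0) h1 w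
      nlinarith
  have hm : 0 < c / 8 * Y := by positivity
  have hlow1 : ∀ w, c / 8 * Y ≤ normAtPlace w (emb y) := fun w => by have := hlow w; nlinarith
  have hlow2 : ∀ w, c / 8 * Y ≤ normAtPlace w (emb (y + r)) := fun w => by
    have := hlow w
    have := (abs_le.mp (hdiff w)).1
    nlinarith
  obtain ⟨ε, hε⟩ : ∃ ε : ℝ, ε = K / Y := ⟨_, rfl⟩
  have hε0 : 0 ≤ ε := by rw [hε]; positivity
  have hlogw : ∀ w, |Real.log (normAtPlace w (emb (y + r))) - Real.log (normAtPlace w (emb y))| ≤ ε := by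
    intro w
    refine (log_sub_le hm (hlow2 w) (hlow1 w)).trans ?_
    calc _ ≤ ρ / (c / 8 * Y) := by gcongr; exact hdiff w
      _ = (8 * ρ / c) / Y := by field_simp
      _ ≤ K / Y := by gcongr
      _ = ε := hε.symm
  have hw := hlip _ _ (emb_norm_ne hyr0) (emb_norm_ne hy0) ε hε0 hlogw
  have hl := log_norm_lip _ _ (emb_norm_ne hyr0) (emb_norm_ne hy0) ε hlogw
  rw [← hn] at hl
  have hpow : ∀ z : 𝓞 F, (∀ w, c / 8 * Y ≤ normAtPlace w (emb z)) →
      (mixedEmbedding.norm (emb z)) ^ (-s.re) ≤ D * Y ^ (-(n - 1 / 4)) := by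
    intro z hz
    have h1 := norm_ge_of_places _ _ hm.le hz
    have hre : 0 < s.re := by
      have : n⁻¹ ≤ 1 := inv_le_one_of_one_le₀ hn1
      linarith
    calc (mixedEmbedding.norm (emb z)) ^ (-s.re) ≤ ((c / 8 * Y) ^ finrank ℚ F) ^ (-s.re) :=
          Real.rpow_le_rpow_of_nonpos (by positivity) h1 (by linarith)
      _ = (c / 8 * Y) ^ (-(n * s.re)) := by
          rw [← Real.rpow_natCast, ← Real.rpow_mul hm.le]; congr 1; rw [hn]; ring
      _ ≤ (c / 8 * Y) ^ (-(n - 1 / 4)) := by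
          refine Real.rpow_le_rpow_of_exponent_le (by linarith) ?_
          have : n * (1 - 1 / 4 * n⁻¹) ≤ n * s.re := by gcongr
          have h2 : n * (1 - 1 / 4 * n⁻¹) = n - 1 / 4 := by field_simp
          linarith
      _ = _ := by rw [Real.mul_rpow (by positivity) hY0.le, ← hD]
  have hB := hpow y hlow1
  have hA := hpow (y + r) hlow2
  have hcp := cpow_diff (norm_pos_emb hyr0) (norm_pos_emb hy0) hs hl (by
    rw [hε]
    rw [show 2 * (n * (K / Y)) = (2 * n * K) / Y by ring, div_le_one hY0]
    exact hy) hB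
  have hsplit : HH s (y + r) - HH s y = ((wt (emb (y + r)) - wt (emb y) : ℝ) : ℂ) *
      ((mixedEmbedding.norm (emb (y + r)) : ℝ) : ℂ) ^ (-s) +
      (wt (emb y) : ℂ) * (((mixedEmbedding.norm (emb (y + r)) : ℝ) : ℂ) ^ (-s) -
        ((mixedEmbedding.norm (emb y) : ℝ) : ℂ) ^ (-s)) := by
    unfold HH; push_cast; ring
  rw [hsplit]
  have hYY : Y ^ (-(n - 1 / 4)) * Y⁻¹ = Y ^ (-(n + 3 / 4)) := by
    rw [← Real.rpow_neg_one, ← Real.rpow_add hY0]; congr 1; ring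
  calc _ ≤ (C₁ * ε) * (D * Y ^ (-(n - 1 / 4))) + 1 * ((D * Y ^ (-(n - 1 / 4))) * (4 * (n * ε))) := by
        refine (norm_add_le _ _).trans (add_le_add ?_ ?_)
        · rw [norm_mul, Complex.norm_real, Real.norm_eq_abs,
            Complex.norm_cpow_eq_rpow_re_of_pos (norm_pos_emb hyr0), Complex.neg_re]
          exact mul_le_mul hw hA (Real.rpow_nonneg (norm_pos_emb hyr0).le _) (by positivity)
        · rw [norm_mul, Complex.norm_real, Real.norm_of_nonneg (wt_nonneg _)]
          exact mul_le_mul (wt_le_one _) hcp (norm_nonneg _) zero_le_one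
    _ = ((C₁ * K) * D + D * (4 * (n * K))) * (Y ^ (-(n - 1 / 4)) * Y⁻¹) := by
        rw [hε]; ring
    _ = _ := by rw [hYY]

lemma summable_emb (t : ℝ) (ht : (finrank ℚ F : ℝ) < t) :
    Summable (fun x : 𝓞 F => ‖emb x‖ ^ (-t)) := by
  have h := ZLattice.summable_norm_rpow (mixedEmbedding.integerLattice F) (-t) (by
    rw [ZLattice.rank ℝ, mixedEmbedding.finrank]; linarith)
  let g : 𝓞 F → mixedEmbedding.integerLattice F := fun x => ⟨emb x, by
    refine ⟨x, ?_⟩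
    simp [emb]⟩
  have hg : Function.Injective g := by
    intro x y hxy
    have := congrArg Subtype.val hxy
    exact RingOfIntegers.ext (mixedEmbedding_injective F this)
  have h2 := h.comp_injective hg
  refine h2.congr fun x => ?_
  simp only [Function.comp, g, Submodule.coe_norm]

lemma finite_emb (R : ℝ) : {x : 𝓞 F | ‖emb x‖ < R}.Finite := by
  have hs := summable_emb (F := F) ((finrank ℚ F : ℝ) + 1) (by linarith)
  have ht := hs.tendsto_cofinite_zero
  have hR : 0 < (max R 1) ^ (-((finrank ℚ F : ℝ) + 1)) := Real.rpow_pos_of_pos (by positivity) _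
  have := ht.eventually (gt_mem_nhds hR)
  rw [Filter.eventually_cofinite] at this
  refine (this.union (Set.finite_singleton 0)).subset ?_
  intro x hx
  by_cases h0 : x = 0
  · right; exact h0
  left
  have hx0 : 0 < ‖emb x‖ := by
    rw [norm_pos_iff]
    intro h
    have := emb_norm_ne h0
    rw [h] at this
    simp at this
  simp only [Set.mem_ofPred_eq, not_lt]
  exact Real.rpow_le_rpow_of_nonpos hx0 (le_max_of_le_left (le_of_lt hx))
    (by have : (0:ℝ) ≤ finrank ℚ F := Nat.cast_nonneg _
        linarith)

lemma HH_summable (s : ℂ) (hs : 1 < s.re) : Summable (fun x : 𝓞 F => ‖HH s x‖) := by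
  obtain ⟨c, hc0, hc1, hc⟩ := est1 (F := F)
  have hn : (0:ℝ) < finrank ℚ F := by exact_mod_cast (finrank_pos (R := ℚ) (M := F))
  have hs0 : s ≠ 0 := by rintro rfl; simp at hs; linarith
  refine Summable.of_nonneg_of_le (fun _ => norm_nonneg _) (fun x => ?_)
    ((summable_emb (F := F) (finrank ℚ F * s.re) (by nlinarith)).mul_left (c ^ (-(finrank ℚ F * s.re))))
  by_cases hx : x = 0
  · subst hx
    rw [HH_zero hs0, norm_zero]
    positivity
  rw [HH_norm s hx]
  by_cases hw : wt (emb x) = 0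
  · rw [hw, zero_mul]; positivity
  have hpos : 0 < ‖emb x‖ := by
    rw [norm_pos_iff]
    intro h
    have := emb_norm_ne hx
    rw [h] at this
    simp at this
  have h1 := norm_ge_of_places _ (c * ‖emb x‖) (by positivity) (hc _ (emb_norm_ne hx) hw)
  calc _ ≤ 1 * ((c * ‖emb x‖) ^ finrank ℚ F) ^ (-s.re) := by
        refine mul_le_mul (wt_le_one _) ?_ (Real.rpow_nonneg (norm_pos_emb hx).le _) zero_le_one
        exact Real.rpow_le_rpow_of_nonpos (by positivity) h1 (by linarith)
    _ = (c * ‖emb x‖) ^ (-(finrank ℚ F * s.re)) := by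
        rw [one_mul, ← Real.rpow_natCast, ← Real.rpow_mul (by positivity)]; congr 1; ring
    _ = _ := by rw [Real.mul_rpow hc0.le (norm_nonneg _)]

/-- Main lattice sum lemma. -/
lemma lattice_sum (c : 𝓞 F → ℂ) (𝔞 : Ideal (𝓞 F)) (h𝔞 : 𝔞 ≠ ⊥) (hc : ∀ x, ‖c x‖ ≤ 1)
    (hper : ∀ x a, a ∈ 𝔞 → c (x + a) = c x)
    (hsum : ∀ [Fintype (𝓞 F ⧸ 𝔞)], ∑ q : 𝓞 F ⧸ 𝔞, c q.out = 0) :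
    ∃ g : ℂ → ℂ, DifferentiableAt ℂ g 1 ∧ ∃ δ > (0:ℝ), ∀ s : ℝ, 1 < s → s < 1 + δ →
      g s = ∑' x : 𝓞 F, c x * HH s x := by
  classical
  have hfin : Finite (𝓞 F ⧸ 𝔞) := Ideal.finiteQuotientOfFreeOfNeBot 𝔞 h𝔞
  have : Fintype (𝓞 F ⧸ 𝔞) := Fintype.ofFinite _
  choose R₀ C hR₀ hC hest using (fun q : 𝓞 F ⧸ 𝔞 => est2 (F := F) q.out)
  have hn : (0:ℝ) < finrank ℚ F := by exact_mod_cast (finrank_pos (R := ℚ) (M := F))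
  have hn1 : (1:ℝ) ≤ finrank ℚ F := by exact_mod_cast (finrank_pos (R := ℚ) (M := F))
  set δ : ℝ := (1 / 4) * (finrank ℚ F : ℝ)⁻¹ with hδ
  have hδ0 : 0 < δ := by positivity
  have hδ1 : δ ≤ 1 / 4 := by
    have : (finrank ℚ F : ℝ)⁻¹ ≤ 1 := inv_le_one_of_one_le₀ hn1
    linarith
  set term : 𝔞 → ℂ → ℂ := fun y s => ∑ q : 𝓞 F ⧸ 𝔞, c q.out * HH s (y.1 + q.out) with hterm
  have hball : ∀ s : ℂ, s ∈ Metric.ball (1:ℂ) δ → ‖s‖ ≤ 2 ∧ 1 - δ ≤ s.re := by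
    intro s hs
    rw [Metric.mem_ball, dist_eq_norm] at hs
    have h1 := norm_le_norm_add_norm_sub' s 1
    rw [norm_one] at h1
    have h2 := (Complex.abs_re_le_norm (s - 1)).trans hs.le
    rw [Complex.sub_re, Complex.one_re, abs_le] at h2
    constructor <;> linarith [h2.1]
  set Rm : ℝ := ∑ q, R₀ q with hRm
  have hRq : ∀ q, R₀ q ≤ Rm := fun q =>
    Finset.single_le_sum (f := R₀) (fun i _ => by linarith [hR₀ i]) (Finset.mem_univ q)
  set Cm : ℝ := ∑ q, C q with hCm
  set bd : 𝔞 → ℝ := fun y => (if ‖emb y.1‖ < Rm then (Fintype.card (𝓞 F ⧸ 𝔞) : ℝ) else 0) +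
    Cm * ‖emb y.1‖ ^ (-((finrank ℚ F : ℝ) + 3 / 4)) with hbd
  have hbdsum : Summable bd := by
    refine Summable.add ?_ ?_
    · refine summable_of_hasFiniteSupport ?_
      refine ((finite_emb (F := F) Rm).preimage (Subtype.val_injective.injOn)).subset ?_
      intro y hy
      by_contra h
      simp only [Set.mem_preimage, Set.mem_ofPred_eq] at h
      simp [h] at hy
    · exact ((summable_emb (F := F) ((finrank ℚ F : ℝ) + 3 / 4) (by linarith)).comp_injective
        Subtype.val_injective).mul_left Cm
  have hbound : ∀ (y : 𝔞) (s : ℂ), s ∈ Metric.ball (1:ℂ) δ → ‖term y s‖ ≤ bd y := by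
    intro y s hs
    obtain ⟨hs2, hsre⟩ := hball s hs
    have hCm0 : 0 ≤ Cm := Finset.sum_nonneg fun q _ => hC q
    by_cases hy : ‖emb y.1‖ < Rm
    · simp only [hbd, hy, if_true]
      refine (norm_sum_le _ _).trans ?_
      have : ∑ q : 𝓞 F ⧸ 𝔞, ‖c q.out * HH s (y.1 + q.out)‖ ≤ ∑ q : 𝓞 F ⧸ 𝔞, (1:ℝ) := by
        refine Finset.sum_le_sum fun q _ => ?_
        rw [norm_mul]
        exact mul_le_one₀ (hc _) (norm_nonneg _) (HH_norm_le_one s (by linarith) _)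
      rw [Finset.sum_const, Finset.card_univ, nsmul_eq_mul, mul_one] at this
      have h3 : 0 ≤ Cm * ‖emb y.1‖ ^ (-((finrank ℚ F : ℝ) + 3 / 4)) := by positivity
      linarith
    · simp only [hbd, hy, if_false, zero_add]
      have : term y s = ∑ q : 𝓞 F ⧸ 𝔞, c q.out * (HH s (y.1 + q.out) - HH s y.1) := by
        simp_rw [mul_sub]
        rw [Finset.sum_sub_distrib, ← Finset.sum_mul, hsum, zero_mul, sub_zero]
      rw [this, hCm, Finset.sum_mul]
      refine (norm_sum_le _ _).trans (Finset.sum_le_sum fun q _ => ?_)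
      rw [norm_mul]
      refine (mul_le_of_le_one_left (norm_nonneg _) (hc _)).trans ?_
      exact hest q y.1 ((hRq q).trans (not_lt.mp hy)) s hs2 hsre
  refine ⟨fun s => ∑' y, term y s, ?_, δ, hδ0, ?_⟩
  · have hd : DifferentiableOn ℂ (fun s => ∑' y, term y s) (Metric.ball (1:ℂ) δ) := by
      refine Complex.differentiableOn_tsum_of_summable_norm hbdsum ?_ Metric.isOpen_ball hbound
      intro y
      refine DifferentiableOn.fun_sum fun q _ => ?_
      refine DifferentiableOn.const_mul ?_ _
      unfold HH
      refine DifferentiableOn.const_mul ?_ _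
      intro s hs
      have hs0 : s ≠ 0 := by
        rintro rfl
        have := (hball 0 hs).2
        simp at this
        linarith
      refine DifferentiableAt.differentiableWithinAt ?_
      exact (differentiableAt_id.neg).const_cpow (Or.inr (neg_ne_zero.mpr hs0))
    exact (hd 1 (Metric.mem_ball_self hδ0)).differentiableAt (Metric.ball_mem_nhds _ hδ0)
  · intro s hs1 hs2
    let e : (𝔞 × (𝓞 F ⧸ 𝔞)) ≃ 𝓞 F :=
      { toFun := fun p => p.1.1 + p.2.out
        invFun := fun x => (⟨x - (Ideal.Quotient.mk 𝔞 x).out, by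
            rw [← Ideal.Quotient.eq]; exact (Quotient.out_eq _).symm⟩, Ideal.Quotient.mk 𝔞 x)
        left_inv := by
          rintro ⟨⟨y, hy⟩, q⟩
          have hq : Ideal.Quotient.mk 𝔞 (y + q.out) = q := by
            rw [map_add, Ideal.Quotient.eq_zero_iff_mem.mpr hy, zero_add]
            exact Quotient.out_eq q
          simp only [hq]
          ext <;> simp
        right_inv := fun x => by simp }
    have hS : Summable (fun x : 𝓞 F => c x * HH (s : ℂ) x) := by
      refine Summable.of_norm ?_
      refine Summable.of_nonneg_of_le (fun _ => norm_nonneg _) (fun x => ?_)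
        (HH_summable (F := F) (s : ℂ) (by simpa using hs1))
      rw [norm_mul]
      exact mul_le_of_le_one_left (norm_nonneg _) (hc _)
    have hS2 : Summable (fun p : 𝔞 × (𝓞 F ⧸ 𝔞) => c (e p) * HH (s : ℂ) (e p)) :=
      hS.comp_injective e.injective
    rw [← e.tsum_eq, Summable.tsum_prod (f := fun p => c (e p) * HH (s : ℂ) (e p)) hS2]
    refine tsum_congr fun y => ?_
    rw [tsum_fintype]
    refine Finset.sum_congr rfl fun q _ => ?_
    congr 1
    change c q.out = c (y.1 + q.out)
    rw [add_comm, hper _ _ y.2]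

end

end S14


namespace S14

open NumberField NumberField.Units NumberField.mixedEmbedding NumberField.InfinitePlace
  NumberField.mixedEmbedding.fundamentalCone NumberField.Units.dirichletUnitTheorem Module

open scoped Classical
set_option linter.unusedSectionVars false

noncomputable section

variable {F : Type*} [Field F] [NumberField F]

/-- The set of nonzero ideals `I` with `I * J` principal. -/
def clsSet (J : Ideal (𝓞 F)) : Set (Ideal (𝓞 F)) :=
  {I | I ≠ ⊥ ∧ ∃ x : 𝓞 F, I * J = Ideal.span {x}}

/-- norm power -/
def Npow (s : ℂ) (I : Ideal (𝓞 F)) : ℂ := ((Ideal.absNorm I : ℕ) : ℂ) ^ (-s)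

lemma emb_unit (u : (𝓞 F)ˣ) (x : 𝓞 F) : emb ((u : 𝓞 F) * x) = u • emb x := by
  simp [emb, unitSMul_smul]

lemma Npow_mul (s : ℂ) (I J : Ideal (𝓞 F)) : Npow s (I * J) = Npow s I * Npow s J := by
  unfold Npow
  rw [map_mul]
  push_cast
  have := Complex.mul_cpow_ofReal_nonneg (a := (Ideal.absNorm I : ℝ)) (b := (Ideal.absNorm J : ℝ))
    (by positivity) (by positivity) (-s)
  simpa using this

lemma absNorm_pos' {I : Ideal (𝓞 F)} (hI : I ≠ ⊥) : 0 < Ideal.absNorm I :=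
  Nat.pos_of_ne_zero (by rwa [Ne, Ideal.absNorm_eq_zero_iff])

lemma Npow_ne {s : ℂ} {I : Ideal (𝓞 F)} (hI : I ≠ ⊥) : Npow s I ≠ 0 := by
  unfold Npow
  rw [Complex.cpow_ne_zero_iff]
  left
  exact_mod_cast (absNorm_pos' hI).ne'

lemma HH_eq (s : ℂ) (x : 𝓞 F) : HH s x = (wt (emb x) : ℂ) * Npow s (Ideal.span {x}) := by
  rw [HH, emb_norm_eq, Npow, Complex.ofReal_natCast]

section cls
variable (J : Ideal (𝓞 F))

/-- chosen generator -/
def clsGen (I : clsSet J) : 𝓞 F := I.2.2.choose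
lemma clsGen_spec (I : clsSet J) : (I : Ideal (𝓞 F)) * J = Ideal.span {clsGen J I} :=
  I.2.2.choose_spec

/-- parametrisation of nonzero elements of `J` -/
def clsPar (q : clsSet J × (𝓞 F)ˣ) : 𝓞 F := (q.2 : 𝓞 F) * clsGen J q.1

lemma clsGen_ne (hJ : J ≠ ⊥) (I : clsSet J) : clsGen J I ≠ 0 := by
  intro h
  have := clsGen_spec J I
  rw [h, Ideal.span_singleton_eq_bot.mpr rfl, Ideal.mul_eq_bot] at this
  exact this.elim I.2.1 hJ

lemma clsPar_span (q : clsSet J × (𝓞 F)ˣ) :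
    Ideal.span {clsPar J q} = (q.1 : Ideal (𝓞 F)) * J := by
  rw [clsGen_spec, clsPar, Ideal.span_singleton_eq_span_singleton]
  exact associated_unit_mul_left _ _ q.2.isUnit

lemma clsPar_inj (hJ : J ≠ ⊥) : Function.Injective (clsPar J) := by
  intro q q' h
  have h1 : q.1 = q'.1 := by
    have := clsPar_span J q
    rw [h, clsPar_span] at this
    exact Subtype.ext (mul_right_cancel₀ hJ this).symm
  refine Prod.ext h1 ?_
  unfold clsPar at h
  rw [h1] at h
  exact Units.ext (mul_right_cancel₀ (clsGen_ne J hJ _) h)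

lemma clsPar_range {x : 𝓞 F} (hx : x ≠ 0) (hxJ : x ∈ J) : x ∈ Set.range (clsPar J) := by
  obtain ⟨I, hI⟩ := Ideal.dvd_iff_le.mpr ((Ideal.span_singleton_le_iff_mem J).mpr hxJ)
  have hI0 : I ≠ ⊥ := by
    rintro rfl
    rw [Ideal.mul_bot, Ideal.span_singleton_eq_bot] at hI
    exact hx hI
  let I' : clsSet J := ⟨I, hI0, x, by rw [mul_comm, hI]⟩
  have h1 : Ideal.span {clsGen J I'} = Ideal.span {x} := by
    rw [← clsGen_spec, hI, mul_comm]
  rw [Ideal.span_singleton_eq_span_singleton] at h1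
  obtain ⟨u, hu⟩ := h1
  exact ⟨(I', u), by simp only [clsPar]; rw [mul_comm, hu]⟩

lemma class_sum (hJ : J ≠ ⊥) (ξ : Ideal (𝓞 F) → ℂ) (c : 𝓞 F → ℂ) (hc1 : ∀ x, ‖c x‖ ≤ 1)
    (hcJ : ∀ x, x ∉ J → c x = 0) (hc : ∀ I x, I * J = Ideal.span {x} → c x = ξ I)
    (s : ℂ) (hs : 1 < s.re) :
    Summable (fun I : clsSet J => ξ I * Npow s (I : Ideal (𝓞 F))) ∧
    ∑' x, c x * HH s x = (torsionOrder F : ℕ) * Npow s J *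
      ∑' I : clsSet J, ξ I * Npow s (I : Ideal (𝓞 F)) := by
  have hs0 : s ≠ 0 := by rintro rfl; simp at hs; linarith
  have hsum : Summable (fun x => c x * HH s x) := by
    refine Summable.of_norm_bounded (HH_summable s hs) fun x => ?_
    rw [norm_mul]
    exact mul_le_of_le_one_left (norm_nonneg _) (hc1 x)
  have hsum' : Summable (fun q => c (clsPar J q) * HH s (clsPar J q)) :=
    hsum.comp_injective (clsPar_inj J hJ)
  have hinner : ∀ I : clsSet J, HasSum (fun u => c (clsPar J (I, u)) * HH s (clsPar J (I, u)))
      ((torsionOrder F : ℕ) * Npow s J * (ξ I * Npow s (I : Ideal (𝓞 F)))) := by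
    intro I
    have h1 := wt_hasSum (emb (clsGen J I)) (emb_norm_ne (clsGen_ne J hJ I))
    have h2 := (Complex.hasSum_ofReal.mpr h1).mul_right
      (ξ I * Npow s ((I : Ideal (𝓞 F)) * J))
    rw [Npow_mul] at h2
    have e1 : (fun u => c (clsPar J (I, u)) * HH s (clsPar J (I, u))) =
        fun u => ((wt (u • emb (clsGen J I)) : ℝ) : ℂ) * (ξ I * (Npow s (I : Ideal (𝓞 F)) * Npow s J)) := by
      funext u
      rw [hc I _ (clsPar_span J (I, u)).symm, HH_eq, clsPar_span, ← Npow_mul, clsPar, emb_unit]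
      ring
    rw [e1]
    have e2 : ((torsionOrder F : ℕ) : ℂ) * Npow s J * (ξ I * Npow s (I : Ideal (𝓞 F))) =
      (((torsionOrder F : ℕ) : ℝ) : ℂ) * (ξ I * (Npow s (I : Ideal (𝓞 F)) * Npow s J)) := by
      push_cast; ring
    rw [e2]
    exact h2
  have hout := hsum'.prod
  simp only [(hinner _).tsum_eq] at hout
  have hw : (((torsionOrder F : ℕ) : ℂ) * Npow s J) ≠ 0 := by
    refine mul_ne_zero ?_ (Npow_ne hJ)
    exact_mod_cast (torsionOrder_pos F).ne'
  refine ⟨(summable_mul_left_iff hw).mp hout, ?_⟩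
  rw [← (clsPar_inj J hJ).tsum_eq (f := fun x => c x * HH s x), hsum'.tsum_prod]
  · simp only [(hinner _).tsum_eq]
    rw [tsum_mul_left]
  · intro x hx
    rw [Function.mem_support] at hx
    apply clsPar_range
    · rintro rfl; rw [HH_zero hs0] at hx; simp at hx
    · by_contra h; rw [hcJ x h] at hx; simp at hx

end cls

lemma mem_clsSet_iff (J : (Ideal (𝓞 F))) (hJ : J ∈ nonZeroDivisors (Ideal (𝓞 F))) (C : ClassGroup (𝓞 F))
    (hC : ClassGroup.mk0 ⟨J, hJ⟩ = C⁻¹) (I : Ideal (𝓞 F)) :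
    I ∈ clsSet J ↔ ∃ h : I ∈ nonZeroDivisors (Ideal (𝓞 F)), ClassGroup.mk0 ⟨I, h⟩ = C := by
  have key : ∀ h : I ∈ nonZeroDivisors (Ideal (𝓞 F)),
      ClassGroup.mk0 ⟨I, h⟩ = C ↔ Submodule.IsPrincipal (I * J) := by
    intro h
    rw [← ClassGroup.mk0_eq_one_iff (mul_mem h hJ)]
    have : (⟨I * J, mul_mem h hJ⟩ : nonZeroDivisors (Ideal (𝓞 F))) = ⟨I, h⟩ * ⟨J, hJ⟩ := rfl
    rw [this, map_mul, hC, mul_inv_eq_one]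
  constructor
  · rintro ⟨h, x, hx⟩
    exact ⟨mem_nonZeroDivisors_of_ne_zero h, (key _).mpr ⟨x, hx⟩⟩
  · rintro ⟨h, hI⟩
    refine ⟨nonZeroDivisors.ne_zero h, ?_⟩
    obtain ⟨x, hx⟩ := (key h).mp hI
    exact ⟨x, hx⟩

/-- Any ideal class is represented by (the inverse of) an ideal prime to `𝔪`. -/
lemma exists_rep (𝔪 : Ideal (𝓞 F)) (h𝔪 : 𝔪 ≠ ⊥) (C : ClassGroup (𝓞 F)) :
    ∃ J : Ideal (𝓞 F), J ≠ ⊥ ∧ IsCoprime J 𝔪 ∧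
      ∀ I : (Ideal (𝓞 F)), I ∈ clsSet J ↔ ∃ h : I ∈ nonZeroDivisors (Ideal (𝓞 F)), ClassGroup.mk0 ⟨I, h⟩ = C := by
  obtain ⟨I0, hI0⟩ := ClassGroup.mk0_surjective C
  have hI0' : (I0 : Ideal (𝓞 F)) ≠ ⊥ := nonZeroDivisors.ne_zero I0.2
  have hmI : 𝔪 * (I0 : Ideal (𝓞 F)) ≠ ⊥ := mul_ne_zero h𝔪 hI0'
  obtain ⟨a, ha0, ha⟩ : ∃ a : 𝓞 F, a ≠ 0 ∧ 𝔪 * (I0 : Ideal (𝓞 F)) ⊔ Ideal.span {a} = I0 := by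
    obtain ⟨a, ha⟩ := IsDedekindDomain.exists_sup_span_eq
      (I := 𝔪 * (I0 : Ideal (𝓞 F))) (J := (I0 : Ideal (𝓞 F))) Ideal.mul_le_right hmI
    by_cases h : a = 0
    · obtain ⟨b, hb, hb0⟩ := Submodule.exists_mem_ne_zero_of_ne_bot hmI
      refine ⟨b, hb0, ?_⟩
      subst h
      rw [Ideal.span_singleton_eq_bot.mpr rfl, sup_bot_eq] at ha
      rw [sup_eq_left.mpr ((Ideal.span_singleton_le_iff_mem _).mpr hb), ha]
    · exact ⟨a, h, ha⟩
  have hale : Ideal.span {a} ≤ (I0 : Ideal (𝓞 F)) := by rw [← ha]; exact le_sup_right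
  obtain ⟨J, hJ⟩ := Ideal.dvd_iff_le.mpr hale
  have hcop : 𝔪 ⊔ J = ⊤ := by
    rw [hJ, mul_comm 𝔪, ← Ideal.mul_sup] at ha
    conv_rhs at ha => rw [← Ideal.mul_top (I0 : Ideal (𝓞 F))]
    exact mul_left_cancel₀ hI0' ha
  have hJ0 : J ≠ ⊥ := by
    rintro rfl
    rw [Ideal.mul_bot, Ideal.span_singleton_eq_bot] at hJ
    exact ha0 hJ
  have hJm := mem_nonZeroDivisors_of_ne_zero hJ0
  refine ⟨J, hJ0, by rw [Ideal.isCoprime_iff_sup_eq, sup_comm, hcop], mem_clsSet_iff J hJm C ?_⟩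
  rw [← hI0, eq_inv_iff_mul_eq_one, ← map_mul]
  have : (⟨J, hJm⟩ * I0 : nonZeroDivisors (Ideal (𝓞 F))) = ⟨J * I0, mul_mem hJm I0.2⟩ := rfl
  rw [this, ClassGroup.mk0_eq_one_iff]
  exact ⟨a, by rw [mul_comm]; exact hJ.symm⟩

/-- Chosen representative. -/
def rep (𝔪 : Ideal (𝓞 F)) (h𝔪 : 𝔪 ≠ ⊥) (C : ClassGroup (𝓞 F)) : Ideal (𝓞 F) :=
  (exists_rep 𝔪 h𝔪 C).choose

lemma decomp (𝔪 : Ideal (𝓞 F)) (h𝔪 : 𝔪 ≠ ⊥) (f : Ideal (𝓞 F) → ℂ) (hf : f ⊥ = 0) (I : Ideal (𝓞 F)) :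
    f I = ∑ C : ClassGroup (𝓞 F), (clsSet (rep 𝔪 h𝔪 C)).indicator f I := by
  by_cases hI : I = ⊥
  · subst hI
    rw [hf]; symm
    apply Finset.sum_eq_zero
    intro C _
    exact Set.indicator_of_notMem (fun h => h.1 rfl) _
  have hIm := mem_nonZeroDivisors_of_ne_zero hI
  rw [Finset.sum_eq_single (ClassGroup.mk0 ⟨I, hIm⟩)]
  · rw [Set.indicator_of_mem]
    exact ((exists_rep 𝔪 h𝔪 _).choose_spec.2.2 I).mpr ⟨hIm, rfl⟩
  · intro C _ hC
    apply Set.indicator_of_notMem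
    intro h
    obtain ⟨_, h'⟩ := ((exists_rep 𝔪 h𝔪 _).choose_spec.2.2 I).mp h
    exact hC h'.symm
  · simp

lemma Npow_bot {s : ℂ} (hs : s ≠ 0) : Npow s (⊥ : Ideal (𝓞 F)) = 0 := by
  simp [Npow, Complex.zero_cpow (neg_ne_zero.mpr hs)]

lemma Npow_summable (s : ℂ) (hs : 1 < s.re) : Summable (fun I : Ideal (𝓞 F) => Npow s I) := by
  have hs0 : s ≠ 0 := by rintro rfl; simp at hs; linarith
  have h1 : ∀ C, Summable ((clsSet (rep (⊤ : Ideal (𝓞 F)) top_ne_bot C)).indicator (Npow s)) := by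
    intro C
    rw [← summable_subtype_iff_indicator]
    have := (class_sum (rep (⊤ : Ideal (𝓞 F)) top_ne_bot C)
      (exists_rep (⊤ : Ideal (𝓞 F)) top_ne_bot C).choose_spec.1 (fun _ => 1)
      (fun x => if x ∈ rep (⊤ : Ideal (𝓞 F)) top_ne_bot C then 1 else 0)
      (fun x => by split_ifs <;> simp) (fun x hx => by simp [hx])
      (fun I x h => by
        rw [if_pos]
        rw [← Ideal.span_singleton_le_iff_mem, ← h]
        exact Ideal.mul_le_right) s hs).1
    simp only [one_mul] at this
    exact this
  have := summable_sum (s := Finset.univ) fun C _ => h1 C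
  refine this.congr fun I => ?_
  exact (decomp _ _ _ (Npow_bot hs0) I).symm

lemma Npow_norm (s : ℂ) (hs : 1 < s.re) (I : Ideal (𝓞 F)) : ‖Npow s I‖ = ((Ideal.absNorm I : ℕ) : ℝ) ^ (-s.re) := by
  by_cases hI : I = ⊥
  · subst hI
    have hs0 : s ≠ 0 := by rintro rfl; simp at hs; linarith
    rw [Npow_bot hs0]
    simp [Real.zero_rpow (show -s.re ≠ 0 by linarith)]
  · unfold Npow
    rw [Complex.norm_natCast_cpow_of_pos (absNorm_pos' hI)]
    simp

/-- hypotheses on a ray class character -/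
structure RayChar (𝔪 : Ideal (𝓞 F)) (ξ : Ideal (𝓞 F) →*₀ ℂ) : Prop where
  ne : 𝔪 ≠ ⊥
  le : ∀ I, ‖ξ I‖ ≤ 1
  nz : ∀ I, ξ I ≠ 0 ↔ IsCoprime I 𝔪
  per : ∀ x y : 𝓞 F, x - y ∈ 𝔪 → ξ (Ideal.span {x}) = ξ (Ideal.span {y})

lemma RayChar.summable {𝔪 : Ideal (𝓞 F)} {ξ : Ideal (𝓞 F) →*₀ ℂ} (h : RayChar 𝔪 ξ) (s : ℂ) (hs : 1 < s.re) :
    Summable (fun I => ξ I * Npow s I) := by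
  refine Summable.of_norm_bounded ((Npow_summable s hs).norm) fun I => ?_
  rw [norm_mul]
  exact mul_le_of_le_one_left (norm_nonneg _) (h.le I)

lemma RayChar.mean {𝔪 : Ideal (𝓞 F)} {ξ : Ideal (𝓞 F) →*₀ ℂ} (h : RayChar 𝔪 ξ)
    (u : 𝓞 F) (hu : IsCoprime (Ideal.span {u}) 𝔪) (hu1 : ξ (Ideal.span {u}) ≠ 1)
    (J : Ideal (𝓞 F)) (hJm : IsCoprime J 𝔪) (c : 𝓞 F → ℂ)
    (hcdef : ∀ x, c x = if x ∈ J then ξ (Ideal.span {x}) else 0)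
    (hper : ∀ x a, a ∈ 𝔪 * J → c (x + a) = c x)
    [Fintype (𝓞 F ⧸ (𝔪 * J))] : ∑ q : 𝓞 F ⧸ (𝔪 * J), c q.out = 0 := by
  obtain ⟨m, hm, j, hj, hmj⟩ := Submodule.mem_sup.mp
    ((Ideal.eq_top_iff_one _).mp (Ideal.isCoprime_iff_sup_eq.mp hJm.symm))
  obtain ⟨v, hv⟩ : ∃ v : 𝓞 F, v = u * j + m := ⟨_, rfl⟩
  have hvm : v - u ∈ 𝔪 := by
    have : v - u = m * (1 - u) := by rw [hv]; linear_combination u * hmj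
    rw [this]; exact Ideal.mul_mem_right _ _ hm
  have hvJ : v - 1 ∈ J := by
    have : v - 1 = j * (u - 1) := by rw [hv]; linear_combination hmj
    rw [this]; exact Ideal.mul_mem_right _ _ hj
  have hvu : IsUnit (Ideal.Quotient.mk (𝔪 * J) v) := by
    have hco : IsCoprime (Ideal.span {v}) (𝔪 * J) := by
      apply IsCoprime.mul_right
      · rw [Ideal.isCoprime_iff_sup_eq, Ideal.eq_top_iff_one] at hu ⊢
        obtain ⟨a, ha, b, hb, hab⟩ := Submodule.mem_sup.mp hu
        obtain ⟨r, rfl⟩ := Ideal.mem_span_singleton.mp ha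
        have : (1 : 𝓞 F) = v * r + (b - (v - u) * r) := by rw [← hab]; ring
        rw [this]
        exact Submodule.add_mem_sup (Ideal.mem_span_singleton.mpr ⟨r, rfl⟩)
          (sub_mem hb (Ideal.mul_mem_right _ _ hvm))
      · rw [Ideal.isCoprime_iff_sup_eq, Ideal.eq_top_iff_one]
        have : (1 : 𝓞 F) = v + (-(v - 1)) := by ring
        rw [this]
        exact Submodule.add_mem_sup (Ideal.mem_span_singleton_self v) (neg_mem hvJ)
    rw [Ideal.isCoprime_iff_sup_eq, Ideal.eq_top_iff_one] at hco
    obtain ⟨a, ha, b, hb, hab⟩ := Submodule.mem_sup.mp hco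
    obtain ⟨r, rfl⟩ := Ideal.mem_span_singleton.mp ha
    refine IsUnit.of_mul_eq_one (Ideal.Quotient.mk _ r) ?_
    rw [← map_mul, ← map_one (Ideal.Quotient.mk (𝔪 * J)), Ideal.Quotient.eq]
    have : v * r - 1 = -b := by rw [← hab]; ring
    rw [this]; exact neg_mem hb
  let e : (𝓞 F ⧸ (𝔪 * J)) ≃ (𝓞 F ⧸ (𝔪 * J)) := hvu.unit.mulLeft
  have hce : ∀ x : 𝓞 F, c ((Ideal.Quotient.mk (𝔪 * J) x).out) = c x := by
    intro x
    have h1 : (Ideal.Quotient.mk (𝔪 * J) x).out - x ∈ 𝔪 * J := by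
      rw [← Ideal.Quotient.eq]; exact Quotient.out_eq' _
    have := hper x _ h1
    rwa [add_sub_cancel] at this
  have h2 : ∀ q, c (e q).out = ξ (Ideal.span {u}) * c q.out := by
    intro q
    have h3 : e q = Ideal.Quotient.mk (𝔪 * J) (v * q.out) := by
      rw [map_mul]
      have e1 : e q = Ideal.Quotient.mk (𝔪 * J) v * q := rfl
      have e2 : Ideal.Quotient.mk (𝔪 * J) q.out = q := Quotient.out_eq' q
      rw [e1, e2]
    rw [h3, hce]
    have hmem : v * q.out ∈ J ↔ q.out ∈ J := by
      have : v * q.out = q.out + (v - 1) * q.out := by ring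
      rw [this, Ideal.add_mem_iff_left J (Ideal.mul_mem_right _ _ hvJ)]
    simp only [hcdef, hmem]
    split_ifs
    · rw [← Ideal.span_singleton_mul_span_singleton, map_mul, h.per v u hvm]
    · simp
  have h4 : ∑ q : 𝓞 F ⧸ (𝔪 * J), c q.out = ξ (Ideal.span {u}) * ∑ q : 𝓞 F ⧸ (𝔪 * J), c q.out := by
    rw [Finset.mul_sum]
    conv_lhs => rw [← Equiv.sum_comp e]
    exact Finset.sum_congr rfl fun q _ => h2 q
  have h5 : (1 - ξ (Ideal.span {u})) * ∑ q : 𝓞 F ⧸ (𝔪 * J), c q.out = 0 := by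
    rw [sub_mul, ← h4, one_mul, sub_self]
  exact (mul_eq_zero.mp h5).resolve_left (sub_ne_zero.mpr hu1.symm)

set_option maxHeartbeats 800000 in
theorem RayChar.ext {𝔪 : Ideal (𝓞 F)} {ξ : Ideal (𝓞 F) →*₀ ℂ} (h : RayChar 𝔪 ξ)
    (u : 𝓞 F) (hu : IsCoprime (Ideal.span {u}) 𝔪) (hu1 : ξ (Ideal.span {u}) ≠ 1) :
    ∃ g : ℂ → ℂ, DifferentiableAt ℂ g 1 ∧ ∃ δ > (0:ℝ), ∀ s : ℝ, 1 < s → s < 1 + δ →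
      g s = ∑' I, ξ I * Npow s I := by
  have h𝔪 := h.ne
  have key : ∀ C : ClassGroup (𝓞 F), ∃ g : ℂ → ℂ, DifferentiableAt ℂ g 1 ∧ ∃ δ > (0:ℝ), ∀ s : ℝ, 1 < s → s < 1 + δ →
      g s = ∑' I, (clsSet (rep 𝔪 h𝔪 C)).indicator (fun I => ξ I * Npow s I) I := by
    intro C
    obtain ⟨hJ0, hJm, -⟩ := (exists_rep 𝔪 h𝔪 C).choose_spec
    change rep 𝔪 h𝔪 C ≠ ⊥ at hJ0
    change IsCoprime (rep 𝔪 h𝔪 C) 𝔪 at hJm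
    generalize rep 𝔪 h𝔪 C = J at hJ0 hJm
    let c : 𝓞 F → ℂ := fun x => if x ∈ J then ξ (Ideal.span {x}) else 0
    have hc1 : ∀ x, ‖c x‖ ≤ 1 := by
      intro x; simp only [c]; split_ifs
      · exact h.le _
      · simp
    have hper : ∀ x a, a ∈ 𝔪 * J → c (x + a) = c x := by
      intro x a ha
      have haJ : a ∈ J := Ideal.mul_le_right ha
      have ham : a ∈ 𝔪 := Ideal.mul_le_left ha
      simp only [c]
      rw [Ideal.add_mem_iff_left J haJ, h.per (x + a) x (by simpa using ham)]
    have hsum : ∀ [Fintype (𝓞 F ⧸ (𝔪 * J))], ∑ q : 𝓞 F ⧸ (𝔪 * J), c q.out = 0 := by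
      exact RayChar.mean h u hu hu1 J hJm c (fun x => rfl) hper
    obtain ⟨g, hg, δ, hδ, hgs⟩ := lattice_sum c (𝔪 * J) (mul_ne_zero h.ne hJ0) hc1 hper hsum
    have hξJ : ξ J ≠ 0 := (h.nz J).mpr hJm
    have hw : ((torsionOrder F : ℕ) : ℂ) ≠ 0 := by exact_mod_cast (torsionOrder_pos F).ne'
    refine ⟨fun s => g s / ((torsionOrder F : ℕ) * Npow s J * ξ J), ?_, δ, hδ, fun s hs1 hs2 => ?_⟩
    · refine hg.div ?_ (mul_ne_zero (mul_ne_zero hw (Npow_ne hJ0)) hξJ)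
      unfold Npow
      have : ((Ideal.absNorm J : ℕ) : ℂ) ≠ 0 := by exact_mod_cast (absNorm_pos' hJ0).ne'
      fun_prop (disch := simp [this])
    · have := (class_sum J hJ0 (fun I => ξ I * ξ J) c hc1 (fun x hx => by simp [c, hx])
        (fun I x hx => by
          have : x ∈ J := by
            rw [← Ideal.span_singleton_le_iff_mem, ← hx]
            exact Ideal.mul_le_right
          simp only [c, this, if_true]
          rw [← hx, map_mul]) s (by simpa using hs1)).2
      simp only
      rw [hgs s hs1 hs2, this, div_eq_iff (mul_ne_zero (mul_ne_zero hw (Npow_ne hJ0)) hξJ), ← tsum_subtype]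
      simp only [mul_right_comm _ (ξ J)]
      rw [tsum_mul_right]
      ring
  choose g hg δ hδ hgs using key
  refine ⟨fun s => ∑ C, g C s, ?_, Finset.univ.inf' Finset.univ_nonempty δ, ?_, ?_⟩
  · fun_prop
  · simpa using hδ
  · intro s hs1 hs2
    have hs0 : (s : ℂ) ≠ 0 := by
      have : s ≠ 0 := by linarith
      exact_mod_cast this
    have hsre : 1 < (s : ℂ).re := by simpa using hs1
    have e1 : ∀ I, ξ I * Npow s I = ∑ C : ClassGroup (𝓞 F),
        (clsSet (rep 𝔪 h𝔪 C)).indicator (fun I => ξ I * Npow s I) I :=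
      decomp 𝔪 h𝔪 _ (by rw [Npow_bot hs0, mul_zero])
    rw [tsum_congr e1, Summable.tsum_finsetSum]
    · refine Finset.sum_congr rfl fun C _ => hgs C s hs1 (hs2.trans_le ?_)
      have := Finset.inf'_le δ (Finset.mem_univ C)
      linarith
    · intro C _
      exact (h.summable s hsre).indicator _

end
end S14


namespace S14

open NumberField NumberField.Units IsDedekindDomain Filter Topology

open scoped Classical
set_option linter.unusedSectionVars false

noncomputable section

variable {F : Type*} [Field F] [NumberField F]

/-- sifted set -/
def Scop (S : Finset (HeightOneSpectrum (𝓞 F))) (I : Ideal (𝓞 F)) : Prop := ∀ v ∈ S, ¬ v.asIdeal ∣ I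

/-- sifted function -/
def sift (f : Ideal (𝓞 F) → ℂ) (S : Finset (HeightOneSpectrum (𝓞 F))) (I : Ideal (𝓞 F)) : ℂ :=
  if Scop S I then f I else 0

lemma sift_norm_le (f : Ideal (𝓞 F) → ℂ) (S) (I) : ‖sift f S I‖ ≤ ‖f I‖ := by
  unfold sift; split_ifs <;> simp

lemma sift_summable (f : Ideal (𝓞 F) → ℂ) (hf : Summable f) (S) : Summable (sift f S) :=
  Summable.of_norm_bounded hf.norm (sift_norm_le f S)

lemma prime_dvd_prime {v w : HeightOneSpectrum (𝓞 F)} (h : w.asIdeal ∣ v.asIdeal) : w = v := by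
  have := Ideal.dvd_iff_le.mp h
  exact HeightOneSpectrum.ext ((v.isMaximal.eq_of_le w.isMaximal.ne_top this).symm)

lemma Scop_mul {S : Finset (HeightOneSpectrum (𝓞 F))} {v} (hv : v ∉ S) (I : Ideal (𝓞 F)) :
    Scop S (v.asIdeal * I) ↔ Scop S I := by
  unfold Scop
  refine forall₂_congr fun w hw => not_congr ?_
  rw [w.prime.dvd_mul]
  constructor
  · rintro (h | h)
    · exact absurd (prime_dvd_prime h ▸ hw) hv
    · exact h
  · exact Or.inr

lemma sift_sum (f : Ideal (𝓞 F) →*₀ ℂ) (hf : Summable f) (S : Finset (HeightOneSpectrum (𝓞 F))) :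
    ∑' I, sift f S I = (∏ v ∈ S, (1 - f v.asIdeal)) * ∑' I, f I := by
  induction S using Finset.induction_on with
  | empty => simp [sift, Scop]
  | insert v S hv ih =>
    rw [Finset.prod_insert hv, mul_assoc, ← ih, sub_mul, one_mul, eq_sub_iff_add_eq, ← tsum_mul_left]
    have hinj : Function.Injective (fun I : Ideal (𝓞 F) => v.asIdeal * I) :=
      fun a b h => mul_left_cancel₀ v.ne_bot h
    let k : Ideal (𝓞 F) → ℂ := fun I => if v.asIdeal ∣ I then sift f S I else 0
    have hk : ∑' I, f v.asIdeal * sift f S I = ∑' I, k I := by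
      rw [← hinj.tsum_eq (f := k)]
      · refine tsum_congr fun I => ?_
        simp only [k, dvd_mul_right, if_true, sift, Scop_mul hv, map_mul]
        split_ifs <;> simp
      · intro I hI
        by_contra h
        apply hI
        simp only [k]
        rw [if_neg]
        rintro ⟨J, rfl⟩
        exact h ⟨J, rfl⟩
    have hks : Summable k := by
      refine Summable.of_norm_bounded hf.norm fun I => ?_
      simp only [k]
      split_ifs
      · exact sift_norm_le _ _ _
      · simp
    rw [hk, ← (sift_summable f hf _).tsum_add hks]
    refine tsum_congr fun I => ?_
    simp only [k, sift]
    by_cases h1 : v.asIdeal ∣ I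
    · have : ¬ Scop (insert v S) I := fun h => h v (Finset.mem_insert_self _ _) h1
      simp [h1, this]
    · have : Scop (insert v S) I ↔ Scop S I := by
        simp [Scop, h1]
      simp [h1, this]

lemma exists_hos {I : Ideal (𝓞 F)} (h0 : I ≠ ⊥) (h1 : I ≠ ⊤) : ∃ v : HeightOneSpectrum (𝓞 F), v.asIdeal ∣ I := by
  obtain ⟨M, hM, hIM⟩ := Ideal.exists_le_maximal I h1
  refine ⟨⟨M, hM.isPrime, ?_⟩, Ideal.dvd_iff_le.mpr hIM⟩
  rintro rfl
  exact h0 (le_bot_iff.mp hIM)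

lemma euler (f : Ideal (𝓞 F) →*₀ ℂ) (hf : Summable f) :
    Tendsto (fun S : Finset (HeightOneSpectrum (𝓞 F)) => (∏ v ∈ S, (1 - f v.asIdeal)) * ∑' I, f I)
      atTop (𝓝 1) := by
  simp_rw [← sift_sum f hf]
  have h1 : ∑' I : Ideal (𝓞 F), (if I = ⊤ then (1 : ℂ) else 0) = 1 := by
    rw [tsum_ite_eq]
  rw [← h1]
  refine tendsto_tsum_of_dominated_convergence hf.norm (fun I => ?_)
    (Eventually.of_forall fun S I => sift_norm_le _ _ _)
  apply tendsto_const_nhds.congr'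
  by_cases hT : I = ⊤
  · subst hT
    refine Eventually.of_forall fun S => ?_
    have : Scop S (⊤ : Ideal (𝓞 F)) := fun v _ h => v.isMaximal.ne_top (top_le_iff.mp (Ideal.dvd_iff_le.mp h))
    have h1 : f ⊤ = 1 := by rw [← Ideal.one_eq_top, map_one]
    simp [sift, this, h1]
  by_cases hB : I = ⊥
  · subst hB
    refine Eventually.of_forall fun S => ?_
    have : f ⊥ = 0 := map_zero f
    simp [sift, hT, this]
  obtain ⟨v, hv⟩ := exists_hos hB hT
  filter_upwards [eventually_ge_atTop {v}] with S hS
  have : ¬ Scop S I := fun h => h v (hS (Finset.mem_singleton_self v)) hv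
  simp [sift, this, hT]

lemma sum_Npow_eq_dedekindZeta (s : ℝ) (hs : 1 < s) :
    ∑' I : Ideal (𝓞 F), Npow s I = dedekindZeta F s := by
  have hs0 : (s : ℂ) ≠ 0 := by
    have : s ≠ 0 := by linarith
    exact_mod_cast this
  have h := (Npow_summable (F := F) (s : ℂ) (by simpa using hs)).hasSum.tsum_fiberwise
    (fun I => Ideal.absNorm I)
  rw [← h.tsum_eq, dedekindZeta, LSeries]
  refine tsum_congr fun n => ?_
  by_cases hn : n = 0
  · subst hn
    simp only [LSeries.term_zero]
    have : ∀ I : ((fun I : Ideal (𝓞 F) => Ideal.absNorm I) ⁻¹' {0}), Npow (s : ℂ) (I : Ideal (𝓞 F)) = 0 := by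
      intro I
      have : (I : Ideal (𝓞 F)) = ⊥ := Ideal.absNorm_eq_zero_iff.mp I.2
      rw [this, Npow_bot hs0]
    simp [this]
  · rw [LSeries.term_of_ne_zero hn]
    have : ∀ I : ((fun I : Ideal (𝓞 F) => Ideal.absNorm I) ⁻¹' {n}),
        Npow (s : ℂ) (I : Ideal (𝓞 F)) = (n : ℂ) ^ (-(s : ℂ)) := by
      intro I
      have : Ideal.absNorm (I : Ideal (𝓞 F)) = n := I.2
      rw [Npow, this]
    rw [tsum_congr this, tsum_const, Complex.cpow_neg, nsmul_eq_mul, div_eq_mul_inv]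
    rfl

/-- `ξ · N^{-s}` as a homomorphism -/
def twist (ξ : Ideal (𝓞 F) →*₀ ℂ) (s : ℂ) (hs : s ≠ 0) : Ideal (𝓞 F) →*₀ ℂ where
  toFun I := ξ I * Npow s I
  map_zero' := by rw [map_zero, zero_mul]
  map_one' := by rw [map_one]; simp [Npow]
  map_mul' I J := by rw [map_mul, Npow_mul]; ring

/-- `N^{-s}` as a homomorphism -/
def twist1 (s : ℂ) (hs : s ≠ 0) : Ideal (𝓞 F) →*₀ ℂ where
  toFun I := Npow s I
  map_zero' := Npow_bot hs
  map_one' := by simp [Npow]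
  map_mul' I J := by rw [Npow_mul]

lemma isCoprime_iff_factors {𝔪 : Ideal (𝓞 F)} (h𝔪 : 𝔪 ≠ ⊥) (I : Ideal (𝓞 F)) :
    IsCoprime I 𝔪 ↔ Scop (Ideal.finite_factors h𝔪).toFinset I := by
  rw [Ideal.isCoprime_iff_sup_eq]
  constructor
  · intro h v hv hvI
    simp only [Set.Finite.mem_toFinset, Set.mem_ofPred_eq] at hv
    refine v.isMaximal.ne_top (top_le_iff.mp ?_)
    rw [← h]
    exact sup_le (Ideal.dvd_iff_le.mp hvI) (Ideal.dvd_iff_le.mp hv)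
  · intro h
    by_contra hne
    obtain ⟨v, hv⟩ := exists_hos (I := I ⊔ 𝔪) (fun h => h𝔪 (le_bot_iff.mp (h ▸ le_sup_right))) hne
    have hv' := Ideal.dvd_iff_le.mp hv
    refine h v ?_ (Ideal.dvd_iff_le.mpr (le_sup_left.trans hv'))
    simp only [Set.Finite.mem_toFinset, Set.mem_ofPred_eq]
    exact Ideal.dvd_iff_le.mpr (le_sup_right.trans hv')

lemma principal_residue {𝔪 : Ideal (𝓞 F)} (h𝔪 : 𝔪 ≠ ⊥) (ξ : Ideal (𝓞 F) → ℂ)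
    (h1 : ∀ I, IsCoprime I 𝔪 → ξ I = 1) (h0 : ∀ I, ¬ IsCoprime I 𝔪 → ξ I = 0) :
    ∃ ρ : ℂ, ρ ≠ 0 ∧ Tendsto (fun s : ℝ => ((s : ℂ) - 1) * ∑' I, ξ I * Npow s I) (𝓝[>] 1) (𝓝 ρ) := by
  refine ⟨dedekindZeta_residue F * ∏ v ∈ (Ideal.finite_factors h𝔪).toFinset,
    (1 - Npow (1 : ℂ) v.asIdeal), ?_, ?_⟩
  · refine mul_ne_zero (by exact_mod_cast dedekindZeta_residue_ne_zero F) ?_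
    rw [Finset.prod_ne_zero_iff]
    intro v _
    have h1 : Ideal.absNorm v.asIdeal ≠ 1 := by
      rw [Ne, Ideal.absNorm_eq_one_iff]; exact v.isMaximal.ne_top
    rw [sub_ne_zero, Npow, Complex.cpow_neg_one]
    intro h
    rw [eq_comm, inv_eq_one] at h
    exact h1 (by exact_mod_cast h)
  · have hlim := (tendsto_sub_one_mul_dedekindZeta_nhdsGT F).mul
      (f := fun s : ℝ => (s - 1 : ℂ) * dedekindZeta F s)
      (g := fun s : ℝ => ∏ v ∈ (Ideal.finite_factors h𝔪).toFinset, (1 - Npow (s : ℂ) v.asIdeal))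
      (b := ∏ v ∈ (Ideal.finite_factors h𝔪).toFinset, (1 - Npow (1 : ℂ) v.asIdeal)) ?_
    · refine hlim.congr' ?_
      filter_upwards [self_mem_nhdsWithin] with s hs
      have hs1 : 1 < s := hs
      have hs0 : (s : ℂ) ≠ 0 := by
        have : s ≠ 0 := by linarith
        exact_mod_cast this
      rw [mul_assoc]
      congr 1
      rw [← sum_Npow_eq_dedekindZeta s hs, mul_comm]
      have := sift_sum (twist1 (F := F) (s : ℂ) hs0)
        (Npow_summable (F := F) (s : ℂ) (by simpa using hs1)) (Ideal.finite_factors h𝔪).toFinset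
      refine Eq.trans this.symm (tsum_congr fun I => ?_)
      simp only [sift]
      by_cases hI : IsCoprime I 𝔪
      · rw [h1 I hI, if_pos ((isCoprime_iff_factors h𝔪 I).mp hI), one_mul]; rfl
      · rw [h0 I hI, if_neg (fun h => hI ((isCoprime_iff_factors h𝔪 I).mpr h)), zero_mul]
    · apply tendsto_finsetProd
      intro v _
      apply Tendsto.sub tendsto_const_nhds
      apply Tendsto.mono_left _ nhdsWithin_le_nhds
      have : ((Ideal.absNorm v.asIdeal : ℕ) : ℂ) ≠ 0 := by exact_mod_cast (absNorm_pos' v.ne_bot).ne'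
      have hc : Continuous (fun s : ℝ => Npow (s : ℂ) v.asIdeal) := by
        unfold Npow
        exact Continuous.const_cpow (by fun_prop) (Or.inl this)
      simpa using hc.tendsto 1

end
end S14


namespace S14

open NumberField NumberField.Units IsDedekindDomain Filter Topology

open scoped Classical
set_option linter.unusedSectionVars false

noncomputable section

variable {F : Type*} [Field F] [NumberField F]

lemma prod_primRoot {p : ℕ} (hp : p.Prime) {y : ℂ} (hy : IsPrimitiveRoot y p) (z : ℂ) :
    ∏ k ∈ Finset.range p, (1 - y ^ (k + 1) * z) = 1 - z ^ p := by
  have h := hy.pow_sub_pow_eq_prod_sub_mul 1 z hp.pos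
  rw [one_pow] at h
  rw [h]
  have himg : (Finset.range p).image (fun k => y ^ (k + 1)) = Polynomial.nthRootsFinset p 1 := by
    apply Finset.eq_of_subset_of_card_le
    · intro w hw
      obtain ⟨k, _, rfl⟩ := Finset.mem_image.mp hw
      rw [Polynomial.mem_nthRootsFinset hp.pos, ← pow_mul, mul_comm, pow_mul, hy.pow_eq_one, one_pow]
    · rw [hy.card_nthRootsFinset, Finset.card_image_of_injOn, Finset.card_range]
      intro a ha b hb hab
      simp only [pow_succ] at hab
      have := mul_right_cancel₀ (hy.ne_zero hp.ne_zero) hab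
      exact hy.pow_inj (by simpa using ha) (by simpa using hb) this
  rw [← himg, Finset.prod_image]
  intro a ha b hb hab
  simp only [pow_succ] at hab
  have := mul_right_cancel₀ (hy.ne_zero hp.ne_zero) hab
  exact hy.pow_inj (by simpa using ha) (by simpa using hb) this

lemma primRoot_of {p : ℕ} (hp : p.Prime) {y : ℂ} (h : y ^ p = 1) (h1 : y ≠ 1) : IsPrimitiveRoot y p := by
  have := orderOf_eq_prime (hp := ⟨hp⟩) h h1
  exact this ▸ IsPrimitiveRoot.orderOf y

/-- Ray class characters of order dividing `p`. -/
structure PChar (p : ℕ) (𝔪 : Ideal (𝓞 F)) (ξ : Ideal (𝓞 F) →*₀ ℂ) : Prop where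
  ne : 𝔪 ≠ ⊥
  one : ∀ I, IsCoprime I 𝔪 → ξ I ^ p = 1
  zero : ∀ I, ¬ IsCoprime I 𝔪 → ξ I = 0
  per : ∀ x y : 𝓞 F, x - y ∈ 𝔪 → ξ (Ideal.span {x}) = ξ (Ideal.span {y})

lemma PChar.ray {p : ℕ} (hp : p.Prime) {𝔪 : Ideal (𝓞 F)} {ξ : Ideal (𝓞 F) →*₀ ℂ} (h : PChar p 𝔪 ξ) : RayChar 𝔪 ξ where
  ne := h.ne
  le I := by
    by_cases hI : IsCoprime I 𝔪
    · exact (Complex.norm_eq_one_of_pow_eq_one (h.one I hI) hp.ne_zero).le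
    · rw [h.zero I hI]; simp
  nz I := by
    constructor
    · intro h1; by_contra h2; exact h1 (h.zero I h2)
    · intro h1 h2
      have := h.one I h1
      rw [h2, zero_pow hp.ne_zero] at this
      exact zero_ne_one this
  per := h.per

/-- power of a character -/
def cpw (ξ : Ideal (𝓞 F) →*₀ ℂ) (k : ℕ) : Ideal (𝓞 F) →*₀ ℂ :=
  (powMonoidWithZeroHom (M₀ := ℂ) (Nat.succ_ne_zero k)).comp ξ

lemma cpw_apply (ξ : Ideal (𝓞 F) →*₀ ℂ) (k : ℕ) (I) : cpw ξ k I = ξ I ^ (k + 1) := rfl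

lemma PChar.cpw {p : ℕ} {𝔪 : Ideal (𝓞 F)} {ξ : Ideal (𝓞 F) →*₀ ℂ} (h : PChar p 𝔪 ξ) (k : ℕ) :
    PChar p 𝔪 (cpw ξ k) where
  ne := h.ne
  one I hI := by rw [cpw_apply, ← pow_mul, mul_comm, pow_mul, h.one I hI, one_pow]
  zero I hI := by rw [cpw_apply, h.zero I hI, zero_pow (Nat.succ_ne_zero k)]
  per x y hxy := by rw [cpw_apply, cpw_apply, h.per x y hxy]

lemma mzh_mul_apply (ξ ξ' : Ideal (𝓞 F) →*₀ ℂ) (I) : (ξ * ξ') I = ξ I * ξ' I := rfl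

lemma norm_one_sub_real (x : ℝ) (h : x ≤ 1) : ‖(1 : ℂ) - (x : ℂ)‖ = 1 - x := by
  rw [← Complex.ofReal_one, ← Complex.ofReal_sub, Complex.norm_real, Real.norm_of_nonneg (by linarith)]

lemma PChar.mul {p : ℕ} {𝔪 : Ideal (𝓞 F)} {ξ ξ' : Ideal (𝓞 F) →*₀ ℂ} (h : PChar p 𝔪 ξ) (h' : PChar p 𝔪 ξ') :
    PChar p 𝔪 (ξ * ξ') where
  ne := h.ne
  one I hI := by rw [mzh_mul_apply, mul_pow, h.one I hI, h'.one I hI, one_mul]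
  zero I hI := by rw [mzh_mul_apply, h.zero I hI, zero_mul]
  per x y hxy := by rw [mzh_mul_apply, mzh_mul_apply, h.per x y hxy, h'.per x y hxy]

/-- L-series -/
def LL (ξ : Ideal (𝓞 F) →*₀ ℂ) (s : ℝ) : ℂ := ∑' I, ξ I * Npow s I

lemma euler_L {p : ℕ} (hp : p.Prime) {𝔪 : Ideal (𝓞 F)} {ξ : Ideal (𝓞 F) →*₀ ℂ} (h : PChar p 𝔪 ξ) (s : ℝ) (hs : 1 < s) :
    Tendsto (fun S : Finset (HeightOneSpectrum (𝓞 F)) =>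
      (∏ v ∈ S, (1 - ξ v.asIdeal * Npow s v.asIdeal)) * LL ξ s) atTop (𝓝 1) := by
  have hs0 : (s : ℂ) ≠ 0 := by
    have : s ≠ 0 := by linarith
    exact_mod_cast this
  exact euler (twist ξ s hs0) ((h.ray hp).summable s (by simpa using hs))

lemma Npow_real (s : ℝ) {I : Ideal (𝓞 F)} (hI : I ≠ ⊥) :
    ∃ x : ℝ, Npow (s : ℂ) I = x ∧ 0 < x ∧ (0 ≤ s → x ≤ 1) := by
  have hpos := absNorm_pos' hI
  refine ⟨(Ideal.absNorm I : ℝ) ^ (-s), ?_, by positivity, fun hs => ?_⟩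
  · rw [Npow, Complex.ofReal_cpow (by positivity)]; simp
  · exact Real.rpow_le_one_of_one_le_of_nonpos (by exact_mod_cast hpos) (by linarith)

lemma LL_conj {p : ℕ} (hp : p.Prime) {𝔪 : Ideal (𝓞 F)} {ξ : Ideal (𝓞 F) →*₀ ℂ} (h : PChar p 𝔪 ξ)
    (k l : ℕ) (hkl : p ∣ (k + 1) + (l + 1)) (s : ℝ) :
    LL (cpw ξ l) s = starRingEnd ℂ (LL (cpw ξ k) s) := by
  unfold LL
  rw [Complex.conj_tsum]
  refine tsum_congr fun I => ?_
  rw [map_mul]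
  by_cases hI : I = ⊥
  · subst hI
    have : cpw ξ l ⊥ = 0 := map_zero _
    have h2 : cpw ξ k ⊥ = 0 := map_zero _
    rw [this, h2]; simp
  obtain ⟨x, hx, -⟩ := Npow_real s hI
  rw [hx, Complex.conj_ofReal]
  congr 1
  rw [cpw_apply, cpw_apply]
  by_cases hc : IsCoprime I 𝔪
  · have h1 := h.one I hc
    have hn := Complex.norm_eq_one_of_pow_eq_one h1 hp.ne_zero
    have h2 : ξ I ^ (k + 1) * ξ I ^ (l + 1) = 1 := by
      rw [← pow_add]
      obtain ⟨m, hm⟩ := hkl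
      rw [hm, pow_mul, h1, one_pow]
    have h3 : ‖ξ I ^ (k + 1)‖ = 1 := by rw [norm_pow, hn, one_pow]
    rw [← Complex.inv_eq_conj h3]
    exact eq_inv_of_mul_eq_one_right h2
  · rw [h.zero I hc]; simp

set_option maxHeartbeats 800000 in
theorem thmD {p : ℕ} (hp : p.Prime) (hp2 : 2 < p) {𝔪 : Ideal (𝓞 F)} {ψ ψ1 : Ideal (𝓞 F) →*₀ ℂ}
    (hψ : PChar p 𝔪 ψ) (hψ1 : PChar p 𝔪 ψ1)
    (hnt : ∀ k : ℕ, ∃ u : 𝓞 F, IsCoprime (Ideal.span {u}) 𝔪 ∧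
      ψ (Ideal.span {u}) * ψ1 (Ideal.span {u}) ^ k ≠ 1)
    (hnt1 : ∃ u : 𝓞 F, IsCoprime (Ideal.span {u}) 𝔪 ∧ ψ1 (Ideal.span {u}) ≠ 1) :
    ∃ v : HeightOneSpectrum (𝓞 F), IsCoprime v.asIdeal 𝔪 ∧ ψ1 v.asIdeal = 1 ∧ ψ v.asIdeal ≠ 1 := by
  by_contra hcon
  push Not at hcon
  have hA : ∀ k, ∃ g : ℂ → ℂ, DifferentiableAt ℂ g 1 ∧ ∃ δ > (0:ℝ), ∀ s : ℝ, 1 < s → s < 1 + δ →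
      g s = LL (ψ * cpw ψ1 k) s := by
    intro k
    obtain ⟨u, hu, hu1⟩ := hnt (k + 1)
    exact ((hψ.mul (hψ1.cpw k)).ray hp).ext u hu hu1
  have hB : ∀ k, ¬ p ∣ k + 1 → ∃ g : ℂ → ℂ, DifferentiableAt ℂ g 1 ∧ ∃ δ > (0:ℝ), ∀ s : ℝ, 1 < s → s < 1 + δ →
      g s = LL (cpw ψ1 k) s := by
    intro k hk
    obtain ⟨u, hu, hu1⟩ := hnt1
    refine ((hψ1.cpw k).ray hp).ext u hu ?_
    rw [cpw_apply]
    have := primRoot_of hp (hψ1.one _ hu) hu1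
    rwa [Ne, this.pow_eq_one_iff_dvd]
  -- limits
  have lim : ∀ (ξ : Ideal (𝓞 F) →*₀ ℂ) (g : ℂ → ℂ), DifferentiableAt ℂ g 1 →
      (∃ δ > (0:ℝ), ∀ s : ℝ, 1 < s → s < 1 + δ → g s = LL ξ s) →
      Tendsto (fun s : ℝ => LL ξ s) (𝓝[>] 1) (𝓝 (g 1)) ∧
      (g 1 = 0 → ∃ d, Tendsto (fun s : ℝ => LL ξ s / ((s : ℂ) - 1)) (𝓝[>] 1) (𝓝 d)) := by
    rintro ξ g hg ⟨δ, hδ, hgs⟩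
    have hev : ∀ᶠ s : ℝ in 𝓝[>] 1, g s = LL ξ s := by
      filter_upwards [Ioo_mem_nhdsGT (show (1:ℝ) < 1 + δ by linarith)] with s hs
      exact hgs s hs.1 hs.2
    have ht : Tendsto (fun s : ℝ => (s : ℂ)) (𝓝[>] 1) (𝓝[≠] 1) := by
      refine tendsto_nhdsWithin_iff.mpr ⟨?_, ?_⟩
      · have := Complex.continuous_ofReal.tendsto 1
        rw [Complex.ofReal_one] at this
        exact this.mono_left nhdsWithin_le_nhds
      · filter_upwards [self_mem_nhdsWithin] with s hs
        have : s ≠ 1 := ne_of_gt hs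
        simpa using this
    refine ⟨?_, fun h0 => ⟨deriv g 1, ?_⟩⟩
    · have := (hg.continuousAt.tendsto.mono_left nhdsWithin_le_nhds).comp ht
      exact this.congr' hev
    · have := (hasDerivAt_iff_tendsto_slope.mp hg.hasDerivAt).comp ht
      refine this.congr' ?_
      filter_upwards [hev] with s hs
      simp only [Function.comp, slope, h0, hs, vsub_eq_sub, sub_zero, smul_eq_mul]
      rw [div_eq_inv_mul]
  -- equality of products
  have hAB : ∀ s : ℝ, 1 < s → ∏ k ∈ Finset.range p, LL (ψ * cpw ψ1 k) s = ∏ k ∈ Finset.range p, LL (cpw ψ1 k) s ∧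
      1 ≤ ‖∏ k ∈ Finset.range p, LL (cpw ψ1 k) s‖ := by
    intro s hs
    have e1 := tendsto_finsetProd (Finset.range p) fun k _ => euler_L hp (hψ.mul (hψ1.cpw k)) s hs
    have e2 := tendsto_finsetProd (Finset.range p) fun k _ => euler_L hp (hψ1.cpw k) s hs
    simp only [Finset.prod_mul_distrib, Finset.prod_const_one] at e1 e2
    have hloc : ∀ v : HeightOneSpectrum (𝓞 F),
        ∏ k ∈ Finset.range p, (1 - (ψ * cpw ψ1 k) v.asIdeal * Npow s v.asIdeal) =
        ∏ k ∈ Finset.range p, (1 - (cpw ψ1 k) v.asIdeal * Npow s v.asIdeal) ∧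
        ‖∏ k ∈ Finset.range p, (1 - (cpw ψ1 k) v.asIdeal * Npow s v.asIdeal)‖ ≤ 1 := by
      intro v
      simp only [mzh_mul_apply, cpw_apply]
      by_cases hv : IsCoprime v.asIdeal 𝔪
      · obtain ⟨x, hx, hx0, hx1⟩ := Npow_real s v.ne_bot
        have hx1 := hx1 (by linarith)
        rw [hx]
        by_cases h1 : ψ1 v.asIdeal = 1
        · have h2 := hcon v hv h1
          simp only [h1, h2, one_pow, one_mul, Finset.prod_const, Finset.card_range, true_and]
          rw [norm_pow, norm_one_sub_real x hx1]
          exact pow_le_one₀ (by linarith) (by linarith)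
        · have hy := primRoot_of hp (hψ1.one _ hv) h1
          rw [prod_primRoot hp hy]
          have : ∀ k, ψ v.asIdeal * ψ1 v.asIdeal ^ (k + 1) * (x : ℂ) = ψ1 v.asIdeal ^ (k + 1) * (ψ v.asIdeal * x) :=
            fun k => by ring
          simp only [this]
          rw [prod_primRoot hp hy, mul_pow, hψ.one _ hv, one_mul]
          refine ⟨rfl, ?_⟩
          have h8 := pow_le_one₀ (n := p) hx0.le hx1
          have := pow_pos hx0 p
          rw [← Complex.ofReal_pow, norm_one_sub_real _ h8]
          linarith
      · simp [hψ.zero _ hv, hψ1.zero _ hv]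
    have hcomm : ∀ S : Finset (HeightOneSpectrum (𝓞 F)),
        (∏ k ∈ Finset.range p, ∏ v ∈ S, (1 - (ψ * cpw ψ1 k) v.asIdeal * Npow s v.asIdeal)) =
        ∏ k ∈ Finset.range p, ∏ v ∈ S, (1 - (cpw ψ1 k) v.asIdeal * Npow s v.asIdeal) := by
      intro S
      rw [Finset.prod_comm, Finset.prod_comm (s := Finset.range p)]
      exact Finset.prod_congr rfl fun v _ => (hloc v).1
    simp only [hcomm] at e1
    generalize ∏ k ∈ Finset.range p, LL (ψ * cpw ψ1 k) s = A at *
    generalize ∏ k ∈ Finset.range p, LL (cpw ψ1 k) s = B at *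
    constructor
    · have f1 := e1.mul_const B
      have f2 := e2.mul_const A
      simp only [one_mul] at f1 f2
      refine tendsto_nhds_unique (f2.congr fun S => ?_) f1
      ring
    · have f := e2.norm
      rw [norm_one] at f
      refine le_of_tendsto f (Eventually.of_forall fun S => ?_)
      rw [norm_mul]
      refine mul_le_of_le_one_left (norm_nonneg _) ?_
      rw [Finset.prod_comm, norm_prod]
      exact Finset.prod_le_one (fun _ _ => norm_nonneg _) fun v _ => (hloc v).2
  -- split off trivial character
  have hp1 : p = (p - 1) + 1 := by omega
  have hsplit : ∀ s, ∏ k ∈ Finset.range p, LL (cpw ψ1 k) s =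
      (∏ k ∈ Finset.range (p - 1), LL (cpw ψ1 k) s) * LL (cpw ψ1 (p - 1)) s := by
    intro s
    conv_lhs => rw [hp1]
    rw [Finset.prod_range_succ]
  obtain ⟨ρ, hρ, hres⟩ := principal_residue hψ.ne (cpw ψ1 (p - 1))
    (fun I hI => by rw [cpw_apply, ← hp1, hψ1.one I hI])
    (fun I hI => by rw [cpw_apply, hψ1.zero I hI, zero_pow (Nat.succ_ne_zero _)])
  change Tendsto (fun s : ℝ => ((s : ℂ) - 1) * LL (cpw ψ1 (p - 1)) s) _ _ at hres
  have hndvd : ∀ k, k < p - 1 → ¬ p ∣ k + 1 := fun k hk h => by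
    have := Nat.le_of_dvd (by omega) h
    omega
  have hB' : ∀ k : ℕ, ∃ g : ℂ → ℂ, k < p - 1 → DifferentiableAt ℂ g 1 ∧ ∃ δ > (0:ℝ), ∀ s : ℝ, 1 < s → s < 1 + δ →
      g s = LL (cpw ψ1 k) s := by
    intro k
    by_cases hk : k < p - 1
    · obtain ⟨g, hg⟩ := hB k (hndvd k hk)
      exact ⟨g, fun _ => hg⟩
    · exact ⟨0, fun h => absurd h hk⟩
  choose gA hgA using hA
  choose gB hgB using hB'
  have limA : Tendsto (fun s : ℝ => ∏ k ∈ Finset.range p, LL (ψ * cpw ψ1 k) s) (𝓝[>] 1)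
      (𝓝 (∏ k ∈ Finset.range p, gA k 1)) :=
    tendsto_finsetProd _ fun k _ => (lim _ _ (hgA k).1 (hgA k).2).1
  have limB : Tendsto (fun s : ℝ => ∏ k ∈ Finset.range (p - 1), LL (cpw ψ1 k) s) (𝓝[>] 1)
      (𝓝 (∏ k ∈ Finset.range (p - 1), gB k 1)) :=
    tendsto_finsetProd _ fun k hk => by
      have hk' := hgB k (Finset.mem_range.mp hk)
      exact (lim _ _ hk'.1 hk'.2).1
  have hs1 : Tendsto (fun s : ℝ => (s : ℂ) - 1) (𝓝[>] 1) (𝓝 0) := by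
    have : Continuous (fun s : ℝ => (s : ℂ) - 1) := by fun_prop
    have := this.tendsto 1
    simp only [Complex.ofReal_one, sub_self] at this
    exact this.mono_left nhdsWithin_le_nhds
  have hzero : ∏ k ∈ Finset.range (p - 1), gB k 1 = 0 := by
    have t1 := hs1.mul limA
    have t2 := limB.mul hres
    rw [zero_mul] at t1
    have : Tendsto (fun s : ℝ => ((s : ℂ) - 1) * ∏ k ∈ Finset.range p, LL (ψ * cpw ψ1 k) s) (𝓝[>] 1)
        (𝓝 ((∏ k ∈ Finset.range (p - 1), gB k 1) * ρ)) := by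
      refine t2.congr' ?_
      filter_upwards [self_mem_nhdsWithin] with s hs
      rw [(hAB s hs).1, hsplit]
      ring
    have := tendsto_nhds_unique this t1
    exact (mul_eq_zero.mp this).resolve_right hρ
  obtain ⟨k, hk, hk0⟩ := Finset.prod_eq_zero_iff.mp hzero
  rw [Finset.mem_range] at hk
  obtain ⟨l, hl⟩ : ∃ l, l = p - 2 - k := ⟨_, rfl⟩
  have hlp : l < p - 1 := by omega
  have hkl : k + 1 + (l + 1) = p := by omega
  have hne : k ≠ l := by
    rintro rfl
    have : 2 ∣ p := ⟨k + 1, by omega⟩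
    have := (Nat.prime_dvd_prime_iff_eq Nat.prime_two hp).mp this
    omega
  have hl0 : gB l 1 = 0 := by
    have h1 := (lim _ _ (hgB k hk).1 (hgB k hk).2).1
    have h2 := (lim _ _ (hgB l hlp).1 (hgB l hlp).2).1
    rw [hk0] at h1
    have h3 := (Complex.continuous_conj.tendsto 0).comp h1
    rw [map_zero] at h3
    refine tendsto_nhds_unique h2 (h3.congr fun s => ?_)
    exact (LL_conj hp hψ1 k l (by rw [hkl]) s).symm
  obtain ⟨d, hd⟩ := (lim _ _ (hgB k hk).1 (hgB k hk).2).2 hk0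
  have hlL := (lim _ _ (hgB l hlp).1 (hgB l hlp).2).1
  rw [hl0] at hlL
  have hrest : Tendsto (fun s : ℝ => ∏ j ∈ ((Finset.range (p - 1)).erase k).erase l, LL (cpw ψ1 j) s) (𝓝[>] 1)
      (𝓝 (∏ j ∈ ((Finset.range (p - 1)).erase k).erase l, gB j 1)) :=
    tendsto_finsetProd _ fun j hj => by
      have hj' := hgB j (Finset.mem_range.mp (Finset.mem_of_mem_erase (Finset.mem_of_mem_erase hj)))
      exact (lim _ _ hj'.1 hj'.2).1
  have tot := ((hd.mul hlL).mul hrest).mul hres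
  rw [mul_zero, zero_mul, zero_mul] at tot
  have tot' : Tendsto (fun s : ℝ => ∏ k ∈ Finset.range p, LL (cpw ψ1 k) s) (𝓝[>] 1) (𝓝 0) := by
    refine tot.congr' ?_
    filter_upwards [self_mem_nhdsWithin] with s hs
    have hs' : (s : ℂ) - 1 ≠ 0 := by
      have : s ≠ 1 := ne_of_gt hs
      rw [sub_ne_zero]
      exact_mod_cast this
    rw [hsplit, ← Finset.mul_prod_erase (Finset.range (p - 1)) _ (Finset.mem_range.mpr hk),
      ← Finset.mul_prod_erase ((Finset.range (p - 1)).erase k) _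
        (Finset.mem_erase.mpr ⟨hne.symm, Finset.mem_range.mpr hlp⟩)]
    field_simp
  have hn := tot'.norm
  rw [norm_zero] at hn
  have : (1 : ℝ) ≤ 0 := by
    refine ge_of_tendsto hn ?_
    filter_upwards [self_mem_nhdsWithin] with s hs
    exact (hAB s hs).2
  linarith

end
end S14


namespace S14

/-- a discrete logarithm modulo `p`-th powers -/
structure Lg (p N : ℕ) (l : ZMod N → ZMod p) : Prop where
  mul : ∀ x y, x ≠ 0 → y ≠ 0 → l (x * y) = l x + l y
  pow : ∀ x, x ≠ 0 → (l x = 0 ↔ ∃ y, y ^ p = x)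

lemma exists_Lg {p N : ℕ} (hp : p.Prime) (hN : N.Prime) (hNmod : N % p = 1) :
    ∃ l : ZMod N → ZMod p, Lg p N l := by
  have := Fact.mk hN
  have := Fact.mk hp
  have hcard : Nat.card (ZMod N)ˣ = N - 1 := by
    rw [Nat.card_eq_fintype_card, ZMod.card_units]
  have hdvd : p ∣ Nat.card (ZMod N)ˣ := by
    rw [hcard, ← hNmod]; exact Nat.dvd_sub_mod N
  let e := (zmodCyclicMulEquiv (G := (ZMod N)ˣ) inferInstance).symm
  classical
  let l : ZMod N → ZMod p := fun x => if h : x = 0 then 0 else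
    ZMod.castHom hdvd (ZMod p) (Multiplicative.toAdd (e (Units.mk0 x h)))
  have hmul : ∀ x y, x ≠ 0 → y ≠ 0 → l (x * y) = l x + l y := by
    intro x y hx hy
    simp only [l, hx, hy, mul_ne_zero hx hy, dite_false]
    rw [← map_add, ← toAdd_mul, ← map_mul]
    simp only [Units.mk0_mul]
  refine ⟨l, hmul, fun x hx => ⟨fun h => ?_, ?_⟩⟩
  · simp only [l, hx, dite_false] at h
    obtain ⟨a, ha⟩ : ∃ a : ZMod (Nat.card (ZMod N)ˣ), a = Multiplicative.toAdd (e (Units.mk0 x hx)) := ⟨_, rfl⟩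
    rw [← ha] at h
    haveI : NeZero (Nat.card (ZMod N)ˣ) := ⟨Nat.card_pos.ne'⟩
    have h2 : p ∣ a.val := by
      rw [← ZMod.natCast_eq_zero_iff, ← h]
      conv_rhs => rw [← ZMod.natCast_zmod_val a]
      simp
    obtain ⟨c, hc⟩ := h2
    have h3 : a = p • (c : ZMod (Nat.card (ZMod N)ˣ)) := by
      rw [← ZMod.natCast_zmod_val a, hc]; simp
    let y : (ZMod N)ˣ := e.symm (Multiplicative.ofAdd (c : ZMod (Nat.card (ZMod N)ˣ)))
    refine ⟨(y : ZMod N), ?_⟩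
    have : y ^ p = Units.mk0 x hx := by
      simp only [y]
      rw [← map_pow, MulEquiv.symm_apply_eq, ← ofAdd_nsmul, ← h3, ha, ofAdd_toAdd]
    rw [← Units.val_pow_eq_pow_val, this]
    rfl
  · rintro ⟨y, rfl⟩
    have hy : y ≠ 0 := by rintro rfl; exact hx (zero_pow hp.ne_zero)
    have : ∀ n : ℕ, l (y ^ (n + 1)) = ((n + 1 : ℕ) : ZMod p) * l y := by
      intro n
      induction n with
      | zero => simp
      | succ n ih =>
        rw [pow_succ, hmul _ _ (pow_ne_zero _ hy) hy, ih]; push_cast; ring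
    have h := this (p - 1)
    rw [show p - 1 + 1 = p from by have := hp.pos; omega] at h
    rw [h]; simp

section
variable {p N : ℕ} {l : ZMod N → ZMod p} (hl : Lg p N l) (hp : p.Prime) (hN : N.Prime)
include hl hp hN

lemma Lg.one : l 1 = 0 := by
  have := Fact.mk hN
  have := hl.mul 1 1 one_ne_zero one_ne_zero
  simpa using this

lemma Lg.npow (x : ZMod N) (hx : x ≠ 0) (n : ℕ) : l (x ^ n) = n * l x := by
  have := Fact.mk hN
  induction n with
  | zero => simp [hl.one hp hN]
  | succ n ih => rw [pow_succ, hl.mul _ _ (pow_ne_zero _ hx) hx, ih]; push_cast; ring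

lemma Lg.prod {ι : Type*} (s : Finset ι) (f : ι → ZMod N) (hf : ∀ i ∈ s, f i ≠ 0) :
    l (∏ i ∈ s, f i) = ∑ i ∈ s, l (f i) := by
  have := Fact.mk hN
  classical
  induction s using Finset.induction_on with
  | empty => simp [hl.one hp hN]
  | insert a s ha ih =>
    rw [Finset.prod_insert ha, Finset.sum_insert ha, hl.mul, ih]
    · exact fun i hi => hf i (Finset.mem_insert_of_mem hi)
    · exact hf a (Finset.mem_insert_self _ _)
    · exact Finset.prod_ne_zero_iff.mpr fun i hi => hf i (Finset.mem_insert_of_mem hi)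

lemma Lg.neg_one (hp2 : 2 < p) : l (-1) = 0 := by
  have := Fact.mk hN
  rw [hl.pow _ (by simp)]
  exact ⟨-1, (hp.odd_of_ne_two (by omega)).neg_one_pow⟩

lemma Lg.neg (hp2 : 2 < p) (x : ZMod N) (hx : x ≠ 0) : l (-x) = l x := by
  have := Fact.mk hN
  rw [← neg_one_mul, hl.mul _ _ (by simp) hx, hl.neg_one hp hN hp2, zero_add]

omit hl hp in
lemma cast_ne {k : ℕ} (h0 : 0 < k) (h1 : k < N) : (k : ZMod N) ≠ 0 := by
  rw [Ne, ZMod.natCast_eq_zero_iff]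
  exact fun h => absurd (Nat.le_of_dvd h0 h) (by omega)

omit hl hp in
lemma fact_ne {k : ℕ} (h1 : k < N) : (k.factorial : ZMod N) ≠ 0 := by
  rw [Ne, ZMod.natCast_eq_zero_iff, hN.dvd_factorial]
  omega

lemma Lg.fact_succ {k : ℕ} (h1 : k + 1 < N) :
    l ((k + 1).factorial : ZMod N) = l ((k + 1 : ℕ) : ZMod N) + l (k.factorial : ZMod N) := by
  rw [Nat.factorial_succ, Nat.cast_mul, hl.mul _ _ (cast_ne hN (by omega) h1) (fact_ne hN (by omega))]

lemma Lg.wilson (hp2 : 2 < p) : l ((N - 1).factorial : ZMod N) = 0 := by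
  have := Fact.mk hN
  rw [ZMod.wilsons_lemma, hl.neg_one hp hN hp2]

lemma Lg.fact_refl (hp2 : 2 < p) (k : ℕ) (hk : k ≤ N - 1) :
    l (k.factorial : ZMod N) + l ((N - 1 - k).factorial : ZMod N) = 0 := by
  have := Fact.mk hN
  have hN1 := hN.one_lt
  induction k with
  | zero => simp [hl.one hp hN, hl.neg_one hp hN hp2]
  | succ k ih =>
    have := ih (by omega)
    obtain ⟨m, hm⟩ : ∃ m, N - 1 - k = m + 1 := ⟨N - 1 - k - 1, by omega⟩
    rw [hm, hl.fact_succ hp hN (by omega)] at this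
    rw [hl.fact_succ hp hN (by omega), show N - 1 - (k + 1) = m by omega]
    have h2 : ((m + 1 : ℕ) : ZMod N) = - ((k + 1 : ℕ) : ZMod N) := by
      rw [eq_neg_iff_add_eq_zero, ← Nat.cast_add, show m + 1 + (k + 1) = N by omega]; simp
    rw [h2, hl.neg hp hN hp2 _ (cast_ne hN (by omega) (by omega))] at this
    rw [← this]; ring

/-- `L_j` -/
lemma partA (hp5 : 5 ≤ p) (hNmod : N % p = 1) (hM : IsPthPow p (Mnum N 1)) :
    ∑ j ∈ Finset.range p, (j : ZMod p) * l (((N - 1) / p * j).factorial : ZMod N) = 0 := by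
  have := Fact.mk hN
  have := Fact.mk hp
  have hp2 : 2 < p := by omega
  have hN1 := hN.one_lt
  obtain ⟨M, hMdef⟩ : ∃ M, M = (N - 1) / p := ⟨_, rfl⟩
  have hNM : N = M * p + 1 := by
    have h1 : p ∣ N - 1 := by rw [← hNmod]; exact Nat.dvd_sub_mod N
    rw [hMdef, Nat.div_mul_cancel h1]; omega
  rw [← hMdef]
  have hNp : (N : ZMod p) = 1 := by rw [hNM]; simp
  have h2ne : (2 : ZMod p) ≠ 0 := by
    have : ((2 : ℕ) : ZMod p) ≠ 0 := by
      rw [Ne, ZMod.natCast_eq_zero_iff]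
      exact fun h => absurd (Nat.le_of_dvd (by norm_num) h) (by omega)
    exact_mod_cast this
  have h3ne : (3 : ZMod p) ≠ 0 := by
    have : ((3 : ℕ) : ZMod p) ≠ 0 := by
      rw [Ne, ZMod.natCast_eq_zero_iff]
      exact fun h => absurd (Nat.le_of_dvd (by norm_num) h) (by omega)
    exact_mod_cast this
  have hk : ∀ k ∈ Finset.range (N - 1), ((k + 1 : ℕ) : ZMod N) ≠ 0 := fun k hk =>
    cast_ne hN (by omega) (by have := Finset.mem_range.mp hk; omega)
  -- T0
  have T0 : ∑ k ∈ Finset.range (N - 1), l ((k + 1 : ℕ) : ZMod N) = 0 := by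
    rw [← hl.prod hp hN _ _ hk, ← hl.wilson hp hN hp2, ← Finset.prod_range_add_one_eq_factorial]
    push_cast; rfl
  -- T1
  have T1 : ∑ k ∈ Finset.range (N - 1), ((k + 1 : ℕ) : ZMod p) * l ((k + 1 : ℕ) : ZMod N) = 0 := by
    have hrefl := Finset.sum_range_reflect
      (fun k => ((k + 1 : ℕ) : ZMod p) * l ((k + 1 : ℕ) : ZMod N)) (N - 1)
    have : ∑ k ∈ Finset.range (N - 1), ((N - 1 - 1 - k + 1 : ℕ) : ZMod p) * l ((N - 1 - 1 - k + 1 : ℕ) : ZMod N)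
        = ∑ k ∈ Finset.range (N - 1), l ((k + 1 : ℕ) : ZMod N) -
          ∑ k ∈ Finset.range (N - 1), ((k + 1 : ℕ) : ZMod p) * l ((k + 1 : ℕ) : ZMod N) := by
      rw [← Finset.sum_sub_distrib]
      refine Finset.sum_congr rfl fun k hk' => ?_
      have hkr := Finset.mem_range.mp hk'
      obtain ⟨m, hm⟩ : ∃ m, N - 1 - 1 - k + 1 = m := ⟨_, rfl⟩
      rw [hm]
      have hmk : m + (k + 1) = N := by omega
      have e1 : (m : ZMod N) = -((k + 1 : ℕ) : ZMod N) := by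
        rw [eq_neg_iff_add_eq_zero, ← Nat.cast_add, hmk]; simp
      have e2 : (m : ZMod p) = 1 - ((k + 1 : ℕ) : ZMod p) := by
        rw [eq_sub_iff_add_eq, ← Nat.cast_add, hmk, hNp]
      rw [e1, e2, hl.neg hp hN hp2 _ (hk k hk')]
      ring
    rw [hrefl, T0, zero_sub] at this
    have h3 : (2 : ZMod p) * ∑ k ∈ Finset.range (N - 1), ((k + 1 : ℕ) : ZMod p) * l ((k + 1 : ℕ) : ZMod N) = 0 := by
      linear_combination this
    exact (mul_eq_zero.mp h3).resolve_left h2ne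
  -- T2
  have T2 : ∑ k ∈ Finset.range (N - 1), ((k + 1 : ℕ) : ZMod p) ^ 2 * l ((k + 1 : ℕ) : ZMod N) =
      - (2 * ∑ j ∈ Finset.range p, (j : ZMod p) * l ((M * j).factorial : ZMod N)) := by
    have hMN : N - 1 = M * p := by omega
    have step1 : ∑ k ∈ Finset.range (N - 1), ((k + 1 : ℕ) : ZMod p) ^ 2 * l ((k + 1 : ℕ) : ZMod N) =
        ∑ k ∈ Finset.range (N - 1), (((p * (k + 1)) / N : ℕ) : ZMod p) ^ 2 * (l (p : ZMod N) + l ((k + 1 : ℕ) : ZMod N)) := by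
      symm
      have hpN : p < N := by
        rw [hNM]
        have : 0 < M := by
          rcases Nat.eq_zero_or_pos M with h | h
          · rw [h] at hNM; omega
          · exact h
        nlinarith
      have hndvd : ∀ k, k < N - 1 → p * (k + 1) % N ≠ 0 := by
        intro k hk h
        have := Nat.dvd_of_mod_eq_zero h
        rcases hN.dvd_mul.mp this with h | h
        · exact absurd (Nat.le_of_dvd hp.pos h) (by omega)
        · exact absurd (Nat.le_of_dvd (by omega) h) (by omega)
      have hlt : ∀ k, p * (k + 1) % N < N := fun k => Nat.mod_lt _ (by omega)
      have hmaps : ∀ k ∈ Finset.range (N - 1), p * (k + 1) % N - 1 ∈ Finset.range (N - 1) := by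
        intro k hk
        have h1 := hndvd k (Finset.mem_range.mp hk)
        have h2 := hlt k
        rw [Finset.mem_range]; omega
      have hinj : Set.InjOn (fun k => p * (k + 1) % N - 1) (Finset.range (N - 1) : Set ℕ) := by
        intro a ha b hb hab
        simp only [Finset.coe_range, Set.mem_Iio] at ha hb
        have h1 := hndvd a ha
        have h2 := hndvd b hb
        simp only at hab
        have h3 : p * (a + 1) % N = p * (b + 1) % N := by omega
        have h4 : (a + 1) ≡ (b + 1) [MOD N] :=
          Nat.ModEq.cancel_left_of_coprime (c := p)
            (by rw [Nat.gcd_comm]; exact (Nat.coprime_primes hp hN).mpr (by omega)) h3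
        have := Nat.ModEq.eq_of_lt_of_lt h4 (by omega) (by omega)
        omega
      refine Finset.sum_nbij (fun k => p * (k + 1) % N - 1) hmaps hinj
        (Finset.surjOn_of_injOn_of_card_le _ hmaps hinj le_rfl) ?_
      intro k hk'
      have h1 := hndvd k (Finset.mem_range.mp hk')
      have e0 : p * (k + 1) % N - 1 + 1 = p * (k + 1) % N := by omega
      rw [e0]
      have hdm := Nat.mod_add_div (p * (k + 1)) N
      have e1 : ((p * (k + 1) % N : ℕ) : ZMod p) = - ((p * (k + 1) / N : ℕ) : ZMod p) := by
        have := congrArg (Nat.cast : ℕ → ZMod p) hdm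
        push_cast at this
        rw [hNp] at this
        simp only [CharP.cast_eq_zero, zero_mul, one_mul] at this
        rw [eq_neg_iff_add_eq_zero]
        exact this
      have e2 : ((p * (k + 1) % N : ℕ) : ZMod N) = (p : ZMod N) * ((k + 1 : ℕ) : ZMod N) := by
        rw [ZMod.natCast_mod, Nat.cast_mul]
      rw [e1, e2, hl.mul _ _ (cast_ne hN hp.pos hpN) (hk k hk')]
      ring
    rw [step1, hMN]
    have hblock : ∀ n, n ≤ p → ∑ k ∈ Finset.range (M * n), (((p * (k + 1)) / N : ℕ) : ZMod p) ^ 2 * (l (p : ZMod N) + l ((k + 1 : ℕ) : ZMod N)) =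
        ∑ j ∈ Finset.range n, (j : ZMod p) ^ 2 * (M * l (p : ZMod N) +
          (l ((M * (j + 1)).factorial : ZMod N) - l ((M * j).factorial : ZMod N))) := by
      intro n hn
      induction n with
      | zero => simp
      | succ n ih =>
        rw [Nat.mul_succ, Finset.sum_range_add, ih (by omega), Finset.sum_range_succ]
        congr 1
        have hM' : M * n + M ≤ N - 1 := by rw [hMN]; nlinarith
        have e1 : ∀ r ∈ Finset.range M, (((p * (M * n + r + 1)) / N : ℕ) : ZMod p) ^ 2 *
            (l (p : ZMod N) + l ((M * n + r + 1 : ℕ) : ZMod N)) =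
            (n : ZMod p) ^ 2 * (l (p : ZMod N) + l ((M * n + r + 1 : ℕ) : ZMod N)) := by
          intro r hr
          have hr := Finset.mem_range.mp hr
          congr 3
          have hpr : p * (r + 1) ≤ M * p := by nlinarith
          have hpr' : p ≤ p * (r + 1) := by nlinarith
          rw [Nat.div_eq_iff (by omega)]
          have : p * (M * n + r + 1) = n * (M * p) + p * (r + 1) := by ring
          rw [this, hNM]
          constructor
          · nlinarith
          · have e5 : n * (M * p + 1) = n * (M * p) + n := by ring
            rw [e5]; omega
        rw [Finset.sum_congr rfl e1, ← Finset.mul_sum, Finset.sum_add_distrib]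
        congr 1
        rw [Finset.sum_const, Finset.card_range, nsmul_eq_mul]
        congr 1
        have : ∀ m, M * n + m ≤ N - 1 → ∑ r ∈ Finset.range m, l ((M * n + r + 1 : ℕ) : ZMod N) =
            l ((M * n + m).factorial : ZMod N) - l ((M * n).factorial : ZMod N) := by
          intro m hm
          induction m with
          | zero => simp
          | succ m ihm =>
            rw [Finset.sum_range_succ, ihm (by omega), ← Nat.add_assoc (M * n) m 1, hl.fact_succ hp hN (by omega)]
            ring
        rw [this M hM', Nat.mul_succ]
    rw [hblock p le_rfl]
    have hsq : ∑ j ∈ Finset.range p, (j : ZMod p) ^ 2 = 0 := by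
      have : ∀ n : ℕ, (6 : ZMod p) * ∑ j ∈ Finset.range n, (j : ZMod p) ^ 2 = n * (n - 1) * (2 * n - 1) := by
        intro n
        induction n with
        | zero => simp
        | succ n ih => rw [Finset.sum_range_succ, mul_add, ih]; push_cast; ring
      have h := this p
      simp only [CharP.cast_eq_zero, zero_mul] at h
      refine (mul_eq_zero.mp h).resolve_left ?_
      have : (6 : ZMod p) = 2 * 3 := by norm_num
      rw [this]; exact mul_ne_zero h2ne h3ne
    have habel : ∀ (L : ℕ → ZMod p) (n : ℕ), ∑ j ∈ Finset.range n, (j : ZMod p) ^ 2 * (L (j + 1) - L j) =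
        (n : ZMod p) ^ 2 * L n - ∑ j ∈ Finset.range n, (2 * (j : ZMod p) + 1) * L (j + 1) := by
      intro L n
      induction n with
      | zero => simp
      | succ n ih => rw [Finset.sum_range_succ, ih, Finset.sum_range_succ _ n]; push_cast; ring
    simp only [mul_add, Finset.sum_add_distrib]
    rw [← Finset.sum_mul, hsq, zero_mul, zero_add]
    have h1 := habel (fun j => l ((M * j).factorial : ZMod N)) p
    rw [show (∑ x ∈ Finset.range p, (x:ZMod p) ^ 2 * (l ((M * x + M * 1).factorial : ZMod N) - l ((M * x).factorial : ZMod N))) =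
      ∑ j ∈ Finset.range p, (j : ZMod p) ^ 2 * (l ((M * (j + 1)).factorial : ZMod N) - l ((M * j).factorial : ZMod N)) by
        simp only [mul_add], h1]
    have hLp : l ((M * p).factorial : ZMod N) = 0 := by rw [← hMN]; exact hl.wilson hp hN hp2
    have hL0 : l ((M * 0).factorial : ZMod N) = 0 := by simp [hl.one hp hN]
    have hshift : ∑ j ∈ Finset.range p, (2 * (j : ZMod p) + 1) * l ((M * (j + 1)).factorial : ZMod N) =
        ∑ j ∈ Finset.range p, (2 * (j : ZMod p) - 1) * l ((M * j).factorial : ZMod N) := by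
      have a1 := Finset.sum_range_succ (fun j : ℕ => (2 * (j : ZMod p) - 1) * l ((M * j).factorial : ZMod N)) p
      have a2 := Finset.sum_range_succ' (fun j : ℕ => (2 * (j : ZMod p) - 1) * l ((M * j).factorial : ZMod N)) p
      rw [hLp, mul_zero, add_zero] at a1
      rw [hL0, mul_zero, add_zero] at a2
      rw [← a1, a2]
      refine Finset.sum_congr rfl fun j _ => ?_
      push_cast; ring
    have hsum0 : ∑ j ∈ Finset.range p, l ((M * j).factorial : ZMod N) = 0 := by
      have a1 := Finset.sum_range_succ (fun j : ℕ => l ((M * j).factorial : ZMod N)) p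
      rw [hLp, add_zero] at a1
      rw [← a1]
      have hr := Finset.sum_range_reflect (fun j : ℕ => l ((M * j).factorial : ZMod N)) (p + 1)
      have : ∑ j ∈ Finset.range (p + 1), l ((M * (p + 1 - 1 - j)).factorial : ZMod N) =
          - ∑ j ∈ Finset.range (p + 1), l ((M * j).factorial : ZMod N) := by
        rw [← Finset.sum_neg_distrib]
        refine Finset.sum_congr rfl fun j hj => ?_
        have hj := Finset.mem_range.mp hj
        have hle : M * j ≤ N - 1 := by rw [hMN]; exact Nat.mul_le_mul_left _ (by omega)
        have h3 := hl.fact_refl hp hN hp2 (M * j) hle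
        have h4 : N - 1 - M * j = M * (p + 1 - 1 - j) := by rw [hMN, ← Nat.mul_sub]; simp
        rw [h4] at h3
        exact eq_neg_of_add_eq_zero_right h3
      rw [hr] at this
      have h5 : (2 : ZMod p) * ∑ j ∈ Finset.range (p + 1), l ((M * j).factorial : ZMod N) = 0 := by
        linear_combination this
      exact (mul_eq_zero.mp h5).resolve_left h2ne
    rw [hshift, hLp, mul_zero, zero_sub]
    simp only [sub_mul, one_mul, Finset.sum_sub_distrib, hsum0, sub_zero, mul_assoc]
    rw [← Finset.mul_sum]
  -- the log of Mnum
  have hlM : 2 * l (Mnum N 1) = ∑ k ∈ Finset.range (N - 1), ((k + 1 : ℕ) : ZMod p) ^ 2 * l ((k + 1 : ℕ) : ZMod N)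
      - ∑ k ∈ Finset.range (N - 1), ((k + 1 : ℕ) : ZMod p) * l ((k + 1 : ℕ) : ZMod N) := by
    have hne : ∀ k ∈ Finset.Icc 1 (N - 1), (k : ZMod N) ≠ 0 := fun k hk => by
      have := Finset.mem_Icc.mp hk
      exact cast_ne hN (by omega) (by omega)
    rw [Mnum, hl.prod hp hN _ _ (fun k hk => Finset.prod_ne_zero_iff.mpr fun a _ => pow_ne_zero _ (hne k hk))]
    have : ∀ k ∈ Finset.Icc 1 (N - 1), 2 * l (∏ a ∈ Finset.Icc 1 (k - 1), (k : ZMod N) ^ a ^ 1) =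
        ((k : ZMod p) ^ 2 - k) * l (k : ZMod N) := by
      intro k hk
      have hk1 := Finset.mem_Icc.mp hk
      rw [Finset.prod_pow_eq_pow_sum, hl.npow hp hN _ (hne k hk)]
      have h : ((∑ a ∈ Finset.Icc 1 (k - 1), a ^ 1 : ℕ)) * 2 = k * (k - 1) := by
        rw [← Finset.sum_range_id_mul_two, Finset.range_eq_Ico]
        simp only [pow_one]
        congr 1
        rw [Finset.sum_eq_sum_Ico_succ_bot (by omega), zero_add]
        refine Finset.sum_congr ?_ fun _ _ => rfl
        ext a; simp; omega
      have h' := congrArg (Nat.cast : ℕ → ZMod p) h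
      rw [Nat.cast_mul, Nat.cast_mul, Nat.cast_sub hk1.1] at h'
      push_cast at h' ⊢
      linear_combination l (k : ZMod N) * h'
    rw [Finset.mul_sum, Finset.sum_congr rfl this, ← Finset.sum_sub_distrib]
    refine (Finset.sum_nbij (fun k => k + 1) ?_ ?_ ?_ ?_).symm
    · intro k hk; have := Finset.mem_range.mp hk; exact Finset.mem_Icc.mpr ⟨by omega, by omega⟩
    · intro a _ b _ h; simpa using h
    · intro k hk
      have := Finset.mem_Icc.mp (Finset.mem_coe.mp hk)
      exact ⟨k - 1, by simp; omega, by simp; omega⟩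
    · intro k _; ring
  have hM0 : l (Mnum N 1) = 0 := by
    obtain ⟨y, hy⟩ := hM
    refine (hl.pow _ ?_).mpr ⟨y, hy⟩
    unfold Mnum
    refine Finset.prod_ne_zero_iff.mpr fun k hk => Finset.prod_ne_zero_iff.mpr fun a _ => pow_ne_zero _ ?_
    have := Finset.mem_Icc.mp hk
    exact cast_ne hN (by omega) (by omega)
  rw [hM0, T1, T2, mul_zero, sub_zero, eq_comm, neg_eq_zero] at hlM
  exact (mul_eq_zero.mp hlM).resolve_left h2ne

end
end S14

namespace S14
noncomputable section

section Symbol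
variable {p N : ℕ} {l : ZMod N → ZMod p} (hl : Lg p N l) (hp : p.Prime) (hN : N.Prime)
variable {R : Type*} [CommRing R] [IsDedekindDomain R] (π : R →+* ZMod N) (ϖ : R)

/-- `ϖ` is a uniformizer at the kernel of `π`. -/
structure Unif : Prop where
  mem : π ϖ = 0
  ne : ϖ ≠ 0
  not_sq : ϖ ∉ (RingHom.ker π) ^ 2

variable {π ϖ}

lemma Unif.exists_rep (hN : N.Prime) (h : Unif π ϖ) (x : R) (hx : x ≠ 0) :
    ∃ (a b : R) (v : ℕ), π a ≠ 0 ∧ π b ≠ 0 ∧ b * x = a * ϖ ^ v := by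
  have := Fact.mk hN
  obtain ⟨P, hP⟩ : ∃ P, P = RingHom.ker π := ⟨_, rfl⟩
  have hPp : P.IsPrime := hP ▸ RingHom.ker_isPrime π
  have hmem : ∀ x, x ∈ P ↔ π x = 0 := fun x => by rw [hP, RingHom.mem_ker]
  have hP0 : P ≠ ⊥ := by
    intro h0
    have : ϖ ∈ P := (hmem _).mpr h.mem
    rw [h0, Ideal.mem_bot] at this
    exact h.ne this
  have hPi : Prime P := Ideal.prime_of_isPrime hP0 hPp
  -- (ϖ) = P * B
  obtain ⟨B, hB⟩ : P ∣ Ideal.span {ϖ} := by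
    rw [Ideal.dvd_span_singleton]; exact (hmem _).mpr h.mem
  have hBP : ¬ P ∣ B := by
    rintro ⟨C, hC⟩
    apply h.not_sq
    rw [← hP, ← Ideal.dvd_span_singleton, hB, hC]
    exact ⟨C, by ring⟩
  obtain ⟨v, C, hPC, hxC⟩ : ∃ v C, ¬ P ∣ C ∧ Ideal.span {x} = P ^ v * C := by
    have hfin : FiniteMultiplicity P (Ideal.span {x}) :=
      FiniteMultiplicity.of_not_isUnit hPi.not_isUnit (by simpa [Ideal.span_singleton_eq_bot] using hx)
    obtain ⟨C, hC, hC'⟩ := hfin.exists_eq_pow_mul_and_not_dvd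
    exact ⟨_, C, hC', hC⟩
  have hBv : ¬ P ∣ B ^ v := fun hd => hBP (hPi.dvd_of_dvd_pow hd)
  obtain ⟨b, hb, hbP⟩ : ∃ b ∈ B ^ v, b ∉ P := by
    by_contra! hcon
    exact hBv (Ideal.dvd_iff_le.mpr hcon)
  have hbx : b * x ∈ Ideal.span {ϖ ^ v} := by
    rw [← Ideal.span_singleton_pow, hB, mul_pow, mul_comm b x]
    refine Ideal.mul_mem_mul ?_ hb
    have : x ∈ P ^ v * C := hxC ▸ Ideal.mem_span_singleton_self x
    exact (Ideal.mul_le_left : P ^ v * C ≤ P ^ v) this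
  obtain ⟨a, ha⟩ := Ideal.mem_span_singleton'.mp hbx
  refine ⟨a, b, v, fun h0 => ?_, fun h0 => hbP ((hmem _).mpr h0), ha.symm⟩
  -- a ∈ P gives contradiction
  have h1 : P ^ (v + 1) ∣ Ideal.span {b} * (P ^ v * C) := by
    rw [← hxC, Ideal.span_singleton_mul_span_singleton, ← ha, ← Ideal.span_singleton_mul_span_singleton,
      pow_succ']
    refine mul_dvd_mul ?_ ?_
    · rw [Ideal.dvd_span_singleton]; exact (hmem _).mpr h0
    · rw [← Ideal.span_singleton_pow, hB, mul_pow]; exact dvd_mul_right _ _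
  have h2 : P ^ v * P ∣ P ^ v * (Ideal.span {b} * C) := by
    rw [← pow_succ]; convert h1 using 1; ring
  have h3 := (mul_dvd_mul_iff_left (pow_ne_zero v hP0)).mp h2
  rcases hPi.dvd_or_dvd h3 with h4 | h4
  · exact hbP (Ideal.dvd_span_singleton.mp h4)
  · exact hPC h4

variable (l) in
/-- the symbol -/
def sy (π : R →+* ZMod N) (ϖ : R) (x : R) : ZMod p :=
  open Classical in
  if h : ∃ abv : R × R × ℕ, π abv.1 ≠ 0 ∧ π abv.2.1 ≠ 0 ∧ abv.2.1 * x = abv.1 * ϖ ^ abv.2.2 then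
    l (π h.choose.1) - l (π h.choose.2.1) else 0

include hl hp hN

lemma sy_eq (h : Unif π ϖ) {x a b : R} {v : ℕ} (ha : π a ≠ 0) (hb : π b ≠ 0)
    (hx : b * x = a * ϖ ^ v) : sy l π ϖ x = l (π a) - l (π b) := by
  have := Fact.mk hN
  have hex : ∃ abv : R × R × ℕ, π abv.1 ≠ 0 ∧ π abv.2.1 ≠ 0 ∧ abv.2.1 * x = abv.1 * ϖ ^ abv.2.2 :=
    ⟨(a, b, v), ha, hb, hx⟩
  rw [sy, dif_pos hex]
  obtain ⟨h1, h2, h3⟩ := hex.choose_spec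
  obtain ⟨a', ha'⟩ : ∃ a', a' = hex.choose.1 := ⟨_, rfl⟩
  obtain ⟨b', hb'⟩ : ∃ a', a' = hex.choose.2.1 := ⟨_, rfl⟩
  obtain ⟨v', hv'⟩ : ∃ a', a' = hex.choose.2.2 := ⟨_, rfl⟩
  rw [← ha'] at h1 h3 ⊢
  rw [← hb'] at h2 h3 ⊢
  rw [← hv'] at h3
  have key : a * b' * ϖ ^ v = a' * b * ϖ ^ v' := by
    calc a * b' * ϖ ^ v = b' * (a * ϖ ^ v) := by ring
      _ = b * (b' * x) := by rw [← hx]; ring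
      _ = _ := by rw [h3]; ring
  have hab : π (a * b') ≠ 0 := by rw [map_mul]; exact mul_ne_zero ha h2
  have hab' : π (a' * b) ≠ 0 := by rw [map_mul]; exact mul_ne_zero h1 hb
  have hvv : v = v' := by
    rcases lt_trichotomy v v' with hlt | heq | hlt
    · exfalso
      obtain ⟨d, rfl⟩ := Nat.exists_eq_add_of_lt hlt
      have : a * b' = a' * b * ϖ ^ (d + 1) := by
        apply mul_right_cancel₀ (pow_ne_zero v h.ne); rw [key]; ring
      apply hab; rw [this, map_mul, map_pow, h.mem]; simp
    · exact heq
    · exfalso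
      obtain ⟨d, rfl⟩ := Nat.exists_eq_add_of_lt hlt
      have : a' * b = a * b' * ϖ ^ (d + 1) := by
        apply mul_right_cancel₀ (pow_ne_zero v' h.ne); rw [← key]; ring
      apply hab'; rw [this, map_mul, map_pow, h.mem]; simp
  subst hvv
  have := congrArg (fun y => l (π y)) (mul_right_cancel₀ (pow_ne_zero v h.ne) key)
  simp only [map_mul] at this
  rw [hl.mul _ _ ha h2, hl.mul _ _ h1 hb] at this
  linear_combination -this

lemma sy_mul (h : Unif π ϖ) {x y : R} (hx : x ≠ 0) (hy : y ≠ 0) :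
    sy l π ϖ (x * y) = sy l π ϖ x + sy l π ϖ y := by
  have := Fact.mk hN
  obtain ⟨a, b, v, ha, hb, hv⟩ := h.exists_rep hN x hx
  obtain ⟨a', b', v', ha', hb', hv'⟩ := h.exists_rep hN y hy
  rw [sy_eq hl hp hN h ha hb hv, sy_eq hl hp hN h ha' hb' hv',
    sy_eq hl hp hN h (a := a * a') (b := b * b') (v := v + v') (by rw [map_mul]; exact mul_ne_zero ha ha')
      (by rw [map_mul]; exact mul_ne_zero hb hb')
      (by rw [pow_add]; linear_combination (b' * y) * hv + a * ϖ ^ v * hv'), map_mul, map_mul,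
      hl.mul _ _ ha ha', hl.mul _ _ hb hb']
  ring

lemma sy_unif (h : Unif π ϖ) : sy l π ϖ ϖ = 0 := by
  have := Fact.mk hN
  rw [sy_eq hl hp hN h (a := 1) (b := 1) (v := 1) (by simp) (by simp) (by simp)]; simp

lemma sy_of_ne (h : Unif π ϖ) {x : R} (hx : π x ≠ 0) : sy l π ϖ x = l (π x) := by
  have := Fact.mk hN
  rw [sy_eq hl hp hN h (a := x) (b := 1) (v := 0) hx (by simp) (by simp)]
  simp [hl.one hp hN]

lemma sy_one (h : Unif π ϖ) : sy l π ϖ 1 = 0 := by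
  have := Fact.mk hN
  rw [sy_of_ne hl hp hN h (by simp)]; simp [hl.one hp hN]

lemma sy_pow (h : Unif π ϖ) {x : R} (hx : x ≠ 0) (n : ℕ) : sy l π ϖ (x ^ n) = n * sy l π ϖ x := by
  induction n with
  | zero => simp [sy_one hl hp hN h]
  | succ n ih => rw [pow_succ, sy_mul hl hp hN h (pow_ne_zero _ hx) hx, ih]; push_cast; ring

end Symbol

/-- two homs to `ZMod N` with the same kernel agree -/
lemma hom_eq_of_ker_le {N : ℕ} {R : Type*} [CommRing R] [NeZero N] (π π' : R →+* ZMod N)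
    (h : RingHom.ker π ≤ RingHom.ker π') : π = π' := by
  ext x
  obtain ⟨n, hn⟩ := ZMod.natCast_zmod_surjective (π x)
  have h1 : x - n ∈ RingHom.ker π := by rw [RingHom.mem_ker, map_sub, map_natCast, hn, sub_self]
  have h2 := h h1
  rw [RingHom.mem_ker, map_sub, map_natCast, sub_eq_zero] at h2
  rw [← hn, h2]

section ClassGp
variable {R : Type*} [CommRing R] [IsDedekindDomain R]
open nonZeroDivisors

/-- universal property of the class group -/
lemma exists_clHom {H : Type*} [CommGroup H] (f : Ideal R → H)
    (hmul : ∀ I J : Ideal R, I ≠ ⊥ → J ≠ ⊥ → f (I * J) = f I * f J)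
    (hpr : ∀ x : R, x ≠ 0 → f (Ideal.span {x}) = 1) :
    ∃ g : ClassGroup R →* H, ∀ (I : Ideal R) (hI : I ∈ (Ideal R)⁰), g (ClassGroup.mk0 ⟨I, hI⟩) = f I := by
  have hs : ∀ c : ClassGroup R, ∃ I : (Ideal R)⁰, ClassGroup.mk0 I = c := ClassGroup.mk0_surjective
  choose s hs using hs
  have key : ∀ I J : (Ideal R)⁰, ClassGroup.mk0 I = ClassGroup.mk0 J → f I = f J := by
    intro I J h
    obtain ⟨x, y, hx, hy, hxy⟩ := ClassGroup.mk0_eq_mk0_iff.mp h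
    have h1 := congrArg f hxy
    rw [hmul _ _ (by simpa using hx) (nonZeroDivisors.ne_zero I.2),
      hmul _ _ (by simpa using hy) (nonZeroDivisors.ne_zero J.2), hpr x hx, hpr y hy, one_mul, one_mul] at h1
    exact h1
  refine ⟨MonoidHom.mk' (fun c => f (s c)) fun a b => ?_, fun I hI => ?_⟩
  · rw [← hmul _ _ (nonZeroDivisors.ne_zero (s a).2) (nonZeroDivisors.ne_zero (s b).2)]
    have := key (s (a * b)) (s a * s b) (by rw [map_mul, hs, hs, hs])
    simpa using this
  · exact key _ ⟨I, hI⟩ (hs _)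

/-- ideals in a Dedekind domain : uniqueness of roots -/
lemma ideal_pow_inj {I J : Ideal R} {n : ℕ} (hn : n ≠ 0) (h : I ^ n = J ^ n) : I = J := by
  rcases eq_or_ne I ⊥ with rfl | hI
  · rw [← Ideal.zero_eq_bot, zero_pow hn] at h
    exact (pow_eq_zero_iff hn |>.mp h.symm).symm
  rcases eq_or_ne J ⊥ with rfl | hJ
  · rw [← Ideal.zero_eq_bot, zero_pow hn] at h
    exact (pow_eq_zero_iff hn |>.mp h)
  have h1 := congrArg UniqueFactorizationMonoid.normalizedFactors h
  rw [UniqueFactorizationMonoid.normalizedFactors_pow, UniqueFactorizationMonoid.normalizedFactors_pow] at h1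
  have h2 := nsmul_right_injective hn h1
  rw [← Ideal.prod_normalizedFactors_eq_self hI, h2, Ideal.prod_normalizedFactors_eq_self hJ]

end ClassGp
end
end S14

namespace S14
noncomputable section
open NumberField Polynomial

/-- the cyclotomic data -/
structure Cyc (p : ℕ) (F : Type*) [Field F] [NumberField F] (ζ : 𝓞 F)
    (om : Gal(F/ℚ) ≃* (ZMod p)ˣ) : Prop where
  prim : IsPrimitiveRoot ζ p
  act : ∀ σ : Gal(F/ℚ), σ • ζ = ζ ^ (om σ : ZMod p).val

lemma conj_conj {p : ℕ} {F : Type*} [Field F] [NumberField F] (om : Gal(F/ℚ) ≃* (ZMod p)ˣ) (x : 𝓞 F) : om.symm (-1) • (om.symm (-1) • x) = x := by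
  rw [smul_smul, ← map_mul]; simp

lemma om_comm {p : ℕ} {F : Type*} [Field F] [NumberField F] (om : Gal(F/ℚ) ≃* (ZMod p)ˣ) (σ τ : Gal(F/ℚ)) : σ * τ = τ * σ := by
  apply om.injective; rw [map_mul, map_mul, mul_comm]

section
variable {p : ℕ} [hpf : Fact p.Prime] {F : Type*} [Field F] [NumberField F] [IsCyclotomicExtension {p} ℚ F]

variable (p F) in
lemma exists_Cyc : ∃ (ζ : 𝓞 F) (om : Gal(F/ℚ) ≃* (ZMod p)ˣ), Cyc p F ζ om := by
  have hirr : Irreducible (cyclotomic p ℚ) := cyclotomic.irreducible_rat hpf.out.pos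
  have hz := IsCyclotomicExtension.zeta_spec p ℚ F
  refine ⟨hz.toInteger, IsCyclotomicExtension.autEquivPow F hirr, hz.toInteger_isPrimitiveRoot, fun σ => ?_⟩
  apply RingOfIntegers.ext
  have := hz.autToPow_spec ℚ σ
  have h2 : ((hz.toInteger ^ ((IsCyclotomicExtension.autEquivPow F hirr σ : (ZMod p)ˣ) : ZMod p).val : 𝓞 F) : F) =
    (IsCyclotomicExtension.zeta p ℚ F) ^ ((IsCyclotomicExtension.autEquivPow F hirr σ : (ZMod p)ˣ) : ZMod p).val :=
      map_pow (algebraMap (𝓞 F) F) _ _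
  exact this.symm.trans h2.symm

variable {ζ : 𝓞 F} {om : Gal(F/ℚ) ≃* (ZMod p)ˣ} (hC : Cyc p F ζ om)
include hC

lemma Cyc.primF : IsPrimitiveRoot (ζ : F) p := hC.prim.map_of_injective RingOfIntegers.coe_injective

lemma Cyc.toInteger : hC.primF.toInteger = ζ := rfl

lemma Cyc.hom_ext {S : Type*} [CommRing S] {f g : 𝓞 F →+* S} (h : f ζ = g ζ) : f = g := by
  have h1 : f.toIntAlgHom = g.toIntAlgHom := by
    apply hC.primF.integralPowerBasis.algHom_ext
    rw [hC.primF.integralPowerBasis_gen]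
    exact h
  ext x
  exact congrArg (fun f : 𝓞 F →ₐ[ℤ] S => f x) h1

lemma Cyc.exists_hom {S : Type*} [CommRing S] (g : S) (hg : (cyclotomic p S).eval g = 0) :
    ∃ f : 𝓞 F →+* S, f ζ = g := by
  have hmin : minpoly ℤ ζ = cyclotomic p ℤ := by
    have h2 := cyclotomic_eq_minpoly hC.primF hpf.out.pos
    rw [h2]
    exact (minpoly.algebraMap_eq RingOfIntegers.coe_injective ζ).symm
  have h0 : aeval g (minpoly ℤ hC.primF.integralPowerBasis.gen) = 0 := by
    rw [hC.primF.integralPowerBasis_gen, hC.toInteger, hmin, aeval_def, ← eval_map, map_cyclotomic, hg]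
  refine ⟨(hC.primF.integralPowerBasis.lift g h0).toRingHom, ?_⟩
  have := hC.primF.integralPowerBasis.lift_gen g h0
  rw [hC.primF.integralPowerBasis_gen, hC.toInteger] at this
  exact this

lemma Cyc.pow_eq (a : ℕ) : ζ ^ ((a : ZMod p)).val = ζ ^ a := by
  have : ζ ^ (a % p) = ζ ^ a := by
    rw [hC.prim.eq_orderOf]; exact pow_mod_orderOf ζ a
  rw [ZMod.val_natCast]; exact this

lemma Cyc.zpow_add (u v : ZMod p) : ζ ^ (u + v).val = ζ ^ u.val * ζ ^ v.val := by
  rw [← pow_add, ← hC.pow_eq (u.val + v.val)]; simp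

lemma Cyc.zpow_mul (u v : ZMod p) : ζ ^ (u * v).val = (ζ ^ u.val) ^ v.val := by
  rw [← pow_mul, ← hC.pow_eq (u.val * v.val)]; simp

lemma Cyc.zpow_neg (u : ZMod p) : ζ ^ (-u).val * ζ ^ u.val = 1 := by
  rw [← hC.zpow_add]; simp

lemma Cyc.zpow_inj {u v : ZMod p} (h : ζ ^ u.val = ζ ^ v.val) : u = v :=
  ZMod.val_injective p (hC.prim.pow_inj (ZMod.val_lt u) (ZMod.val_lt v) h)

lemma Cyc.act_zpow (σ : Gal(F/ℚ)) (u : ZMod p) : σ • (ζ ^ u.val) = ζ ^ ((om σ : ZMod p) * u).val := by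
  rw [smul_pow', hC.act, hC.zpow_mul]

/-- complex conjugation -/
lemma Cyc.conj_embed (φ : F →+* ℂ) (x : 𝓞 F) : φ ((om.symm (-1) • x : 𝓞 F) : F) = starRingEnd ℂ (φ x) := by
  have : ((φ.comp (algebraMap (𝓞 F) F)).comp (MulSemiringAction.toRingHom Gal(F/ℚ) (𝓞 F) (om.symm (-1)))) =
      ((starRingEnd ℂ).comp (φ.comp (algebraMap (𝓞 F) F))) := by
    apply hC.hom_ext
    simp only [RingHom.comp_apply, MulSemiringAction.toRingHom_apply]
    rw [hC.act]
    have hn : (φ (algebraMap (𝓞 F) F ζ)) ^ p = 1 := by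
      rw [← map_pow, ← map_pow, hC.prim.pow_eq_one]; simp
    have h1 : ‖φ (algebraMap (𝓞 F) F ζ)‖ = 1 := Complex.norm_eq_one_of_pow_eq_one hn hpf.out.ne_zero
    have h2 := hC.zpow_neg (1 : ZMod p)
    have h3 := congrArg (fun x => φ (algebraMap (𝓞 F) F x)) h2
    simp only [map_mul, map_one] at h3
    have hv1 : (1 : ZMod p).val = 1 := by
      have := Fact.mk hpf.out.one_lt
      exact ZMod.val_one p
    rw [hv1, pow_one] at h3
    have h4 : (starRingEnd ℂ) (φ (algebraMap (𝓞 F) F ζ)) * φ (algebraMap (𝓞 F) F ζ) = 1 := by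
      rw [mul_comm, Complex.mul_conj, Complex.normSq_eq_norm_sq, h1]; simp
    have h0 : φ (algebraMap (𝓞 F) F ζ) ≠ 0 := by rw [← norm_ne_zero_iff, h1]; simp
    rw [MulEquiv.apply_symm_apply, Units.val_neg, Units.val_one]
    apply mul_right_cancel₀ h0
    rw [h3, h4]
  exact congrArg (fun f : 𝓞 F →+* ℂ => f x) this

/-- Kronecker -/
lemma Cyc.kronecker (hp2 : 2 < p) (u : 𝓞 F) (hu : u * (om.symm (-1) • u) = 1) :
    ∃ j : ℕ, u = ζ ^ j ∨ u = - ζ ^ j := by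
  have h1 : ∀ φ : F →+* ℂ, ‖φ (u : F)‖ = 1 := by
    intro φ
    have h := congrArg (fun x : 𝓞 F => φ (x : F)) hu
    simp only [map_mul, map_one] at h
    rw [hC.conj_embed φ u, Complex.mul_conj, Complex.normSq_eq_norm_sq] at h
    have h2 : ‖φ (u : F)‖ ^ 2 = 1 := by exact_mod_cast h
    nlinarith [norm_nonneg (φ (u : F)), sq_nonneg (‖φ (u : F)‖ - 1)]
  obtain ⟨n, hn, hun⟩ := NumberField.Embeddings.pow_eq_one_of_norm_eq_one F ℂ (RingOfIntegers.isIntegral_coe u) h1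
  have hodd : Odd p := hpf.out.odd_of_ne_two (by omega)
  obtain ⟨r, hr⟩ := hC.primF.exists_neg_pow_of_isOfFinOrder hodd
    (isOfFinOrder_iff_pow_eq_one.mpr ⟨n, hn, hun⟩)
  have hr' : u = (-ζ) ^ r := by apply RingOfIntegers.ext; exact hr.trans (by simp)
  refine ⟨r, ?_⟩
  rw [hr', neg_pow]
  rcases neg_one_pow_eq_or (𝓞 F) r with h | h <;> rw [h] <;> simp

lemma Cyc.unit_conj (hp2 : 2 < p) (u : 𝓞 F) (hu : IsUnit u) :
    ∃ j : ℕ, u = ζ ^ j * (om.symm (-1) • u) ∨ u = - (ζ ^ j * (om.symm (-1) • u)) := by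
  obtain ⟨v, hv⟩ := hu.exists_right_inv
  have hcv : (om.symm (-1) • u) * (om.symm (-1) • v) = 1 := by rw [← smul_mul', hv, smul_one]
  obtain ⟨j, hj⟩ := hC.kronecker hp2 (u * (om.symm (-1) • v)) (by
    rw [smul_mul', conj_conj]
    calc _ = (u * v) * ((om.symm (-1) • u) * (om.symm (-1) • v)) := by ring
      _ = 1 := by rw [hv, hcv, one_mul])
  refine ⟨j, ?_⟩
  have : u = (u * (om.symm (-1) • v)) * (om.symm (-1) • u) := by
    rw [mul_assoc, mul_comm (om.symm (-1) • v), hcv, mul_one]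
  rcases hj with hj | hj
  · left; rw [← hj]; exact this
  · right; rw [← neg_mul, ← hj]; exact this

/-- reduction mod `1-ζ` -/
lemma Cyc.exists_red : ∃ f : 𝓞 F →+* ZMod p, f ζ = 1 ∧ RingHom.ker f = Ideal.span {ζ - 1} := by
  obtain ⟨f, hf⟩ := hC.exists_hom (1 : ZMod p) (by
    rw [eval_one_cyclotomic_prime]; simp)
  refine ⟨f, hf, ?_⟩
  have hpr : (Ideal.span {ζ - 1}).IsPrime := by
    exact (Ideal.span_singleton_prime hC.primF.zeta_sub_one_prime'.ne_zero).mpr hC.primF.zeta_sub_one_prime'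
  have hmax : (Ideal.span {ζ - 1}).IsMaximal := hpr.isMaximal (by
    rw [Ne, Ideal.span_singleton_eq_bot]; exact hC.primF.zeta_sub_one_prime'.ne_zero)
  refine (hmax.eq_of_le (RingHom.ker_ne_top f) ?_).symm
  rw [Ideal.span_singleton_le_iff_mem, RingHom.mem_ker, map_sub, hf, map_one, sub_self]

end
end
end S14

namespace S14
noncomputable section
open NumberField Polynomial
open scoped Pointwise

section
variable {p : ℕ} [hpf : Fact p.Prime] {F : Type*} [Field F] [NumberField F]

/-- the conjugate primes `σ⁻¹ 𝔮` -/
def PP {q : ℕ} (π : 𝓞 F →+* ZMod q) (σ : Gal(F/ℚ)) : Ideal (𝓞 F) :=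
  RingHom.ker (π.comp (MulSemiringAction.toRingHom Gal(F/ℚ) (𝓞 F) σ))

lemma mem_PP {q : ℕ} {π : 𝓞 F →+* ZMod q} {σ : Gal(F/ℚ)} {x : 𝓞 F} : x ∈ PP π σ ↔ π (σ • x) = 0 := by
  rw [PP, RingHom.mem_ker]; rfl

lemma PP_eq_smul {q : ℕ} (π : 𝓞 F →+* ZMod q) (σ : Gal(F/ℚ)) : PP π σ = σ⁻¹ • RingHom.ker π := by
  ext x
  rw [mem_PP, Ideal.mem_inv_pointwise_smul_iff, RingHom.mem_ker]

variable [IsCyclotomicExtension {p} ℚ F]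
variable {ζ : 𝓞 F} {om : Gal(F/ℚ) ≃* (ZMod p)ˣ} (hC : Cyc p F ζ om)
include hC

lemma Cyc.exists_pi {q : ℕ} (hq : q.Prime) (hqp : q % p = 1) : ∃ π : 𝓞 F →+* ZMod q, True := by
  have := Fact.mk hq
  have hp := hpf.out
  have hpN : p ∣ q - 1 := by rw [← hqp]; exact Nat.dvd_sub_mod q
  have hcard : Nat.card (ZMod q)ˣ = q - 1 := by rw [Nat.card_eq_fintype_card, ZMod.card_units]
  obtain ⟨g, hg⟩ := exists_prime_orderOf_dvd_card' (G := (ZMod q)ˣ) p (by rw [hcard]; exact hpN)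
  have hpr : IsPrimitiveRoot (g : ZMod q) p := by
    rw [← hg]; exact (IsPrimitiveRoot.orderOf g).map_of_injective (f := Units.coeHom (ZMod q)) Units.val_injective
  have : NeZero (p : ZMod q) := ⟨by
    intro h
    rw [ZMod.natCast_eq_zero_iff] at h
    have h1 := (Nat.prime_dvd_prime_iff_eq hq hp).mp h
    rw [h1] at hqp; simp at hqp⟩
  obtain ⟨π, _⟩ := hC.exists_hom (g : ZMod q) (by
    have := (isRoot_cyclotomic_iff (n := p) (μ := (g : ZMod q))).mpr hpr
    exact this)
  exact ⟨π, trivial⟩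

variable {q : ℕ} (hq : q.Prime) (hqp : q ≠ p) (π : 𝓞 F →+* ZMod q)
include hq hqp

lemma Cyc.pi_prim : IsPrimitiveRoot (π ζ) p := by
  have := Fact.mk hq
  have h1 : (π ζ) ^ p = 1 := by rw [← map_pow, hC.prim.pow_eq_one, map_one]
  have h2 : π ζ ≠ 1 := by
    intro h
    have : (p : 𝓞 F) ∈ Ideal.span {hC.primF.toInteger - 1} := by
      have hd := hC.primF.toInteger_sub_one_dvd_prime'
      rwa [Ideal.mem_span_singleton]
    obtain ⟨c, hc⟩ := Ideal.mem_span_singleton.mp this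
    have h3 := congrArg π hc
    rw [map_natCast, hC.toInteger, map_mul, map_sub, h, map_one, sub_self, zero_mul,
      ZMod.natCast_eq_zero_iff] at h3
    exact hqp ((Nat.prime_dvd_prime_iff_eq hq hpf.out).mp h3)
  rw [IsPrimitiveRoot.iff_orderOf]
  exact orderOf_eq_prime h1 h2

lemma Cyc.PP_inj : Function.Injective (PP π) := by
  have := Fact.mk hq
  intro σ τ h
  have h1 : π.comp (MulSemiringAction.toRingHom Gal(F/ℚ) (𝓞 F) σ) =
    π.comp (MulSemiringAction.toRingHom Gal(F/ℚ) (𝓞 F) τ) := hom_eq_of_ker_le _ _ h.le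
  have h2 := congrArg (fun f : 𝓞 F →+* ZMod q => f ζ) h1
  simp only [RingHom.comp_apply, MulSemiringAction.toRingHom_apply, hC.act, map_pow] at h2
  have h3 := (hC.pi_prim hq hqp π).pow_inj (ZMod.val_lt _) (ZMod.val_lt _) h2
  exact om.injective (Units.ext (ZMod.val_injective p h3))

omit hC hqp [IsCyclotomicExtension {p} ℚ F] hpf in
lemma PP_max (σ : Gal(F/ℚ)) : (PP π σ).IsMaximal := by
  have := Fact.mk hq
  exact RingHom.ker_isMaximal_of_surjective _ (ZMod.ringHom_surjective _)

omit hC hqp [IsCyclotomicExtension {p} ℚ F] hpf in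
lemma PP_absNorm (σ : Gal(F/ℚ)) : Ideal.absNorm (PP π σ) = q := by
  have := Fact.mk hq
  rw [Ideal.absNorm_apply, Submodule.cardQuot_apply]
  have e := RingHom.quotientKerEquivOfSurjective (ZMod.ringHom_surjective
    (π.comp (MulSemiringAction.toRingHom Gal(F/ℚ) (𝓞 F) σ)))
  rw [show Nat.card (𝓞 F ⧸ PP π σ) = Nat.card (ZMod q) from Nat.card_congr e.toEquiv]
  simp

omit hC hqp [IsCyclotomicExtension {p} ℚ F] hpf in
lemma PP_ne_bot (σ : Gal(F/ℚ)) : PP π σ ≠ ⊥ := by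
  intro h
  have := PP_absNorm hq π σ
  rw [h, Ideal.absNorm_bot] at this
  exact hq.ne_zero this.symm

omit hC hqp [IsCyclotomicExtension {p} ℚ F] hpf in
lemma PP_prime (σ : Gal(F/ℚ)) : Prime (PP π σ) :=
  Ideal.prime_of_isPrime (PP_ne_bot hq π σ) (PP_max hq π σ).isPrime

lemma Cyc.prod_PP_dvd (T : Finset Gal(F/ℚ)) (I : Ideal (𝓞 F)) (h : ∀ σ ∈ T, I ≤ PP π σ) :
    ∏ σ ∈ T, PP π σ ∣ I := by
  classical
  induction T using Finset.induction_on with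
  | empty => simp
  | insert σ T hσ ih =>
    obtain ⟨C, hCC⟩ := ih (fun τ hτ => h τ (Finset.mem_insert_of_mem hτ))
    have h1 : PP π σ ∣ I := Ideal.dvd_iff_le.mpr (h σ (Finset.mem_insert_self _ _))
    rw [hCC] at h1
    rcases (PP_prime hq π σ).dvd_or_dvd h1 with h2 | ⟨D, hD⟩
    · exfalso
      obtain ⟨τ, hτ, h3⟩ := (PP_prime hq π σ).exists_mem_finset_dvd h2
      have h4 := (PP_max hq π τ).eq_of_le (PP_max hq π σ).ne_top (Ideal.dvd_iff_le.mp h3)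
      exact hσ (hC.PP_inj hq hqp π h4 ▸ hτ)
    · rw [Finset.prod_insert hσ, hCC, hD]
      exact ⟨D, by ring⟩

lemma Cyc.prod_PP : ∏ σ, PP π σ = Ideal.span {(q : 𝓞 F)} := by
  have h1 : ∏ σ, PP π σ ∣ Ideal.span {(q : 𝓞 F)} := by
    apply hC.prod_PP_dvd hq hqp
    intro σ _
    rw [Ideal.span_singleton_le_iff_mem, mem_PP]
    have : σ • (q : 𝓞 F) = q := map_natCast (MulSemiringAction.toRingHom Gal(F/ℚ) (𝓞 F) σ) q
    rw [this]; simp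
  obtain ⟨C, hCC⟩ := h1
  have h2 := congrArg Ideal.absNorm hCC
  have hfr : Module.finrank ℚ F = Fintype.card Gal(F/ℚ) := by
    have : IsGalois ℚ F := IsCyclotomicExtension.isGalois {p} ℚ F
    rw [← Nat.card_eq_fintype_card]; exact (IsGalois.card_aut_eq_finrank ℚ F).symm
  rw [map_mul, map_prod, Finset.prod_congr rfl (fun σ _ => PP_absNorm hq π σ), Finset.prod_const,
    Finset.card_univ, Ideal.absNorm_span_natCast, RingOfIntegers.rank, hfr] at h2
  have h3 : Ideal.absNorm C = 1 := by
    have : 0 < q ^ Fintype.card Gal(F/ℚ) := pow_pos hq.pos _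
    nlinarith
  rw [Ideal.absNorm_eq_one_iff] at h3
  rw [hCC, h3, Ideal.mul_top]

lemma Cyc.unif : Unif π (q : 𝓞 F) := by
  classical
  refine ⟨by simp, by exact_mod_cast hq.ne_zero, fun h => ?_⟩
  have h1 : RingHom.ker π = PP π 1 := by ext x; rw [mem_PP, one_smul, RingHom.mem_ker]
  rw [h1, ← Ideal.dvd_span_singleton, ← hC.prod_PP hq hqp π, ← Finset.mul_prod_erase _ _ (Finset.mem_univ (1 : Gal(F/ℚ))), sq] at h
  have h2 := (mul_dvd_mul_iff_left (PP_ne_bot hq π 1)).mp h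
  obtain ⟨σ, hσ, h3⟩ := (PP_prime hq π 1).exists_mem_finset_dvd h2
  have h4 := (PP_max hq π σ).eq_of_le (PP_max hq π 1).ne_top (Ideal.dvd_iff_le.mp h3)
  exact (Finset.mem_erase.mp hσ).1 (hC.PP_inj hq hqp π h4)

lemma Cyc.factor (x y : 𝓞 F) (hxy : x * y = q) (T : Finset Gal(F/ℚ)) (hx : ∀ σ ∈ T, x ∈ PP π σ)
    (hy : ∀ σ ∉ T, y ∈ PP π σ) : Ideal.span {x} = ∏ σ ∈ T, PP π σ := by
  classical
  obtain ⟨A, hA⟩ := hC.prod_PP_dvd hq hqp π T (Ideal.span {x}) (fun σ hσ => by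
    rw [Ideal.span_singleton_le_iff_mem]; exact hx σ hσ)
  obtain ⟨B, hB⟩ := hC.prod_PP_dvd hq hqp π Tᶜ (Ideal.span {y}) (fun σ hσ => by
    rw [Ideal.span_singleton_le_iff_mem]; exact hy σ (Finset.mem_compl.mp hσ))
  have h : Ideal.span {x} * Ideal.span {y} = ∏ σ, PP π σ := by
    rw [hC.prod_PP hq hqp π, Ideal.span_singleton_mul_span_singleton, hxy]
  rw [hA, hB, ← Finset.prod_mul_prod_compl T] at h
  have hne : ∀ S : Finset Gal(F/ℚ), ∏ σ ∈ S, PP π σ ≠ 0 := fun S =>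
    Finset.prod_ne_zero_iff.mpr fun σ _ => PP_ne_bot hq π σ
  have h5 : (∏ σ ∈ T, PP π σ) * (∏ σ ∈ Tᶜ, PP π σ) * (A * B) = (∏ σ ∈ T, PP π σ) * (∏ σ ∈ Tᶜ, PP π σ) * 1 := by
    rw [mul_one]; refine Eq.trans ?_ h; ring
  have h6 := mul_left_cancel₀ (mul_ne_zero (hne _) (hne _)) h5
  have h7 : A = 1 := (Ideal.isUnit_iff.mp (IsUnit.of_mul_eq_one _ h6)).trans Ideal.one_eq_top.symm
  rw [hA, h7, mul_one]

lemma Cyc.prime_over (P : Ideal (𝓞 F)) [P.IsPrime] (h : (q : 𝓞 F) ∈ P) : ∃ σ, P = PP π σ := by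
  have h1 : ∏ σ, PP π σ ≤ P := by
    rw [hC.prod_PP hq hqp π, Ideal.span_singleton_le_iff_mem]; exact h
  obtain ⟨σ, _, hσ⟩ := (Ideal.IsPrime.prod_le ‹P.IsPrime›).mp h1
  exact ⟨σ, ((PP_max hq π σ).eq_of_le (Ideal.IsPrime.ne_top ‹_›) hσ).symm⟩

end
end
end S14

namespace S14
noncomputable section
open NumberField Polynomial
open scoped Pointwise

/-- all the data on the cyclotomic side -/
structure Dat (p N : ℕ) (F : Type*) [Field F] [NumberField F] (ζ : 𝓞 F)
    (om : Gal(F/ℚ) ≃* (ZMod p)ˣ) (l : ZMod N → ZMod p) : Prop where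
  hp : p.Prime
  hp5 : 5 ≤ p
  hN : N.Prime
  hNmod : N % p = 1
  hl : Lg p N l
  hC : Cyc p F ζ om

section
variable {p N : ℕ} {F : Type*} [Field F] [NumberField F]
variable {ζ : 𝓞 F} {om : Gal(F/ℚ) ≃* (ZMod p)ˣ} {l : ZMod N → ZMod p}

lemma Dat.ne (hD : Dat p N F ζ om l) : N ≠ p := by
  intro h; have := hD.hNmod; rw [h] at this; simp at this

/-- the twisted symbol -/
def psi (l : ZMod N → ZMod p) (π : 𝓞 F →+* ZMod N) (χ : Gal(F/ℚ) →* (ZMod p)ˣ) (x : 𝓞 F) : ZMod p :=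
  ∑ σ : Gal(F/ℚ), (χ σ : ZMod p) * sy l π (N : 𝓞 F) (σ • x)

lemma smul_ne {G R : Type*} [Group G] [Ring R] [MulSemiringAction G R] (σ : G) {x : R} (hx : x ≠ 0) : σ • x ≠ 0 :=
  fun h => hx ((smul_eq_zero_iff_eq σ).mp h)

variable [hpf : Fact p.Prime] [IsCyclotomicExtension {p} ℚ F]
variable (hD : Dat p N F ζ om l) (π : 𝓞 F →+* ZMod N) (χ : Gal(F/ℚ) →* (ZMod p)ˣ)
include hD

lemma Dat.unif : Unif π (N : 𝓞 F) := hD.hC.unif hD.hN hD.ne π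

lemma Dat.two_ne : (2 : ZMod p) ≠ 0 := by
  have := hD.hp5
  have : ((2 : ℕ) : ZMod p) ≠ 0 := by
    rw [Ne, ZMod.natCast_eq_zero_iff]
    exact fun h => absurd (Nat.le_of_dvd (by norm_num) h) (by omega)
  exact_mod_cast this

lemma Dat.three_ne : (3 : ZMod p) ≠ 0 := by
  have := hD.hp5
  have : ((3 : ℕ) : ZMod p) ≠ 0 := by
    rw [Ne, ZMod.natCast_eq_zero_iff]
    exact fun h => absurd (Nat.le_of_dvd (by norm_num) h) (by omega)
  exact_mod_cast this

lemma Dat.psi_mul {x y : 𝓞 F} (hx : x ≠ 0) (hy : y ≠ 0) : psi l π χ (x * y) = psi l π χ x + psi l π χ y := by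
  rw [psi, psi, psi, ← Finset.sum_add_distrib]
  refine Finset.sum_congr rfl fun σ _ => ?_
  rw [smul_mul', sy_mul hD.hl hD.hp hD.hN (hD.unif π) (smul_ne σ hx) (smul_ne σ hy)]; ring

lemma Dat.psi_one : psi l π χ 1 = 0 := by
  have := hD.psi_mul π χ (one_ne_zero (α := 𝓞 F)) (one_ne_zero (α := 𝓞 F))
  rw [mul_one] at this
  linear_combination -this

lemma Dat.psi_neg {x : 𝓞 F} (hx : x ≠ 0) : psi l π χ (-x) = psi l π χ x := by
  have h1 : psi l π χ (-1) = 0 := by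
    have := hD.psi_mul π χ (neg_ne_zero.mpr (one_ne_zero (α := 𝓞 F))) (neg_ne_zero.mpr (one_ne_zero (α := 𝓞 F)))
    rw [neg_mul_neg, mul_one, hD.psi_one] at this
    have h2 : (2 : ZMod p) * psi l π χ (-1) = 0 := by linear_combination -this
    exact (mul_eq_zero.mp h2).resolve_left hD.two_ne
  rw [neg_eq_neg_one_mul, hD.psi_mul π χ (neg_ne_zero.mpr one_ne_zero) hx, h1, zero_add]

lemma Dat.psi_pow {x : 𝓞 F} (hx : x ≠ 0) (n : ℕ) : psi l π χ (x ^ n) = n * psi l π χ x := by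
  induction n with
  | zero => simp [hD.psi_one]
  | succ n ih => rw [pow_succ, hD.psi_mul π χ (pow_ne_zero _ hx) hx, ih]; push_cast; ring

lemma Dat.psi_prod {ι : Type*} (s : Finset ι) (f : ι → 𝓞 F) (hf : ∀ i ∈ s, f i ≠ 0) :
    psi l π χ (∏ i ∈ s, f i) = ∑ i ∈ s, psi l π χ (f i) := by
  classical
  induction s using Finset.induction_on with
  | empty => simp [hD.psi_one]
  | insert i s hi ih =>
    rw [Finset.prod_insert hi, Finset.sum_insert hi, hD.psi_mul π χ (hf i (Finset.mem_insert_self _ _))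
      (Finset.prod_ne_zero_iff.mpr fun j hj => hf j (Finset.mem_insert_of_mem hj)),
      ih fun j hj => hf j (Finset.mem_insert_of_mem hj)]

omit hD [IsCyclotomicExtension {p} ℚ F] in
lemma psi_smul (τ : Gal(F/ℚ)) (x : 𝓞 F) : psi l π χ (τ • x) = ((χ τ)⁻¹ : (ZMod p)ˣ) * psi l π χ x := by
  rw [psi, psi, Finset.mul_sum]
  refine Fintype.sum_equiv (Equiv.mulRight τ) _ _ fun σ => ?_
  have h : ((χ τ)⁻¹ : (ZMod p)ˣ) * (χ τ : ZMod p) = 1 := Units.inv_mul _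
  rw [Equiv.coe_mulRight, map_mul, Units.val_mul, smul_smul]
  linear_combination (-((χ σ : ZMod p) * sy l π (N : 𝓞 F) ((σ * τ) • x))) * h

lemma Dat.zeta_ne : ζ ≠ 0 := by
  intro h
  have := hD.hC.prim.pow_eq_one
  rw [h, zero_pow hpf.out.ne_zero] at this
  exact zero_ne_one this

lemma Dat.psi_zeta : psi l π χ ζ = (∑ σ, ((χ σ : ZMod p) * (om σ : ZMod p))) * sy l π (N : 𝓞 F) ζ := by
  rw [psi, Finset.sum_mul]
  refine Finset.sum_congr rfl fun σ _ => ?_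
  rw [hD.hC.act, sy_pow hD.hl hD.hp hD.hN (hD.unif π) hD.zeta_ne]
  rw [ZMod.natCast_val, ZMod.cast_id', id, mul_assoc]

lemma Dat.psi_om_zeta : psi l π om.toMonoidHom ζ = 0 := by
  rw [hD.psi_zeta]
  convert zero_mul _
  have h3 : (2 : ZMod p) ^ 2 ≠ 1 := by
    intro h
    apply hD.three_ne
    linear_combination h
  obtain ⟨u, hu⟩ : ∃ u : (ZMod p)ˣ, (u : ZMod p) = 2 := ⟨Units.mk0 2 hD.two_ne, rfl⟩
  have key : (2 : ZMod p) ^ 2 * ∑ σ : Gal(F/ℚ), ((om σ : ZMod p) * (om σ : ZMod p)) = ∑ σ : Gal(F/ℚ), ((om σ : ZMod p) * (om σ : ZMod p)) := by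
    rw [Finset.mul_sum]
    refine Fintype.sum_equiv (Equiv.mulRight (om.symm u)) _ _ fun σ => ?_
    rw [Equiv.coe_mulRight, map_mul, Units.val_mul, MulEquiv.apply_symm_apply, hu]; ring
  have : ((2 : ZMod p) ^ 2 - 1) * ∑ σ : Gal(F/ℚ), ((om σ : ZMod p) * (om σ : ZMod p)) = 0 := by
    linear_combination key
  exact (mul_eq_zero.mp this).resolve_left (sub_ne_zero.mpr h3)

/-- elements which are real up to roots of unity -/
lemma Dat.psi_real (hχ : χ (om.symm (-1)) = -1) {x : 𝓞 F} (hx : x ≠ 0) (j : ℕ)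
    (h : x = ζ ^ j * (om.symm (-1) • x) ∨ x = - (ζ ^ j * (om.symm (-1) • x))) (hj : (j : ZMod p) * psi l π χ ζ = 0) :
    psi l π χ x = 0 := by
  have hzj : ζ ^ j ≠ 0 := pow_ne_zero _ hD.zeta_ne
  have h1 : psi l π χ x = psi l π χ (ζ ^ j * (om.symm (-1) • x)) := by
    rcases h with h | h
    · exact congrArg _ h
    · refine (congrArg (psi l π χ) h).trans (hD.psi_neg π χ (mul_ne_zero hzj (smul_ne _ hx)))
  rw [hD.psi_mul π χ hzj (smul_ne _ hx), hD.psi_pow π χ hD.zeta_ne, hj, psi_smul, hχ] at h1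
  simp only [inv_neg, inv_one, Units.val_neg, Units.val_one] at h1
  have h2 : (2 : ZMod p) * psi l π χ x = 0 := by linear_combination h1
  exact (mul_eq_zero.mp h2).resolve_left hD.two_ne

lemma Dat.psi_unit {u : 𝓞 F} (hu : IsUnit u) : psi l π om.toMonoidHom u = 0 := by
  have := hD.hp5
  obtain ⟨j, hj⟩ := hD.hC.unit_conj (by omega) u hu
  exact hD.psi_real π _ (by simp) hu.ne_zero j hj (by rw [hD.psi_om_zeta, mul_zero])

lemma Dat.one_sub_zeta_ne : ζ - 1 ≠ 0 := hD.hC.primF.zeta_sub_one_prime'.ne_zero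

lemma Dat.psi_lam : psi l π om.toMonoidHom (ζ - 1) = 0 := by
  have := hD.hp5
  refine hD.psi_real π _ (by simp) hD.one_sub_zeta_ne 1 (Or.inr ?_) (by rw [hD.psi_om_zeta, mul_zero])
  rw [smul_sub, smul_one, pow_one, hD.hC.act]
  have h := hD.hC.zpow_neg (1 : ZMod p)
  have hv1 : (1 : ZMod p).val = 1 := by
    have := Fact.mk hpf.out.one_lt
    exact ZMod.val_one p
  rw [hv1, pow_one] at h
  rw [MulEquiv.apply_symm_apply, Units.val_neg, Units.val_one, mul_sub, mul_comm, h]; ring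

/-! ### ideals -/

omit hD hpf [IsCyclotomicExtension {p} ℚ F] in
variable (F) in
lemma exists_gen (I : Ideal (𝓞 F)) : ∃ x : 𝓞 F, Ideal.span {x} = I ^ (Nat.card (ClassGroup (𝓞 F))) := by
  rcases eq_or_ne I ⊥ with rfl | hI
  · refine ⟨0, ?_⟩
    rw [← Ideal.zero_eq_bot, zero_pow Nat.card_pos.ne']; simp
  · have h1 : (ClassGroup.mk0 ⟨I, mem_nonZeroDivisors_of_ne_zero hI⟩) ^ (Nat.card (ClassGroup (𝓞 F))) = 1 := pow_card_eq_one'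
    rw [← map_pow, ClassGroup.mk0_eq_one_iff] at h1
    obtain ⟨x, hx⟩ := h1.principal
    exact ⟨x, hx.symm⟩

/-- `ψ` on ideals -/
def psiI (l : ZMod N → ZMod p) (π : 𝓞 F →+* ZMod N) (om : Gal(F/ℚ) ≃* (ZMod p)ˣ) (I : Ideal (𝓞 F)) : ZMod p :=
  psi l π om.toMonoidHom (exists_gen F I).choose

lemma Dat.psi_assoc {x y : 𝓞 F} (hx : x ≠ 0) (h : Ideal.span {x} = Ideal.span {y}) :
    psi l π om.toMonoidHom x = psi l π om.toMonoidHom y := by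
  obtain ⟨u, hu⟩ := Ideal.span_singleton_eq_span_singleton.mp h
  rw [← hu, hD.psi_mul π _ hx u.isUnit.ne_zero, hD.psi_unit π u.isUnit, add_zero]

omit hD hpf [IsCyclotomicExtension {p} ℚ F] in
lemma gen_ne {I : Ideal (𝓞 F)} (hI : I ≠ ⊥) {x : 𝓞 F} {n : ℕ} (h : Ideal.span {x} = I ^ n) : x ≠ 0 := by
  rintro rfl
  have := pow_ne_zero n hI
  rw [← h] at this
  exact this (by simp)

lemma Dat.psiI_eq {I : Ideal (𝓞 F)} (hI : I ≠ ⊥) {x : 𝓞 F}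
    (h : Ideal.span {x} = I ^ (Nat.card (ClassGroup (𝓞 F)))) : psiI l π om I = psi l π om.toMonoidHom x := by
  have h1 := (exists_gen F I).choose_spec
  exact hD.psi_assoc π (gen_ne hI h1) (h1.trans h.symm)

lemma Dat.psiI_mul {I J : Ideal (𝓞 F)} (hI : I ≠ ⊥) (hJ : J ≠ ⊥) :
    psiI l π om (I * J) = psiI l π om I + psiI l π om J := by
  obtain ⟨x, hx⟩ := exists_gen F I
  obtain ⟨y, hy⟩ := exists_gen F J
  rw [hD.psiI_eq π hI hx, hD.psiI_eq π hJ hy, hD.psiI_eq π (mul_ne_zero hI hJ) (x := x * y)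
    (by rw [← Ideal.span_singleton_mul_span_singleton, hx, hy, mul_pow]),
    hD.psi_mul π _ (gen_ne hI hx) (gen_ne hJ hy)]

lemma Dat.psiI_one : psiI l π om (1 : Ideal (𝓞 F)) = 0 := by
  have := hD.psiI_mul π (one_ne_zero (α := Ideal (𝓞 F))) (one_ne_zero (α := Ideal (𝓞 F)))
  rw [mul_one] at this
  linear_combination -this

lemma Dat.psiI_pow {I : Ideal (𝓞 F)} (hI : I ≠ ⊥) (n : ℕ) : psiI l π om (I ^ n) = n * psiI l π om I := by
  induction n with
  | zero => rw [pow_zero, hD.psiI_one]; simp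
  | succ n ih => rw [pow_succ, hD.psiI_mul π (pow_ne_zero _ hI) hI, ih]; push_cast; ring

lemma Dat.psiI_prod {ι : Type*} (s : Finset ι) (f : ι → Ideal (𝓞 F)) (hf : ∀ i ∈ s, f i ≠ ⊥) :
    psiI l π om (∏ i ∈ s, f i) = ∑ i ∈ s, psiI l π om (f i) := by
  classical
  induction s using Finset.induction_on with
  | empty => rw [Finset.prod_empty, hD.psiI_one, Finset.sum_empty]
  | insert i s hi ih =>
    rw [Finset.prod_insert hi, Finset.sum_insert hi, hD.psiI_mul π (hf i (Finset.mem_insert_self _ _))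
      (Finset.prod_ne_zero_iff.mpr fun j hj => hf j (Finset.mem_insert_of_mem hj)),
      ih fun j hj => hf j (Finset.mem_insert_of_mem hj)]

omit hD hpf [IsCyclotomicExtension {p} ℚ F] in
lemma smul_span {G R : Type*} [Group G] [CommRing R] [MulSemiringAction G R] (σ : G) (x : R) :
    σ • Ideal.span {x} = Ideal.span {σ • x} := by
  rw [Ideal.smul_closure, Set.smul_set_singleton]

omit hD hpf [IsCyclotomicExtension {p} ℚ F] in
lemma smul_ideal_ne {G R : Type*} [Group G] [CommRing R] [MulSemiringAction G R] (σ : G) {I : Ideal R} (hI : I ≠ ⊥) :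
    σ • I ≠ ⊥ := fun h => hI ((smul_eq_zero_iff_eq σ).mp h)

lemma Dat.psiI_smul {I : Ideal (𝓞 F)} (hI : I ≠ ⊥) (τ : Gal(F/ℚ)) :
    psiI l π om (τ • I) = ((om τ)⁻¹ : (ZMod p)ˣ) * psiI l π om I := by
  obtain ⟨x, hx⟩ := exists_gen F I
  rw [hD.psiI_eq π hI hx, hD.psiI_eq π (smul_ideal_ne τ hI) (x := τ • x) (by
    rw [← smul_span, hx, smul_pow']), psi_smul]
  rfl

lemma Dat.psiI_span {x : 𝓞 F} (hx : x ≠ 0) :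
    psiI l π om (Ideal.span {x}) = (Nat.card (ClassGroup (𝓞 F)) : ZMod p) * psi l π om.toMonoidHom x := by
  rw [hD.psiI_eq π (x := x ^ (Nat.card (ClassGroup (𝓞 F)))) (by simpa using hx) (by
    rw [Ideal.span_singleton_pow]), hD.psi_pow π _ hx]

end
end
end S14

namespace S14
noncomputable section
open NumberField Polynomial
open scoped Pointwise

section sums
variable {q : ℕ} [hq : Fact q.Prime]

lemma sum_pow_zmod {i : ℕ} (hi : i ≠ 0) (hi2 : i < 2 * (q - 1)) :
    ∑ x : ZMod q, x ^ i = if i = q - 1 then -1 else 0 := by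
  classical
  have h1 : ∑ x : ZMod q, x ^ i = ∑ x : (ZMod q)ˣ, (x ^ i : ZMod q) := by
    rw [← Fintype.sum_subtype_add_sum_subtype (fun x : ZMod q => x ≠ 0)]
    rw [Finset.sum_eq_zero (s := (Finset.univ : Finset {x : ZMod q // ¬ x ≠ 0})), add_zero]
    · refine Fintype.sum_equiv unitsEquivNeZero.symm _ _ fun x => ?_
      simp [unitsEquivNeZero]
    · rintro ⟨x, hx⟩ _
      rw [not_not] at hx
      simp [hx, hi]
  rw [h1, FiniteField.sum_pow_units, ZMod.card]
  congr 1
  rw [eq_iff_iff]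
  constructor
  · rintro ⟨c, hc⟩
    have : c = 1 := by
      rcases c with _ | _ | c
      · simp at hc; omega
      · rfl
      · exfalso
        rw [hc] at hi2
        nlinarith
    rw [hc, this, mul_one]
  · rintro h; rw [h]

lemma sum_beta {A B : ℕ} (hA : A ≠ 0) (hAB : A + B < 2 * (q - 1)) :
    ∑ t : ZMod q, t ^ A * (1 - t) ^ B =
      if q - 1 ≤ A + B ∧ A ≤ q - 1 then - ((-1) ^ (q - 1 - A) * (B.choose (q - 1 - A) : ZMod q)) else 0 := by
  have h1 : ∀ t : ZMod q, t ^ A * (1 - t) ^ B = ∑ j ∈ Finset.range (B + 1), ((-1) ^ j * (B.choose j : ZMod q)) * t ^ (A + j) := by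
    intro t
    rw [sub_eq_add_neg, add_comm, add_pow, Finset.mul_sum]
    refine Finset.sum_congr rfl fun j _ => ?_
    rw [one_pow, neg_pow]; ring
  simp_rw [h1]
  rw [Finset.sum_comm]
  simp_rw [← Finset.mul_sum]
  rw [Finset.sum_congr rfl (g := fun j => if j = q - 1 - A ∧ A ≤ q - 1 then - ((-1) ^ (q - 1 - A) * (B.choose (q - 1 - A) : ZMod q)) else 0)]
  · by_cases hh : A ≤ q - 1
    · simp only [hh, and_true, Finset.sum_ite_eq', Finset.mem_range]
      congr 1
      rw [eq_iff_iff]; omega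
    · simp [hh]
  · intro j hj
    rw [Finset.mem_range] at hj
    rw [sum_pow_zmod (by omega) (by omega)]
    by_cases h : A + j = q - 1
    · have : j = q - 1 - A := by omega
      rw [if_pos h, if_pos ⟨this, by omega⟩, this]; ring
    · rw [if_neg h, if_neg (by omega), mul_zero]

end sums

section
variable {p : ℕ} [hpf : Fact p.Prime] {F : Type*} [Field F] [NumberField F]
variable [IsCyclotomicExtension {p} ℚ F]
variable {ζ : 𝓞 F} {om : Gal(F/ℚ) ≃* (ZMod p)ˣ}

/-- the `p`-th power residue character of a prime of degree one -/
structure Jac (p : ℕ) {F : Type*} [Field F] [NumberField F] (ζ : 𝓞 F) (q : ℕ) (π : 𝓞 F →+* ZMod q) (X : MulChar (ZMod q) (𝓞 F)) : Prop where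
  pi : ∀ t, π (X t) = t ^ ((q - 1) / p)
  zp : ∀ t, t ≠ 0 → ∃ i : ℕ, X t = ζ ^ i

variable (hC : Cyc p F ζ om) {q : ℕ} (hq : q.Prime) (hqp : q % p = 1) (π : 𝓞 F →+* ZMod q)

omit [IsCyclotomicExtension {p} ℚ F] in
lemma mul_m {p : ℕ} [hpf : Fact p.Prime] {q : ℕ} (hqp : q % p = 1) : (q - 1) / p * p = q - 1 :=
  Nat.div_mul_cancel ((Nat.modEq_iff_dvd' (by
    rcases Nat.eq_zero_or_pos q with rfl | h
    · simp at hqp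
    · exact h)).mp (by rw [Nat.ModEq, hqp, Nat.mod_eq_of_lt hpf.out.one_lt]))

omit [IsCyclotomicExtension {p} ℚ F] in
lemma q_ne (hqp : q % p = 1) : q ≠ p := by rintro rfl; simp at hqp

include hC hq hqp in
lemma Cyc.exists_Jac : ∃ X : MulChar (ZMod q) (𝓞 F), Jac p ζ q π X := by
  classical
  have := Fact.mk hq
  have hpr := hC.pi_prim hq (q_ne hqp) π
  have hm := mul_m (p := p) hqp
  have hm0 : (q - 1) / p ≠ 0 := by
    intro h; rw [h] at hm; have := hq.two_le; omega
  have h1 : ∀ t : ZMod q, t ≠ 0 → ∃ i : ℕ, (π ζ) ^ i = t ^ ((q - 1) / p) := by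
    intro t ht
    have := NeZero.mk hpf.out.ne_zero
    obtain ⟨i, _, hi⟩ := hpr.eq_pow_of_pow_eq_one (ξ := t ^ ((q - 1) / p)) (by
      rw [← pow_mul, hm, ZMod.pow_card_sub_one_eq_one ht])
    exact ⟨i, hi⟩
  choose! i hi using h1
  have hinj : ∀ a b : ℕ, π ζ ^ a = π ζ ^ b → ζ ^ a = ζ ^ b := by
    intro a b h
    rw [← hC.pow_eq a, ← hC.pow_eq b]
    congr 2
    rw [ZMod.natCast_eq_natCast_iff]
    have hf : IsOfFinOrder (π ζ) := isOfFinOrder_iff_pow_eq_one.mpr ⟨p, hpf.out.pos, hpr.pow_eq_one⟩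
    rwa [hpr.eq_orderOf, ← hf.pow_eq_pow_iff_modEq]
  have hone : ζ ^ i 1 = 1 := by
    have := hinj (i 1) 0 (by rw [hi 1 one_ne_zero]; simp)
    rwa [pow_zero] at this
  refine ⟨{ toFun := fun t => if t = 0 then 0 else ζ ^ i t, map_one' := by simp [hone], map_mul' := ?_, map_nonunit' := ?_ }, ?_, ?_⟩
  · intro x y
    by_cases hx : x = 0
    · simp [hx]
    by_cases hy : y = 0
    · simp [hy]
    rw [if_neg (mul_ne_zero hx hy), if_neg hx, if_neg hy, ← pow_add]
    apply hinj
    rw [hi _ (mul_ne_zero hx hy), pow_add, hi _ hx, hi _ hy, mul_pow]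
  · intro x hx
    simp only [isUnit_iff_ne_zero, not_not] at hx
    simp [hx]
  · intro t
    change π (if t = 0 then 0 else ζ ^ i t) = _
    by_cases ht : t = 0
    · simp [ht, hm0]
    · rw [if_neg ht, map_pow, hi t ht]
  · intro t ht
    exact ⟨i t, by change (if t = 0 then 0 else ζ ^ i t) = _; rw [if_neg ht]⟩

variable {X : MulChar (ZMod q) (𝓞 F)} (hX : Jac p ζ q π X)
include hC hX hq hqp

lemma Jac.pow_p : X ^ p = 1 := by
  have := Fact.mk hq
  ext t
  rw [MulChar.pow_apply_coe, MulChar.one_apply_coe]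
  obtain ⟨i, hi⟩ := hX.zp t t.ne_zero
  rw [hi, ← pow_mul, mul_comm, pow_mul, hC.prim.pow_eq_one, one_pow]

lemma Jac.ne_one : X ≠ 1 := by
  have := Fact.mk hq
  intro h
  obtain ⟨g, hg⟩ := IsCyclic.exists_generator (α := (ZMod q)ˣ)
  have h1 := hX.pi g
  rw [h, MulChar.one_apply_coe, map_one] at h1
  have h2 : g ^ ((q - 1) / p) = 1 := by ext; rw [Units.val_pow_eq_pow_val, ← h1, Units.val_one]
  have h3 := orderOf_dvd_of_pow_eq_one h2
  rw [orderOf_eq_card_of_forall_mem_zpowers hg, Nat.card_eq_fintype_card, ZMod.card_units] at h3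
  have hm := mul_m (p := p) hqp
  have hm0 : (q - 1) / p ≠ 0 := by
    intro h; rw [h] at hm; have := hq.two_le; omega
  have h4 := Nat.le_of_dvd (Nat.pos_of_ne_zero hm0) h3
  have := hpf.out.two_le
  nlinarith [Nat.pos_of_ne_zero hm0]

lemma Jac.order : orderOf X = p := orderOf_eq_prime (hX.pow_p hC hq hqp π) (hX.ne_one hC hq hqp π)

lemma Jac.pow_ne_one {u : ZMod p} (hu : u ≠ 0) : X ^ u.val ≠ 1 := by
  intro h
  have h1 := orderOf_dvd_of_pow_eq_one h
  rw [hX.order hC hq hqp π] at h1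
  have h2 := Nat.le_of_dvd (Nat.pos_of_ne_zero (by rwa [Ne, ZMod.val_eq_zero])) h1
  have := ZMod.val_lt u
  omega

lemma Jac.pow_val (a : ℕ) : X ^ ((a : ZMod p)).val = X ^ a := by
  rw [pow_eq_pow_iff_modEq, hX.order hC hq hqp π, ZMod.val_natCast]
  exact Nat.mod_modEq _ _

lemma Jac.pow_add (u v : ZMod p) : X ^ u.val * X ^ v.val = X ^ (u + v).val := by
  rw [← _root_.pow_add, ← hX.pow_val hC hq hqp π]; simp

lemma Jac.pow_neg (u : ZMod p) : X ^ (-u).val = (X ^ u.val)⁻¹ := by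
  rw [eq_inv_iff_mul_eq_one, hX.pow_add hC hq hqp π]; simp

lemma Jac.act (σ : Gal(F/ℚ)) (u : ZMod p) :
    (X ^ u.val).ringHomComp (MulSemiringAction.toRingHom Gal(F/ℚ) (𝓞 F) σ) = X ^ ((om σ : ZMod p) * u).val := by
  have := Fact.mk hq
  ext t
  rw [MulChar.ringHomComp_apply, MulSemiringAction.toRingHom_apply, MulChar.pow_apply_coe, MulChar.pow_apply_coe]
  obtain ⟨i, hi⟩ := hX.zp t t.ne_zero
  rw [hi, ← pow_mul, ← hC.pow_eq, hC.act_zpow, ← pow_mul, ← hC.pow_eq (i * _)]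
  congr 2
  push_cast
  simp only [ZMod.natCast_val, ZMod.cast_id', id]
  ring_nf

lemma Jac.smul_J (σ : Gal(F/ℚ)) (u v : ZMod p) [Fintype (ZMod q)] :
    σ • (jacobiSum (X ^ u.val) (X ^ v.val)) =
      jacobiSum (X ^ ((om σ : ZMod p) * u).val) (X ^ ((om σ : ZMod p) * v).val) := by
  have h := jacobiSum_ringHomComp (X ^ u.val) (X ^ v.val) (MulSemiringAction.toRingHom Gal(F/ℚ) (𝓞 F) σ)
  rw [hX.act hC hq hqp π, hX.act hC hq hqp π] at h
  exact h.symm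

lemma Jac.pi_J {u v : ZMod p} (hu : u ≠ 0) (hv : v ≠ 0) [Fintype (ZMod q)] :
    π (jacobiSum (X ^ u.val) (X ^ v.val)) = ∑ t : ZMod q, t ^ ((q - 1) / p * u.val) * (1 - t) ^ ((q - 1) / p * v.val) := by
  have := Fact.mk hq
  rw [jacobiSum, map_sum]
  refine Finset.sum_congr rfl fun t _ => ?_
  rw [map_mul, MulChar.pow_apply' _ (by rwa [Ne, ZMod.val_eq_zero]), MulChar.pow_apply' _ (by rwa [Ne, ZMod.val_eq_zero]),
    map_pow, map_pow, hX.pi, hX.pi, pow_mul, pow_mul]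

lemma Jac.mul_inv {u v : ZMod p} (hu : u ≠ 0) (hv : v ≠ 0) (huv : u + v ≠ 0) [Fact q.Prime] :
    jacobiSum (X ^ u.val) (X ^ v.val) * (om.symm (-1) • jacobiSum (X ^ u.val) (X ^ v.val)) = (q : 𝓞 F) := by
  rw [hX.smul_J hC hq hqp π]
  simp only [MulEquiv.apply_symm_apply, Units.val_neg, Units.val_one, neg_mul, one_mul]
  rw [hX.pow_neg hC hq hqp π, hX.pow_neg hC hq hqp π]
  have hinj : Function.Injective (algebraMap (𝓞 F) F) := RingOfIntegers.coe_injective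
  apply hinj
  rw [map_mul, ← jacobiSum_ringHomComp, ← jacobiSum_ringHomComp]
  have h0 : ∀ χ : MulChar (ZMod q) (𝓞 F), χ⁻¹.ringHomComp (algebraMap (𝓞 F) F) = (χ.ringHomComp (algebraMap (𝓞 F) F))⁻¹ := by
    intro χ
    rw [MulChar.ringHomComp_inv]
  have hne : ∀ w : ZMod p, w ≠ 0 → (X ^ w.val).ringHomComp (algebraMap (𝓞 F) F) ≠ 1 := fun w hw =>
    (MulChar.ringHomComp_ne_one_iff hinj).mpr (hX.pow_ne_one hC hq hqp π hw)
  rw [h0, h0, jacobiSum_mul_jacobiSum_inv _ (hne u hu) (hne v hv) _, ZMod.card, map_natCast]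
  · rw [ringChar.eq_zero, ZMod.ringChar_zmod_n]; exact hq.ne_zero.symm
  · rw [← MulChar.ringHomComp_mul, hX.pow_add hC hq hqp π]; exact hne _ huv


lemma Jac.pi_J_zero {u v : ZMod p} (hu : u ≠ 0) (hv : v ≠ 0) (h : u.val + v.val < p) [Fact q.Prime] :
    π (jacobiSum (X ^ u.val) (X ^ v.val)) = 0 := by
  rw [hX.pi_J hC hq hqp π hu hv]
  have hm := mul_m (p := p) hqp
  have hm0 : 0 < (q - 1) / p := by
    rcases Nat.eq_zero_or_pos ((q - 1) / p) with h | h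
    · rw [h] at hm; have := hq.two_le; omega
    · exact h
  have h1 : (q - 1) / p * u.val + (q - 1) / p * v.val < q - 1 := by
    rw [← mul_add]
    calc _ < (q - 1) / p * p := Nat.mul_lt_mul_of_pos_left h hm0
      _ = q - 1 := hm
  rw [sum_beta _ (by omega), if_neg (by omega)]
  exact mul_ne_zero hm0.ne' (by rwa [Ne, ZMod.val_eq_zero])

lemma Jac.span_J {u v : ZMod p} (hu : u ≠ 0) (hv : v ≠ 0) (huv : u + v ≠ 0) [Fact q.Prime] :
    Ideal.span {jacobiSum (X ^ u.val) (X ^ v.val)} =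
      ∏ σ : Gal(F/ℚ) with ((om σ : ZMod p) * u).val + ((om σ : ZMod p) * v).val < p, PP π σ := by
  refine hC.factor hq (q_ne hqp) π _ _ (hX.mul_inv hC hq hqp π hu hv huv) _ ?_ ?_
  · intro σ hσ
    rw [Finset.mem_filter] at hσ
    rw [mem_PP, hX.smul_J hC hq hqp π]
    exact hX.pi_J_zero hC hq hqp π (mul_ne_zero (Units.ne_zero _) hu) (mul_ne_zero (Units.ne_zero _) hv) hσ.2
  · intro σ hσ
    rw [Finset.mem_filter, not_and] at hσ
    have hσ := hσ (Finset.mem_univ _)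
    rw [mem_PP, hX.smul_J hC hq hqp π, hX.smul_J hC hq hqp π]
    simp only [MulEquiv.apply_symm_apply, Units.val_neg, Units.val_one, neg_mul, one_mul, mul_neg]
    have ha := mul_ne_zero (Units.ne_zero (om σ)) hu
    have hb := mul_ne_zero (Units.ne_zero (om σ)) hv
    have hab : (om σ : ZMod p) * u + (om σ : ZMod p) * v ≠ 0 := by
      rw [← mul_add]; exact mul_ne_zero (Units.ne_zero (om σ)) huv
    refine hX.pi_J_zero hC hq hqp π (neg_ne_zero.mpr ha) (neg_ne_zero.mpr hb) ?_
    have := NeZero.mk ha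
    have := NeZero.mk hb
    rw [ZMod.val_neg_of_ne_zero, ZMod.val_neg_of_ne_zero]
    have h1 := ZMod.val_lt ((om σ : ZMod p) * u)
    have h2 := ZMod.val_lt ((om σ : ZMod p) * v)
    have h3 : ((om σ : ZMod p) * u).val + ((om σ : ZMod p) * v).val ≠ p := by
      intro h
      apply hab
      have := congrArg (Nat.cast (R := ZMod p)) h
      simpa using this
    omega

end
end
end S14

namespace S14
noncomputable section
open NumberField Polynomial
open scoped Pointwise

/-- log of the factorial -/
def Lf {p N : ℕ} (l : ZMod N → ZMod p) (u : ZMod p) : ZMod p := l (((N - 1) / p * u.val).factorial : ZMod N)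

section
variable {p N : ℕ} {F : Type*} [Field F] [NumberField F]
variable {ζ : 𝓞 F} {om : Gal(F/ℚ) ≃* (ZMod p)ˣ} {l : ZMod N → ZMod p}
variable [hpf : Fact p.Prime] [IsCyclotomicExtension {p} ℚ F]
variable (hD : Dat p N F ζ om l) (π : 𝓞 F →+* ZMod N)
include hD

lemma Dat.Lf_neg (u : ZMod p) : Lf l (-u) = - Lf l u := by
  have hp5 := hD.hp5
  by_cases hu : u = 0
  · have : Lf l (0 : ZMod p) = 0 := by simp [Lf, hD.hl.one hD.hp hD.hN]
    rw [hu, neg_zero, this, neg_zero]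
  have := NeZero.mk hu
  have h := hD.hl.fact_refl hD.hp hD.hN (by omega) ((N - 1) / p * u.val) (by
    calc _ ≤ (N - 1) / p * p := Nat.mul_le_mul_left _ (ZMod.val_lt u).le
      _ = _ := mul_m hD.hNmod)
  rw [Lf, Lf, ZMod.val_neg_of_ne_zero, Nat.mul_sub, mul_m hD.hNmod]
  exact eq_neg_of_add_eq_zero_right h

lemma Dat.l_beta {u : ZMod p} (hu : p < 2 * u.val) :
    (- ((-1) ^ (N - 1 - (N - 1) / p * u.val) * (((N - 1) / p * u.val).choose (N - 1 - (N - 1) / p * u.val) : ZMod N))) ≠ 0 ∧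
    l (- ((-1) ^ (N - 1 - (N - 1) / p * u.val) * (((N - 1) / p * u.val).choose (N - 1 - (N - 1) / p * u.val) : ZMod N))) =
      2 * Lf l u - Lf l (2 * u) := by
  have hp5 := hD.hp5
  have hN2 := hD.hN.two_le
  have := Fact.mk hD.hN
  have hm := mul_m (p := p) hD.hNmod
  have hlt := ZMod.val_lt u
  have hv : (2 * u).val = 2 * u.val - p := by
    have h1 : (2 * u : ZMod p) = ((2 * u.val - p : ℕ) : ZMod p) := by
      rw [Nat.cast_sub hu.le]; simp
    rw [h1, ZMod.val_natCast_of_lt (by omega)]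
  set m := (N - 1) / p with hmdef
  set A := m * u.val with hA
  have hAle : A ≤ N - 1 := by rw [← hm]; exact Nat.mul_le_mul_left _ hlt.le
  have h2A : m * (2 * u).val = A - (N - 1 - A) := by
    rw [hv, Nat.mul_sub, hm, hA, mul_left_comm]; omega
  have hAge : N - 1 ≤ 2 * A := by
    rw [← hm, hA, mul_left_comm]; exact Nat.mul_le_mul_left _ hu.le
  have hcf := Nat.choose_mul_factorial_mul_factorial (n := A) (k := N - 1 - A) (by omega)
  have hcf' := congrArg (Nat.cast (R := ZMod N)) hcf
  push_cast at hcf'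
  have hA0 := fact_ne hD.hN (k := A) (by omega)
  have hc0 : ((A.choose (N - 1 - A) : ℕ) : ZMod N) ≠ 0 := by
    intro h
    rw [h, zero_mul, zero_mul] at hcf'
    exact hA0 hcf'.symm
  have hlog := congrArg l hcf'
  rw [hD.hl.mul _ _ (mul_ne_zero hc0 (fact_ne hD.hN (by omega))) (fact_ne hD.hN (by omega)),
    hD.hl.mul _ _ hc0 (fact_ne hD.hN (by omega))] at hlog
  have href := hD.hl.fact_refl hD.hp hD.hN (by omega) A hAle
  have h1 : ((-1 : ZMod N)) ^ (N - 1 - A) ≠ 0 := pow_ne_zero _ (neg_ne_zero.mpr one_ne_zero)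
  refine ⟨neg_ne_zero.mpr (mul_ne_zero h1 hc0), ?_⟩
  rw [hD.hl.neg hD.hp hD.hN (by omega) _ (mul_ne_zero h1 hc0), hD.hl.mul _ _ h1 hc0,
    hD.hl.npow hD.hp hD.hN _ (neg_ne_zero.mpr one_ne_zero), hD.hl.neg_one hD.hp hD.hN (by omega), mul_zero, zero_add,
    Lf, Lf, h2A]
  linear_combination hlog - href

lemma Dat.sum_Lf (hM : IsPthPow p (Mnum N 1)) : ∑ u : ZMod p, u * Lf l u = 0 := by
  rw [← partA hD.hl hD.hp hD.hN hD.hp5 hD.hNmod hM]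
  refine Finset.sum_bij' (fun u _ => u.val) (fun j _ => (j : ZMod p)) ?_ ?_ ?_ ?_ ?_
  · intro u _; exact Finset.mem_range.mpr (ZMod.val_lt u)
  · intro j _; exact Finset.mem_univ _
  · intro u _; simp
  · intro j hj; exact ZMod.val_natCast_of_lt (Finset.mem_range.mp hj)
  · intro u _; simp [Lf]

/-- sums over the Galois group -/
lemma Dat.sum_gal (f : ZMod p → ZMod p) (h0 : f 0 = 0) : ∑ σ : Gal(F/ℚ), f (om σ : ZMod p) = ∑ u : ZMod p, f u := by
  classical
  rw [← Fintype.sum_subtype_add_sum_subtype (fun x : ZMod p => x ≠ 0)]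
  rw [Finset.sum_eq_zero (s := (Finset.univ : Finset {x : ZMod p // ¬ x ≠ 0})), add_zero]
  · refine Fintype.sum_equiv (om.toEquiv.trans unitsEquivNeZero) _ _ fun x => ?_
    simp [unitsEquivNeZero]
  · rintro ⟨x, hx⟩ _
    rw [not_not] at hx
    simp [hx, h0]

lemma Dat.psiI_PP (σ : Gal(F/ℚ)) : psiI l π om (PP π σ) = (om σ : ZMod p) * psiI l π om (RingHom.ker π) := by
  have h := hD.psiI_smul π (PP_ne_bot hD.hN π 1) σ⁻¹
  have h1 : PP π 1 = RingHom.ker π := by rw [PP_eq_smul]; simp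
  rw [h1] at h
  rw [PP_eq_smul, h, map_inv, inv_inv]

/-- Part B -/
lemma Dat.partB (hM : IsPthPow p (Mnum N 1)) (σ : Gal(F/ℚ)) :
    psiI l π om (PP π σ) = 0 := by
  classical
  have hN := hD.hN
  have hNf := Fact.mk hD.hN
  have hC := hD.hC
  have hp5 := hD.hp5
  have hqp := hD.hNmod
  obtain ⟨X, hX⟩ := hC.exists_Jac hN hqp π
  set J := jacobiSum (X ^ (1 : ZMod p).val) (X ^ (1 : ZMod p).val) with hJ
  have h11 : (1 : ZMod p) + 1 ≠ 0 := by rw [one_add_one_eq_two]; exact hD.two_ne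
  have hsp := hX.span_J hC hN hqp π (one_ne_zero) (one_ne_zero) h11
  have hmul := hX.mul_inv hC hN hqp π (one_ne_zero) (one_ne_zero) h11
  rw [← hJ] at hsp hmul
  have hJ0 : J ≠ 0 := by
    intro h; rw [h, zero_mul] at hmul
    exact (Nat.cast_ne_zero.mpr hN.ne_zero) hmul.symm
  have hs : ∀ σ : Gal(F/ℚ), sy l π (N : 𝓞 F) (σ • J) = 2 * Lf l (om σ) - Lf l (2 * om σ) := by
    have hbig : ∀ σ : Gal(F/ℚ), p < 2 * (om σ : ZMod p).val → sy l π (N : 𝓞 F) (σ • J) = 2 * Lf l (om σ) - Lf l (2 * om σ) := by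
      intro σ hσ
      have hlt := ZMod.val_lt (om σ : ZMod p)
      have hm := mul_m (p := p) hqp
      have hm0 : 0 < (N - 1) / p := by
        rcases Nat.eq_zero_or_pos ((N - 1) / p) with h | h
        · rw [h] at hm; have := hN.two_le; omega
        · exact h
      have hmk : (N - 1) / p * (om σ : ZMod p).val < N - 1 := by
        calc _ < (N - 1) / p * p := Nat.mul_lt_mul_of_pos_left hlt hm0
          _ = _ := hm
      have hmk2 : N - 1 ≤ (N - 1) / p * (om σ : ZMod p).val + (N - 1) / p * (om σ : ZMod p).val := by
        calc N - 1 = (N - 1) / p * p := hm.symm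
          _ ≤ (N - 1) / p * (2 * (om σ : ZMod p).val) := Nat.mul_le_mul_left _ hσ.le
          _ = _ := by ring
      obtain ⟨h1, h2⟩ := hD.l_beta hσ
      have hpi : π (σ • J) = - ((-1) ^ (N - 1 - (N - 1) / p * (om σ : ZMod p).val) * (((N - 1) / p * (om σ : ZMod p).val).choose (N - 1 - (N - 1) / p * (om σ : ZMod p).val) : ZMod N)) := by
        rw [hJ, hX.smul_J hC hN hqp π, mul_one, hX.pi_J hC hN hqp π (Units.ne_zero _) (Units.ne_zero _),
          sum_beta (mul_ne_zero hm0.ne' (by rw [Ne, ZMod.val_eq_zero]; exact Units.ne_zero _)) (by omega),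
          if_pos ⟨hmk2, hmk.le⟩]
      rw [sy_of_ne hD.hl hD.hp hN (hD.unif π) (by rw [hpi]; exact h1), hpi, h2]
    intro σ
    by_cases hσ : p < 2 * (om σ : ZMod p).val
    · exact hbig σ hσ
    · have hne : NeZero (om σ : ZMod p) := NeZero.mk (Units.ne_zero _)
      have h1 := hbig (σ * om.symm (-1)) (by
        rw [map_mul, MulEquiv.apply_symm_apply, mul_neg, mul_one, Units.val_neg, ZMod.val_neg_of_ne_zero]
        have := (hpf.out.even_iff).not.mpr (by omega : ¬ p = 2)
        have h3 : ¬ 2 ∣ p := fun h => this (even_iff_two_dvd.mpr h)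
        have := ZMod.val_lt (om σ : ZMod p)
        omega)
      have h2 := congrArg (fun x => sy l π (N : 𝓞 F) (σ • x)) hmul
      simp only [smul_mul', smul_smul] at h2
      have h3 : σ • (N : 𝓞 F) = N := map_natCast (MulSemiringAction.toRingHom Gal(F/ℚ) (𝓞 F) σ) N
      rw [sy_mul hD.hl hD.hp hN (hD.unif π) (smul_ne _ hJ0) (smul_ne _ hJ0), h3, sy_unif hD.hl hD.hp hN (hD.unif π), h1] at h2
      rw [map_mul, MulEquiv.apply_symm_apply, mul_neg, mul_one, Units.val_neg, mul_neg, hD.Lf_neg, hD.Lf_neg] at h2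
      linear_combination h2
  have hpsi : psi l π om.toMonoidHom J = 0 := by
    have hS := hD.sum_Lf hM
    have h1 : psi l π om.toMonoidHom J = ∑ u : ZMod p, u * (2 * Lf l u - Lf l (2 * u)) := by
      rw [psi, ← hD.sum_gal (fun u => u * (2 * Lf l u - Lf l (2 * u))) (by simp)]
      refine Finset.sum_congr rfl fun σ _ => ?_
      rw [hs]; rfl
    have h2 : ∑ u : ZMod p, (2 * u) * Lf l (2 * u) = ∑ u : ZMod p, u * Lf l u :=
      Fintype.sum_equiv (Equiv.mulLeft₀ 2 hD.two_ne) _ _ (fun u => rfl)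
    have h3 : 2 * psi l π om.toMonoidHom J = 0 := by
      rw [h1]
      have : (2 : ZMod p) * ∑ u : ZMod p, u * (2 * Lf l u - Lf l (2 * u)) =
        4 * ∑ u : ZMod p, u * Lf l u - ∑ u : ZMod p, (2 * u) * Lf l (2 * u) := by
        rw [Finset.mul_sum, Finset.mul_sum, ← Finset.sum_sub_distrib]
        refine Finset.sum_congr rfl fun u _ => by ring
      rw [this, h2, hS]; simp
    exact (mul_eq_zero.mp h3).resolve_left hD.two_ne
  have h4 := hD.psiI_span π hJ0
  rw [hpsi, mul_zero, hsp, hD.psiI_prod π _ _ (fun σ _ => PP_ne_bot hN π σ), Finset.sum_congr rfl (fun σ _ => hD.psiI_PP π σ),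
    ← Finset.sum_mul] at h4
  have h5 : (∑ σ : Gal(F/ℚ) with ((om σ : ZMod p) * 1).val + ((om σ : ZMod p) * 1).val < p, (om σ : ZMod p)) * 8 = -1 := by
    rw [Finset.sum_filter]
    simp only [mul_one]
    rw [hD.sum_gal (fun u => if u.val + u.val < p then u else 0) (by simp)]
    have : ∑ u : ZMod p, (if u.val + u.val < p then u else 0) = ∑ j ∈ Finset.range ((p - 1) / 2 + 1), (j : ZMod p) := by
      rw [← Finset.sum_filter]
      refine Finset.sum_bij' (fun u _ => u.val) (fun j _ => (j : ZMod p)) ?_ ?_ ?_ ?_ ?_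
      · intro u hu
        rw [Finset.mem_filter] at hu
        exact Finset.mem_range.mpr (by omega)
      · intro j hj
        rw [Finset.mem_range] at hj
        rw [Finset.mem_filter, ZMod.val_natCast_of_lt (by omega)]
        exact ⟨Finset.mem_univ _, by omega⟩
      · intro u _; simp
      · intro j hj
        rw [Finset.mem_range] at hj
        exact ZMod.val_natCast_of_lt (by omega)
      · intro u _; simp
    rw [this, ← Nat.cast_sum]
    have h6 := Finset.sum_range_id_mul_two ((p - 1) / 2 + 1)
    have hodd := hpf.out.odd_of_ne_two (by omega)
    obtain ⟨k, hk⟩ := hodd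
    have hk' : (p - 1) / 2 = k := by omega
    rw [hk'] at h6 ⊢
    have h7 := congrArg (Nat.cast (R := ZMod p)) h6
    have h8 : ((2 * k + 1 : ℕ) : ZMod p) = 0 := by rw [← hk]; simp
    push_cast [Nat.add_sub_cancel] at h7 h8 ⊢
    linear_combination 4 * h7 + (2 * k + 1) * h8
  have h9 : psiI l π om (RingHom.ker π) = 0 := by
    linear_combination (psiI l π om (RingHom.ker π)) * h5 - 8 * h4
  rw [hD.psiI_PP, h9, mul_zero]

/-- the prime above `p` -/
lemma Dat.psiI_lam : psiI l π om (Ideal.span {ζ - 1}) = 0 := by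
  rw [hD.psiI_span π hD.one_sub_zeta_ne, hD.psi_lam, mul_zero]

end
end
end S14

namespace S14
noncomputable section
open NumberField Polynomial
open scoped Pointwise

/-- primary elements -/
def Prim (p : ℕ) {F : Type*} [Field F] [NumberField F] (ζ x : 𝓞 F) : Prop := ∃ a : ℤ, (a : ZMod p) ≠ 0 ∧ (ζ - 1) ^ 2 ∣ x - a

section
variable {p N : ℕ} {F : Type*} [Field F] [NumberField F]
variable {ζ : 𝓞 F} {om : Gal(F/ℚ) ≃* (ZMod p)ˣ} {l : ZMod N → ZMod p}
variable [hpf : Fact p.Prime] [IsCyclotomicExtension {p} ℚ F]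

lemma Prim.mul {x y : 𝓞 F} (hx : Prim p ζ x) (hy : Prim p ζ y) : Prim p ζ (x * y) := by
  obtain ⟨a, ha, c, hc⟩ := hx
  obtain ⟨b, hb, d, hd⟩ := hy
  refine ⟨a * b, by push_cast; exact mul_ne_zero ha hb, c * y + a * d, ?_⟩
  push_cast
  linear_combination y * hc + a * hd

lemma Prim.one : Prim p ζ (1 : 𝓞 F) := ⟨1, by simp, by simp⟩

lemma Prim.pow {x : 𝓞 F} (hx : Prim p ζ x) (n : ℕ) : Prim p ζ (x ^ n) := by
  induction n with
  | zero => rw [pow_zero]; exact Prim.one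
  | succ n ih => rw [pow_succ]; exact ih.mul hx

lemma Prim.prod {ι : Type*} (s : Finset ι) (f : ι → 𝓞 F) (hf : ∀ i ∈ s, Prim p ζ (f i)) : Prim p ζ (∏ i ∈ s, f i) :=
  Finset.prod_induction f (Prim p ζ) (fun _ _ h1 h2 => h1.mul h2) Prim.one hf

variable (hC : Cyc p F ζ om) (hp5 : 5 ≤ p)
include hC hp5

omit hp5 in
lemma Cyc.red_int {a : ℤ} (h : (ζ - 1) ∣ (a : 𝓞 F)) : (a : ZMod p) = 0 := by
  obtain ⟨f, hf, hk⟩ := hC.exists_red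
  have : (a : 𝓞 F) ∈ RingHom.ker f := by rw [hk]; exact Ideal.mem_span_singleton.mpr h
  rwa [RingHom.mem_ker, map_intCast] at this

lemma Cyc.lam_sq_dvd : (ζ - 1) ^ 2 ∣ (p : 𝓞 F) := by
  have h := IsCyclotomicExtension.Rat.associated_zeta_sub_one_pow_prime p hC.primF
  exact (pow_dvd_pow _ (by omega)).trans h.dvd

lemma Cyc.dvd_int {a : ℤ} (h : (a : ZMod p) = 0) : (ζ - 1) ^ 2 ∣ (a : 𝓞 F) := by
  rw [ZMod.intCast_zmod_eq_zero_iff_dvd] at h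
  obtain ⟨c, rfl⟩ := h
  push_cast
  exact (hC.lam_sq_dvd hp5).mul_right _

omit hC hp5 in
lemma zeta_pow_mod (j : ℕ) : (ζ - 1) ^ 2 ∣ ζ ^ j - (1 + j * (ζ - 1)) := by
  induction j with
  | zero => simp
  | succ j ih =>
    obtain ⟨c, hc⟩ := ih
    refine ⟨c * ζ + j, ?_⟩
    push_cast
    rw [pow_succ]
    linear_combination ζ * hc

lemma Cyc.zeta_prim {j : ℕ} {a : ℤ} (h : (ζ - 1) ^ 2 ∣ ζ ^ j - a) : (j : ZMod p) = 0 := by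
  have hl0 : ζ - 1 ≠ 0 := hC.primF.zeta_sub_one_prime'.ne_zero
  have h1 := dvd_sub h (zeta_pow_mod j)
  have h2 : (ζ - 1) ^ 2 ∣ (1 - a : 𝓞 F) + j * (ζ - 1) := by
    convert h1 using 1; ring
  have h3 : (ζ - 1) ∣ ((1 - a : ℤ) : 𝓞 F) := by
    have h4 : (ζ - 1) ∣ (1 - a : 𝓞 F) + j * (ζ - 1) := (dvd_pow_self _ two_ne_zero).trans h2
    push_cast
    exact (dvd_add_left (dvd_mul_left _ _)).mp h4
  have h5 := hC.dvd_int hp5 (hC.red_int h3)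
  push_cast at h5
  have h6 := (dvd_add_right h5).mp h2
  rw [sq] at h6
  have h7 : ζ - 1 ∣ ((j : ℤ) : 𝓞 F) := by
    have := (mul_dvd_mul_iff_right hl0).mp h6
    exact_mod_cast this
  simpa using hC.red_int h7

omit hp5 in
lemma Cyc.mod_lam (x : 𝓞 F) : ∃ a : ℤ, (ζ - 1) ∣ x - a := by
  obtain ⟨f, hf, hk⟩ := hC.exists_red
  refine ⟨(f x).val, ?_⟩
  rw [← Ideal.mem_span_singleton, ← hk, RingHom.mem_ker]
  simp

lemma Cyc.exists_prim (x : 𝓞 F) (hx : ¬ (ζ - 1) ∣ x) : ∃ j : ℕ, Prim p ζ (ζ ^ j * x) := by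
  obtain ⟨a, b, hb⟩ := hC.mod_lam x
  obtain ⟨b0, d, hd⟩ := hC.mod_lam b
  have ha : (a : ZMod p) ≠ 0 := by
    intro h
    apply hx
    have := (dvd_pow_self (ζ - 1) two_ne_zero).trans (hC.dvd_int hp5 h)
    rw [← dvd_sub_left this, hb]
    exact dvd_mul_right _ _
  set j := (-(b0 : ZMod p) / a).val with hj
  have h1 : ((j * a + b0 : ℤ) : ZMod p) = 0 := by
    push_cast; rw [hj]
    rw [ZMod.natCast_val, ZMod.cast_id', id]; field_simp; ring
  obtain ⟨e, he⟩ := hC.dvd_int hp5 h1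
  obtain ⟨c, hc⟩ := zeta_pow_mod (ζ := ζ) j
  refine ⟨j, a, ha, c * x + d + (ζ - 1) * e + j * b, ?_⟩
  push_cast at he
  linear_combination x * hc + (ζ - 1) * he + (1 + j * (ζ - 1)) * hb + (ζ - 1) * hd

omit hp5 in
lemma Cyc.lam_dvd_smul (σ : Gal(F/ℚ)) : (ζ - 1) ∣ σ • (ζ - 1) := by
  rw [smul_sub, smul_one, hC.act]
  exact sub_one_dvd_pow_sub_one ζ _

omit [IsCyclotomicExtension {p} ℚ F] hpf hC hp5 in
lemma smul_int (σ : Gal(F/ℚ)) (a : ℤ) : σ • (a : 𝓞 F) = a := map_intCast (MulSemiringAction.toRingHom Gal(F/ℚ) (𝓞 F) σ) a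

omit hp5 in
lemma Cyc.smul_dvd (σ : Gal(F/ℚ)) {x : 𝓞 F} {a : ℤ} (h : (ζ - 1) ^ 2 ∣ x - a) : (ζ - 1) ^ 2 ∣ σ • x - a := by
  have h1 := map_dvd (MulSemiringAction.toRingHom Gal(F/ℚ) (𝓞 F) σ) h
  rw [map_pow] at h1
  simp only [MulSemiringAction.toRingHom_apply, smul_sub, smul_int] at h1
  exact (pow_dvd_pow_of_dvd (by have := hC.lam_dvd_smul σ; rwa [smul_sub] at this) 2).trans h1

omit hp5 in
lemma Cyc.prim_smul (σ : Gal(F/ℚ)) {x : 𝓞 F} (h : Prim p ζ x) : Prim p ζ (σ • x) := by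
  obtain ⟨a, ha, h⟩ := h
  exact ⟨a, ha, hC.smul_dvd σ h⟩

lemma Cyc.prim_of_mul {u y : 𝓞 F} (hy : Prim p ζ y) (h : Prim p ζ (u * y)) : Prim p ζ u := by
  obtain ⟨a, ha, c, hc⟩ := h
  obtain ⟨b, hb, d, hd⟩ := hy
  set b' : ℤ := (((b : ZMod p)⁻¹).val : ℤ) with hb'
  have h1 : ((b * b' - 1 : ℤ) : ZMod p) = 0 := by
    push_cast
    rw [hb']; push_cast; rw [ZMod.natCast_val, ZMod.cast_id', id, mul_inv_cancel₀ hb, sub_self]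
  have h2 : (b' : ZMod p) ≠ 0 := by
    intro h; push_cast at h1; rw [h] at h1; simp at h1
  obtain ⟨e, he⟩ := hC.dvd_int hp5 h1
  push_cast at he
  refine ⟨a * b', by push_cast; exact mul_ne_zero ha h2, c * b' - u * d * b' - u * e, ?_⟩
  push_cast
  linear_combination b' * hc - u * b' * hd - u * he

lemma Cyc.prim_unit {u : 𝓞 F} (hu : IsUnit u) (h : Prim p ζ u) : u = om.symm (-1) • u := by
  obtain ⟨a, ha, hd⟩ := h
  have hd' := hC.smul_dvd (om.symm (-1)) hd
  have h2 : (2 : ZMod p) ≠ 0 := by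
    have : ((2 : ℕ) : ZMod p) ≠ 0 := by
      rw [Ne, ZMod.natCast_eq_zero_iff]
      exact fun h => absurd (Nat.le_of_dvd (by norm_num) h) (by omega)
    exact_mod_cast this
  obtain ⟨j, hj⟩ := hC.unit_conj (by omega) u hu
  set v := om.symm (-1) • u with hv
  obtain ⟨c, hc⟩ := hd
  obtain ⟨d, hd⟩ := hd'
  obtain ⟨e, he⟩ := zeta_pow_mod (ζ := ζ) j
  rcases hj with hj | hj
  · have hvu : IsUnit v := by
      rw [hj] at hu; exact isUnit_of_mul_isUnit_right hu
    have hPv : Prim p ζ v := ⟨a, ha, d, hd⟩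
    have hPu : Prim p ζ (ζ ^ j * v) := by rw [← hj]; exact ⟨a, ha, c, hc⟩
    obtain ⟨b, hb, hz⟩ := hC.prim_of_mul hp5 hPv hPu
    have h0 := hC.zeta_prim hp5 hz
    have : ζ ^ j = 1 := by
      rw [← hC.pow_eq, h0]; simp
    rw [hj, this, one_mul]
  · exfalso
    have h3 : (ζ - 1) ∣ ((2 * a : ℤ) : 𝓞 F) := by
      refine ⟨- (ζ - 1) * c - (ζ - 1) * d - (j + (ζ - 1) * e) * v, ?_⟩
      push_cast
      linear_combination hj - hc - hd - v * he
    have := hC.red_int h3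
    push_cast at this
    exact mul_ne_zero h2 ha this

end
end
end S14

namespace S14
noncomputable section
open NumberField Polynomial IsDedekindDomain
open scoped Pointwise

section gen
variable {p : ℕ} [hpf : Fact p.Prime] {F : Type*} [Field F] [NumberField F]

lemma exists_PChar {𝔪 : Ideal (𝓞 F)} (h0 : 𝔪 ≠ ⊥) (h1 : 𝔪 ≠ ⊤) (f : Ideal (𝓞 F) → ZMod p)
    (hmul : ∀ I J, IsCoprime I 𝔪 → IsCoprime J 𝔪 → f (I * J) = f I + f J)
    (hper : ∀ x y : 𝓞 F, x - y ∈ 𝔪 → IsCoprime (Ideal.span {x}) 𝔪 → IsCoprime (Ideal.span {y}) 𝔪 →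
      f (Ideal.span {x}) = f (Ideal.span {y})) :
    ∃ ξ : Ideal (𝓞 F) →*₀ ℂ, PChar p 𝔪 ξ ∧ ∀ I, IsCoprime I 𝔪 → ξ I = ZMod.stdAddChar (f I) := by
  classical
  have hone : f 1 = 0 := by
    have := hmul 1 1 isCoprime_one_left isCoprime_one_left
    rw [mul_one] at this
    linear_combination -this
  have hcop : ∀ x y : 𝓞 F, x - y ∈ 𝔪 → IsCoprime (Ideal.span {x}) 𝔪 → IsCoprime (Ideal.span {y}) 𝔪 := by
    intro x y hxy hx
    rw [Ideal.isCoprime_iff_sup_eq] at hx ⊢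
    rw [← hx]
    apply le_antisymm
    · refine sup_le ?_ le_sup_right
      rw [Ideal.span_singleton_le_iff_mem]
      have h3 : y = x - (x - y) := by ring
      rw [h3]
      exact Ideal.sub_mem _ (Ideal.mem_sup_left (Ideal.mem_span_singleton_self x)) (Ideal.mem_sup_right hxy)
    · refine sup_le ?_ le_sup_right
      rw [Ideal.span_singleton_le_iff_mem]
      have h3 : x = y + (x - y) := by ring
      rw [h3]
      exact Ideal.add_mem _ (Ideal.mem_sup_left (Ideal.mem_span_singleton_self y)) (Ideal.mem_sup_right hxy)
  refine ⟨{ toFun := fun I => if IsCoprime I 𝔪 then ZMod.stdAddChar (f I) else 0, map_zero' := ?_, map_one' := ?_, map_mul' := ?_ },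
    ⟨h0, ?_, ?_, ?_⟩, ?_⟩
  · rw [if_neg]
    intro h
    rw [isCoprime_zero_left, Ideal.isUnit_iff] at h
    exact h1 h
  · rw [if_pos isCoprime_one_left, hone, AddChar.map_zero_eq_one]
  · intro I J
    by_cases hI : IsCoprime I 𝔪
    · by_cases hJ : IsCoprime J 𝔪
      · rw [if_pos (hI.mul_left hJ), if_pos hI, if_pos hJ, hmul I J hI hJ, AddChar.map_add_eq_mul]
      · rw [if_neg (fun h => hJ (IsCoprime.mul_left_iff.mp h).2), if_neg hJ, mul_zero]
    · rw [if_neg (fun h => hI (IsCoprime.mul_left_iff.mp h).1), if_neg hI, zero_mul]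
  · intro I hI
    change (if IsCoprime I 𝔪 then _ else _) ^ p = (1 : ℂ)
    rw [if_pos hI, ← AddChar.map_nsmul_eq_pow]
    simp
  · intro I hI
    change (if IsCoprime I 𝔪 then _ else _) = (0 : ℂ)
    rw [if_neg hI]
  · intro x y hxy
    change (if IsCoprime (Ideal.span {x}) 𝔪 then _ else _) = (if IsCoprime (Ideal.span {y}) 𝔪 then _ else (0 : ℂ))
    by_cases hx : IsCoprime (Ideal.span {x}) 𝔪
    · have hy := hcop x y hxy hx
      rw [if_pos hx, if_pos hy, hper x y hxy hx hy]
    · have hy : ¬ IsCoprime (Ideal.span {y}) 𝔪 := fun h => hx (hcop y x (by rw [← neg_sub]; exact 𝔪.neg_mem hxy) h)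
      rw [if_neg hx, if_neg hy]
  · intro I hI
    change (if IsCoprime I 𝔪 then _ else _) = _
    rw [if_pos hI]
end gen

section
variable {p N : ℕ} {F : Type*} [Field F] [NumberField F]
variable {ζ : 𝓞 F} {om : Gal(F/ℚ) ≃* (ZMod p)ˣ} {l : ZMod N → ZMod p}
variable [hpf : Fact p.Prime] [IsCyclotomicExtension {p} ℚ F]
variable (hD : Dat p N F ζ om l) (π : 𝓞 F →+* ZMod N)
include hD

lemma Dat.lam_max : (Ideal.span {ζ - 1}).IsMaximal := by
  have h : (Ideal.span {ζ - 1}).IsPrime := by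
    rw [Ideal.span_singleton_prime hD.one_sub_zeta_ne]
    exact hD.hC.primF.zeta_sub_one_prime'
  exact h.isMaximal (by rw [Ne, Ideal.span_singleton_eq_bot]; exact hD.one_sub_zeta_ne)

lemma Dat.eq_lam (P : Ideal (𝓞 F)) [hP : P.IsPrime] (h : (p : 𝓞 F) ∈ P) : P = Ideal.span {ζ - 1} := by
  have h1 := IsCyclotomicExtension.Rat.associated_zeta_sub_one_pow_prime p hD.hC.primF
  have h2 : (ζ - 1) ^ (p - 1) ∈ P := P.mem_of_dvd h1.symm.dvd h
  have h3 := hP.mem_of_pow_mem _ h2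
  exact (hD.lam_max.eq_of_le hP.ne_top ((Ideal.span_singleton_le_iff_mem _).mpr h3)).symm

omit [IsCyclotomicExtension {p} ℚ F] hpf hD in
lemma smul_nat (σ : Gal(F/ℚ)) (a : ℕ) : σ • (a : 𝓞 F) = a := map_natCast (MulSemiringAction.toRingHom Gal(F/ℚ) (𝓞 F) σ) a

lemma Dat.cop_iff (I : Ideal (𝓞 F)) : IsCoprime I (Ideal.span {((p * N : ℕ) : 𝓞 F)}) ↔
    (∀ σ, ¬ I ≤ PP π σ) ∧ ¬ I ≤ Ideal.span {ζ - 1} := by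
  have := Fact.mk hD.hN
  rw [Ideal.isCoprime_iff_sup_eq]
  constructor
  · intro h
    constructor
    · intro σ hI
      apply (PP_max hD.hN π σ).ne_top
      rw [eq_top_iff, ← h]
      refine sup_le hI ?_
      rw [Ideal.span_singleton_le_iff_mem, mem_PP, smul_nat]; simp
    · intro hI
      apply hD.lam_max.ne_top
      rw [eq_top_iff, ← h]
      refine sup_le hI ?_
      rw [Ideal.span_singleton_le_iff_mem, Nat.cast_mul, Ideal.mem_span_singleton]
      exact ((dvd_pow_self _ two_ne_zero).trans (hD.hC.lam_sq_dvd hD.hp5)).mul_right _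
  · rintro ⟨h1, h2⟩
    by_contra h
    obtain ⟨P, hP, hle⟩ := Ideal.exists_le_maximal _ h
    have hPp := hP.isPrime
    have h3 : ((p * N : ℕ) : 𝓞 F) ∈ P := hle (Ideal.mem_sup_right (Ideal.mem_span_singleton_self _))
    rw [Nat.cast_mul] at h3
    rcases hPp.mem_or_mem h3 with h4 | h4
    · rw [hD.eq_lam P h4] at hle
      exact h2 (le_sup_left.trans hle)
    · obtain ⟨σ, hσ⟩ := hD.hC.prime_over hD.hN hD.ne π P h4
      rw [hσ] at hle
      exact h1 σ (le_sup_left.trans hle)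

lemma Dat.psi'_assoc {x y : 𝓞 F} (hx : Prim p ζ x) (hy : Prim p ζ y) (hx0 : x ≠ 0) (h : Ideal.span {x} = Ideal.span {y}) :
    psi l π (om.toMonoidHom)⁻¹ x = psi l π (om.toMonoidHom)⁻¹ y := by
  obtain ⟨u, hu⟩ := Ideal.span_singleton_eq_span_singleton.mp h
  have hu1 : Prim p ζ (u : 𝓞 F) := hD.hC.prim_of_mul hD.hp5 hx (by rw [mul_comm, hu]; exact hy)
  have h2 := hD.hC.prim_unit hD.hp5 u.isUnit hu1
  rw [← hu, hD.psi_mul π _ hx0 u.isUnit.ne_zero, hD.psi_real π (om.toMonoidHom)⁻¹ (by simp) u.isUnit.ne_zero 0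
    (Or.inl (by rw [pow_zero, one_mul]; exact h2)) (by simp), add_zero]

lemma Dat.exists_prim_gen {I : Ideal (𝓞 F)} (hI : ¬ I ≤ Ideal.span {ζ - 1}) :
    ∃ x, Prim p ζ x ∧ Ideal.span {x} = I ^ (Nat.card (ClassGroup (𝓞 F))) := by
  obtain ⟨x, hx⟩ := exists_gen F I
  have hx1 : ¬ (ζ - 1) ∣ x := by
    rw [← Ideal.mem_span_singleton, ← Ideal.span_singleton_le_iff_mem, hx]
    have := hD.lam_max.isPrime
    intro h
    exact hI (Ideal.IsPrime.le_of_pow_le h)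
  obtain ⟨j, hj⟩ := hD.hC.exists_prim hD.hp5 x hx1
  refine ⟨_, hj, ?_⟩
  rw [← hx, Ideal.span_singleton_eq_span_singleton]
  have hu : IsUnit (ζ ^ j) := (hD.hC.prim.isUnit hpf.out.ne_zero).pow j
  exact (associated_unit_mul_left x _ hu)

/-- the other symbol on ideals -/
def psiJ (l : ZMod N → ZMod p) (π : 𝓞 F →+* ZMod N) (om : Gal(F/ℚ) ≃* (ZMod p)ˣ) (ζ : 𝓞 F) (I : Ideal (𝓞 F)) : ZMod p :=
  open Classical in
  if h : ∃ x, Prim p ζ x ∧ Ideal.span {x} = I ^ (Nat.card (ClassGroup (𝓞 F))) then psi l π (om.toMonoidHom)⁻¹ h.choose else 0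

lemma Dat.psiJ_eq {I : Ideal (𝓞 F)} (hI : I ≠ ⊥) {x : 𝓞 F} (hx : Prim p ζ x)
    (h : Ideal.span {x} = I ^ (Nat.card (ClassGroup (𝓞 F)))) : psiJ l π om ζ I = psi l π (om.toMonoidHom)⁻¹ x := by
  have hex : ∃ x, Prim p ζ x ∧ Ideal.span {x} = I ^ (Nat.card (ClassGroup (𝓞 F))) := ⟨x, hx, h⟩
  rw [psiJ, dif_pos hex]
  exact hD.psi'_assoc π hex.choose_spec.1 hx (gen_ne hI hex.choose_spec.2) (hex.choose_spec.2.trans h.symm)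

lemma Dat.psiJ_span {x : 𝓞 F} (hx : Prim p ζ x) (hx0 : x ≠ 0) :
    psiJ l π om ζ (Ideal.span {x}) = (Nat.card (ClassGroup (𝓞 F)) : ZMod p) * psi l π (om.toMonoidHom)⁻¹ x := by
  rw [hD.psiJ_eq π (x := x ^ (Nat.card (ClassGroup (𝓞 F)))) (by simpa using hx0) (hx.pow _) (by
    rw [Ideal.span_singleton_pow]), hD.psi_pow π _ hx0]

omit hD in
lemma ne_bot_of_not_le {R : Type*} [CommRing R] {I J : Ideal R} (h : ¬ I ≤ J) : I ≠ ⊥ := by rintro rfl; exact h bot_le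

lemma Dat.psi_congr (χ : Gal(F/ℚ) →* (ZMod p)ˣ) {x y : 𝓞 F} (hxy : ∀ σ, x - y ∈ PP π σ) (hx : ∀ σ, x ∉ PP π σ) :
    psi l π χ x = psi l π χ y := by
  refine Finset.sum_congr rfl fun σ _ => ?_
  have h1 := hxy σ
  have h2 := hx σ
  rw [mem_PP] at h1 h2
  rw [smul_sub, map_sub, sub_eq_zero] at h1
  rw [sy_of_ne hD.hl hD.hp hD.hN (hD.unif π) h2, sy_of_ne hD.hl hD.hp hD.hN (hD.unif π) (by rwa [← h1]), h1]

lemma Dat.psi_eq (χ : Gal(F/ℚ) →* (ZMod p)ˣ) {x : 𝓞 F} (hx : ∀ σ, x ∉ PP π σ) :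
    psi l π χ x = ∑ σ, (χ σ : ZMod p) * l (π (σ • x)) := by
  refine Finset.sum_congr rfl fun σ _ => ?_
  have h2 := hx σ
  rw [mem_PP] at h2
  rw [sy_of_ne hD.hl hD.hp hD.hN (hD.unif π) h2]

include π in
lemma Dat.exists_l_ne : ∃ t : ZMod N, t ≠ 0 ∧ l t ≠ 0 := by
  have := Fact.mk hD.hN
  by_contra hcon
  push Not at hcon
  have hs : Function.Surjective (fun x : ZMod N => x ^ p) := by
    intro t
    by_cases ht : t = 0
    · exact ⟨0, by simp [ht, hD.hp.ne_zero]⟩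
    · exact (hD.hl.pow t ht).mp (hcon t ht)
  have hi := Finite.injective_iff_surjective.mpr hs
  have hpr := hD.hC.pi_prim hD.hN hD.ne π
  have h1 : π ζ = 1 := hi (by simp [hpr.pow_eq_one])
  rw [h1] at hpr
  have := hpr.unique IsPrimitiveRoot.one
  exact hD.hp.one_lt.ne' this

open Classical in
lemma Dat.exists_u (σ0 : Gal(F/ℚ)) (t : ZMod N) (ht : t ≠ 0) : ∃ u : 𝓞 F, Prim p ζ u ∧
    IsCoprime (Ideal.span {u}) (Ideal.span {((p * N : ℕ) : 𝓞 F)}) ∧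
    ∀ σ, π (σ • u) = if σ = σ0 then t else 1 := by
  classical
  have hNf := Fact.mk hD.hN
  let P : Option Gal(F/ℚ) → Ideal (𝓞 F) := fun i => i.elim (Ideal.span {ζ - 1}) (PP π)
  let e : Option Gal(F/ℚ) → ℕ := fun i => i.elim 2 (fun _ => 1)
  let x : Option Gal(F/ℚ) → 𝓞 F := fun i => i.elim 1 (fun σ => if σ = σ0 then (t.val : 𝓞 F) else 1)
  have hlp : Prime (Ideal.span {ζ - 1}) := Ideal.prime_of_isPrime
    (by rw [Ne, Ideal.span_singleton_eq_bot]; exact hD.one_sub_zeta_ne) hD.lam_max.isPrime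
  have hne : ∀ σ, PP π σ ≠ Ideal.span {ζ - 1} := by
    intro σ h
    have h1 : (p : 𝓞 F) ∈ PP π σ := by
      rw [h, Ideal.mem_span_singleton]
      exact (dvd_pow_self _ two_ne_zero).trans (hD.hC.lam_sq_dvd hD.hp5)
    rw [mem_PP, smul_nat, map_natCast, ZMod.natCast_eq_zero_iff] at h1
    exact hD.ne ((Nat.prime_dvd_prime_iff_eq hD.hN hD.hp).mp h1)
  obtain ⟨u, hu⟩ := IsDedekindDomain.exists_forall_sub_mem_ideal (s := Finset.univ) P e
    (by rintro (_ | σ) _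
        · exact hlp
        · exact PP_prime hD.hN π σ)
    (by rintro (_ | σ) _ (_ | τ) _ h
        · exact absurd rfl h
        · exact (hne τ).symm
        · exact hne σ
        · intro h2
          exact h (congrArg some (hD.hC.PP_inj hD.hN hD.ne π h2)))
    (fun i => x i)
  have hv : ∀ σ, π (σ • u) = if σ = σ0 then t else 1 := by
    intro σ
    have h1 := hu (some σ) (Finset.mem_univ _)
    change u - (if σ = σ0 then (t.val : 𝓞 F) else 1) ∈ (PP π σ) ^ 1 at h1
    rw [pow_one, mem_PP, smul_sub, map_sub, sub_eq_zero] at h1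
    rw [h1]
    split_ifs
    · rw [smul_nat]; simp
    · simp
  have hl : u - 1 ∈ (Ideal.span {ζ - 1}) ^ 2 := hu none (Finset.mem_univ _)
  rw [Ideal.span_singleton_pow, Ideal.mem_span_singleton] at hl
  refine ⟨u, ⟨1, by simp, by simpa using hl⟩, ?_, hv⟩
  rw [hD.cop_iff π]
  constructor
  · intro σ h
    rw [Ideal.span_singleton_le_iff_mem, mem_PP, hv] at h
    split_ifs at h
    · exact ht h
    · exact one_ne_zero h
  · intro h
    rw [Ideal.span_singleton_le_iff_mem, Ideal.mem_span_singleton] at h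
    have h1 := (dvd_pow_self (ζ - 1) two_ne_zero).trans hl
    have h2 := (dvd_sub_right h).mp h1
    exact hD.hC.primF.zeta_sub_one_prime'.not_isUnit (isUnit_of_dvd_one h2)

lemma Dat.exists_q (hreg : (Nat.card (ClassGroup (𝓞 F)) : ZMod p) ≠ 0) : ∃ 𝔮 : Ideal (𝓞 F), 𝔮.IsPrime ∧ 𝔮 ≠ ⊥ ∧ (p : 𝓞 F) ∉ 𝔮 ∧
    (N : 𝓞 F) ∉ 𝔮 ∧ psiI l π om 𝔮 ≠ 0 ∧
    ∃ x, Prim p ζ x ∧ Ideal.span {x} = 𝔮 ^ (Nat.card (ClassGroup (𝓞 F))) ∧ psi l π (om.toMonoidHom)⁻¹ x = 0 := by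
  have hNf := Fact.mk hD.hN
  have hp5 := hD.hp5
  set 𝔪 := Ideal.span {((p * N : ℕ) : 𝓞 F)} with h𝔪
  have hmP : ∀ σ, 𝔪 ≤ PP π σ := fun σ => by
    rw [h𝔪, Ideal.span_singleton_le_iff_mem, mem_PP, smul_nat]; simp
  have hml : ∀ x ∈ 𝔪, (ζ - 1) ^ 2 ∣ x := fun x hx => by
    rw [h𝔪, Ideal.mem_span_singleton, Nat.cast_mul] at hx
    exact (dvd_of_mul_right_dvd hx |> (hD.hC.lam_sq_dvd hD.hp5).trans)
  have h0 : 𝔪 ≠ ⊥ := by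
    rw [h𝔪, Ne, Ideal.span_singleton_eq_bot]
    exact Nat.cast_ne_zero.mpr (mul_ne_zero hD.hp.ne_zero hD.hN.ne_zero)
  have h1 : 𝔪 ≠ ⊤ := fun h => (PP_max hD.hN π 1).ne_top (top_le_iff.mp (h ▸ hmP 1))
  have hb : ∀ I, IsCoprime I 𝔪 → I ≠ ⊥ := fun I hI => ne_bot_of_not_le ((hD.cop_iff π I).mp hI).2
  have hPPn : ∀ x, IsCoprime (Ideal.span {x}) 𝔪 → ∀ σ, x ∉ PP π σ := fun x hx σ h =>
    ((hD.cop_iff π _).mp hx).1 σ ((Ideal.span_singleton_le_iff_mem _).mpr h)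
  have hx0 : ∀ x, IsCoprime (Ideal.span {x}) 𝔪 → x ≠ 0 := fun x hx h => by
    apply hPPn x hx 1; rw [h]; exact zero_mem _
  obtain ⟨ψ, hψ, hψe⟩ := exists_PChar h0 h1 (psiI l π om) (fun I J hI hJ => hD.psiI_mul π (hb I hI) (hb J hJ)) (by
    intro x y hxy hx hy
    rw [hD.psiI_span π (hx0 x hx), hD.psiI_span π (hx0 y hy), hD.psi_congr π _ (fun σ => hmP σ hxy) (hPPn x hx)])
  obtain ⟨ψ1, hψ1, hψ1e⟩ := exists_PChar h0 h1 (psiJ l π om ζ) (by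
    intro I J hI hJ
    obtain ⟨x, hx, hx'⟩ := hD.exists_prim_gen ((hD.cop_iff π I).mp hI).2
    obtain ⟨y, hy, hy'⟩ := hD.exists_prim_gen ((hD.cop_iff π J).mp hJ).2
    rw [hD.psiJ_eq π (hb I hI) hx hx', hD.psiJ_eq π (hb J hJ) hy hy', hD.psiJ_eq π (mul_ne_zero (hb I hI) (hb J hJ)) (hx.mul hy)
      (by rw [← Ideal.span_singleton_mul_span_singleton, hx', hy', mul_pow]),
      hD.psi_mul π _ (gen_ne (hb I hI) hx') (gen_ne (hb J hJ) hy')]) (by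
    intro x y hxy hx hy
    obtain ⟨j, hj⟩ := hD.hC.exists_prim hp5 x (by
      rw [← Ideal.mem_span_singleton, ← Ideal.span_singleton_le_iff_mem]; exact ((hD.cop_iff π _).mp hx).2)
    have hu : IsUnit (ζ ^ j) := (hD.hC.prim.isUnit hpf.out.ne_zero).pow j
    have hjy : Prim p ζ (ζ ^ j * y) := by
      obtain ⟨a, ha, h2⟩ := hj
      refine ⟨a, ha, ?_⟩
      have h3 : ζ ^ j * y - a = (ζ ^ j * x - a) - ζ ^ j * (x - y) := by ring
      rw [h3]
      exact dvd_sub h2 ((hml _ hxy).mul_left _)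
    have hsx : ∀ x : 𝓞 F, Ideal.span {x} = Ideal.span {ζ ^ j * x} := fun x =>
      Ideal.span_singleton_eq_span_singleton.mpr (associated_unit_mul_left x _ hu).symm
    rw [hsx x, hsx y, hD.psiJ_span π hj (mul_ne_zero hu.ne_zero (hx0 x hx)), hD.psiJ_span π hjy (mul_ne_zero hu.ne_zero (hx0 y hy)),
      hD.psi_congr π _ (x := ζ ^ j * x) (y := ζ ^ j * y)]
    · intro σ
      rw [← mul_sub]
      exact Ideal.mul_mem_left _ _ (hmP σ hxy)
    · exact hPPn _ (by rw [← hsx]; exact hx))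
  obtain ⟨t, ht, hlt⟩ := hD.exists_l_ne π
  have huv : ∀ σ0 : Gal(F/ℚ), ∃ u, IsCoprime (Ideal.span {u}) 𝔪 ∧
      psiI l π om (Ideal.span {u}) = (Nat.card (ClassGroup (𝓞 F)) : ZMod p) * ((om σ0 : ZMod p) * l t) ∧
      psiJ l π om ζ (Ideal.span {u}) = (Nat.card (ClassGroup (𝓞 F)) : ZMod p) * ((om σ0 : ZMod p)⁻¹ * l t) := by
    intro σ0
    obtain ⟨u, hu1, hu2, hu3⟩ := hD.exists_u π σ0 t ht
    refine ⟨u, hu2, ?_, ?_⟩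
    · rw [hD.psiI_span π (hx0 u hu2), hD.psi_eq π _ (hPPn u hu2), Finset.sum_eq_single σ0]
      · rw [hu3, if_pos rfl]; rfl
      · intro σ _ hσ
        rw [hu3, if_neg hσ, hD.hl.one hD.hp hD.hN, mul_zero]
      · intro h; exact absurd (Finset.mem_univ _) h
    · rw [hD.psiJ_span π hu1 (hx0 u hu2), hD.psi_eq π _ (hPPn u hu2), Finset.sum_eq_single σ0]
      · rw [hu3, if_pos rfl]; rw [MonoidHom.inv_apply, Units.val_inv_eq_inv_val]; rfl
      · intro σ _ hσ
        rw [hu3, if_neg hσ, hD.hl.one hD.hp hD.hN, mul_zero]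
      · intro h; exact absurd (Finset.mem_univ _) h
  have hst : ∀ a : ZMod p, (ZMod.stdAddChar a : ℂ) = 1 ↔ a = 0 := by
    intro a
    rw [← AddChar.map_zero_eq_one (ZMod.stdAddChar (N := p))]
    exact ZMod.injective_stdAddChar.eq_iff
  obtain ⟨v, hv, hv1, hv2⟩ := thmD hD.hp (by omega) hψ hψ1 (by
    intro k
    have hk : ∃ σ0 : Gal(F/ℚ), (om σ0 : ZMod p) + k * (om σ0 : ZMod p)⁻¹ ≠ 0 := by
      by_cases hk : (1 : ZMod p) + k = 0
      · refine ⟨om.symm (Units.mk0 2 hD.two_ne), ?_⟩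
        rw [MulEquiv.apply_symm_apply, Units.val_mk0]
        intro h
        have h2 := mul_inv_cancel₀ hD.two_ne
        apply hD.three_ne
        linear_combination 2 * h - k * h2 - hk
      · exact ⟨1, by simpa using hk⟩
    obtain ⟨σ0, hσ0⟩ := hk
    obtain ⟨u, hu, hu1, hu2⟩ := huv σ0
    refine ⟨u, hu, ?_⟩
    rw [hψe _ hu, hψ1e _ hu, ← AddChar.map_nsmul_eq_pow, ← AddChar.map_add_eq_mul, Ne, hst, hu1, hu2, nsmul_eq_mul]
    have h3 := mul_ne_zero (mul_ne_zero hreg hlt) hσ0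
    intro h; apply h3; linear_combination h) (by
    obtain ⟨u, hu, hu1, hu2⟩ := huv 1
    refine ⟨u, hu, ?_⟩
    rw [hψ1e _ hu, Ne, hst, hu2]
    rw [map_one, Units.val_one, inv_one, one_mul]
    exact mul_ne_zero hreg hlt)
  rw [hψ1e _ hv, hst] at hv1
  rw [hψe _ hv, Ne, hst] at hv2
  have hcop := hv
  rw [Ideal.isCoprime_iff_sup_eq] at hcop
  obtain ⟨x, hx, hx'⟩ := hD.exists_prim_gen ((hD.cop_iff π _).mp hv).2
  refine ⟨v.asIdeal, v.isPrime, v.ne_bot, ?_, ?_, hv2, x, hx, hx', ?_⟩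
  · intro h
    apply v.isPrime.ne_top
    rw [eq_top_iff, ← hcop]
    refine sup_le le_rfl ?_
    rw [h𝔪, Ideal.span_singleton_le_iff_mem, Nat.cast_mul]
    exact Ideal.mul_mem_right _ _ h
  · intro h
    apply v.isPrime.ne_top
    rw [eq_top_iff, ← hcop]
    refine sup_le le_rfl ?_
    rw [h𝔪, Ideal.span_singleton_le_iff_mem, Nat.cast_mul]
    exact Ideal.mul_mem_left _ _ h
  · rw [← hD.psiJ_eq π (v.ne_bot) hx hx', hv1]

end
end
end S14

namespace S14
noncomputable section
open NumberField Polynomial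
open scoped Pointwise

lemma cnt {p : ℕ} [hpf : Fact p.Prime] (hp5 : 5 ≤ p) (k : (ZMod p)ˣ) :
    (Finset.filter (fun b : ℕ => (k : ZMod p).val + ((k : ZMod p) * (b : ZMod p)).val < p) (Finset.Ico 1 (p - 1))).card
      = p - (k : ZMod p).val - 1 := by
  have hk0 : (k : ZMod p) ≠ 0 := k.ne_zero
  have hv : ∀ b : ℕ, b < p → ((b : ZMod p)).val = b := fun b hb => ZMod.val_cast_of_lt hb
  rw [Nat.sub_sub, ← Nat.sub_sub, ← Nat.card_Ico 1 (p - (k : ZMod p).val)]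
  refine Finset.card_nbij' (fun b => ((k : ZMod p) * (b : ZMod p)).val)
    (fun c => ((k : ZMod p)⁻¹ * (c : ZMod p)).val) ?_ ?_ ?_ ?_
  · intro b hb
    simp only [Finset.coe_filter, Finset.mem_Ico, Set.mem_ofPred_eq, Finset.coe_Ico, Set.mem_Ico] at hb ⊢
    refine ⟨Nat.pos_of_ne_zero ?_, by omega⟩
    rw [Ne, ZMod.val_eq_zero]
    refine mul_ne_zero hk0 ?_
    intro h
    have := hv b (by omega)
    rw [h, ZMod.val_zero] at this
    omega
  · intro c hc
    simp only [Finset.coe_filter, Finset.mem_Ico, Set.mem_ofPred_eq, Finset.coe_Ico, Set.mem_Ico] at hc ⊢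
    have hcp : c < p := by omega
    have hc0 : (c : ZMod p) ≠ 0 := by
      intro h
      have := hv c hcp
      rw [h, ZMod.val_zero] at this
      omega
    rw [ZMod.natCast_val, ZMod.cast_id', id, mul_inv_cancel_left₀ hk0, hv c hcp]
    refine ⟨⟨Nat.pos_of_ne_zero ?_, ?_⟩, by omega⟩
    · rw [Ne, ZMod.val_eq_zero]
      exact mul_ne_zero (inv_ne_zero hk0) hc0
    · have h1 := ZMod.val_lt ((k : ZMod p)⁻¹ * (c : ZMod p))
      by_contra hcon
      have h2 : ((k : ZMod p)⁻¹ * (c : ZMod p)).val = p - 1 := by omega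
      have h3 : ((k : ZMod p)⁻¹ * (c : ZMod p)) = -1 := by
        have := congrArg (fun n : ℕ => (n : ZMod p)) h2
        simp only [ZMod.natCast_val, ZMod.cast_id', id] at this
        rw [this, Nat.cast_sub (by omega)]; simp
      have h4 : (k : ZMod p) + c = 0 := by
        have := congrArg (fun x => (k : ZMod p) * x) h3
        simp only [mul_inv_cancel_left₀ hk0] at this
        rw [this]; ring
      have h5 : (((k : ZMod p).val + c : ℕ) : ZMod p) = 0 := by push_cast; rw [ZMod.natCast_val, ZMod.cast_id', id, h4]
      rw [ZMod.natCast_eq_zero_iff] at h5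
      have := Nat.le_of_dvd (by omega) h5
      omega
  · intro b hb
    simp only [Finset.coe_filter, Finset.mem_Ico, Set.mem_ofPred_eq] at hb
    simp only [ZMod.natCast_val, ZMod.cast_id', id]
    rw [inv_mul_cancel_left₀ hk0, hv b (by omega)]
  · intro c hc
    simp only [Finset.coe_Ico, Set.mem_Ico] at hc
    simp only [ZMod.natCast_val, ZMod.cast_id', id]
    rw [mul_inv_cancel_left₀ hk0, hv c (by omega)]

section G
variable {p : ℕ} [hpf : Fact p.Prime] {F : Type*} [Field F] [NumberField F]
variable [IsCyclotomicExtension {p} ℚ F]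
variable {ζ : 𝓞 F} {om : Gal(F/ℚ) ≃* (ZMod p)ˣ}

/-- the `p`-th power of the Gauss sum -/
def GG (p : ℕ) {F : Type*} [Field F] [NumberField F] (q : ℕ) [Fact q.Prime] (X : MulChar (ZMod q) (𝓞 F)) : 𝓞 F :=
  (q : 𝓞 F) * ∏ b ∈ Finset.Ico 1 (p - 1), jacobiSum X (X ^ b)

variable (hC : Cyc p F ζ om) {q : ℕ} [hq : Fact q.Prime] (hqp : q % p = 1) (ρ : 𝓞 F →+* ZMod q)
  {X : MulChar (ZMod q) (𝓞 F)} (hX : Jac p ζ q ρ X) (hp5 : 5 ≤ p)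
include hC hX hqp hp5

lemma Jac.G_eq : GG p q X = (q : 𝓞 F) * ∏ b ∈ Finset.Ico 1 (p - 1),
    jacobiSum (X ^ (1 : ZMod p).val) (X ^ (b : ZMod p).val) := by
  rw [GG]
  congr 1
  refine Finset.prod_congr rfl fun b _ => ?_
  rw [hX.pow_val hC hq.out hqp, ZMod.val_one, pow_one]

omit [IsCyclotomicExtension {p} ℚ F] hC hX hqp [NumberField F] in
lemma b_ne {b : ℕ} (hb : b ∈ Finset.Ico 1 (p - 1)) : (b : ZMod p) ≠ 0 ∧ (1 : ZMod p) + b ≠ 0 := by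
  rw [Finset.mem_Ico] at hb
  constructor
  · rw [Ne, ZMod.natCast_eq_zero_iff]
    exact Nat.not_dvd_of_pos_of_lt (by omega) (by omega)
  · have : (1 : ZMod p) + b = ((1 + b : ℕ) : ZMod p) := by push_cast; rfl
    rw [this, Ne, ZMod.natCast_eq_zero_iff]
    exact Nat.not_dvd_of_pos_of_lt (by omega) (by omega)

lemma Jac.span_G : Ideal.span {GG p q X} = ∏ σ : Gal(F/ℚ), PP ρ σ ^ (p - (om σ : ZMod p).val) := by
  rw [hX.G_eq hC hqp ρ hp5, ← Ideal.span_singleton_mul_span_singleton, ← Ideal.prod_span_singleton]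
  have h1 : ∀ b ∈ Finset.Ico 1 (p - 1), Ideal.span {jacobiSum (X ^ (1 : ZMod p).val) (X ^ (b : ZMod p).val)} =
      ∏ σ : Gal(F/ℚ), if (om σ : ZMod p).val + ((om σ : ZMod p) * b).val < p then PP ρ σ else 1 := by
    intro b hb
    rw [hX.span_J hC hq.out hqp ρ one_ne_zero (b_ne hp5 hb).1 (b_ne hp5 hb).2, Finset.prod_filter]
    simp only [mul_one]
  rw [Finset.prod_congr rfl h1, Finset.prod_comm, ← hC.prod_PP hq.out (q_ne hqp) ρ, ← Finset.prod_mul_distrib]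
  refine Finset.prod_congr rfl fun σ _ => ?_
  rw [← Finset.prod_filter, Finset.prod_const, cnt hp5, ← pow_succ']
  congr 1
  have := ZMod.val_lt (om σ : ZMod p)
  omega

lemma Jac.G_conj : GG p q X * (om.symm (-1) • GG p q X) = (q : 𝓞 F) ^ p := by
  rw [hX.G_eq hC hqp ρ hp5, smul_mul', Finset.smul_prod', mul_mul_mul_comm, ← Finset.prod_mul_distrib,
    Finset.prod_congr rfl fun b hb => hX.mul_inv hC hq.out hqp ρ one_ne_zero (b_ne hp5 hb).1 (b_ne hp5 hb).2,
    Finset.prod_const, Nat.card_Ico]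
  have : om.symm (-1) • (q : 𝓞 F) = q := map_natCast (MulSemiringAction.toRingHom Gal(F/ℚ) (𝓞 F) _) q
  rw [this, ← pow_two, ← _root_.pow_add]
  congr 1
  omega

lemma Jac.G_prim : Prim p ζ (GG p q X) := by
  refine Prim.mul ⟨q, ?_, by simp⟩ (Prim.prod _ _ fun b _ => ?_)
  · have : (((q : ℕ) : ℤ) : ZMod p) = ((q % p : ℕ) : ZMod p) := by simp
    rw [this, hqp]; simp
  · have h1 := hX.pow_p hC hq.out hqp
    obtain ⟨z, _, hz⟩ := exists_jacobiSum_eq_neg_one_add (n := p) (by omega) h1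
      (show (X ^ b) ^ p = 1 by rw [pow_right_comm, h1, one_pow])
      (by rw [ZMod.card]; exact ⟨_, ((mul_comm _ _).trans (mul_m hqp)).symm⟩) hC.prim
    refine ⟨-1, by simp, z, ?_⟩
    rw [hz]; push_cast; ring

end G

section G2
variable {p N : ℕ} [hpf : Fact p.Prime] {F : Type*} [Field F] [NumberField F]
variable [IsCyclotomicExtension {p} ℚ F]
variable {ζ : 𝓞 F} {om : Gal(F/ℚ) ≃* (ZMod p)ˣ} {l : ZMod N → ZMod p}
variable (hD : Dat p N F ζ om l) (π : 𝓞 F →+* ZMod N)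
include hD

lemma Dat.sy_prod {ι : Type*} (s : Finset ι) (f : ι → 𝓞 F) (hf : ∀ i ∈ s, f i ≠ 0) :
    sy l π (N : 𝓞 F) (∏ i ∈ s, f i) = ∑ i ∈ s, sy l π (N : 𝓞 F) (f i) := by
  classical
  induction s using Finset.induction_on with
  | empty => rw [Finset.prod_empty, Finset.sum_empty, sy_one hD.hl hD.hp hD.hN (hD.unif π)]
  | insert a s ha ih =>
    rw [Finset.prod_insert ha, Finset.sum_insert ha, sy_mul hD.hl hD.hp hD.hN (hD.unif π)
      (hf a (Finset.mem_insert_self _ _)) (Finset.prod_ne_zero_iff.mpr fun i hi => hf i (Finset.mem_insert_of_mem hi)),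
      ih fun i hi => hf i (Finset.mem_insert_of_mem hi)]

lemma Dat.sy_Y {x : 𝓞 F} (hx : x ≠ 0) :
    sy l π (N : 𝓞 F) (∏ σ : Gal(F/ℚ), (σ⁻¹ • x) ^ (p - (om σ : ZMod p).val)) = - psi l π (om.toMonoidHom)⁻¹ x := by
  rw [hD.sy_prod π _ _ fun σ _ => pow_ne_zero _ (smul_ne _ hx), psi, ← Finset.sum_neg_distrib]
  refine Fintype.sum_equiv (Equiv.inv _) _ _ fun σ => ?_
  rw [sy_pow hD.hl hD.hp hD.hN (hD.unif π) (smul_ne _ hx), Nat.cast_sub (ZMod.val_lt _).le, Equiv.inv_apply]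
  simp only [MonoidHom.inv_apply, map_inv, inv_inv]
  simp

lemma Dat.lG {q : ℕ} [hq : Fact q.Prime] (hqp : q % p = 1) (ρ : 𝓞 F →+* ZMod q) (hqN : q ≠ N)
    {X : MulChar (ZMod q) (𝓞 F)} (hX : Jac p ζ q ρ X) (hreg : (Nat.card (ClassGroup (𝓞 F)) : ZMod p) ≠ 0)
    {x : 𝓞 F} (hx : Prim p ζ x) (hxs : Ideal.span {x} = RingHom.ker ρ ^ Nat.card (ClassGroup (𝓞 F)))
    (hps : psi l π (om.toMonoidHom)⁻¹ x = 0) : ∃ y : ZMod N, y ^ p = π (GG p q X) := by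
  set h := Nat.card (ClassGroup (𝓞 F)) with hh
  have hl := hD.hl
  have hU := hD.unif π
  set c := om.symm (-1) with hc
  have hNf := Fact.mk hD.hN
  have hq0 : π (q : 𝓞 F) ≠ 0 := by
    rw [map_natCast, Ne, ZMod.natCast_eq_zero_iff]
    intro hd
    exact hqN ((Nat.prime_dvd_prime_iff_eq hD.hN hq.out).mp hd).symm
  have hq00 : (q : 𝓞 F) ≠ 0 := by intro h; rw [h, map_zero] at hq0; exact hq0 rfl
  have hconj := hX.G_conj hD.hC hqp ρ hD.hp5
  have hG0 : GG p q X ≠ 0 := by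
    intro h; rw [h, zero_mul] at hconj; exact pow_ne_zero p hq00 hconj.symm
  have hx0 : x ≠ 0 := by
    rintro rfl
    have hk : RingHom.ker ρ ≠ ⊥ := by
      have := PP_ne_bot hq.out ρ 1
      rwa [PP_eq_smul, inv_one, one_smul] at this
    have h2 := pow_ne_zero h hk
    rw [← hxs] at h2
    simp at h2
  set Y : 𝓞 F := ∏ σ : Gal(F/ℚ), (σ⁻¹ • x) ^ (p - (om σ : ZMod p).val) with hY
  have hYG : Ideal.span {Y} = Ideal.span {GG p q X ^ h} := by
    rw [← Ideal.span_singleton_pow, hX.span_G hD.hC hqp ρ hD.hp5, hY, ← Ideal.prod_span_singleton, ← Finset.prod_pow]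
    refine Finset.prod_congr rfl fun σ _ => ?_
    rw [← Ideal.span_singleton_pow, ← smul_span, hxs, PP_eq_smul, smul_pow', pow_right_comm]
  rw [Ideal.span_singleton_eq_span_singleton] at hYG
  obtain ⟨ε, hε⟩ := hYG
  have hY0 : Y ≠ 0 := Finset.prod_ne_zero_iff.mpr fun σ _ => pow_ne_zero _ (smul_ne _ hx0)
  have hYp : Prim p ζ Y := Prim.prod _ _ fun σ _ => (hD.hC.prim_smul _ hx).pow _
  have hεp : Prim p ζ (ε : 𝓞 F) := hD.hC.prim_of_mul hD.hp5 hYp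
    (by rw [mul_comm, hε]; exact (hX.G_prim hD.hC hqp ρ hD.hp5).pow _)
  have hεc := hD.hC.prim_unit hD.hp5 ε.isUnit hεp
  have hcY : c • Y = ∏ σ : Gal(F/ℚ), (σ⁻¹ • (c • x)) ^ (p - (om σ : ZMod p).val) := by
    rw [hY, Finset.smul_prod']
    refine Finset.prod_congr rfl fun σ _ => ?_
    rw [smul_pow', smul_smul, smul_smul, om_comm om]
  have hsY : sy l π (N : 𝓞 F) Y = 0 := by rw [hY, hD.sy_Y π hx0, hps, neg_zero]
  have hscY : sy l π (N : 𝓞 F) (c • Y) = 0 := by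
    rw [hcY, hD.sy_Y π (smul_ne _ hx0), psi_smul, hps, mul_zero, neg_zero]
  have hε0 : (ε : 𝓞 F) ≠ 0 := ε.ne_zero
  have e1 : (h : ZMod p) * sy l π (N : 𝓞 F) (GG p q X) = sy l π (N : 𝓞 F) ε := by
    rw [← sy_pow hl hD.hp hD.hN hU hG0, ← hε, sy_mul hl hD.hp hD.hN hU hY0 hε0, hsY, zero_add]
  have e2 : (h : ZMod p) * sy l π (N : 𝓞 F) (c • GG p q X) = sy l π (N : 𝓞 F) ε := by
    rw [← sy_pow hl hD.hp hD.hN hU (smul_ne _ hG0), ← smul_pow', ← hε, smul_mul',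
      sy_mul hl hD.hp hD.hN hU (smul_ne _ hY0) (smul_ne _ hε0), hscY, zero_add, ← hεc]
  have e3 : sy l π (N : 𝓞 F) (GG p q X) + sy l π (N : 𝓞 F) (c • GG p q X) = 0 := by
    rw [← sy_mul hl hD.hp hD.hN hU hG0 (smul_ne _ hG0), hconj, sy_pow hl hD.hp hD.hN hU hq00]
    simp
  have e4 : sy l π (N : 𝓞 F) (GG p q X) = 0 := by
    have : (h : ZMod p) * (2 * sy l π (N : 𝓞 F) (GG p q X)) = 0 := by
      linear_combination e1 - e2 + h * e3
    rcases mul_eq_zero.mp this with h1 | h1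
    · exact absurd h1 hreg
    · exact (mul_eq_zero.mp h1).resolve_left hD.two_ne
  have hG1 : π (GG p q X) ≠ 0 := by
    intro h
    have := congrArg π hconj
    rw [map_mul, h, zero_mul, map_pow] at this
    exact pow_ne_zero p hq0 this.symm
  rw [sy_of_ne hl hD.hp hD.hN hU hG1] at e4
  exact (hl.pow _ hG1).mp e4

end G2


section gauss
variable {p N q : ℕ} [hpf : Fact p.Prime] [hNf : Fact N.Prime] [hq : Fact q.Prime]

lemma gauss_key (hqN : q ≠ N) (hNmod : N % p = 1) (χ : MulChar (ZMod q) (ZMod N)) (hχ : χ ^ p = 1) (hχ1 : χ ≠ 1)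
    (y : ZMod N) (hy : y ^ p = χ (-1) * q * ∏ i ∈ Finset.Ico 1 (p - 1), jacobiSum χ (χ ^ i)) :
    χ (N : ZMod q) = 1 := by
  have hrc : ringChar (ZMod N) ≠ ringChar (ZMod q) := by
    rw [ZMod.ringChar_zmod_n, ZMod.ringChar_zmod_n]; exact hqN.symm
  let ψ := AddChar.FiniteField.primitiveChar (ZMod q) (ZMod N) hrc
  let k := CyclotomicField ψ.n (ZMod N)
  have hck : CharP k N := charP_of_injective_algebraMap (algebraMap (ZMod N) k).injective N
  have hinj : Function.Injective (algebraMap (ZMod N) k) := (algebraMap (ZMod N) k).injective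
  let χ' : MulChar (ZMod q) k := χ.ringHomComp (algebraMap (ZMod N) k)
  have hpw : ∀ i, χ' ^ i = (χ ^ i).ringHomComp (algebraMap (ZMod N) k) := by
    intro i
    ext t
    simp only [χ', MulChar.pow_apply_coe, MulChar.ringHomComp_apply, map_pow]
  have hχ'p : χ' ^ p = 1 := by
    rw [hpw, hχ]; ext t; simp [MulChar.ringHomComp_apply]
  have hχ'1 : χ' ≠ 1 := by
    intro h
    apply hχ1
    ext t
    apply hinj
    have := congrArg (fun f : MulChar (ZMod q) k => f t) h
    simpa [χ', MulChar.ringHomComp_apply] using this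
  have hord : orderOf χ' = p := orderOf_eq_prime hχ'p hχ'1
  have hcard : ((Fintype.card (ZMod q) : ℕ) : k) ≠ 0 := by
    rw [ZMod.card, Ne, CharP.cast_eq_zero_iff k N]
    intro h
    exact hqN ((Nat.prime_dvd_prime_iff_eq hNf.out hq.out).mp h).symm
  have hg0 := gaussSum_ne_zero_of_nontrivial hcard hχ'1 ψ.prim
  have h1 := gaussSum_pow_eq_prod_jacobiSum (χ := χ') (ψ := ψ.char) (by rw [hord]; exact hpf.out.two_le) ψ.prim
  rw [hord] at h1
  have h2 : gaussSum χ' ψ.char ^ p = algebraMap (ZMod N) k y ^ p := by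
    rw [h1, ← map_pow, hy, map_mul, map_mul, map_prod, ZMod.card, map_natCast]
    congr 1
    refine Finset.prod_congr rfl fun i _ => ?_
    rw [hpw, jacobiSum_ringHomComp]
  have hy0 : y ≠ 0 := by
    rintro rfl
    rw [map_zero, zero_pow hpf.out.ne_zero] at h2
    exact pow_ne_zero p hg0 h2
  have h3 : gaussSum χ' ψ.char ^ (N - 1) = 1 := by
    rw [← mul_m (p := p) hNmod, mul_comm, pow_mul, h2, ← pow_mul, mul_comm, mul_m (p := p) hNmod, ← map_pow,
      ZMod.pow_card_sub_one_eq_one hy0, map_one]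
  have h4 : gaussSum χ' ψ.char ^ N = gaussSum χ' ψ.char := by
    have h := pow_succ (gaussSum χ' ψ.char) (N - 1)
    rwa [Nat.sub_add_cancel hNf.out.one_le, h3, one_mul] at h
  rw [gaussSum_frob] at h4
  have h5 : χ' ^ N = χ' := by
    conv_rhs => rw [← pow_one χ']
    rw [pow_eq_pow_iff_modEq, hord, Nat.ModEq, hNmod, Nat.mod_eq_of_lt hpf.out.one_lt]
  have hu : IsUnit (N : ZMod q) := by
    rw [isUnit_iff_ne_zero, Ne, ZMod.natCast_eq_zero_iff]
    intro h
    exact hqN ((Nat.prime_dvd_prime_iff_eq hq.out hNf.out).mp h)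
  obtain ⟨u, hu⟩ := hu
  have h6 := gaussSum_mulShift χ' ψ.char u
  rw [hu, ← AddChar.pow_mulShift] at h6
  rw [h5] at h4
  rw [h4] at h6
  apply hinj
  rw [map_one]
  exact mul_right_cancel₀ hg0 (h6.trans (one_mul _).symm)

lemma pow_of_pow_one (hqp : q % p = 1) {t : ZMod q} (ht0 : t ≠ 0) (ht : t ^ ((q - 1) / p) = 1) : ∃ b : ZMod q, b ^ p = t := by
  obtain ⟨g, hg⟩ := IsCyclic.exists_generator (α := (ZMod q)ˣ)
  obtain ⟨i, hi⟩ := Subgroup.mem_zpowers_iff.mp (hg (Units.mk0 t ht0))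
  have hm := mul_m (p := p) hqp
  have hm0 : (q - 1) / p ≠ 0 := by
    intro h; rw [h] at hm; have := hq.out.two_le; omega
  have h1 : g ^ (i * ((q - 1) / p : ℕ)) = 1 := by
    rw [zpow_mul, hi, zpow_natCast]
    ext
    simpa using ht
  have ho : orderOf g = q - 1 := by
    rw [orderOf_eq_card_of_forall_mem_zpowers hg, Nat.card_eq_fintype_card, ZMod.card_units]
  have h1' : (((q - 1) / p * p : ℕ) : ℤ) ∣ i * ((q - 1) / p : ℕ) := by
    have := orderOf_dvd_iff_zpow_eq_one.mpr h1
    rw [ho] at this; rw [hm]; exact this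
  rw [Nat.cast_mul, mul_comm i] at h1'
  have hm0' : (((q - 1) / p : ℕ) : ℤ) ≠ 0 := by exact_mod_cast hm0
  obtain ⟨j, rfl⟩ := (mul_dvd_mul_iff_left hm0').mp h1'
  refine ⟨(g ^ j : (ZMod q)ˣ), ?_⟩
  have := congrArg (fun u : (ZMod q)ˣ => (u : ZMod q)) hi
  rw [mul_comm, zpow_mul, zpow_natCast] at this
  simpa using this

lemma pow_of_ne (hqp : q % p ≠ 1) (hne : q ≠ p) {t : ZMod q} (ht0 : t ≠ 0) : ∃ b : ZMod q, b ^ p = t := by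
  have hcop : (Nat.card (ZMod q)ˣ).Coprime p := by
    rw [Nat.card_eq_fintype_card, ZMod.card_units, Nat.coprime_comm, hpf.out.coprime_iff_not_dvd]
    intro h
    apply hqp
    have h2 := (Nat.modEq_iff_dvd' hq.out.one_le).mpr h
    rw [Nat.ModEq, Nat.mod_eq_of_lt hpf.out.one_lt] at h2
    exact h2.symm
  refine ⟨((powCoprime hcop).symm (Units.mk0 t ht0) : (ZMod q)ˣ), ?_⟩
  have := (powCoprime hcop).apply_symm_apply (Units.mk0 t ht0)
  rw [powCoprime_apply] at this
  have := congrArg (fun u : (ZMod q)ˣ => (u : ZMod q)) this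
  simpa using this

end gauss

lemma exists_residue_prime {F : Type*} [Field F] [NumberField F] (𝔮 : Ideal (𝓞 F)) (h1 : 𝔮.IsPrime) (h0 : 𝔮 ≠ ⊥) :
    ∃ q : ℕ, q.Prime ∧ (q : 𝓞 F) ∈ 𝔮 := by
  obtain ⟨q, hq⟩ := CharP.exists (𝓞 F ⧸ 𝔮)
  rcases CharP.char_is_prime_or_zero (𝓞 F ⧸ 𝔮) q with h | rfl
  · refine ⟨q, h, ?_⟩
    rw [← Ideal.Quotient.eq_zero_iff_mem, map_natCast, CharP.cast_eq_zero]
  · exfalso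
    have h2 := Ideal.absNorm_mem 𝔮
    rw [← Ideal.Quotient.eq_zero_iff_mem, map_natCast, CharP.cast_eq_zero_iff (𝓞 F ⧸ 𝔮) 0] at h2
    exact h0 (Ideal.absNorm_eq_zero_iff.mp (zero_dvd_iff.mp h2))

section fin
variable {p N : ℕ} [hpf : Fact p.Prime] {F : Type*} [Field F] [NumberField F]
variable [IsCyclotomicExtension {p} ℚ F]
variable {ζ : 𝓞 F} {om : Gal(F/ℚ) ≃* (ZMod p)ˣ} {l : ZMod N → ZMod p}
variable (hD : Dat p N F ζ om l) (π : 𝓞 F →+* ZMod N)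
include hD

lemma Dat.exists_b (𝔮 : Ideal (𝓞 F)) (h1 : 𝔮.IsPrime) (h0 : 𝔮 ≠ ⊥) (hpq : (p : 𝓞 F) ∉ 𝔮) (hNq : (N : 𝓞 F) ∉ 𝔮)
    (hreg : (Nat.card (ClassGroup (𝓞 F)) : ZMod p) ≠ 0) {x : 𝓞 F} (hx : Prim p ζ x)
    (hxs : Ideal.span {x} = 𝔮 ^ Nat.card (ClassGroup (𝓞 F)))
    (hps : psi l π (om.toMonoidHom)⁻¹ x = 0) : ∃ b : 𝓞 F, (N : 𝓞 F) - b ^ p ∈ 𝔮 := by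
  obtain ⟨q, hq, hqm⟩ := exists_residue_prime 𝔮 h1 h0
  have hqf := Fact.mk hq
  have hNf := Fact.mk hD.hN
  have hqp : q ≠ p := by rintro rfl; exact hpq hqm
  have hqN : q ≠ N := by rintro rfl; exact hNq hqm
  have hN0 : (N : ZMod q) ≠ 0 := by
    rw [Ne, ZMod.natCast_eq_zero_iff]
    intro h
    exact hqN ((Nat.prime_dvd_prime_iff_eq hq hD.hN).mp h)
  suffices h : ∃ b : ZMod q, b ^ p = N by
    obtain ⟨b, hb⟩ := h
    refine ⟨(b.val : 𝓞 F), ?_⟩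
    have h2 : ((N - (b.val : ℤ) ^ p : ℤ) : ZMod q) = 0 := by
      push_cast; rw [ZMod.natCast_val, ZMod.cast_id', id, hb, sub_self]
    rw [ZMod.intCast_zmod_eq_zero_iff_dvd] at h2
    obtain ⟨c, hc⟩ := h2
    have h3 := congrArg (fun z : ℤ => (z : 𝓞 F)) hc
    push_cast at h3
    rw [h3]
    exact Ideal.mul_mem_right _ _ hqm
  by_cases hq1 : q % p = 1
  · obtain ⟨ρ0, -⟩ := hD.hC.exists_pi hq hq1
    obtain ⟨σ, hσ⟩ := hD.hC.prime_over hq hqp ρ0 𝔮 hqm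
    let ρ : 𝓞 F →+* ZMod q := ρ0.comp (MulSemiringAction.toRingHom Gal(F/ℚ) (𝓞 F) σ)
    have hρ : 𝔮 = RingHom.ker ρ := hσ
    rw [hρ] at hxs
    obtain ⟨X, hX⟩ := hD.hC.exists_Jac hq hq1 ρ
    obtain ⟨y, hy⟩ := hD.lG π hq1 ρ hqN hX hreg hx hxs hps
    have hXp := hX.pow_p hD.hC hq hq1
    have hpr := hD.hC.pi_prim hD.hN hD.ne π
    have hz : ∀ t, t ≠ 0 → π (X t) = 1 → X t = 1 := by
      intro t ht h
      obtain ⟨i, hi⟩ := hX.zp t ht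
      rw [hi, map_pow, hpr.pow_eq_one_iff_dvd] at h
      rw [hi, hD.hC.prim.pow_eq_one_iff_dvd]
      exact h
    have hX1 : X (-1) = 1 := by
      have h2 : X (-1) ^ p = 1 := by
        rw [← MulChar.pow_apply' _ hD.hp.ne_zero, hXp, MulChar.one_apply (isUnit_one.neg)]
      have h3 : X (-1) ^ 2 = 1 := by
        rw [← map_pow, neg_one_sq, map_one]
      have h4 := pow_gcd_eq_one.mpr ⟨h2, h3⟩
      have : Nat.gcd p 2 = 1 := by
        rw [← Nat.coprime_iff_gcd_eq_one, Nat.coprime_primes hD.hp Nat.prime_two]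
        have := hD.hp5; omega
      rwa [this, pow_one] at h4
    have hpw : ∀ i, (X.ringHomComp π) ^ i = (X ^ i).ringHomComp π := by
      intro i
      ext t
      simp only [MulChar.pow_apply_coe, MulChar.ringHomComp_apply, map_pow]
    have h5 := gauss_key hqN hD.hNmod (X.ringHomComp π)
      (by rw [hpw, hXp]; ext t; simp [MulChar.ringHomComp_apply])
      (by
        intro h
        apply hX.ne_one hD.hC hq hq1
        refine MulChar.ext fun t => ?_
        rw [MulChar.one_apply_coe]
        refine hz _ t.ne_zero ?_
        have := congrArg (fun f : MulChar (ZMod q) (ZMod N) => f t) h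
        simpa [MulChar.ringHomComp_apply] using this) y
      (by
        rw [hy, GG, map_mul, map_prod, map_natCast, MulChar.ringHomComp_apply, hX1, map_one, one_mul]
        congr 1
        refine Finset.prod_congr rfl fun i _ => ?_
        rw [hpw, jacobiSum_ringHomComp])
    rw [MulChar.ringHomComp_apply] at h5
    have h6 := hz _ hN0 h5
    have h7 := hX.pi (N : ZMod q)
    rw [h6, map_one] at h7
    exact pow_of_pow_one hq1 hN0 h7.symm
  · exact pow_of_ne hq1 hqp hN0

end fin

end
end S14

namespace S14
noncomputable section
open NumberField Polynomial
open scoped Pointwise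

/-- the data for the Kummer extension `L/F` -/
structure LD (p N : ℕ) (F : Type*) [Field F] [NumberField F] (ζ : 𝓞 F)
    (om : Gal(F/ℚ) ≃* (ZMod p)ˣ) (l : ZMod N → ZMod p) (L : Type*) [Field L] [NumberField L]
    [Algebra F L] (α : 𝓞 L) (τ : Gal(L/ℚ)) (δ : Gal(F/ℚ) → Gal(L/ℚ)) : Prop where
  dat : Dat p N F ζ om l
  alpha : α ^ p = (N : 𝓞 L)
  tauF : ∀ x : 𝓞 F, τ • algebraMap (𝓞 F) (𝓞 L) x = algebraMap (𝓞 F) (𝓞 L) x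
  tauA : τ • α = algebraMap (𝓞 F) (𝓞 L) ζ * α
  tau_pow : τ ^ p = 1
  comm : ∀ σ, δ σ * τ = τ ^ (om σ : ZMod p).val * δ σ
  delF : ∀ σ, ∀ x : 𝓞 F, δ σ • algebraMap (𝓞 F) (𝓞 L) x = algebraMap (𝓞 F) (𝓞 L) (σ • x)
  norm : ∀ y : 𝓞 L, algebraMap (𝓞 F) (𝓞 L) (Algebra.intNorm (𝓞 F) (𝓞 L) y) = ∏ i ∈ Finset.range p, τ ^ i • y
  h90 : ∀ t s : 𝓞 L, t ≠ 0 → s ≠ 0 → Algebra.intNorm (𝓞 F) (𝓞 L) t = Algebra.intNorm (𝓞 F) (𝓞 L) s →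
    ∃ c : 𝓞 L, c ≠ 0 ∧ t * (τ • c) = s * c
  deg : Module.finrank (𝓞 F) (𝓞 L) = p

/-- transfer of element identities to ideals -/
lemma relNorm_transfer {F L : Type*} [Field F] [NumberField F] [Field L] [NumberField L] [Algebra F L]
    (g : Gal(L/ℚ)) (σ : Gal(F/ℚ))
    (h : ∀ y : 𝓞 L, Algebra.intNorm (𝓞 F) (𝓞 L) (g • y) = σ • Algebra.intNorm (𝓞 F) (𝓞 L) y)
    (I : Ideal (𝓞 L)) : Ideal.relNorm (𝓞 F) (g • I) = σ • Ideal.relNorm (𝓞 F) I := by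
  obtain ⟨y, hy⟩ := exists_gen L I
  refine ideal_pow_inj (n := Nat.card (ClassGroup (𝓞 L))) Nat.card_pos.ne' ?_
  rw [← map_pow, ← smul_pow', ← hy, smul_span, Ideal.relNorm_singleton, h, ← smul_span,
    ← smul_pow', ← map_pow, ← hy, Ideal.relNorm_singleton]

lemma map_relNorm_transfer {F L : Type*} [Field F] [NumberField F] [Field L] [NumberField L] [Algebra F L]
    {ι : Type*} (s : Finset ι) (g : ι → Gal(L/ℚ))
    (h : ∀ y : 𝓞 L, algebraMap (𝓞 F) (𝓞 L) (Algebra.intNorm (𝓞 F) (𝓞 L) y) = ∏ i ∈ s, g i • y)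
    (I : Ideal (𝓞 L)) : (Ideal.relNorm (𝓞 F) I).map (algebraMap (𝓞 F) (𝓞 L)) = ∏ i ∈ s, g i • I := by
  obtain ⟨y, hy⟩ := exists_gen L I
  refine ideal_pow_inj (n := Nat.card (ClassGroup (𝓞 L))) Nat.card_pos.ne' ?_
  rw [← Ideal.map_pow, ← map_pow, ← hy, Ideal.relNorm_singleton, Ideal.map_span, Set.image_singleton, h,
    ← Finset.prod_pow, ← Ideal.prod_span_singleton]
  refine Finset.prod_congr rfl fun i _ => ?_
  rw [← smul_pow', ← hy, smul_span]

section
variable {p N : ℕ} {F : Type*} [Field F] [NumberField F]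
variable {ζ : 𝓞 F} {om : Gal(F/ℚ) ≃* (ZMod p)ˣ} {l : ZMod N → ZMod p}
variable {L : Type*} [Field L] [NumberField L] [Algebra F L] {α : 𝓞 L} {τ : Gal(L/ℚ)} {δ : Gal(F/ℚ) → Gal(L/ℚ)}

lemma algMap_inj : Function.Injective (algebraMap (𝓞 F) (𝓞 L)) :=
  FaithfulSMul.algebraMap_injective (𝓞 F) (𝓞 L)

variable [hpf : Fact p.Prime] [IsCyclotomicExtension {p} ℚ F]
variable (hL : LD p N F ζ om l L α τ δ)

lemma prod_range_zmod {M : Type*} [CommMonoid M] (f : ℕ → M) :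
    ∏ i ∈ Finset.range p, f i = ∏ u : ZMod p, f u.val := by
  refine Finset.prod_nbij' (fun i => (i : ZMod p)) (fun u => u.val) ?_ ?_ ?_ ?_ ?_
  · simp
  · intro u _; simpa using ZMod.val_lt u
  · intro i hi; exact ZMod.val_cast_of_lt (by simpa using hi)
  · intro u _; simp
  · intro i hi; rw [ZMod.val_cast_of_lt (by simpa using hi)]

include hL

lemma LD.tau_mod (n : ℕ) : τ ^ (n : ZMod p).val = τ ^ n := by
  rw [ZMod.val_natCast]
  conv_rhs => rw [← Nat.mod_add_div n p, _root_.pow_add, pow_mul, hL.tau_pow, one_pow, mul_one]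

lemma LD.comm_pow (σ : Gal(F/ℚ)) (n : ℕ) : δ σ * τ ^ n = τ ^ ((om σ : ZMod p).val * n) * δ σ := by
  induction n with
  | zero => simp
  | succ n ih => rw [pow_succ, ← mul_assoc, ih, mul_assoc, hL.comm, ← mul_assoc, ← _root_.pow_add]; ring_nf

/-- `τ δ_σ = δ_σ τ^{1/ω(σ)}` -/
lemma LD.comm' (σ : Gal(F/ℚ)) : τ * δ σ = δ σ * τ ^ (((om σ)⁻¹ : (ZMod p)ˣ) : ZMod p).val := by
  rw [hL.comm_pow, ← hL.tau_mod, Nat.cast_mul, ZMod.natCast_zmod_val, ZMod.natCast_zmod_val, Units.mul_inv,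
    show (1 : ZMod p) = ((1 : ℕ) : ZMod p) by simp, hL.tau_mod, pow_one]

lemma LD.tauF_pow (i : ℕ) (x : 𝓞 F) : τ ^ i • algebraMap (𝓞 F) (𝓞 L) x = algebraMap (𝓞 F) (𝓞 L) x := by
  induction i with
  | zero => simp
  | succ i ih => rw [pow_succ, mul_smul, hL.tauF, ih]

lemma LD.tauA_pow (i : ℕ) : τ ^ i • α = algebraMap (𝓞 F) (𝓞 L) ζ ^ i * α := by
  induction i with
  | zero => simp
  | succ i ih => rw [pow_succ', mul_smul, ih, smul_mul', smul_pow', hL.tauF, hL.tauA]; ring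

lemma LD.nm_tau (y : 𝓞 L) : Algebra.intNorm (𝓞 F) (𝓞 L) (τ • y) = Algebra.intNorm (𝓞 F) (𝓞 L) y := by
  apply algMap_inj (L := L)
  rw [hL.norm, hL.norm]
  obtain ⟨m, hm⟩ : ∃ m, p = m + 1 := ⟨p - 1, by have := hpf.out.pos; omega⟩
  have hp := hL.tau_pow
  rw [hm] at hp ⊢
  rw [Finset.prod_range_succ, Finset.prod_range_succ']
  refine congrArg₂ (· * ·) ?_ ?_
  · refine Finset.prod_congr rfl fun i _ => ?_
    rw [← mul_smul, pow_succ]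
  · rw [← mul_smul, ← pow_succ, hp, pow_zero]

lemma LD.nm_delta (σ : Gal(F/ℚ)) (y : 𝓞 L) :
    Algebra.intNorm (𝓞 F) (𝓞 L) (δ σ • y) = σ • Algebra.intNorm (𝓞 F) (𝓞 L) y := by
  apply algMap_inj (L := L)
  rw [← hL.delF, hL.norm, hL.norm, Finset.smul_prod', prod_range_zmod, prod_range_zmod]
  refine (Fintype.prod_equiv (Units.mulLeft (om σ)) _ _ fun u => ?_).symm
  rw [← mul_smul, ← mul_smul, hL.comm_pow, ← hL.tau_mod, Nat.cast_mul, ZMod.natCast_zmod_val, ZMod.natCast_zmod_val]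
  rfl

lemma LD.nm_alg (x : 𝓞 F) : Algebra.intNorm (𝓞 F) (𝓞 L) (algebraMap (𝓞 F) (𝓞 L) x) = x ^ p := by
  apply algMap_inj (L := L)
  rw [hL.norm, Finset.prod_congr rfl fun i _ => hL.tauF_pow i x, Finset.prod_const, Finset.card_range, map_pow]

lemma LD.rn_tau (I : Ideal (𝓞 L)) : Ideal.relNorm (𝓞 F) (τ • I) = Ideal.relNorm (𝓞 F) I := by
  have := relNorm_transfer τ (1 : Gal(F/ℚ)) (fun y => by rw [hL.nm_tau, one_smul]) I
  rwa [one_smul] at this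

lemma LD.rn_delta (σ : Gal(F/ℚ)) (I : Ideal (𝓞 L)) :
    Ideal.relNorm (𝓞 F) (δ σ • I) = σ • Ideal.relNorm (𝓞 F) I :=
  relNorm_transfer (δ σ) σ (hL.nm_delta σ) I

lemma LD.map_rn (I : Ideal (𝓞 L)) :
    (Ideal.relNorm (𝓞 F) I).map (algebraMap (𝓞 F) (𝓞 L)) = ∏ i ∈ Finset.range p, τ ^ i • I :=
  map_relNorm_transfer _ _ hL.norm I

lemma LD.rn_map (I : Ideal (𝓞 F)) :
    Ideal.relNorm (𝓞 F) (I.map (algebraMap (𝓞 F) (𝓞 L))) = I ^ p := by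
  rw [Ideal.relNorm_algebraMap, hL.deg]

lemma LD.alpha_ne : α ≠ 0 := by
  intro h
  have := hL.alpha
  rw [h, zero_pow hL.dat.hp.ne_zero] at this
  exact hL.dat.hN.ne_zero (by exact_mod_cast this.symm)

end
end
end S14

namespace S14
noncomputable section
open NumberField Polynomial
open scoped Pointwise

section
variable {p N : ℕ} {F : Type*} [Field F] [NumberField F]
variable {ζ : 𝓞 F} {om : Gal(F/ℚ) ≃* (ZMod p)ˣ} {l : ZMod N → ZMod p}
variable {L : Type*} [Field L] [NumberField L] [Algebra F L] {α : 𝓞 L} {τ : Gal(L/ℚ)} {δ : Gal(F/ℚ) → Gal(L/ℚ)}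
variable [hpf : Fact p.Prime] [IsCyclotomicExtension {p} ℚ F]

lemma sup_pow_le {R : Type*} [CommRing R] (J : Ideal R) (a : R) (n : ℕ) :
    (J ⊔ Ideal.span {a}) ^ n ≤ J ⊔ Ideal.span {a ^ n} := by
  rw [← Ideal.span_singleton_pow]
  induction n with
  | zero => simp
  | succ n ih =>
    rw [pow_succ, pow_succ]
    refine (Ideal.mul_mono_left ih).trans ?_
    rw [Ideal.sup_mul, Ideal.mul_sup, Ideal.mul_sup]
    refine sup_le (sup_le ?_ ?_) (sup_le ?_ ?_)
    · exact Ideal.mul_le_left.trans le_sup_left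
    · exact Ideal.mul_le_left.trans le_sup_left
    · exact Ideal.mul_le_right.trans le_sup_left
    · exact le_sup_right

variable (hL : LD p N F ζ om l L α τ δ)
include hL

lemma LD.ram (π : 𝓞 F →+* ZMod N) :
    ((RingHom.ker π).map (algebraMap (𝓞 F) (𝓞 L)) ⊔ Ideal.span {α}) ^ p
      = (RingHom.ker π).map (algebraMap (𝓞 F) (𝓞 L)) := by
  have := Fact.mk hL.dat.hN
  have hu := hL.dat.unif π
  have hPp : (RingHom.ker π).IsPrime := RingHom.ker_isPrime π
  have hP0 : RingHom.ker π ≠ ⊥ := by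
    intro h0
    have h1 : (N : 𝓞 F) ∈ RingHom.ker π := hu.mem
    rw [h0, Ideal.mem_bot] at h1
    exact hu.ne h1
  have hPi : Prime (RingHom.ker π) := Ideal.prime_of_isPrime hP0 hPp
  apply le_antisymm
  · refine (sup_pow_le _ _ _).trans (sup_le le_rfl ?_)
    rw [hL.alpha, Ideal.span_singleton_le_iff_mem]
    have : algebraMap (𝓞 F) (𝓞 L) (N : 𝓞 F) ∈ (RingHom.ker π).map (algebraMap (𝓞 F) (𝓞 L)) :=
      Ideal.mem_map_of_mem _ hu.mem
    rwa [map_natCast] at this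
  · have h1 : RingHom.ker π ^ p ⊔ Ideal.span {(N : 𝓞 F)} = RingHom.ker π := by
      have h2 : (RingHom.ker π ^ p ⊔ Ideal.span {(N : 𝓞 F)}) ∣ RingHom.ker π ^ p :=
        Ideal.dvd_iff_le.mpr le_sup_left
      obtain ⟨i, hi, hi'⟩ := (dvd_prime_pow hPi _).mp h2
      rw [associated_iff_eq] at hi'
      have h3 : (N : 𝓞 F) ∈ RingHom.ker π ^ i := by
        rw [← hi']; exact Ideal.mem_sup_right (Ideal.mem_span_singleton_self _)
      have h4 : i < 2 := by
        by_contra! h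
        exact hu.not_sq (Ideal.pow_le_pow_right h h3)
      have h5 : i ≠ 0 := by
        rintro rfl
        rw [pow_zero, Ideal.one_eq_top] at hi'
        have : (⊤ : Ideal (𝓞 F)) ≤ RingHom.ker π := by
          rw [← hi']
          refine sup_le (Ideal.pow_le_self hL.dat.hp.ne_zero) ?_
          rw [Ideal.span_singleton_le_iff_mem]; exact hu.mem
        exact hPp.ne_top (top_le_iff.mp this)
      have h6 : i = 1 := by omega
      rw [hi', h6, pow_one]
    conv_lhs => rw [← h1]
    rw [Ideal.map_sup, Ideal.map_pow, Ideal.map_span, Set.image_singleton, map_natCast, ← hL.alpha,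
      ← Ideal.span_singleton_pow]
    exact sup_le (Ideal.pow_right_mono le_sup_left _) (Ideal.pow_right_mono le_sup_right _)

lemma LD.exists_Pi (π : 𝓞 F →+* ZMod N) : ∃ Pi : 𝓞 L →+* ZMod N,
    Unif Pi α ∧ (∀ x, Pi (algebraMap (𝓞 F) (𝓞 L) x) = π x) ∧ ∀ x, Pi (τ • x) = Pi x := by
  have := Fact.mk hL.dat.hN
  obtain ⟨J, hJ⟩ : ∃ J, J = (RingHom.ker π).map (algebraMap (𝓞 F) (𝓞 L)) := ⟨_, rfl⟩
  have hr := hL.ram π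
  rw [← hJ] at hr
  obtain ⟨n', hn⟩ : ∃ n', n' = J ⊔ Ideal.span {α} := ⟨_, rfl⟩
  rw [← hn] at hr
  have hrn : Ideal.relNorm (𝓞 F) n' = RingHom.ker π := by
    refine ideal_pow_inj hL.dat.hp.ne_zero ?_
    rw [← map_pow, hr, hJ, hL.rn_map]
  have habs : Ideal.absNorm n' = N := by
    rw [← Ideal.absNorm_relNorm (𝓞 F) (𝓞 L), hrn]
    have := PP_absNorm hL.dat.hN π 1
    have h1 : PP π (1 : Gal(F/ℚ)) = RingHom.ker π := by ext x; rw [mem_PP, one_smul, RingHom.mem_ker]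
    rwa [h1] at this
  have hcard : Nat.card (𝓞 L ⧸ n') = N := by
    rw [← habs, Ideal.absNorm_apply, Submodule.cardQuot_apply]
  have : Finite (𝓞 L ⧸ n') := Nat.finite_of_card_ne_zero (hcard ▸ hL.dat.hN.ne_zero)
  have : Fintype (𝓞 L ⧸ n') := Fintype.ofFinite _
  let e := ZMod.ringEquivOfPrime (𝓞 L ⧸ n') hL.dat.hN (by rw [← Nat.card_eq_fintype_card, hcard])
  let Pi : 𝓞 L →+* ZMod N := (e.symm : _ →+* ZMod N).comp (Ideal.Quotient.mk n')
  have hker : RingHom.ker Pi = n' := by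
    ext x
    rw [RingHom.mem_ker]
    simp only [Pi, RingHom.comp_apply, RingHom.coe_coe, EmbeddingLike.map_eq_zero_iff]
    exact Ideal.Quotient.eq_zero_iff_mem
  have hn1 : n' ≠ ⊤ := by rw [← hker]; exact (RingHom.ker_isPrime Pi).ne_top
  have hn0 : n' ≠ ⊥ := by
    intro h; rw [h] at hn
    have : α ∈ (⊥ : Ideal (𝓞 L)) := hn ▸ Ideal.mem_sup_right (Ideal.mem_span_singleton_self _)
    exact hL.alpha_ne (by simpa using this)
  have hαn : α ∈ n' := hn ▸ Ideal.mem_sup_right (Ideal.mem_span_singleton_self _)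
  have hJn : J ≤ n' := hn ▸ le_sup_left
  refine ⟨Pi, ⟨?_, hL.alpha_ne, ?_⟩, ?_, ?_⟩
  · rw [← RingHom.mem_ker, hker]; exact hαn
  · rw [hker]
    intro h
    have h2 : n' ≤ n' ^ 2 := by
      conv_lhs => rw [hn]
      refine sup_le ?_ ((Ideal.span_singleton_le_iff_mem _).mpr h)
      rw [← hr]
      exact Ideal.pow_le_pow_right hL.dat.hp.two_le
    have h3 : n' * n' = n' * 1 := by
      rw [mul_one, ← sq]; exact le_antisymm (Ideal.pow_le_self two_ne_zero) h2
    have h4 := mul_left_cancel₀ hn0 h3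
    exact hn1 (by rw [h4, Ideal.one_eq_top])
  · intro x
    have : π = Pi.comp (algebraMap (𝓞 F) (𝓞 L)) := by
      have : NeZero N := ⟨hL.dat.hN.ne_zero⟩
      refine hom_eq_of_ker_le _ _ ?_
      intro y hy
      rw [RingHom.mem_ker, RingHom.comp_apply, ← RingHom.mem_ker, hker]
      exact hJn (hJ ▸ Ideal.mem_map_of_mem _ hy)
    rw [this]; rfl
  · intro x
    have : Pi = Pi.comp (MulSemiringAction.toRingHom Gal(L/ℚ) (𝓞 L) τ) := by
      have : NeZero N := ⟨hL.dat.hN.ne_zero⟩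
      refine hom_eq_of_ker_le _ _ ?_
      rw [hker]
      have : n' ≤ (RingHom.ker Pi).comap (MulSemiringAction.toRingHom Gal(L/ℚ) (𝓞 L) τ) := by
        rw [hker]
        conv_lhs => rw [hn]
        refine sup_le ?_ ?_
        · rw [hJ, Ideal.map_le_iff_le_comap]
          intro y hy
          rw [Ideal.mem_comap, Ideal.mem_comap, MulSemiringAction.toRingHom_apply, hL.tauF]
          exact hJn (hJ ▸ Ideal.mem_map_of_mem _ hy)
        · rw [Ideal.span_singleton_le_iff_mem, Ideal.mem_comap, MulSemiringAction.toRingHom_apply, hL.tauA]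
          exact Ideal.mul_mem_left _ _ hαn
      intro y hy
      exact this hy
    exact (congrArg (fun f : 𝓞 L →+* ZMod N => f x) this).symm

lemma LD.nm_alpha : Algebra.intNorm (𝓞 F) (𝓞 L) α = (N : 𝓞 F) := by
  have := Fact.mk hL.dat.hp
  apply algMap_inj (L := L)
  rw [hL.norm, map_natCast, ← hL.alpha, Finset.prod_congr rfl fun i _ => hL.tauA_pow i, Finset.prod_mul_distrib,
    Finset.prod_const, Finset.card_range, Finset.prod_pow_eq_pow_sum, Finset.sum_range_id]
  obtain ⟨m, hm⟩ := hL.dat.hp.odd_of_ne_two (by have := hL.dat.hp5; omega)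
  have h1 : p * (p - 1) / 2 = p * m := by
    rw [hm, Nat.add_sub_cancel, mul_left_comm, Nat.mul_div_cancel_left _ two_pos]
  rw [h1, pow_mul, ← map_pow, hL.dat.hC.prim.pow_eq_one]
  simp

lemma LD.sy_nm (π : 𝓞 F →+* ZMod N) {y : 𝓞 L} (hy : y ≠ 0) :
    sy l π (N : 𝓞 F) (Algebra.intNorm (𝓞 F) (𝓞 L) y) = 0 := by
  obtain ⟨Pi, hU, hPF, hPt⟩ := hL.exists_Pi π
  have := Fact.mk hL.dat.hN
  have hPt' : ∀ i x, Pi (τ ^ i • x) = Pi x := by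
    intro i x
    induction i with
    | zero => simp
    | succ i ih => rw [pow_succ', mul_smul, hPt, ih]
  have hnm : ∀ a : 𝓞 L, π (Algebra.intNorm (𝓞 F) (𝓞 L) a) = Pi a ^ p := by
    intro a
    rw [← hPF, hL.norm, map_prod, Finset.prod_congr rfl fun i _ => hPt' i a, Finset.prod_const, Finset.card_range]
  obtain ⟨a, b, v, ha, hb, hab⟩ := hU.exists_rep hL.dat.hN y hy
  have h0 : ∀ a : 𝓞 L, Pi a ≠ 0 → sy l π (N : 𝓞 F) (Algebra.intNorm (𝓞 F) (𝓞 L) a) = 0 := by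
    intro a ha
    rw [sy_of_ne hL.dat.hl hL.dat.hp hL.dat.hN (hL.dat.unif π) (by rw [hnm]; exact pow_ne_zero _ ha), hnm]
    exact (hL.dat.hl.pow _ (pow_ne_zero _ ha)).mpr ⟨_, rfl⟩
  have hne : ∀ a : 𝓞 L, Pi a ≠ 0 → Algebra.intNorm (𝓞 F) (𝓞 L) a ≠ 0 := fun a ha h => by
    have := hnm a
    rw [h, map_zero] at this
    exact pow_ne_zero _ ha this.symm
  have hz : Algebra.intNorm (𝓞 F) (𝓞 L) y ≠ 0 := by
    exact Algebra.intNorm_ne_zero.mpr hy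
  have h1 := congrArg (fun t => sy l π (N : 𝓞 F) (Algebra.intNorm (𝓞 F) (𝓞 L) t)) hab
  simp only [map_mul, map_pow] at h1
  have hD := hL.dat
  have hu := hD.unif π
  rw [hL.nm_alpha, sy_mul hD.hl hD.hp hD.hN hu (hne b hb) hz, sy_mul hD.hl hD.hp hD.hN hu (hne a ha) (pow_ne_zero _ hu.ne),
    h0 a ha, h0 b hb, sy_pow hD.hl hD.hp hD.hN hu hu.ne, sy_unif hD.hl hD.hp hD.hN hu, mul_zero, zero_add, add_zero] at h1
  exact h1

end
end
end S14

namespace S14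
noncomputable section
open NumberField Polynomial
open scoped Pointwise

section
variable {p N : ℕ} {F : Type*} [Field F] [NumberField F]
variable {ζ : 𝓞 F} {om : Gal(F/ℚ) ≃* (ZMod p)ˣ} {l : ZMod N → ZMod p}
variable {L : Type*} [Field L] [NumberField L] [Algebra F L] {α : 𝓞 L} {τ : Gal(L/ℚ)} {δ : Gal(F/ℚ) → Gal(L/ℚ)}

lemma rn_ne {I : Ideal (𝓞 L)} (hI : I ≠ ⊥) : Ideal.relNorm (𝓞 F) I ≠ ⊥ := by
  rwa [Ne, Ideal.relNorm_eq_bot_iff]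

variable [hpf : Fact p.Prime] [IsCyclotomicExtension {p} ℚ F]

/-- the invariant on ideals of `L` -/
def Psi (l : ZMod N → ZMod p) (π : 𝓞 F →+* ZMod N) (om : Gal(F/ℚ) ≃* (ZMod p)ˣ) (I : Ideal (𝓞 L)) : ZMod p :=
  psiI l π om (Ideal.relNorm (𝓞 F) I)

variable (hL : LD p N F ζ om l L α τ δ) (π : 𝓞 F →+* ZMod N)
include hL

lemma LD.Psi_mul {I J : Ideal (𝓞 L)} (hI : I ≠ ⊥) (hJ : J ≠ ⊥) :
    Psi l π om (I * J) = Psi l π om I + Psi l π om J := by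
  rw [Psi, map_mul, hL.dat.psiI_mul π (rn_ne hI) (rn_ne hJ)]; rfl

lemma LD.Psi_pow {I : Ideal (𝓞 L)} (hI : I ≠ ⊥) (n : ℕ) :
    Psi l π om (I ^ n) = n * Psi l π om I := by
  rw [Psi, map_pow, hL.dat.psiI_pow π (rn_ne hI)]; rfl

lemma LD.Psi_prod {ι : Type*} (s : Finset ι) (f : ι → Ideal (𝓞 L)) (hf : ∀ i ∈ s, f i ≠ ⊥) :
    Psi l π om (∏ i ∈ s, f i) = ∑ i ∈ s, Psi l π om (f i) := by
  rw [Psi, map_prod, hL.dat.psiI_prod π s _ fun i hi => rn_ne (hf i hi)]; rfl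

lemma LD.Psi_span {y : 𝓞 L} (hy : y ≠ 0) : Psi l π om (Ideal.span {y}) = 0 := by
  rw [Psi, Ideal.relNorm_singleton, hL.dat.psiI_span π (Algebra.intNorm_ne_zero.mpr hy), psi,
    Finset.sum_eq_zero, mul_zero]
  intro σ _
  rw [← hL.nm_delta, hL.sy_nm π (smul_ne _ hy), mul_zero]

lemma LD.Psi_tau (I : Ideal (𝓞 L)) : Psi l π om (τ • I) = Psi l π om I := by
  rw [Psi, hL.rn_tau]; rfl

lemma LD.Psi_tau_pow (i : ℕ) (I : Ideal (𝓞 L)) : Psi l π om (τ ^ i • I) = Psi l π om I := by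
  induction i with
  | zero => simp
  | succ i ih => rw [pow_succ', mul_smul, hL.Psi_tau, ih]

lemma LD.Psi_delta (σ : Gal(F/ℚ)) {I : Ideal (𝓞 L)} (hI : I ≠ ⊥) :
    Psi l π om (δ σ • I) = ((om σ)⁻¹ : (ZMod p)ˣ) * Psi l π om I := by
  rw [Psi, hL.rn_delta, hL.dat.psiI_smul π (rn_ne hI)]; rfl

lemma LD.tau_fix (P : Ideal (𝓞 L)) {d : ℕ} (hd : ¬ p ∣ d) (h : τ ^ d • P = P) : τ • P = P := by
  have h1 : ∀ n : ℕ, (τ ^ d) ^ n • P = P := by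
    intro n
    induction n with
    | zero => simp
    | succ n ih => rw [pow_succ, mul_smul, h, ih]
  have hd0 : (d : ZMod p) ≠ 0 := by rwa [Ne, ZMod.natCast_eq_zero_iff]
  have h2 := h1 ((d : ZMod p)⁻¹).val
  rw [← pow_mul, ← hL.tau_mod, Nat.cast_mul, ZMod.natCast_zmod_val, mul_inv_cancel₀ hd0,
    show (1 : ZMod p) = ((1 : ℕ) : ZMod p) by simp, hL.tau_mod, pow_one] at h2
  exact h2

lemma LD.tau_injOn (P : Ideal (𝓞 L)) (h : τ • P ≠ P) :
    Set.InjOn (fun i : ℕ => τ ^ i • P) (Finset.range p : Set ℕ) := by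
  have key : ∀ i j : ℕ, i < j → j < p → τ ^ i • P = τ ^ j • P → False := by
    intro i j hij hj he
    refine h (hL.tau_fix P (d := j - i) (fun hd => ?_) ?_)
    · exact absurd (Nat.le_of_dvd (by omega) hd) (by omega)
    · have h1 : τ ^ j = τ ^ i * τ ^ (j - i) := by rw [← _root_.pow_add]; congr 1; omega
      rw [h1, mul_smul] at he
      exact (MulAction.injective (τ ^ i) he).symm
  intro i hi j hj he
  simp only [Finset.coe_range, Set.mem_Iio] at hi hj he
  rcases lt_trichotomy i j with h1 | h1 | h1
  · exact (key i j h1 hj he).elim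
  · exact h1
  · exact (key j i h1 hi he.symm).elim

omit [IsCyclotomicExtension {p} ℚ F] hpf hL [Algebra F L] in
lemma smul_prime (g : Gal(L/ℚ)) {P : Ideal (𝓞 L)} (hP : Prime P) : Prime (g • P) := by
  have hP' : P.IsPrime := Ideal.isPrime_of_prime hP
  refine Ideal.prime_of_isPrime (smul_ideal_ne g hP.ne_zero) ?_
  exact Ideal.IsPrime.smul g

/-- relative norm and residue degree one -/
lemma LD.rn_prime {P : Ideal (𝓞 L)} (hP : Prime P) :
    ∃ f, f ≠ 0 ∧ Ideal.relNorm (𝓞 F) P = (P.comap (algebraMap (𝓞 F) (𝓞 L))) ^ f := by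
  have hP' : P.IsPrime := Ideal.isPrime_of_prime hP
  have : P.LiesOver (P.comap (algebraMap (𝓞 F) (𝓞 L))) := ⟨rfl⟩
  obtain ⟨f, hf⟩ := Ideal.exists_relNorm_eq_pow_of_isPrime P (P.comap (algebraMap (𝓞 F) (𝓞 L)))
  refine ⟨f, ?_, hf⟩
  rintro rfl
  rw [pow_zero, Ideal.one_eq_top] at hf
  have h1 := Ideal.relNorm_le_comap (𝓞 F) P
  rw [hf, top_le_iff] at h1
  exact (Ideal.IsPrime.comap (algebraMap (𝓞 F) (𝓞 L)) (K := P)).ne_top h1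

lemma LD.Psi_prime_inv (hM : IsPthPow p (Mnum N 1)) {P : Ideal (𝓞 L)} (hP : Prime P) (hτ : τ • P = P) :
    Psi l π om P = 0 := by
  have hD := hL.dat
  have hP' : P.IsPrime := Ideal.isPrime_of_prime hP
  obtain ⟨f, hf0, hf⟩ := hL.rn_prime hP
  obtain ⟨𝔭, h𝔭⟩ : ∃ 𝔭, 𝔭 = P.comap (algebraMap (𝓞 F) (𝓞 L)) := ⟨_, rfl⟩
  have h𝔭P : 𝔭.IsPrime := h𝔭 ▸ Ideal.IsPrime.comap _
  rw [← h𝔭] at hf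
  have hmem : ∀ x, x ∈ 𝔭 ↔ algebraMap (𝓞 F) (𝓞 L) x ∈ P := fun x => by rw [h𝔭, Ideal.mem_comap]
  have h𝔭0 : 𝔭 ≠ ⊥ := by
    intro h
    have := rn_ne (F := F) hP.ne_zero
    rw [hf, h] at this
    exact this (by rw [← Ideal.zero_eq_bot, zero_pow hf0])
  have hpow : 𝔭.map (algebraMap (𝓞 F) (𝓞 L)) ^ f = P ^ p := by
    rw [← Ideal.map_pow, ← hf, hL.map_rn]
    have : ∀ i : ℕ, τ ^ i • P = P := by
      intro i
      induction i with
      | zero => simp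
      | succ i ih => rw [pow_succ, mul_smul, hτ, ih]
    rw [Finset.prod_congr rfl fun i _ => this i, Finset.prod_const, Finset.card_range]
  obtain ⟨e, -, he⟩ := (dvd_prime_pow hP _).mp ((dvd_pow_self _ hf0).trans hpow.dvd)
  rw [associated_iff_eq] at he
  rw [he, ← pow_mul] at hpow
  have hef : e * f = p := (pow_inj_of_not_isUnit hP.not_isUnit hP.ne_zero).mp hpow
  have hPsi : Psi l π om P = f * psiI l π om 𝔭 := by rw [Psi, hf, hD.psiI_pow π h𝔭0]
  rcases (Nat.dvd_prime hD.hp).mp (Dvd.intro_left e hef) with h1 | h1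
  swap
  · rw [hPsi, h1]; simp
  rw [h1, pow_one] at hf
  have habs : Ideal.absNorm P = Ideal.absNorm 𝔭 := by rw [← hf, Ideal.absNorm_relNorm]
  have hle : 𝔭 ≤ P.comap (algebraMap (𝓞 F) (𝓞 L)) := h𝔭.le
  let f1 : (𝓞 F ⧸ 𝔭) →+* (𝓞 L ⧸ P) := Ideal.quotientMap P (algebraMap (𝓞 F) (𝓞 L)) hle
  have hinj : Function.Injective f1 := Ideal.quotientMap_injective' h𝔭.ge
  have hc1 : Nat.card (𝓞 F ⧸ 𝔭) = Ideal.absNorm 𝔭 := by rw [Ideal.absNorm_apply, Submodule.cardQuot_apply]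
  have hc2 : Nat.card (𝓞 L ⧸ P) = Ideal.absNorm P := by rw [Ideal.absNorm_apply, Submodule.cardQuot_apply]
  have hn0 : Ideal.absNorm P ≠ 0 := by rw [Ne, Ideal.absNorm_eq_zero_iff]; exact hP.ne_zero
  have hfin : Finite (𝓞 L ⧸ P) := Nat.finite_of_card_ne_zero (hc2 ▸ hn0)
  have hsur : Function.Surjective f1 :=
    ((Nat.bijective_iff_injective_and_card f1).mpr ⟨hinj, by rw [hc1, hc2, habs]⟩).2
  obtain ⟨a', ha'⟩ := hsur (Ideal.Quotient.mk P α)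
  obtain ⟨a, rfl⟩ := Ideal.Quotient.mk_surjective a'
  have ha : α - algebraMap (𝓞 F) (𝓞 L) a ∈ P := by
    rw [← Ideal.Quotient.eq_zero_iff_mem, map_sub, ← ha', sub_eq_zero]; rfl
  have ha2 : algebraMap (𝓞 F) (𝓞 L) ζ * α - algebraMap (𝓞 F) (𝓞 L) a ∈ P := by
    have := Ideal.smul_mem_pointwise_smul τ _ P ha
    rwa [hτ, smul_sub, hL.tauA, hL.tauF] at this
  have ha3 : algebraMap (𝓞 F) (𝓞 L) (ζ - 1) * α ∈ P := by
    have := P.sub_mem ha2 ha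
    rw [map_sub, map_one]
    convert this using 1; ring
  rw [hPsi]
  rcases hP'.mem_or_mem ha3 with h2 | h2
  · rw [← hmem] at h2
    rw [← hD.lam_max.eq_of_le h𝔭P.ne_top ((Ideal.span_singleton_le_iff_mem _).mpr h2), hD.psiI_lam, mul_zero]
  · have h3 : (N : 𝓞 F) ∈ 𝔭 := by
      rw [hmem, map_natCast, ← hL.alpha]
      exact P.pow_mem_of_mem h2 _ hD.hp.pos
    obtain ⟨σ, hσ⟩ := hD.hC.prime_over hD.hN hD.ne π 𝔭 h3
    rw [hσ, hD.partB π hM, mul_zero]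

lemma LD.tau_prod_inv (P : Ideal (𝓞 L)) :
    τ • (∏ i ∈ Finset.range p, τ ^ i • P) = ∏ i ∈ Finset.range p, τ ^ i • P := by
  rw [Finset.smul_prod', Finset.prod_congr rfl fun i _ =>
    (show τ • τ ^ i • P = τ ^ i • (τ • P) by rw [← mul_smul, ← mul_smul, ← pow_succ, ← pow_succ']),
    ← hL.map_rn, hL.rn_tau, hL.map_rn]

theorem LD.Psi_inv (hM : IsPthPow p (Mnum N 1)) {I : Ideal (𝓞 L)} (hI : I ≠ ⊥) (hτ : τ • I = I) :
    Psi l π om I = 0 := by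
  obtain ⟨n, hn⟩ : ∃ n, Ideal.absNorm I = n := ⟨_, rfl⟩
  induction n using Nat.strong_induction_on generalizing I with
  | _ n ih =>
  have key : ∀ O : Ideal (𝓞 L), O ≠ ⊤ → τ • O = O → Psi l π om O = 0 → O ∣ I → Psi l π om I = 0 := by
    rintro O hO1 hO hPO ⟨J, rfl⟩
    have hO0 : O ≠ ⊥ := by rintro rfl; exact hI (by rw [Ideal.bot_mul])
    have hJ0 : J ≠ ⊥ := by rintro rfl; exact hI (by rw [Ideal.mul_bot])
    rw [hL.Psi_mul π hO0 hJ0, hPO, zero_add]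
    refine ih (Ideal.absNorm J) ?_ hJ0 ?_ rfl
    · rw [← hn, map_mul]
      have h1 : Ideal.absNorm O ≠ 0 := by rwa [Ne, Ideal.absNorm_eq_zero_iff]
      have h2 : Ideal.absNorm O ≠ 1 := by rwa [Ne, Ideal.absNorm_eq_one_iff]
      have h3 : Ideal.absNorm J ≠ 0 := by rwa [Ne, Ideal.absNorm_eq_zero_iff]
      have h4 : 2 ≤ Ideal.absNorm O := by omega
      nlinarith [Nat.pos_of_ne_zero h3]
    · rw [smul_mul', hO] at hτ
      exact mul_left_cancel₀ hO0 hτ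
  rcases eq_or_ne I ⊤ with rfl | hI1
  · rw [Psi, Ideal.relNorm_top, ← Ideal.one_eq_top, hL.dat.psiI_one]
  obtain ⟨P, hPm, hPI⟩ := Ideal.exists_le_maximal I hI1
  have hP0 : P ≠ ⊥ := by rintro rfl; exact hI (le_bot_iff.mp hPI)
  have hP : Prime P := Ideal.prime_of_isPrime hP0 hPm.isPrime
  by_cases hτP : τ • P = P
  · exact key P hPm.ne_top hτP (hL.Psi_prime_inv π hM hP hτP) (Ideal.dvd_iff_le.mpr hPI)
  have hτI : ∀ i : ℕ, τ ^ i • I = I := by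
    intro i
    induction i with
    | zero => simp
    | succ i ih => rw [pow_succ, mul_smul, hτ, ih]
  refine key (∏ i ∈ Finset.range p, τ ^ i • P) ?_ (hL.tau_prod_inv P) ?_ ?_
  · intro h
    have h1 : (∏ i ∈ Finset.range p, τ ^ i • P) ≤ P := by
      rw [← Ideal.dvd_iff_le]
      have := Finset.dvd_prod_of_mem (fun i : ℕ => τ ^ i • P) (Finset.mem_range.mpr hL.dat.hp.pos)
      simpa using this
    rw [h, top_le_iff] at h1
    exact hPm.ne_top h1
  · rw [hL.Psi_prod π _ _ fun i _ => smul_ideal_ne _ hP0, Finset.sum_congr rfl fun i _ => hL.Psi_tau_pow π i P]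
    simp
  · classical
    rw [← Finset.prod_image (s := Finset.range p) (g := fun i : ℕ => τ ^ i • P) (f := fun Q => Q) (hL.tau_injOn P hτP)]
    refine Finset.prod_primes_dvd _ ?_ ?_
    · intro Q hQ
      obtain ⟨i, _, rfl⟩ := Finset.mem_image.mp hQ
      exact smul_prime _ hP
    · intro Q hQ
      obtain ⟨i, _, rfl⟩ := Finset.mem_image.mp hQ
      rw [Ideal.dvd_iff_le, ← hτI i]
      exact Ideal.pointwise_smul_le_pointwise_smul_iff.mpr hPI

/-- a prime over `𝔮` of residue degree one -/
theorem LD.exists_deg_one (𝔮 : Ideal (𝓞 F)) (h1 : 𝔮.IsPrime) (h0 : 𝔮 ≠ ⊥) (hpq : (p : 𝓞 F) ∉ 𝔮)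
    (hNq : (N : 𝓞 F) ∉ 𝔮) {b : 𝓞 F} (hb : (N : 𝓞 F) - b ^ p ∈ 𝔮) :
    ∃ P : Ideal (𝓞 L), Prime P ∧ Ideal.relNorm (𝓞 F) P = 𝔮 := by
  have hD := hL.dat
  have h𝔮m : 𝔮.IsMaximal := h1.isMaximal h0
  obtain ⟨P, hPm, hPl⟩ : ∃ P : Ideal (𝓞 L), P.IsPrime ∧ P.LiesOver 𝔮 := by
    obtain ⟨P, hP, hP2⟩ := Ideal.exists_maximal_ideal_liesOver_of_isIntegral (S := 𝓞 L) 𝔮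
    exact ⟨P, hP.isPrime, hP2⟩
  have hcom : 𝔮 = P.comap (algebraMap (𝓞 F) (𝓞 L)) := hPl.over
  have hmem : ∀ x, x ∈ 𝔮 ↔ algebraMap (𝓞 F) (𝓞 L) x ∈ P := fun x => by rw [hcom, Ideal.mem_comap]
  have hP0 : P ≠ ⊥ := by
    rintro rfl
    refine h0 (eq_bot_iff.mpr fun x hx => ?_)
    rw [hmem, Ideal.mem_bot] at hx
    exact algMap_inj (L := L) (by rw [hx, map_zero])
  have hP : Prime P := Ideal.prime_of_isPrime hP0 hPm
  obtain ⟨f, hf0, hf⟩ := hL.rn_prime hP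
  rw [← hcom] at hf
  -- `α ≡ ζ^i b`
  have hprod : ∃ c : 𝓞 F, α - algebraMap (𝓞 F) (𝓞 L) c ∈ P := by
    have h2 : α ^ p - (algebraMap (𝓞 F) (𝓞 L) b) ^ p ∈ P := by
      rw [hL.alpha, ← map_natCast (algebraMap (𝓞 F) (𝓞 L)), ← map_pow, ← map_sub, ← hmem]; exact hb
    have hprim : IsPrimitiveRoot (algebraMap (𝓞 F) (𝓞 L) ζ) p := hD.hC.prim.map_of_injective algMap_inj
    rw [hprim.pow_sub_pow_eq_prod_sub_mul _ _ hD.hp.pos] at h2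
    obtain ⟨μ, hμ, hμP⟩ := (Ideal.IsPrime.prod_mem_iff (p := P)).mp h2
    rw [Polynomial.mem_nthRootsFinset hD.hp.pos] at hμ
    have : NeZero p := ⟨hD.hp.ne_zero⟩
    obtain ⟨i, _, hi⟩ := hprim.eq_pow_of_pow_eq_one hμ
    refine ⟨ζ ^ i * b, ?_⟩
    rw [map_mul, map_pow, hi]
    exact hμP
  obtain ⟨c, hc⟩ := hprod
  have hτ : τ • P ≠ P := by
    intro hτ
    have hc2 : algebraMap (𝓞 F) (𝓞 L) ζ * α - algebraMap (𝓞 F) (𝓞 L) c ∈ P := by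
      have := Ideal.smul_mem_pointwise_smul τ _ P hc
      rwa [hτ, smul_sub, hL.tauA, hL.tauF] at this
    have ha3 : algebraMap (𝓞 F) (𝓞 L) (ζ - 1) * α ∈ P := by
      have := P.sub_mem hc2 hc
      rw [map_sub, map_one]
      convert this using 1; ring
    rcases hPm.mem_or_mem ha3 with h2 | h2
    · rw [← hmem] at h2
      refine hpq (𝔮.mem_of_dvd ?_ h2)
      exact (dvd_pow_self _ two_ne_zero).trans (hD.hC.lam_sq_dvd hD.hp5)
    · refine hNq ?_
      rw [hmem, map_natCast, ← hL.alpha]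
      exact P.pow_mem_of_mem h2 _ hD.hp.pos
  refine ⟨P, hP, ?_⟩
  have hf1 : f = 1 := by
    by_contra hf1
    have h2 : P ^ 2 ∣ ∏ i ∈ Finset.range p, τ ^ i • P := by
      rw [← hL.map_rn, hf, Ideal.map_pow]
      refine (pow_dvd_pow P (show 2 ≤ f by omega)).trans (pow_dvd_pow_of_dvd ?_ f)
      rw [Ideal.dvd_iff_le, Ideal.map_le_iff_le_comap, ← hcom]
    obtain ⟨m, hm⟩ : ∃ m, p = m + 1 := ⟨p - 1, by have := hpf.out.pos; omega⟩
    have hr : ∏ i ∈ Finset.range p, τ ^ i • P = (∏ i ∈ Finset.range m, τ ^ (i + 1) • P) * P := by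
      conv_lhs => rw [hm]
      rw [Finset.prod_range_succ']; simp
    rw [hr, sq] at h2
    have h3 := (mul_dvd_mul_iff_right hP0).mp h2
    obtain ⟨i, hi, hi2⟩ := (hP.dvd_finsetProd_iff _).mp h3
    have h4 : P = τ ^ (i + 1) • P :=
      associated_iff_eq.mp (hP.associated_of_dvd (smul_prime _ hP) hi2)
    refine hτ (hL.tau_fix P (d := i + 1) (fun hd => ?_) h4.symm)
    have := Nat.le_of_dvd (by omega) hd
    have := Finset.mem_range.mp hi
    omega
  rw [hf, hf1, pow_one]

end
end
end S14

namespace S14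
noncomputable section

theorem algE {p : ℕ} [hpf : Fact p.Prime] (hp2 : p ≠ 2) {M ι : Type*} [AddCommGroup M] [Fintype ι]
    (T : AddMonoid.End M) (D : ι → AddMonoid.End M) (k : ι → (ZMod p)ˣ) (Ψ : M →+ ZMod p) (h : ℕ)
    (hDT : ∀ i, D i * T = T ^ (k i : ZMod p).val * D i)
    (hnorm : ∀ m, h • ∑ i ∈ Finset.range p, (T ^ i) m = 0)
    (hΨT : ∀ m, Ψ (T m) = Ψ m) (hΨD : ∀ i m, (k i : ZMod p) * Ψ (D i m) = Ψ m)
    (hcard : Fintype.card ι = p - 1) (hh : (h : ZMod p) ≠ 0) (a w : M)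
    (hw : ∑ i, D i (T a - a) = p • w) (ha : Ψ a ≠ 0) : ∃ a', T a' = a' ∧ Ψ a' ≠ 0 := by
  have happ : ∀ (f g : AddMonoid.End M) (m : M), (f * g) m = f (g m) := fun f g m => rfl
  have hsum : ∀ (s : Finset ℕ) (f : ℕ → AddMonoid.End M) (m : M), (∑ i ∈ s, f i) m = ∑ i ∈ s, f i m := by
    intro s f m
    exact AddMonoidHom.finsetSum_apply f s m
  have hΨTp : ∀ (i : ℕ) m, Ψ ((T ^ i) m) = Ψ m := by
    intro i m
    induction i with
    | zero => simp
    | succ i ih => rw [pow_succ', happ, hΨT, ih]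
  let G : ℕ → AddMonoid.End M := fun n => ∑ i ∈ Finset.range n, T ^ i
  have hG : ∀ n, (T - 1) * G n = T ^ n - 1 := fun n => mul_geom_sum T n
  have hΨG : ∀ n m, Ψ (G n m) = n * Ψ m := by
    intro n m
    simp only [G, hsum, map_sum]
    rw [Finset.sum_congr rfl fun i _ => hΨTp i m]; simp
  let B : AddMonoid.End M := ∑ i ∈ Finset.range p, G i
  have hB : ∀ m, (T - 1) (B m) = ∑ i ∈ Finset.range p, (T ^ i) m - p • m := by
    intro m
    rw [← happ]
    simp only [B, Finset.mul_sum, hG, hsum]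
    rw [Finset.sum_congr rfl fun i _ => (show (T ^ i - 1 : AddMonoid.End M) m = (T ^ i) m - m from rfl),
      Finset.sum_sub_distrib]
    simp
  have hΨB : ∀ m, Ψ (B m) = 0 := by
    intro m
    simp only [B, hsum, map_sum, hΨG]
    rw [← Finset.sum_mul, ← Nat.cast_sum, Finset.sum_range_id]
    obtain ⟨n, hn⟩ := hpf.out.odd_of_ne_two hp2
    have h1 : p * (p - 1) / 2 = p * n := by
      rw [hn, Nat.add_sub_cancel, mul_left_comm, Nat.mul_div_cancel_left _ two_pos]
    rw [h1]; simp
  let b : M := ∑ i, G (k i : ZMod p).val (D i a) + B w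
  refine ⟨h • b, ?_, ?_⟩
  · rw [← sub_eq_zero]
    have h1 : (T - 1) b = ∑ i ∈ Finset.range p, (T ^ i) w := by
      simp only [b, map_add, map_sum, hB]
      have h2 : ∀ i, (T - 1) (G (k i : ZMod p).val (D i a)) = D i (T a - a) := by
        intro i
        rw [← happ, hG, map_sub, ← happ (D i) T, hDT]; rfl
      rw [Finset.sum_congr rfl fun i _ => h2 i, hw]
      abel
    have h3 : T (h • b) - h • b = h • (T - 1) b := by
      rw [map_nsmul, ← nsmul_sub]; rfl
    rw [h3, h1, hnorm]
  · rw [map_nsmul, nsmul_eq_mul]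
    refine mul_ne_zero hh ?_
    simp only [b, map_add, map_sum, hΨB, add_zero, hΨG, ZMod.natCast_zmod_val, hΨD]
    rw [Finset.sum_const, Finset.card_univ, hcard, nsmul_eq_mul]
    refine mul_ne_zero ?_ ha
    rw [Nat.cast_sub hpf.out.one_lt.le]
    simp

end
end S14

namespace S14
noncomputable section
open NumberField Polynomial
open scoped Pointwise

section
variable {p N : ℕ} {F : Type*} [Field F] [NumberField F]
variable {ζ : 𝓞 F} {om : Gal(F/ℚ) ≃* (ZMod p)ˣ} {l : ZMod N → ZMod p}
variable {L : Type*} [Field L] [NumberField L] [Algebra F L] {α : 𝓞 L} {τ : Gal(L/ℚ)} {δ : Gal(F/ℚ) → Gal(L/ℚ)}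
variable [hpf : Fact p.Prime] [IsCyclotomicExtension {p} ℚ F]

omit [IsCyclotomicExtension {p} ℚ F] in
lemma card_gal (om : Gal(F/ℚ) ≃* (ZMod p)ˣ) [Fintype Gal(F/ℚ)] : Fintype.card Gal(F/ℚ) = p - 1 := by
  rw [Fintype.card_congr om.toEquiv, ZMod.card_units p]

omit hpf in
lemma prod_unit [IsGalois ℚ F] {ε : 𝓞 F} (hε : IsUnit ε) :
    (∏ σ : Gal(F/ℚ), σ • ε) = 1 ∨ (∏ σ : Gal(F/ℚ), σ • ε) = -1 := by
  have h1 := NumberField.isUnit_iff_norm.mp hε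
  rw [RingOfIntegers.coe_norm] at h1
  have h2 : algebraMap (𝓞 F) F (∏ σ : Gal(F/ℚ), σ • ε) = algebraMap ℚ F (Algebra.norm ℚ (ε : F)) := by
    rw [Algebra.norm_eq_prod_automorphisms, map_prod]; rfl
  rcases eq_or_eq_neg_of_abs_eq h1 with h | h
  · left
    apply FaithfulSMul.algebraMap_injective (𝓞 F) F
    rw [h2, h]; simp
  · right
    apply FaithfulSMul.algebraMap_injective (𝓞 F) F
    rw [h2, h]; simp

variable (hL : LD p N F ζ om l L α τ δ) (π : 𝓞 F →+* ZMod N)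
include hL

theorem LD.final (hM : IsPthPow p (Mnum N 1)) {I : Ideal (𝓞 L)} (hI : I ≠ ⊥) {y1 y2 : 𝓞 L} (h1 : y1 ≠ 0) (h2 : y2 ≠ 0)
    (h : Ideal.span {y1} * τ • I = Ideal.span {y2} * I) : Psi l π om I = 0 := by
  have hD := hL.dat
  have : IsGalois ℚ F := IsCyclotomicExtension.isGalois {p} ℚ F
  let nm : 𝓞 L →* 𝓞 F := Algebra.intNorm (𝓞 F) (𝓞 L)
  have hnm0 : ∀ {y : 𝓞 L}, y ≠ 0 → nm y ≠ 0 := fun hy => Algebra.intNorm_ne_zero.mpr hy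
  obtain ⟨ε, hε⟩ : ∃ ε : (𝓞 F)ˣ, nm y1 * ε = nm y2 := by
    have h3 := congrArg (Ideal.relNorm (𝓞 F)) h
    rw [map_mul, map_mul, hL.rn_tau, Ideal.relNorm_singleton, Ideal.relNorm_singleton] at h3
    have h4 := mul_right_cancel₀ (rn_ne (F := F) hI) h3
    exact Ideal.span_singleton_eq_span_singleton.mp h4
  let k : Gal(F/ℚ) → ℕ := fun σ => (om σ : ZMod p).val
  let m : Gal(F/ℚ) → ℕ := fun σ => (((om σ)⁻¹ : (ZMod p)ˣ) : ZMod p).val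
  let Z : 𝓞 L → ℕ → 𝓞 L := fun y n => ∏ j ∈ Finset.range n, τ ^ j • y
  have hA : ∀ n, Ideal.span {Z y1 n} * τ ^ n • I = Ideal.span {Z y2 n} * I := by
    intro n
    induction n with
    | zero => simp [Z]
    | succ n ih =>
      have h3 := congrArg (fun J => τ ^ n • J) h
      simp only [smul_mul', smul_span, ← mul_smul, ← pow_succ] at h3
      have h4 : ∀ y, Ideal.span {Z y (n + 1)} = Ideal.span {Z y n} * Ideal.span {τ ^ n • y} := by
        intro y
        rw [Ideal.span_singleton_mul_span_singleton]
        simp only [Z, Finset.prod_range_succ]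
      rw [h4, h4, mul_assoc, h3, mul_left_comm, ih]; ring
  have hZ0 : ∀ {y : 𝓞 L}, y ≠ 0 → ∀ n, Z y n ≠ 0 := fun hy n =>
    Finset.prod_ne_zero_iff.mpr fun j _ => smul_ne _ hy
  have hnmtau : ∀ (j : ℕ) (y : 𝓞 L), nm (τ ^ j • y) = nm y := by
    intro j y
    induction j with
    | zero => simp
    | succ j ih => rw [pow_succ', mul_smul]; exact (hL.nm_tau _).trans ih
  have hnmZ : ∀ y n, nm (Z y n) = nm y ^ n := by
    intro y n
    simp only [Z]
    rw [map_prod, Finset.prod_congr rfl fun j _ => hnmtau j y, Finset.prod_const, Finset.card_range]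
  let Y : 𝓞 L → 𝓞 L := fun y => ∏ σ : Gal(F/ℚ), (δ σ • Z y (m σ)) ^ k σ
  have hY0 : ∀ {y : 𝓞 L}, y ≠ 0 → Y y ≠ 0 := fun hy =>
    Finset.prod_ne_zero_iff.mpr fun σ _ => pow_ne_zero _ (smul_ne _ (hZ0 hy _))
  have hnmY : ∀ y, nm (Y y) = ∏ σ : Gal(F/ℚ), (σ • nm y) ^ (m σ * k σ) := by
    intro y
    simp only [Y]
    rw [map_prod]
    refine Finset.prod_congr rfl fun σ _ => ?_
    rw [map_pow, pow_mul, ← smul_pow', ← hnmZ y]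
    exact congrArg (· ^ k σ) (hL.nm_delta σ _)
  obtain ⟨I2, hI2⟩ : ∃ I2, I2 = ∏ σ : Gal(F/ℚ), (δ σ • I) ^ k σ := ⟨_, rfl⟩
  have hI20 : I2 ≠ ⊥ := by
    rw [hI2]
    exact Finset.prod_ne_zero_iff.mpr fun σ _ => pow_ne_zero _ (smul_ideal_ne _ hI)
  have hE : Ideal.span {Y y1} * τ • I2 = Ideal.span {Y y2} * I2 := by
    have h3 : ∀ σ, Ideal.span {δ σ • Z y1 (m σ)} * τ • δ σ • I = Ideal.span {δ σ • Z y2 (m σ)} * δ σ • I := by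
      intro σ
      have h4 := congrArg (fun J => δ σ • J) (hA (m σ))
      simp only [smul_mul', smul_span, ← mul_smul] at h4
      rw [← mul_smul, hL.comm']
      exact h4
    rw [hI2, Finset.smul_prod']
    simp only [Y]
    rw [← Ideal.prod_span_singleton, ← Ideal.prod_span_singleton, ← Finset.prod_mul_distrib, ← Finset.prod_mul_distrib]
    refine Finset.prod_congr rfl fun σ _ => ?_
    rw [← Ideal.span_singleton_pow, ← Ideal.span_singleton_pow, smul_pow', ← mul_pow, ← mul_pow, h3]
  -- the unit
  have hmk : ∀ σ, ∃ n, m σ * k σ = 1 + p * n := by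
    intro σ
    have h3 : ((m σ * k σ : ℕ) : ZMod p) = 1 := by
      simp only [m, k]
      rw [Nat.cast_mul, ZMod.natCast_zmod_val, ZMod.natCast_zmod_val, Units.inv_mul]
    have h4 : (m σ * k σ) % p = 1 := by
      have h5 : ((m σ * k σ : ℕ) : ZMod p) = ((1 : ℕ) : ZMod p) := by rw [h3]; simp
      rw [ZMod.natCast_eq_natCast_iff] at h5
      rw [h5, Nat.mod_eq_of_lt hD.hp.one_lt]
    exact ⟨m σ * k σ / p, by rw [← h4, Nat.mod_add_div]⟩
  choose n hn using hmk
  obtain ⟨η, hη⟩ : ∃ η : 𝓞 F, ∏ σ : Gal(F/ℚ), (σ • (ε : 𝓞 F)) ^ (m σ * k σ) = η ^ p := by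
    refine ⟨(∏ σ : Gal(F/ℚ), σ • (ε : 𝓞 F)) * ∏ σ : Gal(F/ℚ), (σ • (ε : 𝓞 F)) ^ n σ, ?_⟩
    have h5 : (∏ σ : Gal(F/ℚ), σ • (ε : 𝓞 F)) ^ p = ∏ σ : Gal(F/ℚ), σ • (ε : 𝓞 F) := by
      rcases prod_unit ε.isUnit with h | h
      · rw [h, one_pow]
      · rw [h, (hD.hp.odd_of_ne_two (by have := hD.hp5; omega)).neg_one_pow]
    rw [mul_pow, h5, ← Finset.prod_pow, ← Finset.prod_mul_distrib]
    refine Finset.prod_congr rfl fun σ _ => ?_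
    rw [hn, _root_.pow_add, pow_one, mul_comm p, pow_mul]
  have hηu : IsUnit η := by
    have h5 : IsUnit (η ^ p) := by
      rw [← hη]
      refine (IsUnit.prod_univ_iff).mpr fun σ => ?_
      exact (IsUnit.map (MulSemiringAction.toRingHom Gal(F/ℚ) (𝓞 F) σ) ε.isUnit).pow _
    exact (isUnit_pow_iff hD.hp.ne_zero).mp h5
  have hηL : IsUnit (algebraMap (𝓞 F) (𝓞 L) η) := hηu.map _
  have hnY : nm (Y y2) = nm (algebraMap (𝓞 F) (𝓞 L) η * Y y1) := by
    rw [map_mul, show nm (algebraMap (𝓞 F) (𝓞 L) η) = η ^ p from hL.nm_alg η, ← hη, hnmY, hnmY,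
      ← Finset.prod_mul_distrib]
    refine Finset.prod_congr rfl fun σ _ => ?_
    rw [← hε, smul_mul', mul_pow, mul_comm]
  obtain ⟨c, hc0, hc⟩ := hL.h90 (Y y2) (algebraMap (𝓞 F) (𝓞 L) η * Y y1) (hY0 h2)
    (mul_ne_zero hηL.ne_zero (hY0 h1)) hnY
  have hinv : τ • (Ideal.span {c} * I2) = Ideal.span {c} * I2 := by
    have hs1 : Ideal.span {Y y1} ≠ ⊥ := by rw [Ne, Ideal.span_singleton_eq_bot]; exact hY0 h1
    have hs2 : Ideal.span {Y y2} ≠ ⊥ := by rw [Ne, Ideal.span_singleton_eq_bot]; exact hY0 h2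
    refine mul_left_cancel₀ (mul_ne_zero hs1 hs2) ?_
    have h6 : Ideal.span {Y y2} * Ideal.span {τ • c} = Ideal.span {Y y1} * Ideal.span {c} := by
      rw [Ideal.span_singleton_mul_span_singleton, hc, mul_assoc, ← Ideal.span_singleton_mul_span_singleton,
        Ideal.span_singleton_eq_top.mpr hηL, Ideal.top_mul, Ideal.span_singleton_mul_span_singleton]
    rw [smul_mul', smul_span]
    calc Ideal.span {Y y1} * Ideal.span {Y y2} * (Ideal.span {τ • c} * τ • I2)
        = (Ideal.span {Y y2} * Ideal.span {τ • c}) * (Ideal.span {Y y1} * τ • I2) := by ring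
      _ = _ := by rw [h6, hE]; ring
  have hc1 : Ideal.span {c} ≠ ⊥ := by rwa [Ne, Ideal.span_singleton_eq_bot]
  have h7 := hL.Psi_inv π hM (mul_ne_zero hc1 hI20) hinv
  rw [hL.Psi_mul π hc1 hI20, hL.Psi_span π hc0, zero_add, hI2,
    hL.Psi_prod π _ _ fun σ _ => pow_ne_zero _ (smul_ideal_ne _ hI)] at h7
  have h8 : ∀ σ : Gal(F/ℚ), Psi l π om ((δ σ • I) ^ k σ) = Psi l π om I := by
    intro σ
    rw [hL.Psi_pow π (smul_ideal_ne _ hI), hL.Psi_delta π σ hI, ← mul_assoc]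
    simp only [k]
    rw [ZMod.natCast_zmod_val, Units.mul_inv, one_mul]
  rw [Finset.sum_congr rfl fun σ _ => h8 σ, Finset.sum_const, Finset.card_univ, card_gal om, nsmul_eq_mul,
    Nat.cast_sub hD.hp.one_lt.le] at h7
  simpa using h7

end
end
end S14

namespace S14
noncomputable section
open scoped TensorProduct

theorem rank_lemma {p : ℕ} [hpf : Fact p.Prime] {A : Type*} [CommGroup A] [Finite A]
    (f : A →* Multiplicative (ZMod p)) (hf : ∃ a, f a ≠ 1) (hr : pRank p A ≤ 1) {z : A} (hz : f z = 1) :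
    ∃ w, z = w ^ p := by
  let f' : Additive A →+ ZMod p := MonoidHom.toAdditiveLeft f
  let B := ZMod p ⊗[ℤ] Additive A
  let g : (ZMod p) ⊗[ℤ] Additive A →ₗ[ℤ] ZMod p :=
    TensorProduct.lift ((LinearMap.mul ℤ (ZMod p)).compl₂ f'.toIntLinearMap)
  have hg : ∀ c a, g (c ⊗ₜ a) = c * f' a := fun c a => rfl
  let G : (ZMod p) ⊗[ℤ] Additive A →ₗ[ZMod p] ZMod p := g.toAddMonoidHom.toZModLinearMap p
  have hG : ∀ x, G x = g x := fun x => rfl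
  have hfin : Module.Finite (ZMod p) ((ZMod p) ⊗[ℤ] Additive A) := by
    have : Module.Finite ℤ (Additive A) := Module.Finite.of_finite
    infer_instance
  have hsurj : Function.Surjective G := by
    obtain ⟨a, ha⟩ := hf
    have ha' : f' (Additive.ofMul a) ≠ 0 := ha
    intro c
    refine ⟨(c * (f' (Additive.ofMul a))⁻¹) ⊗ₜ Additive.ofMul a, ?_⟩
    rw [hG, hg, mul_assoc, inv_mul_cancel₀ ha', mul_one]
  have hker : LinearMap.ker G = ⊥ := by
    have h1 := LinearMap.finrank_range_add_finrank_ker G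
    rw [LinearMap.range_eq_top.mpr hsurj, finrank_top, Module.finrank_self] at h1
    unfold pRank at hr
    apply Submodule.finrank_eq_zero.mp
    omega
  have hz0 : (1 : ZMod p) ⊗ₜ[ℤ] Additive.ofMul z = 0 := by
    have : (1 : ZMod p) ⊗ₜ[ℤ] Additive.ofMul z ∈ LinearMap.ker G := by
      rw [LinearMap.mem_ker, hG, hg, one_mul]
      exact hz
    rwa [hker] at this
  let R : AddSubgroup (Additive A) := (nsmulAddMonoidHom p : Additive A →+ Additive A).range
  let Q := Additive A ⧸ R
  have hQ : ∀ x : Q, p • x = 0 := by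
    intro x
    obtain ⟨a, rfl⟩ := QuotientAddGroup.mk_surjective x
    rw [← QuotientAddGroup.mk_nsmul, QuotientAddGroup.eq_zero_iff]
    exact ⟨a, rfl⟩
  let _ : Module (ZMod p) Q := AddCommGroup.zmodModule hQ
  let mk : Additive A →+ Q := QuotientAddGroup.mk' R
  let m1 : ZMod p →ₗ[ℤ] Additive A →ₗ[ℤ] Q :=
    LinearMap.mk₂ ℤ (fun c a => c • mk a) (fun a b c => add_smul _ _ _)
      (fun c m n => by rw [smul_assoc]) (fun a b c => by rw [map_add, smul_add])
      (fun c m n => by rw [map_zsmul, smul_comm])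
  have h2 := congrArg (TensorProduct.lift m1) hz0
  rw [TensorProduct.lift.tmul, map_zero] at h2
  have h3 : (1 : ZMod p) • mk (Additive.ofMul z) = 0 := h2
  rw [one_smul] at h3
  have h4 := (QuotientAddGroup.eq_zero_iff _).mp h3
  obtain ⟨w, hw⟩ := h4
  exact ⟨w.toMul, congrArg Additive.toMul hw.symm⟩

end
end S14

namespace S14
noncomputable section
open NumberField Polynomial
open scoped Pointwise

section
variable {p N : ℕ} {F : Type*} [Field F] [NumberField F]
variable {ζ : 𝓞 F} {om : Gal(F/ℚ) ≃* (ZMod p)ˣ} {l : ZMod N → ZMod p}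
variable {L : Type*} [Field L] [NumberField L] [Algebra F L] {α : 𝓞 L} {τ : Gal(L/ℚ)} {δ : Gal(F/ℚ) → Gal(L/ℚ)}
variable {K : Type*} [Field K] [NumberField K] [Algebra K L]
variable [hpf : Fact p.Prime] [IsCyclotomicExtension {p} ℚ F]
variable (hL : LD p N F ζ om l L α τ δ) (π : 𝓞 F →+* ZMod N)

/-- the genus invariant on natural numbers -/
def nu (l : ZMod N → ZMod p) (π : 𝓞 F →+* ZMod N) (n : ℕ) : ZMod p := sy l π (N : 𝓞 F) (n : 𝓞 F)

include hL

lemma LD.nu_mul {m n : ℕ} (hm : m ≠ 0) (hn : n ≠ 0) : nu l π (m * n) = nu l π m + nu l π n := by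
  have hD := hL.dat
  rw [nu, Nat.cast_mul, sy_mul hD.hl hD.hp hD.hN (hD.unif π) (Nat.cast_ne_zero.mpr hm) (Nat.cast_ne_zero.mpr hn)]; rfl

lemma LD.nu_pow {m : ℕ} (hm : m ≠ 0) (n : ℕ) : nu l π (m ^ n) = n * nu l π m := by
  have hD := hL.dat
  rw [nu, Nat.cast_pow, sy_pow hD.hl hD.hp hD.hN (hD.unif π) (Nat.cast_ne_zero.mpr hm)]; rfl

lemma LD.nu_norm {y : 𝓞 L} (hy : y ≠ 0) : nu l π (Ideal.absNorm (Ideal.span {y})) = 0 := by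
  have hD := hL.dat
  have : IsGalois ℚ F := IsCyclotomicExtension.isGalois {p} ℚ F
  have h0 : Ideal.absNorm (Ideal.span {y}) ≠ 0 := by
    rw [Ne, Ideal.absNorm_eq_zero_iff, Ideal.span_singleton_eq_bot]; exact hy
  have h1 : ((Ideal.absNorm (Ideal.span {y}) ^ 2 : ℕ) : 𝓞 F) =
      ∏ σ : Gal(F/ℚ), ∏ i ∈ Finset.range 2, Algebra.intNorm (𝓞 F) (𝓞 L) (δ σ • y) := by
    simp only [Finset.prod_const, Finset.card_range]
    rw [← Ideal.absNorm_relNorm (𝓞 F) (𝓞 L), Ideal.relNorm_singleton, Ideal.absNorm_span_singleton,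
      Finset.prod_pow]
    set z := Algebra.intNorm (𝓞 F) (𝓞 L) y with hz
    have h2 : ((Algebra.norm ℤ z : ℤ) : 𝓞 F) = ∏ σ : Gal(F/ℚ), σ • z := by
      apply FaithfulSMul.algebraMap_injective (𝓞 F) F
      rw [map_intCast, map_prod]
      have h3 := Algebra.norm_eq_prod_automorphisms ℚ (z : F)
      rw [← Algebra.coe_norm_int] at h3
      have h5 : ((Algebra.norm ℤ z : ℤ) : F) = ∏ σ : Gal(F/ℚ), σ (z : F) := by simpa using h3
      exact h5
    rw [Finset.prod_congr rfl fun σ _ => hL.nm_delta σ y, ← h2]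
    have := Int.natAbs_sq (Algebra.norm ℤ z)
    have h4 := congrArg (Int.cast (R := 𝓞 F)) this
    push_cast at h4 ⊢
    simpa using h4
  have h2 : nu l π (Ideal.absNorm (Ideal.span {y}) ^ 2) = 0 := by
    rw [nu, h1, hD.sy_prod π, Finset.sum_eq_zero]
    · intro σ _
      rw [hD.sy_prod π, Finset.sum_eq_zero]
      · intro i _
        exact hL.sy_nm π (smul_ne _ hy)
      · intro i _
        exact Algebra.intNorm_ne_zero.mpr (smul_ne _ hy)
    · intro σ _
      exact Finset.prod_ne_zero_iff.mpr fun i _ => Algebra.intNorm_ne_zero.mpr (smul_ne _ hy)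
  rw [hL.nu_pow π h0] at h2
  exact (mul_eq_zero.mp h2).resolve_left (by exact_mod_cast hD.two_ne)

lemma LD.exists_phi (degK : Module.finrank (𝓞 K) (𝓞 L) = p - 1) : ∃ f : ClassGroup (𝓞 K) →* Multiplicative (ZMod p),
    ∀ (I : Ideal (𝓞 K)) hI, f (ClassGroup.mk0 ⟨I, hI⟩) = Multiplicative.ofAdd (nu l π (Ideal.absNorm I)) := by
  have hD := hL.dat
  have hp5 := hD.hp5
  refine exists_clHom (fun I => Multiplicative.ofAdd (nu l π (Ideal.absNorm I))) ?_ ?_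
  · intro I J hI hJ
    rw [map_mul, hL.nu_mul π (by rwa [Ne, Ideal.absNorm_eq_zero_iff]) (by rwa [Ne, Ideal.absNorm_eq_zero_iff])]; rfl
  · intro x hx
    have h0 : Ideal.absNorm (Ideal.span {x}) ≠ 0 := by
      rw [Ne, Ideal.absNorm_eq_zero_iff, Ideal.span_singleton_eq_bot]; exact hx
    have h1 := hL.nu_norm π (y := algebraMap (𝓞 K) (𝓞 L) x) (by
      rwa [Ne, FaithfulSMul.algebraMap_eq_zero_iff])
    rw [← Set.image_singleton, ← Ideal.map_span, Ideal.absNorm_algebraMap, degK, hL.nu_pow π h0] at h1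
    have h2 : ((p - 1 : ℕ) : ZMod p) ≠ 0 := by
      rw [Ne, ZMod.natCast_eq_zero_iff]
      exact Nat.not_dvd_of_pos_of_lt (by omega) (by omega)
    exact congrArg Multiplicative.ofAdd ((mul_eq_zero.mp h1).resolve_left h2)

lemma LD.exists_phi_ne : ∃ P : Ideal (𝓞 L), Prime P ∧ nu l π (Ideal.absNorm P) ≠ 0 := by
  have hD := hL.dat
  have hp5 := hD.hp5
  have := Fact.mk hD.hN
  have hN0 := hD.hN.pos
  have hp0 := hD.hp.pos
  obtain ⟨t, ht, hlt⟩ := hD.exists_l_ne π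
  have hco : Nat.Coprime p N := (Nat.coprime_primes hD.hp hD.hN).mpr hD.ne.symm
  obtain ⟨⟨k, hk1, hk2⟩⟩ := Nonempty.intro (Nat.chineseRemainder hco 2 t.val)
  have hkN : (k : ZMod N) = t := by
    rw [(ZMod.natCast_eq_natCast_iff _ _ _).mpr hk2, ZMod.natCast_val, ZMod.cast_id]
  have hkp : (k : ZMod p) = 2 := by
    rw [(ZMod.natCast_eq_natCast_iff _ _ _).mpr hk1]; simp
  have hku : IsUnit (k : ZMod (p * N)) := by
    rw [ZMod.isUnit_iff_coprime, Nat.coprime_mul_iff_right]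
    constructor
    · rw [Nat.coprime_comm, hD.hp.coprime_iff_not_dvd, ← ZMod.natCast_eq_zero_iff, hkp]; exact hD.two_ne
    · rw [Nat.coprime_comm, hD.hN.coprime_iff_not_dvd, ← ZMod.natCast_eq_zero_iff, hkN]; exact ht
  have : NeZero (p * N) := ⟨by positivity⟩
  obtain ⟨q, hq1, hq, hqk⟩ := Nat.forall_exists_prime_gt_and_eq_mod hku (p + N)
  have := Fact.mk hq
  have hqN : (q : ZMod N) = t := by
    rw [← hkN, ZMod.natCast_eq_natCast_iff]
    exact ((ZMod.natCast_eq_natCast_iff _ _ _).mp hqk).of_mul_left p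
  have hqp : q % p = 2 := by
    have : q ≡ k [MOD p] := ((ZMod.natCast_eq_natCast_iff _ _ _).mp hqk).of_mul_right N
    have h2 := this.trans hk1
    rw [Nat.ModEq, Nat.mod_eq_of_lt (by omega : 2 < p)] at h2
    exact h2
  obtain ⟨b, hb⟩ := pow_of_ne (p := p) (q := q) (by omega) (by omega) (t := (N : ZMod q)) (by
    rw [Ne, ZMod.natCast_eq_zero_iff]
    exact Nat.not_dvd_of_pos_of_lt (by omega) (by omega))
  -- a prime of F over q
  have hspan : Ideal.absNorm (Ideal.span {(q : 𝓞 F)}) = q ^ (p - 1) := by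
    rw [Ideal.absNorm_span_natCast, NumberField.RingOfIntegers.rank,
      IsCyclotomicExtension.finrank (n := p) F (Polynomial.cyclotomic.irreducible_rat hp0), Nat.totient_prime hD.hp]
  have hne : Ideal.span {(q : 𝓞 F)} ≠ ⊤ := by
    intro h
    rw [h, Ideal.absNorm_top] at hspan
    have := Nat.one_lt_pow (n := p - 1) (by omega) hq.one_lt
    omega
  obtain ⟨𝔮, h𝔮m, h𝔮⟩ := Ideal.exists_le_maximal _ hne
  have hq𝔮 : (q : 𝓞 F) ∈ 𝔮 := h𝔮 (Ideal.mem_span_singleton_self _)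
  have h𝔮0 : 𝔮 ≠ ⊥ := by
    rintro rfl
    exact hq.ne_zero (by simpa using hq𝔮)
  have hnot : ∀ n : ℕ, 0 < n → n < q → (n : 𝓞 F) ∉ 𝔮 := by
    intro n hn hnq hmem
    have hc : IsCoprime (n : ℤ) (q : ℤ) := Nat.isCoprime_iff_coprime.mpr
      (Nat.Coprime.symm ((hq.coprime_iff_not_dvd).mpr (Nat.not_dvd_of_pos_of_lt hn hnq)))
    obtain ⟨u, v, huv⟩ := hc
    apply h𝔮m.ne_top
    rw [Ideal.eq_top_iff_one]
    have : (1 : 𝓞 F) = (u : 𝓞 F) * n + v * q := by exact_mod_cast (congrArg (Int.cast (R := 𝓞 F)) huv).symm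
    rw [this]
    exact 𝔮.add_mem (𝔮.mul_mem_left _ hmem) (𝔮.mul_mem_left _ hq𝔮)
  have hbm : (N : 𝓞 F) - (b.val : 𝓞 F) ^ p ∈ 𝔮 := by
    have h1 : ((b.val ^ p : ℕ) : ZMod q) = (N : ℕ) := by
      push_cast; rw [ZMod.natCast_val, ZMod.cast_id, hb]
    have h2 : (q : ℤ) ∣ (N : ℤ) - (b.val ^ p : ℕ) := by
      exact Nat.modEq_iff_dvd.mp ((ZMod.natCast_eq_natCast_iff _ _ _).mp h1)
    obtain ⟨c, hc⟩ := h2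
    have h3 := congrArg (Int.cast (R := 𝓞 F)) hc
    push_cast at h3
    rw [h3]
    exact 𝔮.mul_mem_right _ hq𝔮
  obtain ⟨P, hP, hPq⟩ := hL.exists_deg_one 𝔮 h𝔮m.isPrime h𝔮0 (hnot p hp0 (by omega)) (hnot N hN0 (by omega)) hbm
  refine ⟨P, hP, ?_⟩
  rw [← Ideal.absNorm_relNorm (𝓞 F) (𝓞 L), hPq]
  have hd := Ideal.absNorm_dvd_absNorm_of_le h𝔮
  rw [hspan, Nat.dvd_prime_pow hq] at hd
  obtain ⟨f, hf, hff⟩ := hd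
  have hf0 : f ≠ 0 := by
    rintro rfl
    rw [pow_zero, Ideal.absNorm_eq_one_iff] at hff
    exact h𝔮m.ne_top hff
  have hπq : π (q : 𝓞 F) = t := by rw [map_natCast, hqN]
  rw [hff, hL.nu_pow π hq.ne_zero, nu, sy_of_ne hD.hl hD.hp hD.hN (hD.unif π) (by rw [hπq]; exact ht), hπq]
  refine mul_ne_zero ?_ hlt
  rw [Ne, ZMod.natCast_eq_zero_iff]
  exact Nat.not_dvd_of_pos_of_lt (by omega) (by omega)

end
end
end S14

namespace S14
noncomputable section
open NumberField Polynomial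
open scoped Pointwise nonZeroDivisors

/-- the class of an ideal, additively written -/
def cl {R : Type*} [CommRing R] [IsDedekindDomain R] (I : Ideal R) : Additive (ClassGroup R) := by
  classical
  exact if h : I ∈ (Ideal R)⁰ then Additive.ofMul (ClassGroup.mk0 ⟨I, h⟩) else 0

section
variable {R : Type*} [CommRing R] [IsDedekindDomain R]

lemma mem_nzd {I : Ideal R} (h : I ≠ ⊥) : I ∈ (Ideal R)⁰ := mem_nonZeroDivisors_of_ne_zero h

lemma cl_eq {I : Ideal R} (h : I ≠ ⊥) : cl I = Additive.ofMul (ClassGroup.mk0 ⟨I, mem_nzd h⟩) := by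
  rw [cl, dif_pos (mem_nzd h)]

lemma cl_mul {I J : Ideal R} (hI : I ≠ ⊥) (hJ : J ≠ ⊥) : cl (I * J) = cl I + cl J := by
  rw [cl_eq hI, cl_eq hJ, cl_eq (mul_ne_zero hI hJ), ← ofMul_mul, ← map_mul]; rfl

lemma cl_span {x : R} (hx : x ≠ 0) : cl (Ideal.span {x}) = 0 := by
  have h : Ideal.span {x} ≠ ⊥ := by rwa [Ne, Ideal.span_singleton_eq_bot]
  rw [cl_eq h, ofMul_eq_zero, ClassGroup.mk0_eq_one_iff]
  exact ⟨x, rfl⟩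

lemma cl_one : cl (1 : Ideal R) = 0 := by
  rw [Ideal.one_eq_top, ← Ideal.span_singleton_one, cl_span one_ne_zero]

lemma cl_pow {I : Ideal R} (hI : I ≠ ⊥) (n : ℕ) : cl (I ^ n) = n • cl I := by
  induction n with
  | zero => rw [pow_zero, cl_one, zero_smul]
  | succ n ih => rw [pow_succ, cl_mul (pow_ne_zero n hI) hI, ih, succ_nsmul]

lemma cl_prod {ι : Type*} (s : Finset ι) (f : ι → Ideal R) (hf : ∀ i ∈ s, f i ≠ ⊥) :
    cl (∏ i ∈ s, f i) = ∑ i ∈ s, cl (f i) := by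
  classical
  induction s using Finset.induction_on with
  | empty => rw [Finset.prod_empty, Finset.sum_empty, cl_one]
  | insert i s hi ih =>
    rw [Finset.prod_insert hi, Finset.sum_insert hi, cl_mul (hf i (Finset.mem_insert_self _ _))
      (Finset.prod_ne_zero_iff.mpr fun j hj => hf j (Finset.mem_insert_of_mem hj)),
      ih fun j hj => hf j (Finset.mem_insert_of_mem hj)]

lemma cl_surj (c : Additive (ClassGroup R)) : ∃ I : Ideal R, I ≠ ⊥ ∧ cl I = c := by
  obtain ⟨⟨I, hI⟩, h⟩ := ClassGroup.mk0_surjective c.toMul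
  have hI0 : I ≠ ⊥ := nonZeroDivisors.ne_zero hI
  exact ⟨I, hI0, by rw [cl_eq hI0, h]; rfl⟩

lemma exists_addHom {H : Type*} [AddCommGroup H] (f : Ideal R → H)
    (hmul : ∀ I J : Ideal R, I ≠ ⊥ → J ≠ ⊥ → f (I * J) = f I + f J)
    (hpr : ∀ x : R, x ≠ 0 → f (Ideal.span {x}) = 0) :
    ∃ g : Additive (ClassGroup R) →+ H, ∀ I : Ideal R, I ≠ ⊥ → g (cl I) = f I := by
  obtain ⟨g, hg⟩ := exists_clHom (H := Multiplicative H) (fun I => Multiplicative.ofAdd (f I))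
    (fun I J hI hJ => by rw [hmul I J hI hJ]; rfl) (fun x hx => by rw [hpr x hx]; rfl)
  refine ⟨MonoidHom.toAdditiveLeft g, fun I hI => ?_⟩
  rw [cl_eq hI]
  exact congrArg Multiplicative.toAdd (hg I (mem_nzd hI))

end

lemma exists_act {L : Type*} [Field L] [NumberField L] (g : Gal(L/ℚ)) :
    ∃ T : AddMonoid.End (Additive (ClassGroup (𝓞 L))), ∀ I : Ideal (𝓞 L), I ≠ ⊥ → T (cl I) = cl (g • I) := by
  refine exists_addHom (fun I => cl (g • I)) ?_ ?_
  · intro I J hI hJ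
    simp only [smul_mul']
    exact cl_mul (smul_ideal_ne g hI) (smul_ideal_ne g hJ)
  · intro x hx
    simp only [smul_span]
    exact cl_span (smul_ne g hx)

lemma exists_ext {K L : Type*} [Field L] [NumberField L] [Field K] [NumberField K] [Algebra K L] :
    ∃ T : Additive (ClassGroup (𝓞 K)) →+ Additive (ClassGroup (𝓞 L)), ∀ I : Ideal (𝓞 K), I ≠ ⊥ →
      T (cl I) = cl (I.map (algebraMap (𝓞 K) (𝓞 L))) := by
  have hinj := FaithfulSMul.algebraMap_injective (𝓞 K) (𝓞 L)
  have hne : ∀ I : Ideal (𝓞 K), I ≠ ⊥ → I.map (algebraMap (𝓞 K) (𝓞 L)) ≠ ⊥ := fun I hI h =>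
    hI ((Ideal.map_eq_bot_iff_of_injective hinj).mp h)
  refine exists_addHom (fun I => cl (I.map (algebraMap (𝓞 K) (𝓞 L)))) ?_ ?_
  · intro I J hI hJ
    simp only [Ideal.map_mul]
    exact cl_mul (hne I hI) (hne J hJ)
  · intro x hx
    simp only [Ideal.map_span, Set.image_singleton]
    exact cl_span (by rwa [Ne, FaithfulSMul.algebraMap_eq_zero_iff])

section
variable {p N : ℕ} {F : Type*} [Field F] [NumberField F]
variable {ζ : 𝓞 F} {om : Gal(F/ℚ) ≃* (ZMod p)ˣ} {l : ZMod N → ZMod p}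
variable {L : Type*} [Field L] [NumberField L] [Algebra F L] {α : 𝓞 L} {τ : Gal(L/ℚ)} {δ : Gal(F/ℚ) → Gal(L/ℚ)}
variable {K : Type*} [Field K] [NumberField K] [Algebra K L]
variable [hpf : Fact p.Prime] [IsCyclotomicExtension {p} ℚ F]
variable (hL : LD p N F ζ om l L α τ δ) (π : 𝓞 F →+* ZMod N)
include hL π

theorem LD.main (hM : IsPthPow p (Mnum N 1)) (hreg : (Nat.card (ClassGroup (𝓞 F)) : ZMod p) ≠ 0)
    (degK : Module.finrank (𝓞 K) (𝓞 L) = p - 1)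
    (normK : ∀ y : 𝓞 L, algebraMap (𝓞 K) (𝓞 L) (Algebra.intNorm (𝓞 K) (𝓞 L) y) = ∏ σ, δ σ • y) :
    2 ≤ classRank p K := by
  have hD := hL.dat
  have hp5 := hD.hp5
  by_contra hcon
  have hr : pRank p (ClassGroup (𝓞 K)) ≤ 1 := by
    rw [classRank] at hcon; omega
  obtain ⟨f, hf⟩ := hL.exists_phi (K := K) π degK
  have hrK : ∀ {I : Ideal (𝓞 L)}, I ≠ ⊥ → Ideal.relNorm (𝓞 K) I ≠ ⊥ := fun h => rn_ne h
  have hfn : ∃ a, f a ≠ 1 := by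
    obtain ⟨P, hP, hP1⟩ := hL.exists_phi_ne π
    refine ⟨ClassGroup.mk0 ⟨Ideal.relNorm (𝓞 K) P, mem_nzd (hrK hP.ne_zero)⟩, ?_⟩
    rw [hf, Ideal.absNorm_relNorm]
    exact hP1
  obtain ⟨𝔮, h1, h0, hpq, hNq, hps, x, hx, hxs, hpsx⟩ := hD.exists_q π hreg
  obtain ⟨b, hb⟩ := hD.exists_b π 𝔮 h1 h0 hpq hNq hreg hx hxs hpsx
  obtain ⟨P, hP, hP1⟩ := hL.exists_deg_one 𝔮 h1 h0 hpq hNq hb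
  have hP0 : P ≠ ⊥ := hP.ne_zero
  have hτP0 : τ • P ≠ ⊥ := smul_ideal_ne τ hP0
  have hPsi : Psi l π om P ≠ 0 := by rw [Psi, hP1]; exact hps
  have hz : ∃ w, ClassGroup.mk0 ⟨Ideal.relNorm (𝓞 K) (τ • P), mem_nzd (hrK hτP0)⟩ /
      ClassGroup.mk0 ⟨Ideal.relNorm (𝓞 K) P, mem_nzd (hrK hP0)⟩ = w ^ p := by
    apply rank_lemma f hfn hr
    rw [_root_.map_div, hf, hf, Ideal.absNorm_relNorm, Ideal.absNorm_relNorm, ← Ideal.absNorm_relNorm (𝓞 F) (𝓞 L) (τ • P),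
      hL.rn_tau, Ideal.absNorm_relNorm, div_self']
  obtain ⟨w, hw⟩ := hz
  have hw' : cl (Ideal.relNorm (𝓞 K) (τ • P)) - cl (Ideal.relNorm (𝓞 K) P) = p • Additive.ofMul w := by
    rw [cl_eq (hrK hτP0), cl_eq (hrK hP0)]
    exact hw
  obtain ⟨T, hT⟩ := exists_act τ
  choose A hA using fun g : Gal(L/ℚ) => exists_act g
  obtain ⟨j, hj⟩ := exists_ext (K := K) (L := L)
  obtain ⟨Q, hQ⟩ : ∃ Q : Additive (ClassGroup (𝓞 L)) →+ ZMod p, ∀ I : Ideal (𝓞 L), I ≠ ⊥ → Q (cl I) = Psi l π om I :=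
    exists_addHom (fun I => Psi l π om I) (fun I J hI hJ => hL.Psi_mul π hI hJ) (fun x hx => hL.Psi_span π hx)
  have hTi : ∀ (i : ℕ) (I : Ideal (𝓞 L)), I ≠ ⊥ → (T ^ i) (cl I) = cl (τ ^ i • I) := by
    intro i I hI
    induction i with
    | zero => simp
    | succ i ih =>
      rw [pow_succ', pow_succ', mul_smul, ← hT _ (smul_ideal_ne _ hI), ← ih]; rfl
  have hjn : ∀ I : Ideal (𝓞 L), I ≠ ⊥ → j (cl (Ideal.relNorm (𝓞 K) I)) = ∑ σ, A (δ σ) (cl I) := by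
    intro I hI
    rw [hj _ (hrK hI), map_relNorm_transfer Finset.univ δ normK, cl_prod _ _ fun σ _ => smul_ideal_ne _ hI]
    exact Finset.sum_congr rfl fun σ _ => (hA (δ σ) I hI).symm
  have hex : ∃ a', T a' = a' ∧ Q a' ≠ 0 := by
    refine algE (p := p) (by omega) T (fun σ : Gal(F/ℚ) => A (δ σ)) (fun σ => om σ) Q
        (Nat.card (ClassGroup (𝓞 F))) ?_ ?_ ?_ ?_ (card_gal om) hreg (cl P) (j (Additive.ofMul w)) ?_ ?_
    · intro σ
      ext m
      obtain ⟨I, hI, rfl⟩ := cl_surj m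
      change A (δ σ) (T (cl I)) = (T ^ _) (A (δ σ) (cl I))
      rw [hT I hI, hA _ _ (smul_ideal_ne τ hI), hA _ _ hI, hTi _ _ (smul_ideal_ne _ hI), ← mul_smul, ← mul_smul,
        hL.comm]
    · intro m
      obtain ⟨I, hI, rfl⟩ := cl_surj m
      rw [Finset.sum_congr rfl fun i _ => hTi i I hI, ← cl_prod _ _ fun i _ => smul_ideal_ne _ hI, ← hL.map_rn]
      have hne : (Ideal.relNorm (𝓞 F) I).map (algebraMap (𝓞 F) (𝓞 L)) ≠ ⊥ := fun h =>
        rn_ne hI ((Ideal.map_eq_bot_iff_of_injective algMap_inj).mp h)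
      obtain ⟨y, hy⟩ := exists_gen F (Ideal.relNorm (𝓞 F) I)
      have hy0 : y ≠ 0 := by
        rintro rfl
        rw [Ideal.span_singleton_eq_bot.mpr rfl] at hy
        exact pow_ne_zero _ (rn_ne hI) hy.symm
      rw [← cl_pow hne, ← Ideal.map_pow, ← hy, Ideal.map_span, Set.image_singleton, cl_span]
      rwa [Ne, FaithfulSMul.algebraMap_eq_zero_iff]
    · intro m
      obtain ⟨I, hI, rfl⟩ := cl_surj m
      rw [hT I hI, hQ _ hI, hQ _ (smul_ideal_ne _ hI), hL.Psi_tau]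
    · intro σ m
      obtain ⟨I, hI, rfl⟩ := cl_surj m
      rw [hA _ I hI, hQ _ hI, hQ _ (smul_ideal_ne _ hI), hL.Psi_delta π σ hI, ← mul_assoc, Units.mul_inv, one_mul]
    · rw [← map_nsmul, ← hw', map_sub, hjn _ hτP0, hjn _ hP0, ← Finset.sum_sub_distrib]
      refine Finset.sum_congr rfl fun σ _ => ?_
      rw [map_sub, hT _ hP0]
    · rw [hQ _ hP0]; exact hPsi
  obtain ⟨a', ha1, ha2⟩ := hex
  obtain ⟨I, hI, rfl⟩ := cl_surj a'
  rw [hT I hI, cl_eq hI, cl_eq (smul_ideal_ne τ hI)] at ha1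
  obtain ⟨y1, y2, hy1, hy2, hy⟩ := ClassGroup.mk0_eq_mk0_iff.mp (Additive.ofMul.injective ha1)
  rw [hQ I hI] at ha2
  exact ha2 (hL.final π hM hI hy1 hy2 hy)

end
end
end S14

namespace S14
noncomputable section
open NumberField Polynomial IntermediateField
open scoped Pointwise

section
variable {p N : ℕ} {F : Type*} [Field F] [NumberField F]
variable {ζ : 𝓞 F} {om : Gal(F/ℚ) ≃* (ZMod p)ˣ} {l : ZMod N → ZMod p}
variable {L : Type*} [Field L] [NumberField L] [Algebra F L]
variable {K : Type*} [Field K] [NumberField K] [Algebra K L]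
variable [hpf : Fact p.Prime] [IsCyclotomicExtension {p} ℚ F] [IsCyclotomicExtension {p} K L]
variable (hD : Dat p N F ζ om l) (π : 𝓞 F →+* ZMod N)
include hD

lemma Dat.finranks (hK : Module.finrank ℚ K = p) : Module.finrank K L = p - 1 ∧ Module.finrank F L = p := by
  have hp5 := hD.hp5
  have hF : Module.finrank ℚ F = p - 1 := by
    rw [IsCyclotomicExtension.finrank (n := p) F (Polynomial.cyclotomic.irreducible_rat (by omega)), Nat.totient_prime hD.hp]
  have h1 := Module.finrank_mul_finrank ℚ F L
  have h2 := Module.finrank_mul_finrank ℚ K L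
  rw [hF] at h1
  rw [hK] at h2
  have : IsGalois K L := IsCyclotomicExtension.isGalois {p} K L
  have hz := IsCyclotomicExtension.zeta_spec p K L
  have : FiniteDimensional K L := IsCyclotomicExtension.finiteDimensional {p} K L
  have h3 : Module.finrank K L ≤ p - 1 := by
    rw [← IsGalois.card_aut_eq_finrank]
    have := Nat.card_le_card_of_injective _ (hz.autToPow_injective K)
    rwa [Nat.card_eq_fintype_card (α := (ZMod p)ˣ), ZMod.card_units] at this
  have h4 : p - 1 ∣ Module.finrank K L := by
    have hc : Nat.Coprime (p - 1) p := by
      have := (Nat.coprime_self_add_right (m := p - 1) (n := 1)).mpr (Nat.coprime_one_right _)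
      rwa [show p - 1 + 1 = p by omega] at this
    refine hc.dvd_of_dvd_mul_left (m := p) ?_
    rw [h2, ← h1]
    exact dvd_mul_right _ _
  have h5 : 0 < Module.finrank K L := Module.finrank_pos
  have h6 : Module.finrank K L = p - 1 := le_antisymm h3 (Nat.le_of_dvd h5 h4)
  refine ⟨h6, ?_⟩
  rw [h6, ← h1, mul_comm] at h2
  exact (Nat.eq_of_mul_eq_mul_left (by omega) h2).symm

include π in
lemma Dat.irr : Irreducible (X ^ p - C (N : F)) := by
  have hp5 := hD.hp5
  refine X_pow_sub_C_irreducible_of_prime hD.hp fun b hb => ?_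
  have hbi : IsIntegral ℤ b := by
    refine IsIntegral.of_pow hD.hp.pos ?_
    rw [hb]
    exact isIntegral_algebraMap (R := ℤ) (x := (N : ℤ)) |> fun h => by simpa using h
  obtain ⟨c, rfl⟩ : ∃ c : 𝓞 F, (c : F) = b := ⟨⟨b, hbi⟩, rfl⟩
  have hc : c ^ p = (N : 𝓞 F) := by
    apply RingOfIntegers.coe_injective
    push_cast
    simpa using hb
  have hu := hD.unif π
  have := Fact.mk hD.hN
  have hc0 : π c = 0 := by
    have h := hu.mem
    rw [← hc, map_pow] at h
    exact pow_eq_zero_iff hD.hp.ne_zero |>.mp h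
  apply hu.not_sq
  rw [← hc]
  exact Ideal.pow_le_pow_right (by omega) (Ideal.pow_mem_pow (RingHom.mem_ker.mpr hc0) p)

lemma Dat.exists_delta (hK : Module.finrank ℚ K = p) : ∃ g : Gal(F/ℚ) ≃ Gal(L/K),
    ∀ σ x, g σ (algebraMap F L x) = algebraMap F L (σ x) := by
  have hp5 := hD.hp5
  have hz : IsPrimitiveRoot (algebraMap F L ζ) p :=
    hD.hC.primF.map_of_injective (FaithfulSMul.algebraMap_injective F L)
  have : IsGalois K L := IsCyclotomicExtension.isGalois {p} K L
  have : FiniteDimensional K L := IsCyclotomicExtension.finiteDimensional {p} K L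
  have hinj := hz.autToPow_injective K
  have hbij : Function.Bijective (hz.autToPow K) := by
    rw [Nat.bijective_iff_injective_and_card]
    refine ⟨hinj, ?_⟩
    rw [IsGalois.card_aut_eq_finrank, (hD.finranks (L := L) hK).1, Nat.card_eq_fintype_card, ZMod.card_units]
  let e := Equiv.ofBijective _ hbij
  refine ⟨om.toEquiv.trans e.symm, fun σ x => ?_⟩
  have hs : hz.autToPow K (e.symm (om σ)) = om σ := e.apply_symm_apply _
  have h1 := hz.autToPow_spec K (e.symm (om σ))
  rw [hs] at h1
  have h2 : σ (ζ : F) = (ζ : F) ^ (om σ : ZMod p).val := by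
    have := congrArg (algebraMap (𝓞 F) F) (hD.hC.act σ)
    rw [map_pow] at this
    exact this
  let f1 : F →ₐ[ℚ] L := (((e.symm (om σ) : Gal(L/K)) : L →+* L).comp (algebraMap F L)).toRatAlgHom
  let f2 : F →ₐ[ℚ] L := ((algebraMap F L).comp (σ : F →+* F)).toRatAlgHom
  have h3 : f1 = f2 := by
    apply (hD.hC.primF.powerBasis ℚ).algHom_ext
    rw [IsPrimitiveRoot.powerBasis_gen]
    change (e.symm (om σ)) (algebraMap F L ζ) = algebraMap F L (σ ζ)
    rw [h2, map_pow, ← h1]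
  exact DFunLike.congr_fun h3 x

variable {a : L} (ha : a ^ p = (N : L))
include π ha

omit [IsCyclotomicExtension {p} K L] in
omit [NumberField K] [Algebra K L] in
lemma Dat.adj (hdeg : Module.finrank F L = p) : F⟮a⟯ = ⊤ := by
  have : FiniteDimensional F L := Module.Finite.of_restrictScalars_finite ℚ F L
  rw [Field.primitive_element_iff_minpoly_natDegree_eq, hdeg,
    ← minpoly.eq_of_irreducible_of_monic (hD.irr π) _ (monic_X_pow_sub_C _ hD.hp.ne_zero), natDegree_X_pow_sub_C]
  simp [ha]

omit [IsCyclotomicExtension {p} K L] [NumberField K] [Algebra K L] in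
lemma Dat.exists_tau (hdeg : Module.finrank F L = p) : IsGalois F L ∧ ∃ t : Gal(L/F),
    t a = algebraMap F L ζ * a ∧ t ^ p = 1 ∧ (∀ x, x ∈ Subgroup.zpowers t) ∧
    ∀ y : L, algebraMap F L (Algebra.norm F y) = ∏ i ∈ Finset.range p, (t ^ i) y := by
  have hp5 := hD.hp5
  have : FiniteDimensional F L := Module.Finite.of_restrictScalars_finite ℚ F L
  have hadj := hD.adj π ha hdeg
  have hne : NeZero p := ⟨hD.hp.ne_zero⟩
  have hprim : (primitiveRoots p F).Nonempty := ⟨ζ, (mem_primitiveRoots hD.hp.pos).mpr hD.hC.primF⟩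
  have hsplit : IsSplittingField F L (X ^ p - C (N : F)) := by
    have := isSplittingField_X_pow_sub_C_of_root_adjoin_eq_top (K := F) (L := L) (by rwa [hdeg]) (a := (N : F)) (α := a)
      (by rw [hdeg, ha]; simp) hadj
    rwa [hdeg] at this
  have hirr := hD.irr π
  have hgal : IsGalois F L := isGalois_of_isSplittingField_X_pow_sub_C hprim hirr L
  refine ⟨hgal, ?_⟩
  let e := autEquivZmod hirr L hD.hC.primF
  have hti : ∀ i : ℕ, (e.symm (Multiplicative.ofAdd 1)) ^ i = e.symm (Multiplicative.ofAdd (i : ZMod p)) := by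
    intro i
    rw [← map_pow]
    congr 1
    rw [← ofAdd_nsmul]; simp
  refine ⟨e.symm (Multiplicative.ofAdd 1), ?_, ?_, ?_, ?_⟩
  · have := autEquivZmod_symm_apply_natCast hirr L (α := a) (by rw [ha]; simp) hD.hC.primF 1
    rw [Nat.cast_one, pow_one, Algebra.smul_def] at this
    exact this
  · rw [hti]; simp
  · intro x
    refine Subgroup.mem_zpowers_iff.mpr ⟨((Multiplicative.toAdd (e x)).val : ℤ), ?_⟩
    rw [zpow_natCast, hti, ZMod.natCast_val, ZMod.cast_id]
    exact e.symm_apply_apply x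
  · intro y
    rw [Algebra.norm_eq_prod_automorphisms, prod_range_zmod]
    refine (Fintype.prod_equiv (Multiplicative.ofAdd.trans e.symm.toEquiv) _ _ fun u => ?_).symm
    rw [hti, ZMod.natCast_val, ZMod.cast_id]
    rfl

end
end
end S14

namespace S14
noncomputable section
open NumberField Polynomial IntermediateField
open scoped Pointwise

theorem hilbert90 {F L : Type*} [Field F] [Field L] [Algebra F L] (t : Gal(L/F)) {p : ℕ}
    (hp : 0 < p) (ht : orderOf t = p) {x : L} (hx : ∏ i ∈ Finset.range p, (t ^ i) x = 1) :
    ∃ y : Lˣ, (y : L) / t y = x := by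
  let b : ℕ → L := fun i => ∏ j ∈ Finset.range i, (t ^ j) x
  have hb : ∀ i, x * t (b i) = b (i + 1) := by
    intro i
    simp only [b]
    rw [Finset.prod_range_succ', map_prod, mul_comm]
    congr 1
    refine Finset.prod_congr rfl fun j _ => ?_
    rw [pow_succ', AlgEquiv.mul_apply]
  have hind : LinearIndependent L (fun i : Fin p => ((t ^ (i : ℕ) : Gal(L/F)) : L → L)) := by
    refine LinearIndependent.comp (ι' := Fin p)
      (linearIndependent_monoidHom L L) (fun i => ((t ^ (i : ℕ) : Gal(L/F)) : L →* L)) ?_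
    intro i j h
    have h1 : t ^ (i : ℕ) = t ^ (j : ℕ) := by
      ext z; exact DFunLike.ext_iff.1 h z
    apply Fin.ext
    exact pow_injOn_Iio_orderOf (by rw [ht]; exact i.2) (by rw [ht]; exact j.2) h1
  obtain ⟨θ, hθ⟩ : ∃ θ : L, ∑ i ∈ Finset.range p, b i * (t ^ i) θ ≠ 0 := by
    by_contra! hc
    have h0 := Fintype.linearIndependent_iff.mp hind (fun i => b i) (by
      ext z
      rw [Finset.sum_apply]
      have := hc z
      rw [Finset.sum_range] at this
      simpa using this) ⟨0, hp⟩
    simp [b] at h0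
  set c := ∑ i ∈ Finset.range p, b i * (t ^ i) θ with hcd
  have hxc : x * t c = c := by
    have e1 : x * t c = ∑ i ∈ Finset.range p, b (i + 1) * (t ^ (i + 1)) θ := by
      rw [hcd, map_sum, Finset.mul_sum]
      refine Finset.sum_congr rfl fun i _ => ?_
      rw [map_mul, ← mul_assoc, hb, pow_succ', AlgEquiv.mul_apply]
    have e2 := Finset.sum_range_succ' (fun i => b i * (t ^ i) θ) p
    rw [Finset.sum_range_succ] at e2
    have e3 : b p = 1 := hx
    have e4 : b 0 = 1 := by simp [b]
    have e5 : t ^ p = 1 := by rw [← ht]; exact pow_orderOf_eq_one t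
    rw [e3, e4, e5, pow_zero] at e2
    rw [e1, ← add_right_cancel e2]
  refine ⟨Units.mk0 c hθ, ?_⟩
  rw [Units.val_mk0, div_eq_iff, hxc]
  rw [Ne, map_eq_zero_iff t t.injective]; exact hθ

section
variable {p N : ℕ} {F : Type*} [Field F] [NumberField F]
variable {ζ : 𝓞 F} {om : Gal(F/ℚ) ≃* (ZMod p)ˣ} {l : ZMod N → ZMod p}
variable {L : Type*} [Field L] [NumberField L] [Algebra F L]
variable {K : Type*} [Field K] [NumberField K] [Algebra K L]
variable [hpf : Fact p.Prime] [IsCyclotomicExtension {p} ℚ F] [IsCyclotomicExtension {p} K L]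
variable (hD : Dat p N F ζ om l) (π : 𝓞 F →+* ZMod N)
include hD π

theorem Dat.exists_LD (hK : Module.finrank ℚ K = p) {α : K} (hα : α ^ p = (N : K)) :
    ∃ (a : 𝓞 L) (τ : Gal(L/ℚ)) (δ : Gal(F/ℚ) → Gal(L/ℚ)), LD p N F ζ om l L a τ δ ∧
    Module.finrank (𝓞 K) (𝓞 L) = p - 1 ∧
    ∀ y : 𝓞 L, algebraMap (𝓞 K) (𝓞 L) (Algebra.intNorm (𝓞 K) (𝓞 L) y) = ∏ σ, δ σ • y := by
  have hp5 := hD.hp5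
  obtain ⟨hKL, hFL⟩ := hD.finranks (L := L) hK
  have : IsGalois K L := IsCyclotomicExtension.isGalois {p} K L
  have : FiniteDimensional K L := IsCyclotomicExtension.finiteDimensional {p} K L
  have : FiniteDimensional F L := Module.Finite.of_restrictScalars_finite ℚ F L
  obtain ⟨g, hg⟩ := hD.exists_delta (L := L) hK
  have haL : (algebraMap K L α) ^ p = (N : L) := by rw [← map_pow, hα, map_natCast]
  have hadj := hD.adj π haL hFL
  obtain ⟨hgal, t, hta, htp, htz, htn⟩ := hD.exists_tau π haL hFL
  have hai : IsIntegral ℤ (algebraMap K L α) := by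
    refine IsIntegral.of_pow hD.hp.pos ?_
    rw [haL]
    exact isIntegral_algebraMap (R := ℤ) (x := (N : ℤ)) |> fun h => by simpa using h
  obtain ⟨a, ha⟩ : ∃ a : 𝓞 L, algebraMap (𝓞 L) L a = algebraMap K L α := ⟨⟨_, hai⟩, rfl⟩
  let τ : Gal(L/ℚ) := t.restrictScalars ℚ
  let δ : Gal(F/ℚ) → Gal(L/ℚ) := fun σ => (g σ).restrictScalars ℚ
  have hτi : ∀ (i : ℕ) (y : L), (τ ^ i) y = (t ^ i) y := by
    intro i y
    induction i generalizing y with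
    | zero => rfl
    | succ i ih =>
      rw [pow_succ, pow_succ, AlgEquiv.mul_apply, AlgEquiv.mul_apply, ih]; rfl
  have hco : ∀ (h : Gal(L/ℚ)) (y : 𝓞 L), algebraMap (𝓞 L) L (h • y) = h (algebraMap (𝓞 L) L y) := fun h y => rfl
  have hal : ∀ x : 𝓞 F, algebraMap (𝓞 L) L (algebraMap (𝓞 F) (𝓞 L) x) = algebraMap F L (algebraMap (𝓞 F) F x) := fun x => rfl
  have htia : ∀ i : ℕ, (t ^ i) (algebraMap K L α) = algebraMap F L ζ ^ i * algebraMap K L α := by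
    intro i
    induction i with
    | zero => simp
    | succ i ih =>
      rw [pow_succ, AlgEquiv.mul_apply, hta, map_mul, AlgEquiv.commutes, ih, pow_succ]; ring
  refine ⟨a, τ, δ, ⟨hD, ?_, ?_, ?_, ?_, ?_, ?_, ?_, ?_, ?_⟩, ?_, ?_⟩
  · apply RingOfIntegers.coe_injective
    rw [map_pow, ha, haL, map_natCast]
  · intro x
    apply RingOfIntegers.coe_injective
    exact t.commutes (x : F)
  · apply RingOfIntegers.coe_injective
    rw [hco, ha, map_mul, ha]
    exact hta
  · ext y
    rw [hτi, htp]; rfl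
  · intro σ
    have hδF : ∀ x : F, δ σ (algebraMap F L x) = algebraMap F L (σ x) := fun x => hg σ x
    have hτF : ∀ (i : ℕ) (x : F), (τ ^ i) (algebraMap F L x) = algebraMap F L x := fun i x => by
      rw [hτi]; exact AlgEquiv.commutes _ x
    have hτF1 : ∀ (x : F), τ (algebraMap F L x) = algebraMap F L x := fun x => t.commutes x
    have hδa : δ σ (algebraMap K L α) = algebraMap K L α := (g σ).commutes α
    have hτa : τ (algebraMap K L α) = algebraMap F L ζ * algebraMap K L α := hta
    have hact : σ (ζ : F) = (ζ : F) ^ (om σ : ZMod p).val := by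
      have := congrArg (algebraMap (𝓞 F) F) (hD.hC.act σ)
      rw [map_pow] at this
      exact this
    have htop : Algebra.adjoin F {algebraMap K L α} = ⊤ := by
      rw [← IntermediateField.adjoin_simple_toSubalgebra_of_isAlgebraic (Algebra.IsAlgebraic.isAlgebraic _), hadj]; rfl
    ext y
    have hy : y ∈ Algebra.adjoin F {algebraMap K L α} := by rw [htop]; trivial
    induction hy using Algebra.adjoin_induction with
    | mem x hx =>
      rw [Set.mem_singleton_iff] at hx
      subst hx
      rw [AlgEquiv.mul_apply, AlgEquiv.mul_apply, hδa, hτa, map_mul, hδa, hδF, hact, hτi, htia, map_pow]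
    | algebraMap x => rw [AlgEquiv.mul_apply, AlgEquiv.mul_apply, hτF1, hδF, hτF]
    | add x y _ _ hx hy => rw [map_add, map_add, hx, hy]
    | mul x y _ _ hx hy => rw [map_mul, map_mul, hx, hy]
  · intro σ x
    apply RingOfIntegers.coe_injective
    exact hg σ x
  · intro y
    apply RingOfIntegers.coe_injective
    rw [hal, Algebra.algebraMap_intNorm (A := 𝓞 F) (K := F) (L := L) (B := 𝓞 L), htn, map_prod]
    refine Finset.prod_congr rfl fun i _ => ?_
    rw [hco, hτi]
  · intro u s hu hs hus
    have hs' : (s : L) ≠ 0 := RingOfIntegers.coe_ne_zero_iff.mpr hs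
    have hu' : (u : L) ≠ 0 := RingOfIntegers.coe_ne_zero_iff.mpr hu
    have hn : Algebra.norm F (u : L) = Algebra.norm F (s : L) := by
      rw [← Algebra.algebraMap_intNorm (A := 𝓞 F) (K := F) (L := L) (B := 𝓞 L), hus,
        Algebra.algebraMap_intNorm (A := 𝓞 F) (K := F) (L := L) (B := 𝓞 L)]
    have hord : orderOf t = p := by
      rw [orderOf_eq_card_of_forall_mem_zpowers htz, IsGalois.card_aut_eq_finrank, hFL]
    obtain ⟨y, hy⟩ := hilbert90 t hD.hp.pos hord (x := (u : L) / s) (by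
      have h1 : Algebra.norm F ((u : L) / s) * Algebra.norm F (s : L) = 1 * Algebra.norm F (s : L) := by
        rw [← map_mul, div_mul_cancel₀ _ hs', one_mul, hn]
      rw [← htn, mul_right_cancel₀ (Algebra.norm_ne_zero_iff.mpr hs') h1, map_one])
    obtain ⟨n, hn0, hni⟩ : ∃ n : ℤ, n ≠ 0 ∧ IsIntegral ℤ (n • (y : L)) := by
      have : IsAlgebraic ℤ (y : L) := by
        rw [IsFractionRing.isAlgebraic_iff ℤ ℚ]
        exact Algebra.IsAlgebraic.isAlgebraic _
      obtain ⟨n, hn0, hni⟩ := this.exists_integral_multiple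
      exact ⟨n, hn0, hni⟩
    refine ⟨⟨n • (y : L), hni⟩, ?_, ?_⟩
    · intro h0
      have := congrArg (algebraMap (𝓞 L) L) h0
      have h1 : n • (y : L) = 0 := this
      rcases smul_eq_zero.mp h1 with h | h
      · exact hn0 h
      · exact y.ne_zero h
    · apply RingOfIntegers.coe_injective
      have hty : t (y : L) ≠ 0 := by
        rw [Ne, map_eq_zero_iff t t.injective]; exact y.ne_zero
      rw [div_eq_div_iff hty hs'] at hy
      have e : (u : L) * t (n • (y : L)) = s * (n • (y : L)) := by
        rw [map_zsmul, zsmul_eq_mul, zsmul_eq_mul]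
        linear_combination -(n : L) * hy
      exact e
  · rw [← IsFractionRing.finrank_eq (𝓞 F) F (𝓞 L) L, hFL]
  · rw [← IsFractionRing.finrank_eq (𝓞 K) K (𝓞 L) L, hKL]
  · intro y
    apply RingOfIntegers.coe_injective
    have e1 : algebraMap (𝓞 L) L (algebraMap (𝓞 K) (𝓞 L) (Algebra.intNorm (𝓞 K) (𝓞 L) y)) =
      algebraMap K L (algebraMap (𝓞 K) K <| Algebra.intNorm (𝓞 K) (𝓞 L) y) := rfl
    rw [e1, Algebra.algebraMap_intNorm (A := 𝓞 K) (K := K) (L := L) (B := 𝓞 L),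
      Algebra.norm_eq_prod_automorphisms, map_prod]
    exact (Fintype.prod_equiv g _ _ fun σ => rfl).symm

end

end
end S14

theorem statement14 (p N : ℕ) (hp : p.Prime) (hp5 : 5 ≤ p)
    (hreg : RegularPrime ⟨p, hp.pos⟩)
    (hN : N.Prime) (hNmod : N % p = 1)
    (K : Type*) [Field K] [NumberField K]
    (α : K) (hα : α ^ p = (N : K)) (hKdeg : Module.finrank ℚ K = p)
    (hM : IsPthPow p (Mnum N 1)) :
    2 ≤ classRank p K := by
  have hpf : Fact p.Prime := ⟨hp⟩
  have hNf : Fact N.Prime := ⟨hN⟩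
  let F := CyclotomicField p ℚ
  let L := CyclotomicField p K
  have : NeZero p := ⟨hp.ne_zero⟩
  have hcF : IsCyclotomicExtension {p} ℚ F := CyclotomicField.isCyclotomicExtension p ℚ
  have hcL : IsCyclotomicExtension {p} K L := CyclotomicField.isCyclotomicExtension p K
  have hNF : NumberField F := IsCyclotomicExtension.numberField {p} ℚ F
  have hNL : NumberField L := IsCyclotomicExtension.numberField {p} K L
  obtain ⟨ζ, om, hC⟩ := S14.exists_Cyc p F
  obtain ⟨l, hl⟩ := S14.exists_Lg hp hN hNmod
  have hD : S14.Dat p N F ζ om l := ⟨hp, hp5, hN, hNmod, hl, hC⟩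
  obtain ⟨π, -⟩ := hC.exists_pi hN hNmod
  have hz := IsCyclotomicExtension.zeta_spec p K L
  have hi : Nonempty (F →+* L) := by
    have hzF := IsCyclotomicExtension.zeta_spec p ℚ F
    refine ⟨((hzF.powerBasis ℚ).lift (IsCyclotomicExtension.zeta p K L) ?_).toRingHom⟩
    rw [IsPrimitiveRoot.powerBasis_gen, ← Polynomial.cyclotomic_eq_minpoly_rat hzF hp.pos, Polynomial.aeval_def,
      Polynomial.eval₂_eq_eval_map, Polynomial.map_cyclotomic]
    exact hz.isRoot_cyclotomic hp.pos
  obtain ⟨i⟩ := hi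
  let _ : Algebra F L := i.toAlgebra
  obtain ⟨a, τ, δ, hLD, h1, h2⟩ := hD.exists_LD (L := L) π hKdeg hα
  refine hLD.main π hM ?_ h1 h2
  rw [Ne, ZMod.natCast_eq_zero_iff]
  exact hreg
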